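/- Fix an integer n ≥ 1 and assume the Riemann Hypothesis. Then for admissible T → ∞, ∑_{0<γ≤T} ζ^{(n)}(ρ) = (−1)^{n+1} (1/(n+1)) (T/2π) log^{n+1}(T/2π) + (−1)^{n+1} ∑_{k=0}^{n} binom(n,k) (−1)^k k! (−1 + ∑_{j=0}^{k} (−1)^j C_j) (T/2π) log^{n−k}(T/2π) + n! A_n (T/2π) + O(T^{1/2} log^{n+5/2} T). -/

import Mathlib

open Complex Filter Finset

/-- The order of vanishing of the Riemann zeta function at a point `ρ`:
the least `k` such that the `k`-th derivative of `ζ` is nonzero at `ρ`. -/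
noncomputable def zetaZeroOrder (ρ : ℂ) : ℕ :=
  sInf {k : ℕ | iteratedDeriv k riemannZeta ρ ≠ 0}

/-- A non-trivial zero of the Riemann zeta function. -/
def IsNontrivialZero (ρ : ℂ) : Prop :=
  riemannZeta ρ = 0 ∧ 0 < ρ.re ∧ ρ.re < 1

/-- `∑_{0<γ≤T} ζ^{(n)}(ρ)`, the sum of the `n`-th derivative of `ζ` over the
non-trivial zeros `ρ = β + iγ` with `0 < γ ≤ T`, counted with multiplicity. -/
noncomputable def zetaZeroSum (n : ℕ) (T : ℝ) : ℂ :=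
  ∑ᶠ ρ ∈ {ρ : ℂ | IsNontrivialZero ρ ∧ 0 < ρ.im ∧ ρ.im ≤ T},
    (zetaZeroOrder ρ : ℂ) * iteratedDeriv n riemannZeta ρ

/-- `T` is admissible: `|T - γ| ≥ δ / log T` for every ordinate `γ` of a
non-trivial zero of `ζ`. -/
def AdmissibleHeight (δ T : ℝ) : Prop :=
  ∀ ρ : ℂ, IsNontrivialZero ρ → δ / Real.log T ≤ |T - ρ.im|

/-- The full main term in the asymptotic expansion of `∑_{0<γ≤T} ζ^{(n)}(ρ)`,
expressed in terms of the Laurent coefficients `C j` of `ζ` and `A j` of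
`Dζ/ζ` about `s = 1`. -/
noncomputable def mainTerm (C A : ℕ → ℂ) (n : ℕ) (T : ℝ) : ℂ :=
  (-1 : ℂ) ^ (n + 1) * (1 / ((n : ℂ) + 1)) *
      (((T / (2 * Real.pi)) * Real.log (T / (2 * Real.pi)) ^ (n + 1) : ℝ) : ℂ)
  + (-1 : ℂ) ^ (n + 1) *
      ∑ k ∈ Finset.range (n + 1),
        (n.choose k : ℂ) * (-1 : ℂ) ^ k * (k.factorial : ℂ) *
          (-1 + ∑ j ∈ Finset.range (k + 1), (-1 : ℂ) ^ j * C j) *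
          (((T / (2 * Real.pi)) * Real.log (T / (2 * Real.pi)) ^ (n - k) : ℝ) : ℂ)
  + (n.factorial : ℂ) * A n * ((T / (2 * Real.pi) : ℝ) : ℂ)

open scoped Topology
open MeasureTheory
open scoped Nat
open intervalIntegral (integral_eq_sub_of_hasDerivAt integral_add_adjacent_intervals integral_mono_on integral_mono_interval continuous_parametric_intervalIntegral_of_continuous')
set_option linter.unusedVariables false
set_option linter.unusedSimpArgs false

local notation "π" => Real.pi
local notation "RE" => Real.exp
local notation "RL" => Real.log
local notation "ZZ" => riemannZeta
local notation "LZ" => logDeriv riemannZeta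
local notation "mI(" t ")" => ((-t : ℝ) : ℂ) * I
local notation "CB" => Metric.closedBall
local notation "EO" => ENNReal.ofReal
local notation "CJ" => starRingEnd ℂ
local notation "cI(" c "," t ")" => ((c : ℂ) + ((-t : ℝ) : ℂ) * I)
local notation "aI(" a "," v ")" => ((a : ℂ) + v * I)
local notation "LA" => (by linarith)
local notation "PA" => (by positivity)
local notation "NA" => (by norm_num)
local notation "FA" => (by fun_prop)
local notation "PN1" => nhdsWithin (1 : ℂ) {(1 : ℂ)}ᶜ
local notation "HC(" C ")" => ∀ᶠ s in nhdsWithin (1 : ℂ) {(1 : ℂ)}ᶜ, HasSum (fun j : ℕ => C j * (s - 1) ^ j) (riemannZeta s - 1 / (s - 1))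
local notation "HA(" A ")" => ∀ᶠ s in nhdsWithin (1 : ℂ) {(1 : ℂ)}ᶜ, HasSum (fun j : ℕ => A j * (s - 1) ^ j) (deriv riemannZeta s / riemannZeta s + 1 / (s - 1))


/-! ### Part B: the truncated formula for zeta -/

/-- remainder integral -/
noncomputable def zRem (N : ℕ) (s : ℂ) : ℂ :=
  ∫ u in Set.Ioi (N : ℝ), ((Int.fract u : ℝ) : ℂ) * (u : ℂ) ^ (-s - 1)

lemma norm_ofReal_cpow_pos {u : ℝ} (hu : 0 < u) (s : ℂ) : ‖(u : ℂ) ^ s‖ = u ^ s.re :=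
  Complex.norm_cpow_eq_rpow_re_of_pos hu s

lemma zRem_integrand_bound {u : ℝ} (hu : 0 < u) (s : ℂ) :
    ‖((Int.fract u : ℝ) : ℂ) * (u : ℂ) ^ (-s - 1)‖ ≤ u ^ (-s.re - 1) := by
  rw [norm_mul, norm_ofReal_cpow_pos hu, norm_real, Real.norm_eq_abs,
    abs_of_nonneg (Int.fract_nonneg u)]
  have h1 : (-s - 1).re = -s.re - 1 := by simp
  rw [h1]
  have := Int.fract_lt_one u
  have h2 : 0 ≤ u ^ (-s.re - 1) := PA
  nlinarith [Int.fract_nonneg u]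

lemma measurable_cpow_ofReal (s : ℂ) : Measurable (fun u : ℝ => (u : ℂ) ^ s) := by
  fun_prop

lemma zRem_measurable (s : ℂ) :
    Measurable (fun u : ℝ => ((Int.fract u : ℝ) : ℂ) * (u : ℂ) ^ (-s - 1)) := by
  apply Measurable.mul
  · exact Complex.measurable_ofReal.comp measurable_fract
  · exact measurable_cpow_ofReal _

lemma zRem_integrable {N : ℕ} (hN : 1 ≤ N) {s : ℂ} (hs : 0 < s.re) :
    IntegrableOn (fun u : ℝ => ((Int.fract u : ℝ) : ℂ) * (u : ℂ) ^ (-s - 1))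
      (Set.Ioi (N : ℝ)) := by
  have hN' : (0 : ℝ) < N := by exact_mod_cast hN
  have h := integrableOn_Ioi_rpow_of_lt (a := -s.re - 1) (c := N) LA hN'
  refine Integrable.mono' h (zRem_measurable s).aestronglyMeasurable ?_
  filter_upwards [ae_restrict_mem measurableSet_Ioi] with u hu
  exact zRem_integrand_bound (hN'.trans hu) s

lemma zRem_norm_le {N : ℕ} (hN : 1 ≤ N) {s : ℂ} (hs : 0 < s.re) :
    ‖zRem N s‖ ≤ (N : ℝ) ^ (-s.re) / s.re := by
  have hN' : (0 : ℝ) < N := by exact_mod_cast hN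
  have h := integrableOn_Ioi_rpow_of_lt (a := -s.re - 1) (c := N) LA hN'
  have h2 := integral_Ioi_rpow_of_lt (a := -s.re - 1) (c := N) LA hN'
  have : ‖zRem N s‖ ≤ ∫ u in Set.Ioi (N : ℝ), u ^ (-s.re - 1) := by
    apply norm_integral_le_of_norm_le h
    filter_upwards [ae_restrict_mem measurableSet_Ioi] with u hu
    exact zRem_integrand_bound (hN'.trans hu) s
  rw [h2] at this
  convert this using 1
  rw [sub_add_cancel, neg_div_neg_eq]

lemma zRem_differentiableAt {s : ℂ} (hs : 0 < s.re) :
    DifferentiableAt ℂ (zRem 1) s := by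
  set f : ℝ → ℂ := (Set.Ioi (1 : ℝ)).indicator (fun u => ((Int.fract u : ℝ) : ℂ)) with hf
  have hfm : Measurable f :=
    (Complex.measurable_ofReal.comp measurable_fract).indicator measurableSet_Ioi
  have hfb : ∀ u, ‖f u‖ ≤ 1 := by
    intro u
    by_cases hu : u ∈ Set.Ioi (1 : ℝ)
    · simp only [hf, Set.indicator_of_mem hu, norm_real, Real.norm_eq_abs,
        abs_of_nonneg (Int.fract_nonneg u)]
      exact (Int.fract_lt_one u).le
    · simp [hf, Set.indicator_of_notMem hu]
  have h1 : ∀ s : ℂ, zRem 1 s = mellin f (-s) := by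
    intro s
    rw [zRem, mellin, ← integral_indicator measurableSet_Ioi,
      ← integral_indicator measurableSet_Ioi]
    congr 1
    ext u
    simp only [Set.indicator, hf, Set.mem_Ioi, Nat.cast_one, smul_eq_mul]
    split_ifs with h1 h2
    · ring
    · exact absurd (zero_lt_one.trans h1) h2
    · simp
    · rfl
  have h2 : DifferentiableAt ℂ (mellin f) (-s) := by
    apply mellin_differentiableAt_of_isBigO_rpow (a := 0) (b := -s.re - 1)
    · apply LocallyIntegrable.locallyIntegrableOn
      apply (locallyIntegrable_const (1 : ℝ)).mono hfm.aestronglyMeasurable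
      filter_upwards with u
      simpa using hfb u
    · simp only [neg_zero, Real.rpow_zero]
      exact Asymptotics.isBigO_of_le _ (fun u => by simpa using hfb u)
    · simpa using hs
    · apply (Asymptotics.isBigO_zero (fun x : ℝ => x ^ (-(-s.re - 1))) (𝓝[>] 0)).congr' _
        (Filter.EventuallyEq.refl _ _)
      have : Set.Iio (1 : ℝ) ∈ 𝓝[>] (0 : ℝ) := mem_nhdsWithin_of_mem_nhds (Iio_mem_nhds one_pos)
      filter_upwards [this] with u hu
      have : u ∉ Set.Ioi (1 : ℝ) := by simpa using (le_of_lt hu)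
      simp [hf, Set.indicator_of_notMem this]
    · simp
  have h3 : zRem 1 = fun s => mellin f (-s) := funext h1
  rw [h3]
  exact h2.comp s differentiableAt_id.neg

lemma zeta_formula_aux {s : ℂ} (hs : 1 < s.re) :
    ZZ s = 1 + 1 / (s - 1) - s * zRem 1 s := by
  have h0 := LSeries_eq_mul_integral' (fun _ => (1 : ℂ)) (r := 1) zero_le_one hs (by
    apply Asymptotics.isBigO_of_le
    intro n
    simp)
  have hs1 : s - 1 ≠ 0 := by
    intro h
    have := congrArg Complex.re h
    simp at this; linarith
  have h00 : LSeries (fun _ => (1 : ℂ)) s = ZZ s := by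
    have := LSeries_one_eq_riemannZeta hs
    exact this
  rw [h00] at h0
  rw [h0]
  have hi1 : IntegrableOn (fun u : ℝ => (u : ℂ) ^ (-s)) (Set.Ioi 1) :=
    integrableOn_Ioi_cpow_of_lt (by simp; linarith) one_pos
  have hi2 := zRem_integrable (le_refl 1) (s := s) LA
  have : ∫ t in Set.Ioi (1 : ℝ), (∑ k ∈ Icc 1 ⌊t⌋₊, (1:ℂ)) * t ^ (-(s + 1))
      = (∫ t in Set.Ioi (1 : ℝ), (t : ℂ) ^ (-s)) - zRem 1 s := by
    rw [zRem, Nat.cast_one] at *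
    rw [← integral_sub hi1 hi2]
    apply setIntegral_congr_fun measurableSet_Ioi
    intro t ht
    have ht0 : (0 : ℝ) < t := zero_lt_one.trans ht
    have e1 : ((⌊t⌋₊ : ℕ) : ℂ) = (t : ℂ) - ((Int.fract t : ℝ) : ℂ) := by
      rw [← Complex.ofReal_natCast, natCast_floor_eq_intCast_floor ht0.le, ← Complex.ofReal_sub,
        Int.self_sub_fract]
    have e2 : (t : ℂ) ^ (-s) = t * (t : ℂ) ^ (-s - 1) := by
      have htc : (t : ℂ) ≠ 0 := by exact_mod_cast ht0.ne'
      rw [Complex.cpow_sub _ _ htc, Complex.cpow_one]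
      field_simp
    simp only [sum_const, Nat.card_Icc, add_tsub_cancel_right, nsmul_eq_mul, mul_one]
    rw [e1, e2, neg_add']
    ring
  rw [this, integral_Ioi_cpow_of_lt (by simp; linarith) one_pos]
  have : -s + 1 ≠ 0 := by
    intro h; apply hs1; linear_combination -h
  simp
  field_simp
  ring

lemma zeta_formula_one {s : ℂ} (hs : 0 < s.re) (hs1 : s ≠ 1) :
    ZZ s = 1 + 1 / (s - 1) - s * zRem 1 s := by
  have hopen : IsOpen {z : ℂ | 0 < z.re} := isOpen_lt continuous_const continuous_re
  have key : Set.EqOn riemannZeta₁ (fun s => (s - 1) + 1 - (s - 1) * (s * zRem 1 s))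
      {z : ℂ | 0 < z.re} := by
    have hU : IsPreconnected {z : ℂ | 0 < z.re} :=
      (convex_halfSpace_re_gt 0).isPreconnected
    apply AnalyticOnNhd.eqOn_of_preconnected_of_eventuallyEq (𝕜 := ℂ) (z₀ := 2) _ _ hU (by simp)
    · filter_upwards [(isOpen_lt continuous_const continuous_re).mem_nhds
        (show (2 : ℂ) ∈ {z : ℂ | 1 < z.re} by simp)] with z hz
      have hz1 : z ≠ 1 := by rintro rfl; simp at hz
      have hz1' := sub_ne_zero.2 hz1
      have h2 := riemannZeta_eq_inv_sub_mul hz1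
      rw [zeta_formula_aux hz] at h2
      field_simp at h2
      rw [← h2]; ring
    · exact fun z _ => differentiable_riemannZeta₁.analyticAt z
    · apply DifferentiableOn.analyticOnNhd _ hopen
      intro z hz
      have := zRem_differentiableAt hz
      apply DifferentiableAt.differentiableWithinAt
      fun_prop
  have h := key hs
  have hz1' := sub_ne_zero.2 hs1
  rw [riemannZeta_eq_inv_sub_mul hs1, h]
  field_simp

lemma zRem_step {N : ℕ} (hN : 1 ≤ N) {s : ℂ} (hs : 0 < s.re) (hs1 : s ≠ 1) :
    s * zRem N s = s * zRem (N + 1) s + ((N : ℂ) ^ (1 - s) / (s - 1)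
      - ((N + 1 : ℕ) : ℂ) ^ (1 - s) / (s - 1) - ((N + 1 : ℕ) : ℂ) ^ (-s)) := by
  have hN' : (0 : ℝ) < N := by exact_mod_cast hN
  have hs0 : s ≠ 0 := by rintro rfl; simp at hs
  have hz1' := sub_ne_zero.2 hs1
  have hi := zRem_integrable hN hs
  have hle : (N : ℝ) ≤ ((N + 1 : ℕ) : ℝ) := by push_cast; linarith
  have hsplit : zRem N s = (∫ u in Set.Ioc (N : ℝ) ((N + 1 : ℕ) : ℝ),
      ((Int.fract u : ℝ) : ℂ) * (u : ℂ) ^ (-s - 1)) + zRem (N + 1) s := by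
    rw [zRem, zRem, ← Set.Ioc_union_Ioi_eq_Ioi hle]
    apply setIntegral_union Set.Ioc_disjoint_Ioi_same measurableSet_Ioi
    · exact hi.mono_set Set.Ioc_subset_Ioi_self
    · exact hi.mono_set (Set.Ioi_subset_Ioi hle)
  have hF : (∫ u in Set.Ioc (N : ℝ) ((N + 1 : ℕ) : ℝ),
      ((Int.fract u : ℝ) : ℂ) * (u : ℂ) ^ (-s - 1)) =
      ∫ u in (N : ℝ)..((N + 1 : ℕ) : ℝ), ((u : ℂ) - N) * (u : ℂ) ^ (-s - 1) := by
    rw [intervalIntegral.integral_of_le hle, integral_Ioc_eq_integral_Ioo,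
      integral_Ioc_eq_integral_Ioo]
    apply setIntegral_congr_fun measurableSet_Ioo
    intro u hu
    have : Int.fract u = u - N := by
      have : ⌊u⌋ = (N : ℤ) := by
        rw [Int.floor_eq_iff]
        have h2 := hu.2
        push_cast at h2
        exact ⟨by simpa using hu.1.le, by simpa using h2⟩
      rw [Int.fract, this]; simp
    simp only [this]; push_cast; ring
  have hFTC : ∫ u in (N : ℝ)..((N + 1 : ℕ) : ℝ), ((u : ℂ) - N) * (u : ℂ) ^ (-s - 1) =
      ((((N + 1 : ℕ) : ℝ) : ℂ) ^ (1 - s) / (1 - s) + N * (((N + 1 : ℕ) : ℝ) : ℂ) ^ (-s) / s) -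
      (((N : ℝ) : ℂ) ^ (1 - s) / (1 - s) + N * ((N : ℝ) : ℂ) ^ (-s) / s) := by
    have h1s : 1 - s ≠ 0 := by intro h; apply hz1'; linear_combination -h
    apply integral_eq_sub_of_hasDerivAt
      (f := fun u : ℝ => (u : ℂ) ^ (1 - s) / (1 - s) + N * (u : ℂ) ^ (-s) / s)
    · intro u hu
      rw [Set.uIcc_of_le hle] at hu
      have hu0 : 0 < u := hN'.trans_le hu.1
      have huc : (u : ℂ) ≠ 0 := by exact_mod_cast hu0.ne'
      have d1 := (hasDerivAt_ofReal_cpow_const hu0.ne' h1s).div_const (1 - s)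
      have d2 := ((hasDerivAt_ofReal_cpow_const hu0.ne' (neg_ne_zero.2 hs0)).const_mul
        (N : ℂ)).div_const s
      convert d1.fun_add d2 using 1
      rw [show (1 : ℂ) - s - 1 = 1 + (-s - 1) by ring, Complex.cpow_add _ _ huc,
          Complex.cpow_one]
      field_simp
      ring
    · apply ContinuousOn.intervalIntegrable
      rw [Set.uIcc_of_le hle]
      intro u hu
      have hu0 : 0 < u := hN'.trans_le hu.1
      apply ContinuousAt.continuousWithinAt
      have : ContinuousAt (fun u : ℝ => (u : ℂ) ^ (-s - 1)) u :=
        Complex.continuousAt_ofReal_cpow_const _ _ (Or.inr hu0.ne')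
      fun_prop
  rw [hsplit, hF, hFTC, mul_add]
  have e2 : ∀ M : ℕ, 1 ≤ M → (M : ℂ) ^ (1 - s) = M * (M : ℂ) ^ (-s) := by
    intro M hM
    have : (M : ℂ) ≠ 0 := by exact_mod_cast (by omega : M ≠ 0)
    rw [sub_eq_add_neg, Complex.cpow_add _ _ this, Complex.cpow_one]
  have h1s : 1 - s ≠ 0 := by intro h; apply hz1'; linear_combination -h
  simp only [Complex.ofReal_natCast]
  rw [e2 N hN, e2 (N + 1) (by omega)]
  rw [show (1 : ℂ) - s = -(s - 1) by ring]
  push_cast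
  field_simp
  ring

theorem zeta_formula {N : ℕ} (hN : 1 ≤ N) {s : ℂ} (hs : 0 < s.re) (hs1 : s ≠ 1) :
    ZZ s = ∑ m ∈ Icc 1 N, (m : ℂ) ^ (-s) + (N : ℂ) ^ (1 - s) / (s - 1)
      - s * zRem N s := by
  induction N, hN using Nat.le_induction with
  | base => rw [zeta_formula_one hs hs1]; simp
  | succ N hN ih =>
    rw [ih, zRem_step hN hs hs1, sum_Icc_succ_top (by omega)]
    ring

/-! ### Part B2: pointwise bounds for zeta -/

lemma zeta1_formula {s : ℂ} (hs : 0 < s.re) :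
    riemannZeta₁ s = s - (s - 1) * (s * zRem 1 s) := by
  by_cases hs1 : s = 1
  · subst hs1; simp
  · have h := zeta_formula_one hs hs1
    have h2 := riemannZeta_eq_inv_sub_mul hs1
    have hz := sub_ne_zero.2 hs1
    rw [h] at h2
    field_simp at h2
    rw [← h2]; ring

lemma zeta1_bound {s : ℂ} (hs : 0 < s.re) :
    ‖riemannZeta₁ s‖ ≤ ‖s‖ + ‖s - 1‖ * ‖s‖ / s.re := by
  rw [zeta1_formula hs]
  refine (norm_sub_le _ _).trans ?_
  gcongr
  rw [norm_mul, norm_mul, mul_div_assoc, div_eq_mul_inv]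
  gcongr
  have := zRem_norm_le (le_refl 1) hs
  simpa using this

lemma norm_natCast_cpow_pos {m : ℕ} (hm : 1 ≤ m) (s : ℂ) : ‖(m : ℂ) ^ s‖ = (m : ℝ) ^ s.re :=
  Complex.norm_natCast_cpow_of_pos hm s

lemma sum_rpow_neg_half (N : ℕ) : ∑ m ∈ Icc 1 N, (m : ℝ) ^ (-(1/2) : ℝ) ≤ 2 * √N := by
  induction N with
  | zero => simp
  | succ N ih =>
    rw [sum_Icc_succ_top (by omega)]
    have h1 : ((N + 1 : ℕ) : ℝ) ^ (-(1/2) : ℝ) = 1 / √((N + 1 : ℕ) : ℝ) := by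
      rw [Real.rpow_neg PA, Real.sqrt_eq_rpow]; simp
    rw [h1]
    have h2 : 0 < √((N + 1 : ℕ) : ℝ) := PA
    have h3 : √((N + 1 : ℕ) : ℝ) ^ 2 = N + 1 := by rw [Real.sq_sqrt PA]; simp
    have h4 : √(N : ℝ) ^ 2 = N := by rw [Real.sq_sqrt PA]
    have h5 : √(N : ℝ) ≤ √((N + 1 : ℕ) : ℝ) := Real.sqrt_le_sqrt (by push_cast; linarith)
    have : 1 / √((N + 1 : ℕ) : ℝ) ≤ 2 * (√((N + 1 : ℕ) : ℝ) - √(N : ℝ)) := by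
      rw [div_le_iff₀ h2]
      nlinarith [Real.sqrt_nonneg (N : ℝ)]
    linarith

/-- For `σ ≥ 1/2`, `|t| ≥ 1`: `|ζ| ≤ C |t|^{1/2}`. -/
lemma zeta_bound_half {s : ℂ} (hs : 1 / 2 ≤ s.re) (ht : 1 ≤ |s.im|) :
    ‖ZZ s‖ ≤ 12 * √|s.im| := by
  set T := |s.im| with hT
  have hT0 : 0 < T := LA
  set N := ⌊T⌋₊ with hN
  have hN1 : 1 ≤ N := by rw [hN, Nat.one_le_floor_iff]; exact ht
  have hNT : (N : ℝ) ≤ T := Nat.floor_le hT0.le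
  have hTN : T ≤ 2 * N := by
    have := Nat.lt_floor_add_one T
    have h1 : (1 : ℝ) ≤ N := by exact_mod_cast hN1
    linarith
  have hN1' : (1 : ℝ) ≤ N := by exact_mod_cast hN1
  have hN0 : (0 : ℝ) < N := LA
  have hs0 : 0 < s.re := LA
  have hs1 : s ≠ 1 := by rintro rfl; simp at hT; linarith
  have hsT : T ≤ ‖s - 1‖ := by
    have := abs_im_le_norm (s - 1); simpa using this
  rw [zeta_formula hN1 hs0 hs1]
  have a1 : ‖∑ m ∈ Icc 1 N, (m : ℂ) ^ (-s)‖ ≤ 2 * √T := by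
    calc _ ≤ ∑ m ∈ Icc 1 N, ‖(m : ℂ) ^ (-s)‖ := norm_sum_le _ _
      _ ≤ ∑ m ∈ Icc 1 N, (m : ℝ) ^ (-(1/2) : ℝ) := by
          apply sum_le_sum
          intro m hm
          have hm1 := (mem_Icc.1 hm).1
          rw [norm_natCast_cpow_pos hm1]
          apply Real.rpow_le_rpow_of_exponent_le (by exact_mod_cast hm1)
          simp; linarith
      _ ≤ 2 * √N := sum_rpow_neg_half N
      _ ≤ 2 * √T := by gcongr
  have a2 : ‖(N : ℂ) ^ (1 - s) / (s - 1)‖ ≤ √T := by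
    rw [norm_div, norm_natCast_cpow_pos hN1]
    have : (N : ℝ) ^ (1 - s).re ≤ √T := by
      calc (N : ℝ) ^ (1 - s).re ≤ (N : ℝ) ^ (1 / 2 : ℝ) := by
            apply Real.rpow_le_rpow_of_exponent_le hN1'
            simp; linarith
        _ ≤ √T := by rw [← Real.sqrt_eq_rpow]; exact Real.sqrt_le_sqrt hNT
    rw [div_le_iff₀ LA]
    nlinarith [Real.sqrt_nonneg T]
  have a3 : ‖s * zRem N s‖ ≤ 9 * √T := by
    rw [norm_mul]
    have h1 := zRem_norm_le hN1 hs0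
    have h2 : ‖s‖ ≤ s.re + T := by
      have := norm_le_abs_re_add_abs_im s
      rwa [abs_of_pos hs0] at this
    have h3 : (N : ℝ) ^ (-s.re) ≤ 2 / √T := by
      calc (N : ℝ) ^ (-s.re) ≤ (N : ℝ) ^ (-(1 / 2) : ℝ) := by
            apply Real.rpow_le_rpow_of_exponent_le hN1'; linarith
        _ = 1 / √N := by rw [Real.rpow_neg hN0.le, Real.sqrt_eq_rpow]; simp
        _ ≤ 2 / √T := by
          rw [div_le_div_iff₀ PA PA, one_mul]
          rw [← Real.sqrt_sq (show (0:ℝ) ≤ 2 by norm_num), ← Real.sqrt_mul NA]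
          apply Real.sqrt_le_sqrt; linarith
    calc ‖s‖ * ‖zRem N s‖ ≤ (s.re + T) * ((N : ℝ) ^ (-s.re) / s.re) := by gcongr
      _ = ((s.re + T) / s.re) * (N : ℝ) ^ (-s.re) := by ring
      _ ≤ (3 * T) * (2 / √T) := by
          gcongr
          rw [div_le_iff₀ hs0]; nlinarith
      _ = 6 * √T := by
          have : √T ^ 2 = T := Real.sq_sqrt hT0.le
          field_simp; rw [this]; ring
      _ ≤ 9 * √T := by nlinarith [Real.sqrt_nonneg T]
  calc _ ≤ ‖∑ m ∈ Icc 1 N, (m : ℂ) ^ (-s)‖ + ‖(N : ℂ) ^ (1 - s) / (s - 1)‖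
        + ‖s * zRem N s‖ := (norm_sub_le _ _).trans (by gcongr; exact norm_add_le _ _)
    _ ≤ _ := LA

/-- For `1/2 ≤ σ ≤ 1 + 1/log T`: `|ζ| ≤ C T^{1-σ} (1 + log T)`. -/
lemma zeta_bound_strip {s : ℂ} (hs : 1 / 2 ≤ s.re) (ht : 3 ≤ |s.im|) {T : ℝ} (hT : |s.im| ≤ T)
    (hs2 : s.re ≤ 1 + 1 / RL T) :
    ‖ZZ s‖ ≤ 60 * |s.im| ^ (1 - s.re) * (1 + RL |s.im|) := by
  set t := |s.im| with htt
  have hT0 : 0 < t := LA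
  set N := ⌊t⌋₊ with hN
  have hN1 : 1 ≤ N := by rw [hN, Nat.one_le_floor_iff]; linarith
  have hNT : (N : ℝ) ≤ t := Nat.floor_le hT0.le
  have hTN : t ≤ 2 * N := by
    have := Nat.lt_floor_add_one t
    have h1 : (1 : ℝ) ≤ N := by exact_mod_cast hN1
    linarith
  have hN1' : (1 : ℝ) ≤ N := by exact_mod_cast hN1
  have hN0 : (0 : ℝ) < N := LA
  have hs0 : 0 < s.re := LA
  have hs1 : s ≠ 1 := by rintro rfl; simp at htt; linarith
  have hsT : t ≤ ‖s - 1‖ := by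
    have := abs_im_le_norm (s - 1); simpa using this
  have hlog1 : 1 ≤ RL t := by
    rw [Real.le_log_iff_exp_le hT0]; linarith [Real.exp_one_lt_d9]
  have hlogT : RL t ≤ RL T := Real.log_le_log hT0 hT
  have hs2' : s.re ≤ 1 + 1 / RL t := hs2.trans (by gcongr)
  have hs3 : s.re ≤ 2 := by
    have : 1 / RL t ≤ 1 := by rw [div_le_one LA]; exact hlog1
    linarith
  -- key monotone bound
  have key : ∀ x : ℝ, 1 ≤ x → x ≤ t → x ^ (1 - s.re) ≤ 3 * t ^ (1 - s.re) := by
    intro x hx1 hxt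
    have hp : 0 < t ^ (1 - s.re) := PA
    rcases le_total s.re 1 with h | h
    · have : x ^ (1 - s.re) ≤ t ^ (1 - s.re) :=
        Real.rpow_le_rpow LA hxt LA
      linarith
    · have h1 : x ^ (1 - s.re) ≤ 1 := Real.rpow_le_one_of_one_le_of_nonpos hx1 LA
      have h2 : (1 : ℝ) ≤ 3 * t ^ (1 - s.re) := by
        have : t ^ (1 - s.re) = RE (-(RL t * (s.re - 1))) := by
          rw [Real.rpow_def_of_pos hT0]; congr 1; ring
        rw [this, Real.exp_neg]
        have h3 : RL t * (s.re - 1) ≤ 1 := by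
          have : s.re - 1 ≤ 1 / RL t := LA
          calc _ ≤ RL t * (1 / RL t) := by gcongr
            _ = 1 := by field_simp
        have h4 : RE (RL t * (s.re - 1)) ≤ 3 := by
          have := Real.exp_le_exp.2 h3
          linarith [Real.exp_one_lt_d9]
        have h5 := Real.exp_pos (RL t * (s.re - 1))
        rw [← div_eq_mul_inv, le_div_iff₀ h5]; linarith
      linarith
  rw [zeta_formula hN1 hs0 hs1]
  set P := t ^ (1 - s.re) with hP
  have hPp : 0 < P := PA
  have a1 : ‖∑ m ∈ Icc 1 N, (m : ℂ) ^ (-s)‖ ≤ 3 * P * (1 + RL t) := by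
    calc _ ≤ ∑ m ∈ Icc 1 N, ‖(m : ℂ) ^ (-s)‖ := norm_sum_le _ _
      _ ≤ ∑ m ∈ Icc 1 N, 3 * P * (m : ℝ)⁻¹ := by
          apply sum_le_sum
          intro m hm
          have hm1 := (mem_Icc.1 hm).1
          have hm2 := (mem_Icc.1 hm).2
          have hm1' : (1 : ℝ) ≤ m := by exact_mod_cast hm1
          have hm2' : (m : ℝ) ≤ N := by exact_mod_cast hm2
          rw [norm_natCast_cpow_pos hm1]
          have : (m : ℝ) ^ (-s).re = (m : ℝ) ^ (1 - s.re) * (m : ℝ)⁻¹ := by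
            rw [← Real.rpow_neg_one (m : ℝ), ← Real.rpow_add LA]
            congr 1; simp; ring
          rw [this]
          gcongr
          exact key m hm1' (hm2'.trans hNT)
      _ = 3 * P * ∑ m ∈ Icc 1 N, (m : ℝ)⁻¹ := by rw [mul_sum]
      _ ≤ 3 * P * (1 + RL t) := by
          gcongr
          have h1 := harmonic_le_one_add_log N
          rw [harmonic_eq_sum_Icc] at h1
          push_cast at h1
          exact h1.trans (by gcongr)
  have a2 : ‖(N : ℂ) ^ (1 - s) / (s - 1)‖ ≤ 3 * P := by
    rw [norm_div, norm_natCast_cpow_pos hN1]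
    have : (N : ℝ) ^ (1 - s).re ≤ 3 * P := by simpa using key N hN1' hNT
    rw [div_le_iff₀ LA]
    nlinarith
  have a3 : ‖s * zRem N s‖ ≤ 24 * P := by
    rw [norm_mul]
    have h1 := zRem_norm_le hN1 hs0
    have h2 : ‖s‖ ≤ s.re + t := by
      have := norm_le_abs_re_add_abs_im s
      rwa [abs_of_pos hs0] at this
    have h3 : (N : ℝ) ^ (-s.re) ≤ 6 * P / t := by
      have : (N : ℝ) ^ (-s.re) = (N : ℝ) ^ (1 - s.re) * (N : ℝ)⁻¹ := by
        rw [← Real.rpow_neg_one (N : ℝ), ← Real.rpow_add LA]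
        congr 1; ring
      rw [this]
      have hk := key N hN1' hNT
      calc (N : ℝ) ^ (1 - s.re) * (N : ℝ)⁻¹ ≤ (3 * P) * (2 / t) := by
            gcongr
            rw [inv_eq_one_div, div_le_div_iff₀ hN0 hT0]; linarith
        _ = 6 * P / t := by ring
    calc ‖s‖ * ‖zRem N s‖ ≤ (s.re + t) * ((N : ℝ) ^ (-s.re) / s.re) := by gcongr
      _ = ((s.re + t) / s.re) * (N : ℝ) ^ (-s.re) := by ring
      _ ≤ (3 * t) * (6 * P / t) := by
          gcongr
          rw [div_le_iff₀ hs0]; nlinarith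
      _ = 18 * P := by field_simp; ring
      _ ≤ 24 * P := LA
  calc _ ≤ ‖∑ m ∈ Icc 1 N, (m : ℂ) ^ (-s)‖ + ‖(N : ℂ) ^ (1 - s) / (s - 1)‖
        + ‖s * zRem N s‖ := (norm_sub_le _ _).trans (by gcongr; exact norm_add_le _ _)
    _ ≤ 3 * P * (1 + RL t) + 3 * P + 24 * P := LA
    _ ≤ _ := by nlinarith [mul_pos hPp (by linarith : 0 < RL t)]

/-! ### Part A: Gamma function bounds -/

lemma norm_Gamma_le_Gamma_re {s : ℂ} (hs : 0 < s.re) : ‖Gamma s‖ ≤ Real.Gamma s.re := by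
  rw [Complex.Gamma_eq_integral hs, Real.Gamma_eq_integral hs]
  refine (norm_integral_le_integral_norm _).trans (le_of_eq ?_)
  apply setIntegral_congr_fun measurableSet_Ioi
  intro x hx
  have hx0 : (0 : ℝ) < x := hx
  simp only [norm_mul, norm_ofReal_cpow_pos hx0]
  simp [norm_exp]

lemma norm_Gamma_half_sq (t : ℝ) :
    ‖Gamma (1 / 2 + t * I)‖ ^ 2 = π / Real.cosh (π * t) := by
  have h := Complex.Gamma_mul_Gamma_one_sub (1 / 2 + t * I)
  have h1 : (1 : ℂ) - (1 / 2 + t * I) = CJ (1 / 2 + t * I) := by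
    apply Complex.ext <;> norm_num
  have h2 : Complex.sin (π * (1 / 2 + t * I)) = Real.cosh (π * t) := by
    rw [show (π : ℂ) * (1 / 2 + t * I) = (π * t : ℝ) * I + π / 2 by
      push_cast; ring, Complex.sin_add_pi_div_two, Complex.cos_mul_I]
    push_cast; rfl
  rw [h1, Complex.Gamma_conj, Complex.mul_conj, h2] at h
  have h3 : Complex.normSq (Gamma (1 / 2 + t * I)) = π / Real.cosh (π * t) := by
    exact_mod_cast h
  rwa [Complex.normSq_eq_norm_sq] at h3

lemma norm_Gamma_half (t : ℝ) :
    ‖Gamma (1 / 2 + t * I)‖ ≤ 3 * RE (-(π * |t| / 2)) := by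
  have h3 := norm_Gamma_half_sq t
  have hc : RE (π * |t|) / 2 ≤ Real.cosh (π * t) := by
    rw [← Real.cosh_abs, abs_mul, abs_of_pos Real.pi_pos, Real.cosh_eq]
    have := Real.exp_pos (-(π * |t|)); linarith
  have h4 : (3 * RE (-(π * |t| / 2))) ^ 2 = 9 * RE (-(π * |t|)) := by
    rw [mul_pow, ← Real.exp_nat_mul]; norm_num; ring
  apply le_of_sq_le_sq _ PA
  rw [h3, h4, Real.exp_neg]
  have he := Real.exp_pos (π * |t|)
  rw [div_le_iff₀ LA, ← div_eq_mul_inv, div_mul_eq_mul_div, le_div_iff₀ he]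
  nlinarith [Real.pi_lt_four]

lemma exists_Gamma_bound_Icc {a b : ℝ} (ha : 0 < a) :
    ∃ M, 0 ≤ M ∧ ∀ x ∈ Set.Icc a b, Real.Gamma x ≤ M := by
  have hc : ContinuousOn Real.Gamma (Set.Icc a b) := by
    intro x hx
    have hx0 : 0 < x := ha.trans_le hx.1
    exact (Real.differentiableAt_Gamma (fun m => by
      have : (0 : ℝ) ≤ m := Nat.cast_nonneg m
      linarith)).continuousAt.continuousWithinAt
  obtain ⟨M, hM⟩ := isCompact_Icc.bddAbove_image hc
  refine ⟨max M 0, le_max_right _ _, fun x hx => ?_⟩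
  exact (hM (Set.mem_image_of_mem _ hx)).trans (le_max_left _ _)

lemma gamma_bound_aux {σ τ : ℝ} (hσ : σ ∈ Set.Icc (1 / 2 : ℝ) (3 / 2)) (hτ : 1 ≤ τ) :
    ‖Gamma (σ + τ * I)‖ ≤ 100 * τ ^ (σ - 1 / 2) * RE (-(π * τ / 2)) := by
  have hτ0 : 0 < τ := LA
  set f : ℂ → ℂ := fun s => Gamma s * Complex.exp (-(I * π * s / 2)) *
    (Complex.exp (-(RL τ * (s - 1 / 2))) * Complex.exp ((s - τ * I) ^ 2)) with hf
  have hnorm : ∀ s : ℂ, ‖f s‖ = ‖Gamma s‖ * RE (π * s.im / 2) *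
      (RE (-(RL τ * (s.re - 1 / 2))) * RE (s.re ^ 2 - (s.im - τ) ^ 2)) := by
    intro s
    simp only [hf, norm_mul, norm_exp]
    congr 3
    · simp
      ring
    · simp
    · simp [sq]
  have hdiff : DiffContOnCl ℂ f (Complex.re ⁻¹' Set.Ioo (1 / 2 : ℝ) (3 / 2)) := by
    apply DifferentiableOn.diffContOnCl
    intro s hs
    have hcl : s.re ∈ Set.Icc (1 / 2 : ℝ) (3 / 2) := by
      have h1 : closure (Complex.re ⁻¹' Set.Ioo (1 / 2 : ℝ) (3 / 2)) ⊆
          Complex.re ⁻¹' Set.Icc (1 / 2 : ℝ) (3 / 2) :=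
        closure_minimal (Set.preimage_mono Set.Ioo_subset_Icc_self)
          (isClosed_Icc.preimage continuous_re)
      exact h1 hs
    have hG : DifferentiableAt ℂ Gamma s := by
      apply differentiableAt_Gamma
      intro m h
      have := congrArg Complex.re h
      simp at this
      have h0 : (0 : ℝ) ≤ m := Nat.cast_nonneg m
      linarith [hcl.1]
    apply DifferentiableAt.differentiableWithinAt
    fun_prop
  obtain ⟨M, hM0, hM⟩ := exists_Gamma_bound_Icc (a := 1 / 2) (b := 3 / 2) NA
  have hlog : 0 ≤ RL τ := Real.log_nonneg hτ
  have hhalf : ∀ t : ℝ, ‖Gamma (1 / 2 + t * I)‖ * RE (π * t / 2) ≤ 3 := by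
    intro t
    have h1 := norm_Gamma_half t
    have h2 : RE (-(π * |t| / 2)) * RE (π * t / 2) ≤ 1 := by
      rw [← Real.exp_add, Real.exp_le_one_iff]
      nlinarith [le_abs_self t, Real.pi_pos]
    calc _ ≤ 3 * RE (-(π * |t| / 2)) * RE (π * t / 2) := by gcongr
      _ ≤ 3 := by nlinarith
  have main : ‖f (σ + τ * I)‖ ≤ 100 := by
    apply PhragmenLindelof.vertical_strip hdiff (z := σ + τ * I) (C := 100)
    · refine ⟨1, by rw [lt_div_iff₀ NA]; linarith [Real.pi_gt_three], 2, ?_⟩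
      apply Asymptotics.IsBigO.of_bound (M * RE (9 / 4))
      have : Complex.re ⁻¹' Set.Ioo (1 / 2 : ℝ) (3 / 2) ∈
        comap (_root_.abs ∘ Complex.im) atTop ⊓ 𝓟 (Complex.re ⁻¹' Set.Ioo (1 / 2 : ℝ) (3 / 2)) :=
        mem_inf_of_right (mem_principal_self _)
      filter_upwards [this] with s hs
      have hs1 : (1 / 2 : ℝ) < s.re := hs.1
      have hs2 : s.re < 3 / 2 := hs.2
      rw [hnorm]
      have e1 : ‖Gamma s‖ ≤ M :=
        (norm_Gamma_le_Gamma_re LA).trans (hM _ ⟨hs1.le, hs2.le⟩)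
      have e2 : RE (-(RL τ * (s.re - 1 / 2))) ≤ 1 := by
        rw [Real.exp_le_one_iff]; nlinarith
      have e3 : RE (s.re ^ 2 - (s.im - τ) ^ 2) ≤ RE (9 / 4) := by
        apply Real.exp_le_exp.2; nlinarith [sq_nonneg (s.im - τ)]
      have e4 : RE (π * s.im / 2) ≤ ‖RE (2 * RE (1 * |s.im|))‖ := by
        rw [Real.norm_eq_abs, abs_of_pos (Real.exp_pos _)]
        apply Real.exp_le_exp.2
        have := Real.add_one_le_exp (1 * |s.im|)
        have h1 := le_abs_self s.im
        have h2 := abs_nonneg s.im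
        nlinarith [Real.pi_lt_four, Real.pi_pos]
      calc _ ≤ M * ‖RE (2 * RE (1 * |s.im|))‖ * (1 * RE (9 / 4)) := by gcongr
        _ = _ := by ring
    · intro z hz
      rw [hnorm, hz]
      have hzz : z = 1 / 2 + z.im * I := by
        apply Complex.ext <;> simp [hz]
      have h1 := hhalf z.im
      rw [← hzz] at h1
      have h2 : RE (-(RL τ * ((1 / 2 : ℝ) - 1 / 2))) = 1 := by simp
      have h3 : RE ((1 / 2 : ℝ) ^ 2 - (z.im - τ) ^ 2) ≤ 3 := by
        have : RE ((1 / 2 : ℝ) ^ 2 - (z.im - τ) ^ 2) ≤ RE 1 :=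
          Real.exp_le_exp.2 (by nlinarith [sq_nonneg (z.im - τ)])
        linarith [Real.exp_one_lt_d9]
      rw [h2, one_mul]
      refine le_trans (mul_le_mul h1 h3 (Real.exp_pos _).le NA) NA
    · intro z hz
      rw [hnorm, hz]
      have hzz : z = (1 / 2 + z.im * I) + 1 := by
        apply Complex.ext <;> simp [hz]; norm_num
      have hne : (1 / 2 + z.im * I : ℂ) ≠ 0 := by
        intro h; have := congrArg Complex.re h; norm_num at this
      have h1 := hhalf z.im
      have hG : ‖Gamma z‖ = ‖(1 / 2 + z.im * I : ℂ)‖ *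
          ‖Gamma (1 / 2 + z.im * I)‖ := by
        conv_lhs => rw [hzz, Complex.Gamma_add_one _ hne]
        rw [norm_mul]
      have h2 : RE (-(RL τ * ((3 / 2 : ℝ) - 1 / 2))) = τ⁻¹ := by
        rw [Real.exp_neg]; norm_num; rw [Real.exp_log hτ0]
      have h3 : ‖(1 / 2 + z.im * I : ℂ)‖ ≤ τ * (3 / 2 + |z.im - τ|) := by
        have a1 := norm_le_abs_re_add_abs_im (1 / 2 + z.im * I : ℂ)
        have a2 : |z.im| ≤ |z.im - τ| + τ := by
          have := abs_add_le (z.im - τ) τ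
          rw [sub_add_cancel, abs_of_pos hτ0] at this
          exact this
        have a3 : |(1 / 2 + z.im * I : ℂ).re| + |(1 / 2 + z.im * I : ℂ).im| = 1 / 2 + |z.im| := by
          norm_num
        rw [a3] at a1
        nlinarith [abs_nonneg (z.im - τ)]
      have h4 : (3 / 2 + |z.im - τ|) * RE (-(z.im - τ) ^ 2) ≤ 5 / 2 := by
        set y := |z.im - τ| with hy
        have : (z.im - τ) ^ 2 = y ^ 2 := by rw [hy, sq_abs]
        rw [this, Real.exp_neg]
        have b1 := Real.add_one_le_exp (y ^ 2)
        have b2 := Real.exp_pos (y ^ 2)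
        rw [← div_eq_mul_inv, div_le_iff₀ b2]
        nlinarith [sq_nonneg (y - 1)]
      have h5 : RE ((3 / 2 : ℝ) ^ 2 - (z.im - τ) ^ 2) =
          RE (9 / 4) * RE (-(z.im - τ) ^ 2) := by
        rw [← Real.exp_add]; congr 1; ring
      have h6 : RE (9 / 4) ≤ 10 := by
        have e9 : RE (9 / 4) = RE 1 ^ 2 * RE (1 / 4) := by
          rw [← Real.exp_nat_mul, ← Real.exp_add]; norm_num
        have e10 : RE (1 / 4) ≤ 4 / 3 := by
          have := Real.exp_bound_div_one_sub_of_interval (x := 1 / 4) NA NA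
          norm_num at this ⊢; exact this
        have e11 := Real.exp_one_lt_d9
        have e12 := Real.exp_pos 1
        rw [e9]
        calc RE 1 ^ 2 * RE (1 / 4) ≤ 2.7183 ^ 2 * (4 / 3) := by gcongr; linarith
          _ ≤ 10 := NA
      rw [hG, h2, h5]
      calc _ ≤ (τ * (3 / 2 + |z.im - τ|)) * ‖Gamma (1 / 2 + z.im * I)‖ *
            RE (π * z.im / 2) * (τ⁻¹ * (RE (9 / 4) *
            RE (-(z.im - τ) ^ 2))) := by gcongr
        _ = (‖Gamma (1 / 2 + z.im * I)‖ * RE (π * z.im / 2)) *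
            ((3 / 2 + |z.im - τ|) * RE (-(z.im - τ) ^ 2)) * RE (9 / 4) := by
            field_simp
        _ ≤ 3 * (5 / 2) * 10 := by gcongr
        _ ≤ 100 := NA
    · simpa using hσ.1
    · simpa using hσ.2
  rw [hnorm] at main
  simp only [add_re, ofReal_re, mul_re, I_re, mul_zero, ofReal_im, I_im, mul_one, sub_self,
    add_zero, add_im, mul_im, zero_add] at main
  have e1 : τ ^ (σ - 1 / 2) = RE (RL τ * (σ - 1 / 2)) := Real.rpow_def_of_pos hτ0 _
  have e2 : 1 ≤ RE (σ ^ 2 - 0 ^ 2) := by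
    apply Real.one_le_exp; nlinarith [hσ.1]
  rw [e1]
  have p1 := Real.exp_pos (RL τ * (σ - 1 / 2))
  have p2 := Real.exp_pos (π * τ / 2)
  rw [Real.exp_neg] at main ⊢
  rw [← div_eq_mul_inv, le_div_iff₀ p2]
  have : ‖Gamma (σ + τ * I)‖ * RE (π * τ / 2) *
      (RE (RL τ * (σ - 1 / 2)))⁻¹ ≤ 100 := by
    refine le_trans ?_ main
    rw [← mul_assoc]
    exact le_mul_of_one_le_right PA e2
  rwa [← div_eq_mul_inv, div_le_iff₀ p1] at this

/-- Upper Stirling bound. -/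
theorem gamma_bound {s : ℂ} (h1 : 1 / 2 ≤ s.re) (h2 : s.re ≤ 7 / 2) (ht : 1 ≤ |s.im|) :
    ‖Gamma s‖ ≤ 2000 * |s.im| ^ (s.re - 1 / 2) * RE (-(π * |s.im| / 2)) := by
  wlog hpos : 0 ≤ s.im generalizing s
  · have := this (s := CJ s) (by simpa using h1) (by simpa using h2)
      (by simpa using ht) (by simp; linarith)
    rw [Complex.Gamma_conj] at this
    simpa using this
  rw [abs_of_nonneg hpos] at *
  have hzz : ∀ z : ℂ, (z.re : ℂ) + z.im * I = z := Complex.re_add_im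
  have step0 : ∀ z : ℂ, z.im = s.im → 1 / 2 ≤ z.re → z.re ≤ 3 / 2 → ‖Gamma z‖ ≤
      100 * s.im ^ (z.re - 1 / 2) * RE (-(π * s.im / 2)) := by
    intro z hz a b
    have := gamma_bound_aux (σ := z.re) (τ := s.im) ⟨a, b⟩ ht
    have e : ((z.re : ℂ) + (s.im : ℂ) * I) = z := by rw [← hz]; exact hzz z
    rwa [e] at this
  have rec1 : ∀ z : ℂ, z.im = s.im → 1 / 2 ≤ z.re - 1 → z.re ≤ 7 / 2 → ‖Gamma z‖ ≤
      s.im * (7 / 2) * ‖Gamma (z - 1)‖ := by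
    intro z hz a b
    have hne : z - 1 ≠ 0 := by
      intro h; have := congrArg Complex.im h; simp at this; linarith
    have h := Complex.Gamma_add_one (z - 1) hne
    rw [sub_add_cancel] at h
    rw [h, norm_mul]
    gcongr
    have := norm_le_abs_re_add_abs_im (z - 1)
    simp only [sub_re, one_re, sub_im, one_im, sub_zero] at this
    rw [abs_of_nonneg LA, hz, abs_of_nonneg hpos] at this
    nlinarith
  have hs0 : 0 < s.im := LA
  set E := RE (-(π * s.im / 2)) with hE
  have hEp : 0 < E := Real.exp_pos _
  have hpow : ∀ x : ℝ, s.im * s.im ^ (x - 1 - 1 / 2) = s.im ^ (x - 1 / 2) := by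
    intro x
    nth_rewrite 1 [← Real.rpow_one s.im]
    rw [← Real.rpow_add hs0]
    congr 1; ring
  have step1 : ∀ z : ℂ, z.im = s.im → 1 / 2 ≤ z.re → z.re ≤ 5 / 2 → ‖Gamma z‖ ≤
      350 * s.im ^ (z.re - 1 / 2) * E := by
    intro z hz a b
    have hp : 0 < s.im ^ (z.re - 1 / 2) * E := PA
    rcases le_total z.re (3 / 2) with h | h
    · have := step0 z hz a h; nlinarith
    · have r := rec1 z hz LA LA
      have := step0 (z - 1) (by simpa using hz) (by simp; linarith) (by simp; linarith)
      simp only [sub_re, one_re] at this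
      calc ‖Gamma z‖ ≤ s.im * (7 / 2) *
            (100 * s.im ^ (z.re - 1 - 1 / 2) * E) := r.trans (by gcongr)
        _ = 350 * (s.im * s.im ^ (z.re - 1 - 1 / 2)) * E := by ring
        _ = _ := by rw [hpow]
  have hp : 0 < s.im ^ (s.re - 1 / 2) * E := PA
  rcases le_total s.re (5 / 2) with h | h
  · have := step1 s rfl h1 h; nlinarith
  · have r := rec1 s rfl LA LA
    have := step1 (s - 1) (by simp) (by simp; linarith) (by simp; linarith)
    simp only [sub_re, one_re] at this
    calc ‖Gamma s‖ ≤ s.im * (7 / 2) *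
          (350 * s.im ^ (s.re - 1 - 1 / 2) * E) := r.trans (by gcongr)
      _ = 1225 * (s.im * s.im ^ (s.re - 1 - 1 / 2)) * E := by ring
      _ = 1225 * (s.im ^ (s.re - 1 / 2) * E) := by rw [hpow]; ring
      _ ≤ _ := by nlinarith

lemma cauchy_bound {f : ℂ → ℂ} {c : ℂ} {r M : ℝ} (n : ℕ) (hr : 0 < r)
    (hf : DifferentiableOn ℂ f (CB c r))
    (hM : ∀ z ∈ CB c r, ‖f z‖ ≤ M) :
    ‖iteratedDeriv n f c‖ ≤ n.factorial * M / r ^ n := by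
  apply Complex.norm_iteratedDeriv_le_of_forall_mem_sphere_norm_le n hr
  · apply DifferentiableOn.diffContOnCl
    exact hf.mono Metric.closure_ball_subset_closedBall
  · exact fun z hz => hM z (Metric.sphere_subset_closedBall hz)

/-- log-derivative bound from growth on a disc -/
lemma logDeriv_disc {f : ℂ → ℂ} {c : ℂ} {r R M : ℝ} (hr : 0 ≤ r) (hrR : r < R) (hM : 0 < M)
    (hf : DifferentiableOn ℂ f (Metric.ball c R)) (hne : ∀ z ∈ Metric.ball c R, f z ≠ 0)
    (hb : ∀ z ∈ Metric.ball c R, ‖f z‖ ≤ RE M * ‖f c‖) {z : ℂ}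
    (hz : z ∈ CB c r) : ‖logDeriv f z‖ ≤ 8 * M * R / (R - r) ^ 2 := by
  have hR : 0 < R := hr.trans_lt hrR
  have hd : DifferentiableOn ℂ (logDeriv f) (Metric.ball c R) :=
    (hf.deriv Metric.isOpen_ball).div hf hne
  obtain ⟨g, hg0, hg⟩ := hd.isExactOn_ball.with_val_at c 0
  have hfd : ∀ z ∈ Metric.ball c R, DifferentiableAt ℂ f z := fun z hz =>
    hf.differentiableAt (Metric.isOpen_ball.mem_nhds hz)
  have hder : ∀ z ∈ Metric.ball c R, HasDerivAt (fun z => f z * Complex.exp (-g z)) 0 z := by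
    intro z hz
    have h1 := (hfd z hz).hasDerivAt.mul ((hg z hz).neg.cexp)
    refine HasDerivAt.congr_deriv (f := fun z => f z * Complex.exp (-g z)) h1 ?_
    rw [logDeriv_apply]
    have := hne z hz
    simp only [Pi.neg_apply]
    field_simp
    ring
  have hcm : c ∈ Metric.ball c R := Metric.mem_ball_self hR
  have hconst : ∀ z ∈ Metric.ball c R, f z * Complex.exp (-g z) = f c := by
    intro z hz
    have := IsOpen.is_const_of_deriv_eq_zero Metric.isOpen_ball
      (convex_ball c R).isPreconnected
      (fun z hz => (hder z hz).differentiableAt.differentiableWithinAt)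
      (fun z hz => (hder z hz).deriv) hz hcm
    simpa [hg0] using this
  have hre : ∀ z ∈ Metric.ball c R, (g z).re ≤ M := by
    intro z hz
    have h1 := congrArg norm (hconst z hz)
    rw [norm_mul, norm_exp, neg_re, Real.exp_neg] at h1
    have h2 := hb z hz
    have h3 : 0 < ‖f c‖ := norm_pos_iff.2 (hne c hcm)
    have h4 := Real.exp_pos (g z).re
    have h5 : ‖f z‖ = ‖f c‖ * RE (g z).re := by
      rw [← h1]; field_simp
    rw [h5, mul_comm] at h2
    exact Real.exp_le_exp.1 (le_of_mul_le_mul_right h2 h3)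
  set ε := (R - r) / 2 with hε
  have hε0 : 0 < ε := by rw [hε]; linarith
  have hsub : CB z ε ⊆ CB c (R - ε) := by
    intro w hw
    rw [Metric.mem_closedBall] at *
    have := dist_triangle w z c
    rw [hε] at *; linarith
  have hsub2 : CB c (R - ε) ⊆ Metric.ball c R :=
    Metric.closedBall_subset_ball LA
  have hgb : ∀ w ∈ CB c (R - ε), ‖g w‖ ≤ 2 * M * R / ε := by
    intro w hw
    have hw' : ‖w - c‖ ≤ R - ε := by simpa [dist_eq_norm] using hw
    have h := Complex.borelCaratheodory_zero (f := fun u => g (c + u)) (M := M) (R := R)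
      (z := w - c) hM ?_ ?_ hR ?_ (by simpa using hg0)
    · simp only [add_sub_cancel] at h
      refine h.trans ?_
      rw [div_le_div_iff₀ LA hε0]
      have : ‖w - c‖ ≤ R := LA
      have h0 := norm_nonneg (w - c)
      nlinarith [mul_le_mul this hw' h0 hR.le, mul_nonneg hM.le h0,
        mul_le_mul_of_nonneg_left (show ‖w - c‖ * ε ≤ R * (R - ‖w - c‖) by nlinarith)
          (by linarith : (0:ℝ) ≤ 2 * M)]
    · intro u hu
      have : c + u ∈ Metric.ball c R := by simpa using hu
      exact ((hg _ this).differentiableAt.comp u FA).differentiableWithinAt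
    · intro u hu
      exact hre (c + u) (by simpa using hu)
    · simpa using lt_of_le_of_lt hw' LA
  have hc := cauchy_bound (f := g) (c := z) (M := 2 * M * R / ε) 1 hε0
    (fun w hw => (hg w (hsub2 (hsub hw))).differentiableAt.differentiableWithinAt)
    (fun w hw => hgb w (hsub hw))
  rw [iteratedDeriv_one, (hg z (hsub2 (hsub (Metric.mem_closedBall_self hε0.le)))).deriv] at hc
  refine hc.trans (le_of_eq ?_)
  have : R - r ≠ 0 := LA
  rw [hε]; simp; field_simp; norm_num

lemma gamma_le_pow {Y : ℝ} (hY : 1 ≤ Y) (k : ℕ) : ∀ u : ℝ, 1 / 2 ≤ u → u ≤ k + 3 / 2 → u ≤ Y →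
    Real.Gamma u ≤ 2 * Y ^ u := by
  induction k with
  | zero =>
    intro u h1 h2 h3
    have hG : Real.Gamma u ≤ max (Real.Gamma (1 / 2)) (Real.Gamma (3 / 2)) := by
      apply Real.convexOn_Gamma.le_max_of_mem_Icc (by simp) (by simp)
      exact ⟨h1, by simpa using h2⟩
    have hs : Real.Gamma (1 / 2) ≤ 2 := by
      rw [Real.Gamma_one_half_eq, Real.sqrt_le_left NA]
      linarith [Real.pi_lt_four]
    have hs2 : Real.Gamma (3 / 2) ≤ 2 := by
      rw [show (3 / 2 : ℝ) = 1 / 2 + 1 by norm_num, Real.Gamma_add_one NA]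
      linarith
    have h4 : 1 ≤ Y ^ u := Real.one_le_rpow hY LA
    have := max_le hs hs2
    linarith
  | succ k ih =>
    intro u h1 h2 h3
    rcases le_total u (k + 3 / 2) with h | h
    · exact ih u h1 h h3
    · have hk : (0 : ℝ) ≤ k := Nat.cast_nonneg k
      have h5 := ih (u - 1) LA (by push_cast at h2; linarith) LA
      have h6 := Real.Gamma_add_one (s := u - 1) LA
      rw [sub_add_cancel] at h6
      rw [h6]
      have h7 : Y ^ u = Y * Y ^ (u - 1) := by
        rw [Real.rpow_sub_one LA]; field_simp
      rw [h7]
      have h8 : 0 < Real.Gamma (u - 1) := Real.Gamma_pos_of_pos LA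
      calc (u - 1) * Real.Gamma (u - 1) ≤ Y * (2 * Y ^ (u - 1)) := by
            apply mul_le_mul LA h5 h8.le LA
        _ = _ := by ring

lemma gamma_half_lower (t : ℝ) :
    RE (-(π * |t| / 2)) ≤ ‖Gamma (1 / 2 + t * I)‖ := by
  apply le_of_sq_le_sq _ (norm_nonneg _)
  rw [norm_Gamma_half_sq, ← Real.exp_nat_mul]
  rw [← Real.cosh_abs, abs_mul, abs_of_pos Real.pi_pos, le_div_iff₀ (Real.cosh_pos _), Real.cosh_eq]
  have e1 : ((2 : ℕ) : ℝ) * -(π * |t| / 2) = -(π * |t|) := by push_cast; ring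
  rw [e1]
  have h1 : RE (-(π * |t|)) * RE (π * |t|) = 1 := by
    rw [← Real.exp_add]; simp
  have h2 : RE (-(π * |t|)) ≤ 1 := by
    rw [Real.exp_le_one_iff]; have := Real.pi_pos; have := abs_nonneg t; nlinarith
  have h3 := Real.exp_pos (-(π * |t|))
  nlinarith [Real.pi_gt_three]

lemma gamma_center_lower (N : ℕ) (t : ℝ) :
    RE (-(π * |t| / 2)) * N.factorial ≤
      ‖Gamma (((N + 1 : ℕ) : ℂ) + 1 / 2 + t * I)‖ * 2 := by
  induction N with
  | zero =>
    have hne : (1 / 2 + t * I : ℂ) ≠ 0 := by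
      intro h; have := congrArg Complex.re h; norm_num at this
    have h := Complex.Gamma_add_one _ hne
    rw [show ((0 + 1 : ℕ) : ℂ) + 1 / 2 + t * I = 1 / 2 + t * I + 1 by push_cast; ring, h, norm_mul]
    have h1 : 1 / 2 ≤ ‖(1 / 2 + t * I : ℂ)‖ := by
      have := abs_re_le_norm (1 / 2 + t * I : ℂ)
      norm_num at this ⊢; exact this
    have h2 := gamma_half_lower t
    simp only [Nat.factorial_zero, Nat.cast_one, mul_one]
    nlinarith [norm_nonneg (Gamma (1 / 2 + t * I))]
  | succ N ih =>
    have hne : (((N + 1 : ℕ) : ℂ) + 1 / 2 + t * I : ℂ) ≠ 0 := by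
      intro h; have := congrArg Complex.re h; norm_num at this
      have h0 : (0 : ℝ) ≤ N := Nat.cast_nonneg N
      linarith
    have h := Complex.Gamma_add_one _ hne
    rw [show ((N + 1 + 1 : ℕ) : ℂ) + 1 / 2 + t * I = ((N + 1 : ℕ) : ℂ) + 1 / 2 + t * I + 1 by
      push_cast; ring, h, norm_mul]
    have h1 : ((N + 1 : ℕ) : ℝ) ≤ ‖(((N + 1 : ℕ) : ℂ) + 1 / 2 + t * I : ℂ)‖ := by
      have := re_le_norm (((N + 1 : ℕ) : ℂ) + 1 / 2 + t * I : ℂ)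
      simp at this ⊢; norm_num at this; linarith
    rw [Nat.factorial_succ]; push_cast at ih h1 ⊢
    calc RE (-(π * |t| / 2)) * (((N : ℝ) + 1) * N.factorial)
        = ((N : ℝ) + 1) * (RE (-(π * |t| / 2)) * N.factorial) := by ring
      _ ≤ ‖((N : ℂ) + 1 + 1 / 2 + t * I : ℂ)‖ *
          (‖Gamma ((N : ℂ) + 1 + 1 / 2 + t * I)‖ * 2) := by gcongr
      _ = _ := by ring

lemma gamma_ne_neg {s : ℂ} (hs : 0 < s.re) (m : ℕ) : s ≠ -m := by
  intro h
  have := congrArg Complex.re h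
  simp at this
  have h0 : (0 : ℝ) ≤ m := Nat.cast_nonneg m
  linarith

lemma digamma_deriv_big {N : ℕ} (hN : 8 ≤ N) {t : ℝ} (ht : |t| ≤ N) {z : ℂ}
    (hz : ‖z - (N + 1 / 2 + t * I)‖ ≤ N / 4) : ‖deriv digamma z‖ ≤ 2000 / N := by
  have hN' : (8 : ℝ) ≤ N := by exact_mod_cast hN
  have hN0 : (0 : ℝ) < N := LA
  set c : ℂ := N + 1 / 2 + t * I with hc
  set f : ℂ → ℂ := fun w => Gamma w * Complex.exp (-(RL N * w)) with hf
  have hre : ∀ w ∈ Metric.ball c N, 1 / 2 < w.re ∧ w.re < 2 * N + 1 / 2 := by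
    intro w hw
    have h1 := abs_re_le_norm (w - c)
    have h2 : ‖w - c‖ < N := by simpa [dist_eq_norm] using hw
    have h3 : (w - c).re = w.re - (N + 1 / 2) := by simp [hc]
    rw [h3] at h1
    have := abs_le.1 (h1.trans h2.le)
    have := abs_lt.1 (h1.trans_lt h2)
    constructor <;> linarith
  have hΓ : ∀ w ∈ Metric.ball c N, DifferentiableAt ℂ Gamma w := fun w hw =>
    differentiableAt_Gamma _ (gamma_ne_neg (by linarith [(hre w hw).1]))
  have hΓ0 : ∀ w ∈ Metric.ball c N, Gamma w ≠ 0 := fun w hw =>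
    Complex.Gamma_ne_zero (gamma_ne_neg (by linarith [(hre w hw).1]))
  have hnorm : ∀ w : ℂ, ‖f w‖ = ‖Gamma w‖ * (N : ℝ) ^ (-w.re) := by
    intro w
    simp only [hf, norm_mul, norm_exp, Real.rpow_def_of_pos hN0]
    congr 2
    rw [neg_re, Complex.re_ofReal_mul]; ring
  have hfc : RE (-(5 * N)) ≤ ‖f c‖ := by
    obtain ⟨k, rfl⟩ : ∃ k, N = k + 1 := ⟨N - 1, by omega⟩
    have h1 := gamma_center_lower k t
    have hcc : c.re = ((k + 1 : ℕ) : ℝ) + 1 / 2 := by simp [hc]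
    rw [hnorm, hcc]
    set n : ℕ := k + 1 with hn
    have h2 : (n : ℝ) ^ n / n.factorial ≤ RE n := Real.pow_div_factorial_le_exp _ hN0.le n
    have h3 : (n ! : ℝ) = n * k ! := by rw [hn, Nat.factorial_succ]; push_cast; ring
    have h4 : (n : ℝ) ^ (-((n : ℝ) + 1 / 2)) = ((n : ℝ) ^ n * (n : ℝ) ^ (1 / 2 : ℝ))⁻¹ := by
      rw [Real.rpow_neg hN0.le, Real.rpow_add hN0, Real.rpow_natCast]
    have h5 : (n : ℝ) ^ (1 / 2 : ℝ) ≤ n := by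
      calc (n : ℝ) ^ (1 / 2 : ℝ) ≤ (n : ℝ) ^ (1 : ℝ) :=
            Real.rpow_le_rpow_of_exponent_le LA NA
        _ = n := Real.rpow_one _
    have h5' : 0 < (n : ℝ) ^ (1 / 2 : ℝ) := PA
    have h6 : (n : ℝ) ^ 3 / 6 ≤ RE n := by
      have := Real.pow_div_factorial_le_exp _ hN0.le 3
      simpa [Nat.factorial] using this
    have h7 : RE (-(2 * n)) ≤ RE (-(π * |t| / 2)) := by
      apply Real.exp_le_exp.2; nlinarith [Real.pi_lt_four, abs_nonneg t, Real.pi_pos]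
    have hfac : (0 : ℝ) < k.factorial := PA
    have hnn : (0 : ℝ) < (n : ℝ) ^ n := PA
    rw [div_le_iff₀ PA, h3] at h2
    rw [h4, ← div_eq_mul_inv, le_div_iff₀ PA]
    have h8 : RE (-(2 * n)) * k ! / 2 ≤ ‖Gamma c‖ := by
      have : RE (-(2 * n)) * k.factorial ≤
        RE (-(π * |t| / 2)) * k ! := by gcongr
      linarith
    refine le_trans ?_ h8
    have e1 : RE (-(5 * n)) = RE (-(2 * n)) * (RE n)⁻¹ ^ 3 := by
      rw [← Real.exp_neg, ← Real.exp_nat_mul, ← Real.exp_add]; congr 1; push_cast; ring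
    rw [e1]
    have E := Real.exp_pos n
    have h9 : (n : ℝ) ^ 2 ≤ RE n := by nlinarith
    have h10 : 2 ≤ RE n := by nlinarith
    calc RE (-(2 * n)) * (RE n)⁻¹ ^ 3 * ((n : ℝ) ^ n * (n : ℝ) ^ (1 / 2 : ℝ))
        ≤ RE (-(2 * n)) * (RE n)⁻¹ ^ 3 * ((RE n * (n * k !)) * n) := by
          gcongr
      _ = RE (-(2 * n)) * (RE n)⁻¹ ^ 2 * ((n : ℝ) ^ 2 * k !) := by
          field_simp
      _ ≤ RE (-(2 * n)) * (RE n)⁻¹ ^ 2 * (RE n * k !) := by gcongr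
      _ = RE (-(2 * n)) * k ! / RE n := by field_simp
      _ ≤ RE (-(2 * n)) * k ! / 2 := by gcongr
  have hfw : ∀ w ∈ Metric.ball c N, ‖f w‖ ≤ RE (5 * N) := by
    intro w hw
    obtain ⟨a, b⟩ := hre w hw
    rw [hnorm]
    have h1 := norm_Gamma_le_Gamma_re (s := w) LA
    have h2 := gamma_le_pow (Y := 3 * N) LA (2 * N) w.re a.le
      (by push_cast; linarith) LA
    have h3 : (3 * (N : ℝ)) ^ w.re = 3 ^ w.re * (N : ℝ) ^ w.re :=
      Real.mul_rpow NA hN0.le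
    have h4 : (3 : ℝ) ^ w.re ≤ RE (2 * w.re) := by
      rw [Real.rpow_def_of_pos NA]
      apply Real.exp_le_exp.2
      have := Real.log_three_lt_d9
      nlinarith
    have h5 : (N : ℝ) ^ w.re * (N : ℝ) ^ (-w.re) = 1 := by
      rw [← Real.rpow_add hN0]; simp
    have h6 : (2 : ℝ) ≤ RE 1 := by
      have := Real.add_one_le_exp 1; linarith
    calc ‖Gamma w‖ * (N : ℝ) ^ (-w.re)
        ≤ (2 * (3 ^ w.re * (N : ℝ) ^ w.re)) * (N : ℝ) ^ (-w.re) := by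
          rw [← h3]; gcongr; linarith
      _ = 2 * 3 ^ w.re * ((N : ℝ) ^ w.re * (N : ℝ) ^ (-w.re)) := by ring
      _ ≤ RE 1 * RE (2 * w.re) := by rw [h5, mul_one]; gcongr
      _ ≤ _ := by rw [← Real.exp_add]; apply Real.exp_le_exp.2; linarith
  have hlog : ∀ w ∈ CB c (N / 2), ‖logDeriv f w‖ ≤ 320 := by
    intro w hw
    have := logDeriv_disc (f := f) (c := c) (r := N / 2) (R := N) (M := 10 * N) LA
      LA LA
      (fun w hw => ((hΓ w hw).mul FA).differentiableWithinAt)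
      (fun w hw => mul_ne_zero (hΓ0 w hw) (Complex.exp_ne_zero _))
      (fun w hw => by
        refine (hfw w hw).trans ?_
        calc RE (5 * N) = RE (10 * N) * RE (-(5 * N)) := by
              rw [← Real.exp_add]; congr 1; ring
          _ ≤ _ := by gcongr) hw
    refine this.trans (le_of_eq ?_)
    field_simp; norm_num
  have hball : CB z (N / 4) ⊆ CB c (N / 2) := by
    intro w hw
    rw [Metric.mem_closedBall] at *
    have := dist_triangle w z c
    rw [dist_eq_norm z c] at this
    linarith
  have hball2 : CB c (N / 2) ⊆ Metric.ball c N :=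
    Metric.closedBall_subset_ball LA
  have hdl : DifferentiableOn ℂ (logDeriv f) (Metric.ball c N) := by
    have h : DifferentiableOn ℂ f (Metric.ball c N) :=
      fun w hw => ((hΓ w hw).mul FA).differentiableWithinAt
    exact (h.deriv Metric.isOpen_ball).div h
      (fun w hw => mul_ne_zero (hΓ0 w hw) (Complex.exp_ne_zero _))
  have hc1 := cauchy_bound (f := logDeriv f) (c := z) (r := N / 4) (M := 320) 1 LA
    (hdl.mono (hball.trans hball2)) (fun w hw => hlog w (hball hw))
  have hzb : z ∈ Metric.ball c N := hball2 (hball (Metric.mem_closedBall_self LA))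
  have heq : logDeriv f =ᶠ[𝓝 z] fun w => digamma w - RL N := by
    filter_upwards [Metric.isOpen_ball.mem_nhds hzb] with w hw
    have hexp : HasDerivAt (fun w : ℂ => Complex.exp (-(RL N * w)))
        (Complex.exp (-(RL N * w)) * (-(RL N * 1))) w :=
      (((hasDerivAt_id w).const_mul _).neg).cexp
    rw [hf, logDeriv_mul (g := fun w : ℂ => Complex.exp (-(RL N * w))) _ (hΓ0 w hw)
      (Complex.exp_ne_zero _) (hΓ w hw) hexp.differentiableAt,
      logDeriv_apply (fun w : ℂ => Complex.exp (-(RL N * w))), hexp.deriv,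
      mul_div_cancel_left₀ _ (Complex.exp_ne_zero _), Complex.digamma_def]
    ring
  rw [iteratedDeriv_one, heq.deriv_eq, deriv_sub_const] at hc1
  refine hc1.trans ?_
  simp only [Nat.factorial_one, Nat.cast_one, pow_one]
  rw [div_le_div_iff₀ LA hN0]
  nlinarith

lemma differentiableAt_digamma {z : ℂ} (hz : 0 < z.re) : DifferentiableAt ℂ digamma z := by
  have hopen : IsOpen {w : ℂ | 0 < w.re} := isOpen_lt continuous_const continuous_re
  have h : DifferentiableOn ℂ Gamma {w : ℂ | 0 < w.re} := fun w hw =>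
    (differentiableAt_Gamma _ (gamma_ne_neg hw)).differentiableWithinAt
  exact ((h.deriv hopen).div h (fun w hw => Complex.Gamma_ne_zero (gamma_ne_neg hw))).differentiableAt
    (hopen.mem_nhds hz)

lemma deriv_digamma_add_nat {z : ℂ} (hz : 0 < z.re) (N : ℕ) :
    deriv digamma z = deriv digamma (z + N) + ∑ k ∈ range N, 1 / (z + k) ^ 2 := by
  induction N with
  | zero => simp
  | succ N ih =>
    rw [Finset.sum_range_succ, ih]
    have hw : 0 < (z + N).re := by simp; positivity
    have hopen : IsOpen {w : ℂ | 0 < w.re} := isOpen_lt continuous_const continuous_re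
    have heq : (fun w => digamma (w + 1)) =ᶠ[𝓝 (z + N)]
        fun w => digamma w + w⁻¹ := by
      filter_upwards [hopen.mem_nhds hw] with w hw
      rw [Complex.digamma_apply_add_one w (gamma_ne_neg hw)]
      try simp
    have h1 := heq.deriv_eq
    have hne : z + N ≠ 0 := by intro h; rw [h] at hw; simp at hw
    rw [deriv_comp_add_const, deriv_fun_add (differentiableAt_digamma hw)
      (differentiableAt_inv hne), deriv_inv] at h1
    have e : z + ((N + 1 : ℕ) : ℂ) = z + N + 1 := by push_cast; ring
    rw [e, h1]
    simp [one_div]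
    ring

lemma deriv_digamma_bound {z : ℂ} (h1 : 1 / 8 ≤ z.re) (h2 : z.re ≤ 3) (ht : 1 / 2 ≤ |z.im|) :
    ‖deriv digamma z‖ ≤ 3000 / |z.im| := by
  set N : ℕ := ⌈|z.im|⌉₊ + 16 with hN
  have hN1 : |z.im| + 16 ≤ N := by rw [hN]; push_cast; linarith [Nat.le_ceil |z.im|]
  have hN2 : (N : ℝ) ≤ |z.im| + 17 := by
    rw [hN]; push_cast; linarith [Nat.ceil_lt_add_one (abs_nonneg z.im)]
  have hN0 : (0 : ℝ) < N := LA
  have hz0 : (0 : ℝ) < |z.im| := LA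
  rw [deriv_digamma_add_nat LA N]
  have e1 : ‖deriv digamma (z + N)‖ ≤ 2000 / N := by
    apply digamma_deriv_big (by omega) (t := z.im) LA
    have : z + N - (N + 1 / 2 + z.im * I) = ((z.re - 1 / 2 : ℝ) : ℂ) := by
      apply Complex.ext
      · simp; ring
      · simp
    rw [this, norm_real, Real.norm_eq_abs, abs_le]
    constructor <;> linarith
  have e2 : ‖∑ k ∈ range N, 1 / (z + k) ^ 2‖ ≤ N * (1 / |z.im| ^ 2) := by
    refine (norm_sum_le _ _).trans ?_
    refine (Finset.sum_le_card_nsmul _ _ (1 / |z.im| ^ 2) ?_).trans ?_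
    · intro k _
      rw [norm_div, norm_pow, norm_one]
      gcongr
      have := abs_im_le_norm (z + k)
      simpa using this
    · simp
  refine (norm_add_le _ _).trans ((add_le_add e1 e2).trans ?_)
  have e3 : 2000 / (N : ℝ) ≤ 2000 / |z.im| := by gcongr; linarith
  have e4 : N * (1 / |z.im| ^ 2) ≤ 35 / |z.im| := by
    rw [mul_one_div, div_le_div_iff₀ PA hz0]
    nlinarith
  have : 3000 / |z.im| = 2000 / |z.im| + 35 / |z.im| + 965 / |z.im| := by ring
  have : 0 < 965 / |z.im| := PA
  linarith

/-- polygamma bound -/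
lemma polygamma_bound (n : ℕ) : ∃ K > 0, ∀ z : ℂ, 1 / 2 ≤ z.re → z.re ≤ 5 / 2 → 1 ≤ |z.im| →
    ‖iteratedDeriv (n + 1) digamma z‖ ≤ K / |z.im| := by
  refine ⟨n.factorial * 6000 / (1 / 4) ^ n, by positivity, fun z h1 h2 ht => ?_⟩
  have hsub : ∀ w ∈ CB z (1 / 4), 1 / 4 ≤ w.re ∧ w.re ≤ 3 ∧ |z.im| / 2 ≤ |w.im| := by
    intro w hw
    have hw' : ‖w - z‖ ≤ 1 / 4 := by simpa [dist_eq_norm] using hw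
    have a := abs_le.1 ((abs_re_le_norm (w - z)).trans hw')
    have b := (abs_im_le_norm (w - z)).trans hw'
    simp only [sub_re, sub_im] at a b
    have := abs_sub_abs_le_abs_sub z.im w.im
    rw [abs_sub_comm] at this
    refine ⟨by linarith, by linarith, by linarith⟩
  have hopen : IsOpen {w : ℂ | 0 < w.re} := isOpen_lt continuous_const continuous_re
  have hd : DifferentiableOn ℂ (deriv digamma) {w : ℂ | 0 < w.re} :=
    DifferentiableOn.deriv (fun w hw => (differentiableAt_digamma hw).differentiableWithinAt) hopen
  have := cauchy_bound (f := deriv digamma) (c := z) (r := 1 / 4) (M := 6000 / |z.im|) n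
    NA (hd.mono fun w hw => by
      have := (hsub w hw).1
      simp only [Set.mem_ofPred_eq]; linarith) (fun w hw => by
      obtain ⟨a, b, c⟩ := hsub w hw
      refine (deriv_digamma_bound LA b LA).trans ?_
      rw [div_le_div_iff₀ LA LA]
      nlinarith)
  rw [iteratedDeriv_succ']
  refine this.trans (le_of_eq ?_)
  ring

/-! ### Local factorisation of entire functions -/

/-- the product of `s - ρ` over a multiset -/
noncomputable def zprod (Z : Multiset ℂ) (s : ℂ) : ℂ := (Z.map (fun ρ => s - ρ)).prod

/-- Blaschke-type completed factor -/
noncomputable def bprod (c : ℂ) (R : ℝ) (Z : Multiset ℂ) (s : ℂ) : ℂ :=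
  (Z.map (fun ρ => ((R : ℂ) ^ 2 - (s - c) * CJ (ρ - c)) / R)).prod

lemma differentiable_zprod (Z : Multiset ℂ) : Differentiable ℂ (zprod Z) := by
  induction Z using Multiset.induction with
  | empty => unfold zprod; simp
  | cons a Z ih =>
    have : zprod (a ::ₘ Z) = fun s => (s - a) * zprod Z s := by
      funext s; simp [zprod]
    rw [this]; fun_prop

lemma differentiable_bprod (c : ℂ) (R : ℝ) (Z : Multiset ℂ) : Differentiable ℂ (bprod c R Z) := by
  induction Z using Multiset.induction with
  | empty => unfold bprod; simp
  | cons a Z ih =>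
    have : bprod c R (a ::ₘ Z) =
        fun s => (((R : ℂ) ^ 2 - (s - c) * CJ (a - c)) / R) * bprod c R Z s := by
      funext s; simp [bprod]
    rw [this]; fun_prop

lemma zprod_cons (a : ℂ) (Z : Multiset ℂ) (s : ℂ) : zprod (a ::ₘ Z) s = (s - a) * zprod Z s := by
  simp [zprod]

lemma bprod_cons (c : ℂ) (R : ℝ) (a : ℂ) (Z : Multiset ℂ) (s : ℂ) : bprod c R (a ::ₘ Z) s =
    (((R : ℂ) ^ 2 - (s - c) * CJ (a - c)) / R) * bprod c R Z s := by
  simp [bprod]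

lemma bprod_norm_sphere {c : ℂ} {R : ℝ} (hR : 0 < R) (Z : Multiset ℂ) {s : ℂ} (hs : ‖s - c‖ = R) :
    ‖bprod c R Z s‖ = ‖zprod Z s‖ := by
  induction Z using Multiset.induction with
  | empty => simp [bprod, zprod]
  | cons a Z ih =>
    rw [zprod_cons, bprod_cons, norm_mul, norm_mul, ih]
    congr 1
    have h1 : (R : ℂ) ^ 2 = (s - c) * CJ (s - c) := by
      rw [Complex.mul_conj, Complex.normSq_eq_norm_sq, hs]; push_cast; ring
    rw [h1, ← mul_sub, ← map_sub, norm_div, norm_mul, hs, norm_real, Real.norm_eq_abs,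
      abs_of_pos hR, Complex.norm_conj]
    rw [mul_div_cancel_left₀ _ hR.ne']
    congr 1; ring

lemma bprod_center {c : ℂ} {r R : ℝ} (hr : 0 < r) (hR : 0 < R) (Z : Multiset ℂ)
    (hZ : ∀ ρ ∈ Z, ρ ∈ CB c r) :
    (R / r) ^ Multiset.card Z * ‖zprod Z c‖ ≤ ‖bprod c R Z c‖ := by
  induction Z using Multiset.induction with
  | empty => simp [bprod, zprod]
  | cons a Z ih =>
    have ih' := ih (fun ρ h => hZ ρ (Multiset.mem_cons_of_mem h))
    have ha : ‖c - a‖ ≤ r := by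
      have := hZ a (Multiset.mem_cons_self a Z)
      rwa [Metric.mem_closedBall, dist_comm, dist_eq_norm] at this
    rw [zprod_cons, bprod_cons, norm_mul, norm_mul, Multiset.card_cons, pow_succ]
    have h1 : ‖((R : ℂ) ^ 2 - (c - c) * CJ (a - c)) / R‖ = R := by
      simp only [sub_self, zero_mul, sub_zero, norm_div, norm_pow, norm_real,
        Real.norm_eq_abs, abs_of_pos hR]
      field_simp
    rw [h1]
    calc (R / r) ^ Multiset.card Z * (R / r) * (‖c - a‖ * ‖zprod Z c‖)
        = (R / r) * ‖c - a‖ * ((R / r) ^ Multiset.card Z * ‖zprod Z c‖) := by ring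
      _ ≤ (R / r) * r * ‖bprod c R Z c‖ := by gcongr
      _ = R * ‖bprod c R Z c‖ := by field_simp

lemma bprod_ball_bound {f g : ℂ → ℂ} {c : ℂ} {R M : ℝ} (hR : 0 < R) (hg : Differentiable ℂ g)
    {Z : Multiset ℂ} (hfac : ∀ s, f s = zprod Z s * g s)
    (hM : ∀ s ∈ CB c R, ‖f s‖ ≤ M) {s : ℂ} (hs : s ∈ CB c R) :
    ‖g s * bprod c R Z s‖ ≤ M := by
  have hd : Differentiable ℂ (fun s => g s * bprod c R Z s) := hg.mul (differentiable_bprod c R Z)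
  apply Complex.norm_le_of_forall_mem_frontier_norm_le (U := Metric.ball c R) Metric.isBounded_ball
    hd.diffContOnCl
  · intro z hz
    rw [frontier_ball _ hR.ne'] at hz
    have hz' : ‖z - c‖ = R := by simpa [dist_eq_norm] using hz
    rw [norm_mul, bprod_norm_sphere hR Z hz', mul_comm, ← norm_mul, ← hfac]
    exact hM z (Metric.sphere_subset_closedBall hz)
  · rwa [closure_ball _ hR.ne']

lemma jensen_count {f g : ℂ → ℂ} {c : ℂ} {r R M : ℝ} (hr : 0 < r) (hR : 0 < R)
    (hg : Differentiable ℂ g)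
    {Z : Multiset ℂ} (hfac : ∀ s, f s = zprod Z s * g s) (hZ : ∀ ρ ∈ Z, ρ ∈ CB c r)
    (hM : ∀ s ∈ CB c R, ‖f s‖ ≤ M) :
    (R / r) ^ Multiset.card Z * ‖f c‖ ≤ M := by
  have h1 := bprod_ball_bound hR hg hfac hM (s := c) (Metric.mem_closedBall_self hR.le)
  have h2 := bprod_center hr hR Z hZ
  rw [norm_mul] at h1
  rw [hfac c, norm_mul]
  calc (R / r) ^ Multiset.card Z * (‖zprod Z c‖ * ‖g c‖)
      = ((R / r) ^ Multiset.card Z * ‖zprod Z c‖) * ‖g c‖ := by ring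
    _ ≤ ‖bprod c R Z c‖ * ‖g c‖ := by gcongr
    _ ≤ M := by rwa [mul_comm]

lemma exists_factor {f : ℂ → ℂ} (hf : Differentiable ℂ f) {c : ℂ} (hc : f c ≠ 0) {r : ℝ}
    (hr : 0 < r) : ∃ (Z : Multiset ℂ) (g : ℂ → ℂ), Differentiable ℂ g ∧
      (∀ ρ ∈ Z, ρ ∈ CB c r) ∧ (∀ s, f s = zprod Z s * g s) ∧
      ∀ s ∈ CB c r, g s ≠ 0 := by
  set S : Set ℕ := {k | ∃ (Z : Multiset ℂ) (g : ℂ → ℂ), Multiset.card Z = k ∧ Differentiable ℂ g ∧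
      (∀ ρ ∈ Z, ρ ∈ CB c r) ∧ (∀ s, f s = zprod Z s * g s)} with hS
  have hne : S.Nonempty := ⟨0, 0, f, by simp, hf, by simp, by simp [zprod]⟩
  obtain ⟨M, hM⟩ := (isCompact_closedBall c (2 * r)).exists_bound_of_continuousOn
    hf.continuous.continuousOn
  have hfc : 0 < ‖f c‖ := norm_pos_iff.2 hc
  have hbdd : BddAbove S := by
    obtain ⟨K, hK⟩ := pow_unbounded_of_one_lt (M / ‖f c‖) (by norm_num : (1 : ℝ) < 2)
    refine ⟨K, ?_⟩
    rintro k ⟨Z, g, rfl, hg, hZ, hfac⟩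
    have h := jensen_count hr (by linarith : 0 < 2 * r) hg hfac hZ hM
    rw [mul_div_cancel_right₀ _ hr.ne', ← le_div_iff₀ hfc] at h
    by_contra hlt
    push Not at hlt
    have := pow_le_pow_right₀ (by norm_num : (1 : ℝ) ≤ 2) hlt.le
    linarith
  obtain ⟨Z, g, hk, hg, hZ, hfac⟩ := Nat.sSup_mem hne hbdd
  refine ⟨Z, g, hg, hZ, hfac, ?_⟩
  intro s hs hgs
  have hmem : sSup S + 1 ∈ S := by
    refine ⟨s ::ₘ Z, dslope g s, by simp [hk], ?_, ?_, ?_⟩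
    · have : DifferentiableOn ℂ (dslope g s) Set.univ :=
        (Complex.differentiableOn_dslope univ_mem).2 hg.differentiableOn
      exact differentiableOn_univ.1 this
    · intro ρ hρ
      rcases Multiset.mem_cons.1 hρ with rfl | h
      · exact hs
      · exact hZ ρ h
    · intro w
      have := sub_smul_dslope g s w
      rw [hgs, sub_zero, smul_eq_mul] at this
      rw [hfac, zprod_cons, ← this]; ring
  have := le_csSup hbdd hmem
  omega

lemma bfactor_lower {c : ℂ} {r R : ℝ} (hr : 0 < r) {a s : ℂ}
    (ha : a ∈ CB c r) (hs : s ∈ CB c r) :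
    R ^ 2 - r ^ 2 ≤ ‖(R : ℂ) ^ 2 - (s - c) * CJ (a - c)‖ := by
  have h1 : ‖s - c‖ ≤ r := by simpa [dist_eq_norm] using hs
  have h2 : ‖a - c‖ ≤ r := by simpa [dist_eq_norm] using ha
  have h3 : ‖(s - c) * CJ (a - c)‖ ≤ r ^ 2 := by
    rw [norm_mul, Complex.norm_conj]
    nlinarith [norm_nonneg (s - c), norm_nonneg (a - c)]
  have h4 := norm_sub_norm_le ((R : ℂ) ^ 2) ((s - c) * CJ (a - c))
  have h5 : ‖(R : ℂ) ^ 2‖ = R ^ 2 := by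
    rw [norm_pow, norm_real, Real.norm_eq_abs, sq_abs]
  linarith

lemma bprod_ne_zero {c : ℂ} {r R : ℝ} (hr : 0 < r) (hrR : r < R) {Z : Multiset ℂ}
    (hZ : ∀ ρ ∈ Z, ρ ∈ CB c r) {s : ℂ} (hs : s ∈ CB c r) :
    bprod c R Z s ≠ 0 := by
  induction Z using Multiset.induction with
  | empty => simp [bprod]
  | cons a Z ih =>
    rw [bprod_cons]
    refine mul_ne_zero ?_ (ih (fun ρ h => hZ ρ (Multiset.mem_cons_of_mem h)))
    have h := bfactor_lower (R := R) hr (hZ a (Multiset.mem_cons_self a Z)) hs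
    refine div_ne_zero ?_ (by exact_mod_cast (hr.trans hrR).ne')
    rw [← norm_pos_iff]
    nlinarith

lemma logDeriv_bprod_bound {c : ℂ} {r R : ℝ} (hr : 0 < r) (hrR : r < R) {Z : Multiset ℂ}
    (hZ : ∀ ρ ∈ Z, ρ ∈ CB c r) {s : ℂ} (hs : s ∈ CB c r) :
    ‖logDeriv (bprod c R Z) s‖ ≤ Multiset.card Z * (r / (R ^ 2 - r ^ 2)) := by
  have hR : 0 < R := hr.trans hrR
  induction Z using Multiset.induction with
  | empty =>
    have : bprod c R 0 = fun _ => 1 := by funext s; simp [bprod]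
    rw [this]; simp
  | cons a Z ih =>
    have hZ' := fun ρ h => hZ ρ (Multiset.mem_cons_of_mem h)
    have ha := hZ a (Multiset.mem_cons_self a Z)
    have e : bprod c R (a ::ₘ Z) = fun s =>
        (((R : ℂ) ^ 2 - (s - c) * CJ (a - c)) / R) * bprod c R Z s := by
      funext s; rw [bprod_cons]
    have hl := bfactor_lower (R := R) hr ha hs
    have hpos : 0 < R ^ 2 - r ^ 2 := by nlinarith
    have hne : ((R : ℂ) ^ 2 - (s - c) * CJ (a - c)) ≠ 0 := by
      rw [← norm_pos_iff]; linarith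
    have hRc : (R : ℂ) ≠ 0 := by exact_mod_cast hR.ne'
    have hd : HasDerivAt (fun s : ℂ => ((R : ℂ) ^ 2 - (s - c) * CJ (a - c)) / R)
        ((0 - 1 * CJ (a - c)) / R) s :=
      ((hasDerivAt_const s ((R : ℂ) ^ 2)).sub
        (((hasDerivAt_id s).sub_const c).mul_const _)).div_const _
    rw [e, logDeriv_mul (f := fun s : ℂ => ((R : ℂ) ^ 2 - (s - c) * CJ (a - c)) / R)
      s (div_ne_zero hne hRc) (bprod_ne_zero hr hrR hZ' hs) hd.differentiableAt
      (differentiable_bprod c R Z s), Multiset.card_cons]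
    refine (norm_add_le _ _).trans ?_
    have h2 : ‖logDeriv (fun s : ℂ => ((R : ℂ) ^ 2 - (s - c) * CJ (a - c)) / R) s‖ ≤
        r / (R ^ 2 - r ^ 2) := by
      rw [logDeriv_apply, hd.deriv, div_div_div_cancel_right₀ hRc, norm_div]
      have h3 : ‖(0 : ℂ) - 1 * CJ (a - c)‖ ≤ r := by
        rw [zero_sub, norm_neg, one_mul, Complex.norm_conj]
        simpa [dist_eq_norm] using ha
      gcongr
    have := ih hZ'
    push_cast
    linarith

lemma lpf_abstract {f g : ℂ → ℂ} {c : ℂ} {r r1 R M : ℝ} (hr : 0 < r) (hr1 : r < r1) (hR : r1 < R)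
    (hM : 0 < M) (hg : Differentiable ℂ g) {Z : Multiset ℂ}
    (hZ : ∀ ρ ∈ Z, ρ ∈ CB c r1) (hfac : ∀ s, f s = zprod Z s * g s)
    (hne : ∀ s ∈ CB c r1, g s ≠ 0) (hfc : f c ≠ 0)
    (hb : ∀ s ∈ CB c R, ‖f s‖ ≤ RE M * ‖f c‖) :
    (Multiset.card Z : ℝ) ≤ M / RL (R / r1) ∧
    ∀ s ∈ CB c r, ‖logDeriv g s‖ ≤
      (8 * r1 / (r1 - r) ^ 2 + (r1 / (R ^ 2 - r1 ^ 2)) / RL (R / r1)) * M := by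
  have hr10 : 0 < r1 := hr.trans hr1
  have hR0 : 0 < R := hr10.trans hR
  have hfc0 : 0 < ‖f c‖ := norm_pos_iff.2 hfc
  have hlog : 0 < RL (R / r1) := Real.log_pos ((one_lt_div hr10).2 hR)
  have hq : 0 < R / r1 := PA
  have hcard : (Multiset.card Z : ℝ) ≤ M / RL (R / r1) := by
    have h := jensen_count hr10 hR0 hg hfac hZ hb
    have h1 : (R / r1) ^ Multiset.card Z ≤ RE M := le_of_mul_le_mul_right h hfc0
    have h2 := Real.log_le_log PA h1
    rw [Real.log_pow, Real.log_exp] at h2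
    rwa [le_div_iff₀ hlog]
  refine ⟨hcard, fun s hs => ?_⟩
  set h : ℂ → ℂ := fun s => g s * bprod c R Z s with hh
  have hcb : ∀ s ∈ Metric.ball c r1, s ∈ CB c r1 :=
    fun s hs => Metric.ball_subset_closedBall hs
  have hnez : ∀ s ∈ CB c r1, h s ≠ 0 := fun s hs =>
    mul_ne_zero (hne s hs) (bprod_ne_zero hr10 hR hZ hs)
  have hcenter : ‖f c‖ ≤ ‖h c‖ := by
    have h2 := bprod_center hr10 hR0 Z hZ
    rw [hfac, hh, norm_mul, norm_mul, mul_comm]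
    gcongr
    refine le_trans ?_ h2
    apply le_mul_of_one_le_left (norm_nonneg _)
    exact one_le_pow₀ ((one_le_div hr10).2 hR.le)
  have hs1 : s ∈ CB c r1 := Metric.closedBall_subset_closedBall hr1.le hs
  have key := logDeriv_disc (f := h) (c := c) (r := r) (R := r1) (M := M) hr.le hr1 hM
    ((hg.mul (differentiable_bprod c R Z)).differentiableOn) (fun z hz => hnez z (hcb z hz))
    (fun z hz => by
      have := bprod_ball_bound hR0 hg hfac hb
        (Metric.closedBall_subset_closedBall hR.le (hcb z hz))
      refine this.trans ?_
      gcongr) hs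
  have hsplit : logDeriv h s = logDeriv g s + logDeriv (bprod c R Z) s :=
    logDeriv_mul s (hne s hs1) (bprod_ne_zero hr10 hR hZ hs1) (hg s) (differentiable_bprod c R Z s)
  have h3 := logDeriv_bprod_bound hr10 hR hZ hs1
  have h4 : logDeriv g s = logDeriv h s - logDeriv (bprod c R Z) s := by rw [hsplit]; ring
  rw [h4]
  refine (norm_sub_le _ _).trans ((add_le_add key h3).trans ?_)
  have hpos : 0 < R ^ 2 - r1 ^ 2 := by nlinarith
  calc 8 * M * r1 / (r1 - r) ^ 2 + Multiset.card Z * (r1 / (R ^ 2 - r1 ^ 2))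
      ≤ 8 * M * r1 / (r1 - r) ^ 2 + M / RL (R / r1) * (r1 / (R ^ 2 - r1 ^ 2)) := by gcongr
    _ = _ := by ring

lemma zprod_ne_zero {Z : Multiset ℂ} {s : ℂ} (hs : s ∉ Z) : zprod Z s ≠ 0 := by
  rw [zprod]
  intro h
  rw [Multiset.prod_eq_zero_iff, Multiset.mem_map] at h
  obtain ⟨ρ, hρ, h⟩ := h
  exact hs (by rwa [sub_eq_zero.1 h])

/-- log-derivative of a product -/
lemma logDeriv_zprod {Z : Multiset ℂ} {s : ℂ} (hs : s ∉ Z) :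
    logDeriv (zprod Z) s = (Z.map (fun ρ => (s - ρ)⁻¹)).sum := by
  induction Z using Multiset.induction with
  | empty =>
    have : zprod 0 = fun _ => 1 := by funext s; simp [zprod]
    rw [this]; simp
  | cons a Z ih =>
    have e : zprod (a ::ₘ Z) = fun s => (s - a) * zprod Z s := by
      funext s; rw [zprod_cons]
    have h1 : s - a ≠ 0 := fun h => hs (by rw [sub_eq_zero.1 h]; exact Multiset.mem_cons_self a Z)
    have h2 : s ∉ Z := fun h => hs (Multiset.mem_cons_of_mem h)
    have h3 : zprod Z s ≠ 0 := zprod_ne_zero h2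
    rw [e, logDeriv_mul (f := fun s => s - a) s h1 h3 FA (differentiable_zprod Z s),
      ih h2, logDeriv_apply]
    simp

/-- `∑ 1/(s-ρ)^{k}` -/
noncomputable def zsm (Z : Multiset ℂ) (k : ℕ) (s : ℂ) : ℂ :=
  (Z.map (fun ρ => ((s - ρ) ^ k)⁻¹)).sum

lemma iteratedDeriv_inv_sub (n : ℕ) (ρ s : ℂ) :
    iteratedDeriv n (fun s => (s - ρ)⁻¹) s = (-1) ^ n * n ! * ((s - ρ) ^ (n + 1))⁻¹ := by
  have h1 := iteratedDeriv_comp_sub_const n (fun s : ℂ => s⁻¹) ρ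
  rw [show (fun s => (s - ρ)⁻¹) = fun z => (fun s : ℂ => s⁻¹) (z - ρ) from rfl, h1]
  simp only [iteratedDeriv_eq_iterate]
  rw [iter_deriv_inv]
  have : (-1 - (n : ℤ)) = -((n + 1 : ℕ) : ℤ) := by push_cast; ring
  rw [this, zpow_neg, zpow_natCast]

lemma iteratedDeriv_zsm_one (n : ℕ) {Z : Multiset ℂ} {s : ℂ} (hs : s ∉ Z) :
    ContDiffAt ℂ n (zsm Z 1) s ∧
    iteratedDeriv n (zsm Z 1) s = (-1) ^ n * n ! * zsm Z (n + 1) s := by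
  induction Z using Multiset.induction with
  | empty =>
    have : zsm 0 1 = fun _ => 0 := by funext s; simp [zsm]
    rw [this]
    refine ⟨contDiffAt_const, ?_⟩
    simp [zsm]
  | cons a Z ih =>
    have h1 : s ≠ a := fun h => hs (by rw [h]; exact Multiset.mem_cons_self a Z)
    have h2 : s ∉ Z := fun h => hs (Multiset.mem_cons_of_mem h)
    obtain ⟨i1, i2⟩ := ih h2
    have e : zsm (a ::ₘ Z) 1 = fun s => (s - a)⁻¹ + zsm Z 1 s := by
      funext s; simp [zsm]
    have hc : ContDiffAt ℂ n (fun s => (s - a)⁻¹) s :=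
      (contDiffAt_id.sub contDiffAt_const).inv (sub_ne_zero.2 h1)
    rw [e]
    refine ⟨hc.add i1, ?_⟩
    rw [iteratedDeriv_fun_add hc i1, iteratedDeriv_inv_sub n a s, i2]
    simp [zsm]; ring

lemma zeta_two_lower (t : ℝ) : 1 / 4 ≤ ‖ZZ (2 + t * I)‖ := by
  have hre : 1 < (2 + t * I : ℂ).re := by simp
  have h1 := zeta_eq_tsum_one_div_nat_add_one_cpow hre
  have hs : Summable (fun n : ℕ => 1 / ((n : ℂ) + 1) ^ (2 + t * I : ℂ)) := by
    have := (Complex.summable_one_div_nat_cpow (p := 2 + t * I)).2 hre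
    have := (summable_nat_add_iff 1).2 this
    simpa using this
  rw [hs.tsum_eq_zero_add] at h1
  have hn : ∀ n : ℕ, ‖1 / (((n + 1 : ℕ) : ℂ) + 1) ^ (2 + t * I : ℂ)‖ = 1 / ((n : ℝ) + 2) ^ 2 := by
    intro n
    rw [norm_div, norm_one]
    have := norm_natCast_cpow_of_pos (n := n + 2) (by omega) (2 + t * I)
    push_cast at this ⊢
    rw [show (n : ℂ) + 1 + 1 = n + 2 by ring, this]
    simp
  have h2 : HasSum (fun n : ℕ => 1 / ((n : ℝ) + 2) ^ 2) (π ^ 2 / 6 - 1) := by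
    have := (hasSum_nat_add_iff 2).2 (by
      simpa [Finset.sum_range_succ] using hasSum_zeta_two :
      HasSum (fun n : ℕ => 1 / (n : ℝ) ^ 2)
        ((π ^ 2 / 6 - 1) + ∑ i ∈ range 2, 1 / (i : ℝ) ^ 2))
    simpa using this
  have h3 : ‖∑' n : ℕ, 1 / (((n + 1 : ℕ) : ℂ) + 1) ^ (2 + t * I : ℂ)‖ ≤ π ^ 2 / 6 - 1 := by
    rw [← h2.tsum_eq]
    refine (norm_tsum_le_tsum_norm ?_).trans (le_of_eq ?_)
    · simp only [hn]; exact h2.summable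
    · simp only [hn]
  have h4 : π ^ 2 / 6 - 1 ≤ 3 / 4 := by
    nlinarith [Real.pi_lt_d2, Real.pi_pos]
  rw [h1]
  have h5 := norm_sub_le_norm_add (1 / (((0 : ℕ) : ℂ) + 1) ^ (2 + t * I : ℂ))
    (∑' n : ℕ, 1 / (((n + 1 : ℕ) : ℂ) + 1) ^ (2 + t * I : ℂ))
  simp only [Nat.cast_zero, zero_add, one_cpow, div_one, norm_one] at h5 ⊢
  linarith

lemma zeta1_eq {s : ℂ} (hs : s ≠ 1) : riemannZeta₁ s = (s - 1) * ZZ s := by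
  rw [riemannZeta_eq_inv_sub_mul hs]
  have : s - 1 ≠ 0 := sub_ne_zero.2 hs
  field_simp

/-- Under RH the zeros of `riemannZeta₁` with positive real part are on the critical line. -/
lemma zeta1_zero_re (hRH : RiemannHypothesis) {s : ℂ} (hs : 0 < s.re)
    (h0 : riemannZeta₁ s = 0) : s.re = 1 / 2 ∧ ZZ s = 0 ∧ s ≠ 1 := by
  have hs1 : s ≠ 1 := by
    rintro rfl
    simp at h0
  have hz : ZZ s = 0 := by
    rw [zeta1_eq hs1] at h0
    exact (mul_eq_zero.1 h0).resolve_left (sub_ne_zero.2 hs1)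
  refine ⟨hRH s hz ?_ hs1, hz, hs1⟩
  rintro ⟨n, rfl⟩
  simp at hs
  have : (0 : ℝ) ≤ n := Nat.cast_nonneg n
  linarith

theorem zeta_lpf (hRH : RiemannHypothesis) : ∃ K > (0 : ℝ), ∀ t : ℝ, ∃ (Z : Multiset ℂ) (g : ℂ → ℂ),
    Differentiable ℂ g ∧
    (∀ ρ ∈ Z, ρ.re = 1 / 2 ∧ |ρ.im - t| ≤ 1 ∧ ZZ ρ = 0) ∧
    (∀ s, riemannZeta₁ s = zprod Z s * g s) ∧
    (Multiset.card Z : ℝ) ≤ K * RL (|t| + 3) ∧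
    (∀ s ∈ CB (2 + t * I) (8 / 5), g s ≠ 0 ∧
      ‖logDeriv g s‖ ≤ K * RL (|t| + 3)) := by
  set B : ℝ := 8 * (17 / 10) / (17 / 10 - 8 / 5) ^ 2 +
      ((17 / 10) / ((9 / 5) ^ 2 - (17 / 10) ^ 2)) / RL ((9 / 5) / (17 / 10)) with hB
  set D := RL ((9 / 5) / (17 / 10)) with hD
  have hD0 : 0 < D := Real.log_pos NA
  have hB0 : 0 < B := by rw [hB]; positivity
  refine ⟨(1 / D + B) * 10, by positivity, fun t => ?_⟩
  set c : ℂ := 2 + t * I with hc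
  have hlog3 : 1 ≤ RL (|t| + 3) := by
    rw [Real.le_log_iff_exp_le PA]
    linarith [Real.exp_one_lt_d9, abs_nonneg t]
  have hc1 : c ≠ 1 := by
    intro h; have := congrArg Complex.re h; simp [hc] at this
  have hfc : 1 / 4 ≤ ‖riemannZeta₁ c‖ := by
    rw [zeta1_eq hc1, norm_mul]
    have h1 := zeta_two_lower t
    have h2 : 1 ≤ ‖c - 1‖ := by
      have := re_le_norm (c - 1)
      simp [hc] at this ⊢; linarith
    rw [hc] at *
    nlinarith
  have hfc0 : riemannZeta₁ c ≠ 0 := by rw [← norm_pos_iff]; linarith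
  set M := 10 * RL (|t| + 3) with hM
  have hM0 : 0 < M := by rw [hM]; linarith
  have hbound : ∀ s ∈ CB c (9 / 5), ‖riemannZeta₁ s‖ ≤ RE M * ‖riemannZeta₁ c‖ := by
    intro s hs
    have hs' : ‖s - c‖ ≤ 9 / 5 := by simpa [dist_eq_norm] using hs
    have hre := abs_le.1 ((abs_re_le_norm (s - c)).trans hs')
    have hre' : (s - c).re = s.re - 2 := by simp [hc]
    rw [hre'] at hre
    have h1 := zeta1_bound (s := s) LA
    have hcn : ‖c‖ ≤ 2 + |t| := by
      rw [hc]; refine (norm_add_le _ _).trans ?_; simp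
    have hsn : ‖s‖ ≤ |t| + 4 := by
      have := norm_add_le (s - c) c
      rw [sub_add_cancel] at this; linarith
    have hsn1 : ‖s - 1‖ ≤ |t| + 5 := by
      have := norm_sub_le s 1; simp at this; linarith
    set y := |t| + 3 with hy
    have hy3 : 3 ≤ y := by rw [hy]; linarith [abs_nonneg t]
    have h2 : ‖riemannZeta₁ s‖ ≤ 12 * y ^ 2 := by
      refine h1.trans ?_
      have a1 : ‖s - 1‖ * ‖s‖ / s.re ≤ (y + 2) * (y + 1) / (1 / 5) := by
        gcongr
        · linarith
        · linarith
        · linarith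
      have : (y + 2) * (y + 1) / (1 / 5) = 5 * ((y + 2) * (y + 1)) := by ring
      nlinarith
    have h3 : RE M = y ^ 10 := by
      rw [hM, mul_comm, Real.exp_mul, Real.exp_log LA]; norm_cast
    rw [h3]
    have h4 : 48 * y ^ 2 ≤ y ^ 10 := by
      have : (3 : ℝ) ^ 8 ≤ y ^ 8 := by gcongr
      have h5 : y ^ 10 = y ^ 8 * y ^ 2 := by ring
      rw [h5]; nlinarith [sq_nonneg y]
    nlinarith [pow_pos (by linarith : 0 < y) 10]
  obtain ⟨Z, g, hg, hZ, hfac, hne⟩ := exists_factor differentiable_riemannZeta₁ hfc0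
    (by norm_num : (0 : ℝ) < 17 / 10)
  obtain ⟨hcard, hld⟩ := lpf_abstract (r := 8 / 5) (r1 := 17 / 10) (R := 9 / 5) NA
    NA NA hM0 hg hZ hfac hne hfc0 hbound
  refine ⟨Z, g, hg, ?_, hfac, ?_, ?_⟩
  · intro ρ hρ
    have hb := hZ ρ hρ
    have hb' : ‖ρ - c‖ ≤ 17 / 10 := by simpa [dist_eq_norm] using hb
    have hre := abs_le.1 ((abs_re_le_norm (ρ - c)).trans hb')
    have hre' : (ρ - c).re = ρ.re - 2 := by simp [hc]
    have him' : (ρ - c).im = ρ.im - t := by simp [hc]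
    rw [hre'] at hre
    have hz : riemannZeta₁ ρ = 0 := by
      rw [hfac, zprod, Multiset.prod_eq_zero, zero_mul]
      exact Multiset.mem_map.2 ⟨ρ, hρ, sub_self ρ⟩
    obtain ⟨a, b, -⟩ := zeta1_zero_re hRH LA hz
    refine ⟨a, ?_, b⟩
    have h2 : (ρ - c).re ^ 2 + (ρ - c).im ^ 2 ≤ (17 / 10) ^ 2 := by
      have := Complex.sq_norm (ρ - c)
      rw [normSq_apply] at this
      nlinarith [norm_nonneg (ρ - c)]
    rw [hre', him', a] at h2
    apply abs_le_of_sq_le_sq _ NA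
    nlinarith
  · refine hcard.trans ?_
    rw [hM, div_le_iff₀ hD0]
    have : (1 / D + B) * 10 * RL (|t| + 3) * D =
      10 * RL (|t| + 3) + B * 10 * RL (|t| + 3) * D := by field_simp
    rw [this]
    have : 0 < B * 10 * RL (|t| + 3) * D := PA
    linarith
  · intro s hs
    refine ⟨hne s (Metric.closedBall_subset_closedBall NA hs), (hld s hs).trans ?_⟩
    have h0 : 0 < 1 / D * 10 * RL (|t| + 3) := PA
    have h1 : (1 / D + B) * 10 * RL (|t| + 3) =
      1 / D * 10 * RL (|t| + 3) + B * M := by rw [hM]; ring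
    rw [h1]
    exact le_trans (le_of_eq (by rw [hB])) (le_add_of_nonneg_left h0.le)

lemma zeta_ld_aux {t B : ℝ} {Z : Multiset ℂ} {g : ℂ → ℂ} (hg : Differentiable ℂ g)
    (hfac : ∀ s, riemannZeta₁ s = zprod Z s * g s)
    (hb : ∀ s ∈ CB (2 + t * I) (8 / 5), g s ≠ 0 ∧ ‖logDeriv g s‖ ≤ B)
    (n : ℕ) {s : ℂ} (hs : s ∈ CB (2 + t * I) (31 / 20)) (hsZ : s ∉ Z)
    (hs1 : 1 / 4 ≤ ‖s - 1‖) :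
    ZZ s ≠ 0 ∧
    ‖iteratedDeriv n LZ s - (-1) ^ n * n ! * zsm Z (n + 1) s‖ ≤
      n.factorial * B / (1 / 20) ^ n + n ! * 4 ^ (n + 1) := by
  have hsub : CB s (1 / 20) ⊆ CB (2 + t * I) (8 / 5) := by
    apply Metric.closedBall_subset_closedBall'
    have := Metric.mem_closedBall.1 hs
    linarith
  have hne1 : s ≠ 1 := by rintro rfl; norm_num at hs1
  have hgs : ∀ z ∈ CB s (1 / 20), g z ≠ 0 := fun z hz => (hb z (hsub hz)).1
  have hss : s ∈ CB s (1 / 20) := Metric.mem_closedBall_self NA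
  have hz1 : ∀ z, z ∉ Z → z ≠ 1 → g z ≠ 0 → ZZ z ≠ 0 := by
    intro z h1 h2 h3 h4
    have := hfac z
    rw [zeta1_eq h2, h4, mul_zero] at this
    exact mul_ne_zero (zprod_ne_zero h1) h3 this.symm
  refine ⟨hz1 s hsZ hne1 (hgs s hss), ?_⟩
  have hld : DifferentiableOn ℂ (logDeriv g) (CB s (1 / 20)) := by
    intro z hz
    have : DifferentiableAt ℂ (logDeriv g) z := by
      have h1 : logDeriv g = fun z => deriv g z / g z := by funext z; rw [logDeriv_apply]
      rw [h1]
      exact ((hg.analyticAt z).deriv.differentiableAt).div (hg z) (hgs z hz)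
    exact this.differentiableWithinAt
  have hcb := cauchy_bound n (by norm_num : (0 : ℝ) < 1 / 20) hld
    (fun z hz => (hb z (hsub hz)).2)
  have hev : logDeriv ZZ =ᶠ[𝓝 s]
      fun z => (zsm Z 1 z + logDeriv g z) - (z - 1)⁻¹ := by
    have e1 : ∀ᶠ z in 𝓝 s, z ∉ Z := by
      have : IsClosed {z : ℂ | z ∈ Z} := by
        have h : {z : ℂ | z ∈ Z} = (Z.toFinset : Set ℂ) := by ext; simp
        rw [h]; exact Z.toFinset.finite_toSet.isClosed
      exact this.isOpen_compl.mem_nhds hsZ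
    have e2 : ∀ᶠ z in 𝓝 s, z ≠ 1 := isOpen_ne.mem_nhds hne1
    have e3 : ∀ᶠ z in 𝓝 s, z ∈ CB s (1 / 20) :=
      Metric.closedBall_mem_nhds s NA
    filter_upwards [e1, e2, e3] with z h1 h2 h3
    have hgz := hgs z h3
    have hzz := hz1 z h1 h2 hgz
    have hz0 : z - 1 ≠ 0 := sub_ne_zero.2 h2
    have k1 : logDeriv riemannZeta₁ z = logDeriv (zprod Z) z + logDeriv g z := by
      have : riemannZeta₁ = fun z => zprod Z z * g z := funext hfac
      rw [this]
      exact logDeriv_mul z (zprod_ne_zero h1) hgz (differentiable_zprod Z z) (hg z)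
    have k2 : logDeriv riemannZeta₁ z = (z - 1)⁻¹ + logDeriv ZZ z := by
      have h4 : riemannZeta₁ =ᶠ[𝓝 z] fun z => (z - 1) * ZZ z := by
        filter_upwards [isOpen_ne.mem_nhds h2] with w hw
        exact zeta1_eq hw
      rw [logDeriv_apply, h4.deriv_eq, h4.eq_of_nhds, ← logDeriv_apply,
        logDeriv_mul (f := fun z => z - 1) z hz0 hzz FA (differentiableAt_riemannZeta h2),
        logDeriv_apply]
      simp
    rw [logDeriv_zprod h1] at k1
    have k3 : zsm Z 1 z = (Z.map (fun ρ => (z - ρ)⁻¹)).sum := by simp [zsm]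
    rw [k3]
    linear_combination k1 - k2
  obtain ⟨c1, c2⟩ := iteratedDeriv_zsm_one n hsZ
  have c3 : ContDiffAt ℂ n (logDeriv g) s := by
    have : AnalyticAt ℂ (logDeriv g) s :=
      hld.analyticAt (Metric.closedBall_mem_nhds s NA)
    exact this.contDiffAt
  have c4 : ContDiffAt ℂ n (fun z : ℂ => (z - 1)⁻¹) s :=
      (contDiffAt_id.sub contDiffAt_const).inv (sub_ne_zero.2 hne1)
  rw [hev.iteratedDeriv_eq n]
  have e5 := iteratedDeriv_sub (c1.add c3) c4
  have e6 := iteratedDeriv_add c1 c3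
  have e7 : iteratedDeriv n (fun z => (zsm Z 1 z + logDeriv g z) - (z - 1)⁻¹) s =
    (-1) ^ n * n ! * zsm Z (n + 1) s + iteratedDeriv n (logDeriv g) s -
      (-1) ^ n * n ! * ((s - 1) ^ (n + 1))⁻¹ := by
    rw [← c2, ← iteratedDeriv_inv_sub n 1 s, ← e6]; exact e5
  rw [e7]
  have e8 : ‖(-1) ^ n * (n ! : ℂ) * ((s - 1) ^ (n + 1))⁻¹‖ ≤ n.factorial * 4 ^ (n + 1) := by
    simp only [norm_mul, norm_pow, norm_neg, norm_one, one_pow, one_mul, norm_inv,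
      Complex.norm_natCast]
    gcongr
    rw [← inv_pow]
    gcongr
    rw [inv_le_comm₀ LA NA]
    linarith
  calc _ = ‖iteratedDeriv n (logDeriv g) s - (-1) ^ n * (n ! : ℂ) * ((s - 1) ^ (n + 1))⁻¹‖ := by
        congr 1; ring
    _ ≤ _ := (norm_sub_le _ _).trans (add_le_add hcb e8)

lemma one_le_log_add_three (t : ℝ) : 1 ≤ RL (|t| + 3) := by
  rw [Real.le_log_iff_exp_le PA]
  linarith [Real.exp_one_lt_d9, abs_nonneg t]

theorem zeta_ld (hRH : RiemannHypothesis) (n : ℕ) : ∃ K > (0 : ℝ), ∀ t : ℝ, ∃ Z : Multiset ℂ,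
    (∀ ρ ∈ Z, ρ.re = 1 / 2 ∧ |ρ.im - t| ≤ 1 ∧ ZZ ρ = 0) ∧
    (Multiset.card Z : ℝ) ≤ K * RL (|t| + 3) ∧
    ∀ s ∈ CB (2 + t * I) (31 / 20), s ∉ Z → 1 / 4 ≤ ‖s - 1‖ →
      ZZ s ≠ 0 ∧
      ‖logDeriv ZZ s - zsm Z 1 s‖ ≤ K * RL (|t| + 3) ∧
      ‖iteratedDeriv n LZ s - (-1) ^ n * n ! * zsm Z (n + 1) s‖ ≤
        K * RL (|t| + 3) := by
  obtain ⟨K, hK, h⟩ := zeta_lpf hRH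
  refine ⟨K + 4 + (n.factorial * K / (1 / 20) ^ n + n ! * 4 ^ (n + 1)), by positivity,
    fun t => ?_⟩
  obtain ⟨Z, g, hg, hZ, hfac, hcard, hb⟩ := h t
  have hl := one_le_log_add_three t
  set l := RL (|t| + 3)
  refine ⟨Z, hZ, ?_, fun s hs hsZ hs1 => ?_⟩
  · refine hcard.trans ?_
    gcongr
    have : 0 < (n.factorial * K / (1 / 20) ^ n + n ! * 4 ^ (n + 1) : ℝ) := PA
    linarith
  · have h0 := zeta_ld_aux hg hfac hb 0 hs hsZ hs1
    have h1 := zeta_ld_aux hg hfac hb n hs hsZ hs1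
    refine ⟨h0.1, ?_, ?_⟩
    · have h2 := h0.2
      simp only [iteratedDeriv_zero, pow_zero, Nat.factorial_zero, Nat.cast_one, one_mul,
        zero_add, pow_one, div_one] at h2
      refine h2.trans ?_
      have : 0 ≤ (n.factorial * K / (1 / 20) ^ n + n ! * 4 ^ (n + 1) : ℝ) * l := PA
      nlinarith
    · refine h1.2.trans ?_
      have e : (n ! : ℝ) * (K * l) / (1 / 20) ^ n = n.factorial * K / (1 / 20) ^ n * l := by
        ring
      rw [e]
      have h3 : (n.factorial * 4 ^ (n + 1) : ℝ) ≤ n.factorial * 4 ^ (n + 1) * l :=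
        le_mul_of_one_le_right PA hl
      have h4 : 0 ≤ (K + 4) * l := PA
      nlinarith

lemma gauss_ft {T : ℝ} (hT : 0 < T) (d : ℝ) :
    ∫ t : ℝ, (RE (-(t / T) ^ 2) : ℂ) * cexp (-(I * t * d)) =
      ((Real.sqrt π * T * RE (-(T * d) ^ 2 / 4) : ℝ) : ℂ) := by
  have h := fourierIntegral_gaussian (b := (1 / T ^ 2 : ℝ)) (by
    rw [Complex.ofReal_re]; positivity) (-(d : ℂ))
  have e : ∀ t : ℝ, (RE (-(t / T) ^ 2) : ℂ) * cexp (-(I * t * d)) =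
      cexp (I * (-(d : ℂ)) * t) * cexp (-((1 / T ^ 2 : ℝ) : ℂ) * t ^ 2) := by
    intro t
    push_cast
    rw [mul_comm]
    congr 2 <;> ring
  simp_rw [e]
  rw [h]
  push_cast
  congr 1
  · have : ((π : ℂ) / (1 / (T : ℂ) ^ 2)) = ((π * T ^ 2 : ℝ) : ℂ) := by
      push_cast; field_simp
    rw [this, show (1 / 2 : ℂ) = ((1 / 2 : ℝ) : ℂ) by push_cast; rfl,
      ← Complex.ofReal_cpow PA, ← Real.sqrt_eq_rpow, Real.sqrt_mul Real.pi_pos.le,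
      Real.sqrt_sq hT.le]
    push_cast; rfl
  · congr 1
    have : (T : ℂ) ≠ 0 := by exact_mod_cast hT.ne'
    field_simp

lemma integrable_gauss_weight {T : ℝ} (hT : 0 < T) :
    Integrable (fun t : ℝ => RE (-(t / T) ^ 2)) := by
  have := integrable_exp_neg_mul_sq (b := 1 / T ^ 2) PA
  refine this.congr (ae_of_all _ fun t => ?_)
  show RE _ = RE _
  congr 1; field_simp

set_option maxHeartbeats 1000000 in
lemma gauss_mv {X : Type*} [MeasurableSpace X] {μ : Measure X} [SFinite μ] {h : X → ℂ} {l : X → ℝ}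
    (hh : Integrable h μ) (hl : Measurable l) {T : ℝ} (hT : 0 < T) {K : X → ℝ}
    (hK : ∀ x, ∫⁻ y, EO (Real.sqrt π * T * RE (-(T * (l x - l y)) ^ 2 / 4)) ∂μ ≤
      EO (K x))
    (hitg : Integrable (fun x => ‖h x‖ ^ 2 * K x) μ) (hK0 : ∀ x, 0 ≤ K x) :
    Integrable (fun t : ℝ => RE (-(t / T) ^ 2) * ‖∫ x, h x * cexp (-(I * t * l x)) ∂μ‖ ^ 2) ∧
    ∫ t : ℝ, RE (-(t / T) ^ 2) * ‖∫ x, h x * cexp (-(I * t * l x)) ∂μ‖ ^ 2 ≤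
      ∫ x, ‖h x‖ ^ 2 * K x ∂μ := by
  set w : ℝ → ℝ := fun t => RE (-(t / T) ^ 2) with hw
  have hwi : Integrable w := integrable_gauss_weight hT
  set A : ℝ → ℂ := fun t => ∫ x, h x * cexp (-(I * t * l x)) ∂μ with hA
  have hn1 : ∀ (t d : ℝ), ‖cexp (-(I * t * d))‖ = 1 := by
    intro t d
    have : -(I * t * d) = ((-(t * d) : ℝ) : ℂ) * I := by push_cast; ring
    rw [this, Complex.norm_exp_ofReal_mul_I]
  have hprod : Integrable (fun p : ℝ × X × X => (w p.1 : ℂ) *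
      ((h p.2.1 * CJ (h p.2.2)))) (volume.prod (μ.prod μ)) := by
    have hwc : Integrable (fun t : ℝ => (w t : ℂ)) := hwi.ofReal
    refine Integrable.mul_prod (g := fun q : X × X => h q.1 * CJ (h q.2)) hwc ?_
    refine Integrable.mul_prod (f := h) (g := fun y => CJ (h y)) hh ?_
    refine Integrable.mono hh (Complex.continuous_conj.comp_aestronglyMeasurable hh.1) ?_
    exact ae_of_all _ fun x => by simp
  have hprod2 : Integrable (fun p : ℝ × X × X => ((w p.1 : ℂ) *
      ((h p.2.1 * CJ (h p.2.2)))) * cexp (-(I * p.1 * ((l p.2.1 - l p.2.2 : ℝ) : ℂ))))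
        (volume.prod (μ.prod μ)) := by
    refine Integrable.mul_bdd (c := 1) hprod ?_ ?_
    · apply Measurable.aestronglyMeasurable
      have h1 : Measurable (fun p : ℝ × X × X => l p.2.1) := FA
      have h2 : Measurable (fun p : ℝ × X × X => l p.2.2) := FA
      fun_prop
    · exact ae_of_all _ fun p => (hn1 _ _).le
  have hsq : ∀ t, ((w t * ‖A t‖ ^ 2 : ℝ) : ℂ) = ∫ p, ((w t : ℂ) *
      ((h p.1 * CJ (h p.2)))) * cexp (-(I * t * ((l p.1 - l p.2 : ℝ) : ℂ))) ∂(μ.prod μ) := by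
    intro t
    have e1 : ((‖A t‖ ^ 2 : ℝ) : ℂ) = A t * CJ (A t) := by
      rw [Complex.mul_conj, Complex.normSq_eq_norm_sq]
    rw [Complex.ofReal_mul, e1, hA]
    simp only
    rw [← integral_conj, ← integral_prod_mul, ← integral_const_mul]
    congr 1; funext p
    have : CJ (cexp (-(I * t * l p.2))) = cexp (I * t * l p.2) := by
      rw [← Complex.exp_conj]; simp
    rw [map_mul, this]
    have e2 : cexp (-(I * t * ((l p.1 - l p.2 : ℝ) : ℂ))) =
        cexp (-(I * t * l p.1)) * cexp (I * t * l p.2) := by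
      rw [← Complex.exp_add]; congr 1; push_cast; ring
    rw [e2]; ring
  have hI1 : Integrable (fun t => ((w t * ‖A t‖ ^ 2 : ℝ) : ℂ)) := by
    refine (hprod2.integral_prod_left).congr (ae_of_all _ fun t => ?_)
    exact (hsq t).symm
  have hI2 : Integrable (fun t => w t * ‖A t‖ ^ 2) := by
    exact hI1.re.congr (ae_of_all _ fun t => Complex.ofReal_re _)
  refine ⟨hI2, ?_⟩
  set k : X → X → ℝ := fun x y => Real.sqrt π * T * RE (-(T * (l x - l y)) ^ 2 / 4) with hk
  have hk0 : ∀ x y, 0 ≤ k x y := fun x y => by rw [hk]; positivity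
  have hksymm : ∀ x y, k x y = k y x := fun x y => by
    simp only [hk]; congr 3; ring
  have hkm : Measurable (fun p : X × X => k p.1 p.2) := by
    have h1 : Measurable (fun p : X × X => l p.1) := FA
    have h2 : Measurable (fun p : X × X => l p.2) := FA
    simp only [hk]; fun_prop
  have hmain : ((∫ t, w t * ‖A t‖ ^ 2 : ℝ) : ℂ) =
      ∫ p, (h p.1 * CJ (h p.2)) * (k p.1 p.2 : ℂ) ∂(μ.prod μ) := by
    rw [← integral_complex_ofReal]
    simp_rw [hsq]
    rw [integral_integral_swap hprod2]
    congr 1; funext p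
    rw [hk]
    simp only
    rw [← gauss_ft hT, ← integral_const_mul]
    congr 1; funext t
    ring
  have hK2 : ∀ x, ∫⁻ y, EO (k x y) ∂μ ≤ EO (K x) := hK
  clear_value k
  have hle : EO (∫ t, w t * ‖A t‖ ^ 2) ≤ EO (∫ x, ‖h x‖ ^ 2 * K x ∂μ) := by
    have a1 : (∫ t, w t * ‖A t‖ ^ 2) ≤ ‖((∫ t, w t * ‖A t‖ ^ 2 : ℝ) : ℂ)‖ := by
      rw [norm_real]; exact le_abs_self _
    refine (ENNReal.ofReal_le_ofReal a1).trans ?_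
    rw [hmain, ofReal_norm]
    refine (enorm_integral_le_lintegral_enorm _).trans ?_
    have hhm : AEMeasurable (fun x => EO (‖h x‖ ^ 2)) μ := by
      have := hh.1.aemeasurable; fun_prop
    have a2 : ∀ p : X × X, ‖(h p.1 * CJ (h p.2)) * (k p.1 p.2 : ℂ)‖ₑ ≤
        2⁻¹ * (EO (‖h p.1‖ ^ 2) * EO (k p.1 p.2)) +
        2⁻¹ * (EO (‖h p.2‖ ^ 2) * EO (k p.2 p.1)) := by
      intro p
      have : (2⁻¹ : ENNReal) = EO (1 / 2) := by
        rw [one_div, ENNReal.ofReal_inv_of_pos NA]; simp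
      rw [this, hksymm p.2 p.1, ← ENNReal.ofReal_mul PA, ← ENNReal.ofReal_mul PA,
        ← ENNReal.ofReal_mul PA, ← ENNReal.ofReal_mul PA,
        ← ENNReal.ofReal_add (by have := hk0 p.1 p.2; positivity)
          (by have := hk0 p.1 p.2; positivity), ← ofReal_norm]
      apply ENNReal.ofReal_le_ofReal
      rw [norm_mul, norm_mul, RCLike.norm_conj, norm_real, Real.norm_of_nonneg (hk0 _ _)]
      nlinarith [mul_nonneg (sq_nonneg (‖h p.1‖ - ‖h p.2‖)) (hk0 p.1 p.2)]
    refine (lintegral_mono a2).trans ?_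
    have m1 : AEMeasurable (fun p : X × X => EO (‖h p.1‖ ^ 2) * EO (k p.1 p.2))
        (μ.prod μ) := (hhm.comp_fst).mul hkm.ennreal_ofReal.aemeasurable
    have m2 : AEMeasurable (fun p : X × X => EO (‖h p.2‖ ^ 2) * EO (k p.2 p.1))
        (μ.prod μ) := by
      refine (hhm.comp_snd).mul ?_
      have : Measurable (fun p : X × X => k p.2 p.1) := hkm.comp measurable_swap
      exact this.ennreal_ofReal.aemeasurable
    rw [lintegral_add_left' (m1.const_mul _), lintegral_const_mul'' _ m1, lintegral_const_mul'' _ m2]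
    have s1 : ∫⁻ p, EO (‖h p.2‖ ^ 2) * EO (k p.2 p.1) ∂(μ.prod μ) =
        ∫⁻ p, EO (‖h p.1‖ ^ 2) * EO (k p.1 p.2) ∂(μ.prod μ) :=
      lintegral_prod_swap (μ := μ) (ν := μ) (fun p : X × X => EO (‖h p.1‖ ^ 2) * EO (k p.1 p.2))
    rw [s1, ← add_mul, ENNReal.inv_two_add_inv_two, one_mul, lintegral_prod _ m1]
    rw [ofReal_integral_eq_lintegral_ofReal hitg (ae_of_all _ fun x => by have := hK0 x; positivity)]
    apply lintegral_mono
    intro x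
    simp only
    rw [lintegral_const_mul' _ _ ENNReal.ofReal_ne_top, ENNReal.ofReal_mul PA]
    gcongr
    exact hK2 x
  exact (ENNReal.ofReal_le_ofReal_iff (integral_nonneg fun x => by have := hK0 x; positivity)).1 hle

lemma summable_gauss_int : Summable (fun d : ℤ => RE (-(d : ℝ) ^ 2 / 16)) := by
  have h := (Real.summable_one_div_int_pow (p := 2)).2 NA
  refine Summable.of_norm_bounded_eventually (h.mul_left 16) ?_
  have : ∀ᶠ d : ℤ in cofinite, d ≠ 0 := by
    exact (Set.finite_singleton (0 : ℤ)).subset (by intro d hd; simpa using hd)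
  filter_upwards [this] with d hd
  have hd' : (0 : ℝ) < (d : ℝ) ^ 2 := PA
  rw [Real.norm_of_nonneg (Real.exp_pos _).le, neg_div, Real.exp_neg]
  have := Real.add_one_le_exp ((d : ℝ) ^ 2 / 16)
  rw [mul_one_div, inv_le_comm₀ (Real.exp_pos _) PA, inv_div]
  linarith

lemma kernel_sum_bound : ∃ C > (0 : ℝ), ∀ (T : ℝ) (N : ℕ), 0 < T → (N : ℝ) ≤ 2 * T → ∀ m : Fin N,
    ∑ k : Fin N, RE (-(T * (RL ((m : ℕ) + 1 : ℝ) - RL ((k : ℕ) + 1 : ℝ))) ^ 2 / 4) ≤ C := by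
  refine ⟨∑' d : ℤ, RE (-(d : ℝ) ^ 2 / 16),
    summable_gauss_int.tsum_pos (fun d => (Real.exp_pos _).le) 0 (Real.exp_pos _),
    fun T N hT hN m => ?_⟩
  have key : ∀ a b : ℝ, 1 ≤ a → 1 ≤ b → a ≤ N → b ≤ a → (a - b) / (2 * T) ≤ RL a - RL b := by
    intro a b ha hb haN hba
    have h1 := Real.log_le_sub_one_of_pos (x := b / a) PA
    rw [Real.log_div PA PA] at h1
    have h2 : (a - b) / (2 * T) ≤ (a - b) / a := by
      gcongr
      linarith
    have h3 : (a - b) / a = 1 - b / a := by field_simp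
    linarith
  have h1 : ∀ k : Fin N, RE (-(T * (RL ((m : ℕ) + 1 : ℝ) - RL ((k : ℕ) + 1 : ℝ))) ^ 2 / 4)
      ≤ RE (-((((m : ℕ) : ℤ) - ((k : ℕ) : ℤ) : ℤ) : ℝ) ^ 2 / 16) := by
    intro k
    apply Real.exp_le_exp.2
    push_cast
    set a : ℝ := (m : ℕ) + 1 with ha
    set b : ℝ := (k : ℕ) + 1 with hb
    have ha1 : 1 ≤ a := by rw [ha]; linarith [Nat.cast_nonneg (α := ℝ) (m : ℕ)]
    have hb1 : 1 ≤ b := by rw [hb]; linarith [Nat.cast_nonneg (α := ℝ) (k : ℕ)]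
    have haN : a ≤ N := by rw [ha]; exact_mod_cast m.2
    have hbN : b ≤ N := by rw [hb]; exact_mod_cast k.2
    have hd : ((m : ℕ) : ℝ) - ((k : ℕ) : ℝ) = a - b := by rw [ha, hb]; ring
    rw [hd]
    have : |(a - b) / 2| ≤ |T * (RL a - RL b)| := by
      rcases le_total b a with h | h
      · have := key a b ha1 hb1 haN h
        rw [div_le_iff₀ PA] at this
        rw [abs_of_nonneg LA]
        refine le_trans ?_ (le_abs_self _)
        linarith
      · have := key b a hb1 ha1 hbN h
        rw [div_le_iff₀ PA] at this
        rw [abs_of_nonpos LA]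
        refine le_trans ?_ (neg_le_abs _)
        linarith
    have := sq_le_sq.2 this
    linarith
  refine (sum_le_sum fun k _ => h1 k).trans ?_
  have hinj : Function.Injective (fun k : Fin N => (((m : ℕ) : ℤ) - ((k : ℕ) : ℤ) : ℤ)) := by
    intro k k' h
    simp only [sub_right_inj, Nat.cast_inj] at h
    exact Fin.ext h
  have := summable_gauss_int.sum_le_tsum (Finset.univ.map ⟨_, hinj⟩) (fun d _ => (Real.exp_pos _).le)
  rw [Finset.sum_map] at this
  exact this

lemma sum_Icc_eq_fin {E : Type*} [AddCommMonoid E] (N : ℕ) (g : ℕ → E) :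
    ∑ m ∈ Finset.Icc 1 N, g m = ∑ i : Fin N, g ((i : ℕ) + 1) := by
  induction N with
  | zero => simp
  | succ N ih => rw [sum_Icc_succ_top (by omega), ih, Fin.sum_univ_castSucc]; simp

lemma integral_fin_count {N : ℕ} (f : Fin N → ℂ) : ∫ i, f i ∂Measure.count = ∑ i, f i := by
  rw [integral_countable Integrable.of_finite, tsum_fintype]
  simp [Measure.real]

lemma integral_fin_count_real {N : ℕ} (f : Fin N → ℝ) : ∫ i, f i ∂Measure.count = ∑ i, f i := by
  rw [integral_countable Integrable.of_finite, tsum_fintype]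
  simp [Measure.real]

lemma ofReal_cpow_split {u : ℝ} (hu : 0 < u) (σ t : ℝ) :
    (u : ℂ) ^ (-(σ + t * I : ℂ)) = ((u ^ (-σ) : ℝ) : ℂ) * cexp (-(I * t * (RL u : ℝ))) := by
  have h0 : (u : ℂ) ≠ 0 := by exact_mod_cast hu.ne'
  rw [Complex.ofReal_cpow hu.le, cpow_def_of_ne_zero h0, cpow_def_of_ne_zero h0,
    ← Complex.exp_add, ← Complex.ofReal_log hu.le]
  congr 1; push_cast; ring

lemma dirpoly_mv : ∃ C > (0 : ℝ), ∀ (T σ : ℝ) (N : ℕ), 0 < T → (N : ℝ) ≤ 2 * T → 1 / 2 ≤ σ →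
    Integrable (fun t : ℝ => RE (-(t / T) ^ 2) *
      ‖∑ m ∈ Finset.Icc 1 N, (m : ℂ) ^ (-(σ + t * I : ℂ))‖ ^ 2) ∧
    ∫ t : ℝ, RE (-(t / T) ^ 2) * ‖∑ m ∈ Finset.Icc 1 N, (m : ℂ) ^ (-(σ + t * I : ℂ))‖ ^ 2 ≤
      C * T * (1 + RL N) := by
  obtain ⟨C, hC, hk⟩ := kernel_sum_bound
  refine ⟨Real.sqrt π * C, by positivity, fun T σ N hT hN hσ => ?_⟩
  have hA : ∀ t : ℝ, ∑ m ∈ Finset.Icc 1 N, (m : ℂ) ^ (-(σ + t * I : ℂ)) =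
      ∫ i : Fin N, ((((i : ℕ) + 1 : ℝ) ^ (-σ) : ℝ) : ℂ) *
        cexp (-(I * t * (RL ((i : ℕ) + 1 : ℝ) : ℝ))) ∂Measure.count := by
    intro t
    rw [integral_fin_count, sum_Icc_eq_fin]
    refine sum_congr rfl fun i _ => ?_
    rw [← ofReal_cpow_split PA]
    push_cast; rfl
  simp_rw [hA]
  have := gauss_mv (X := Fin N) (μ := Measure.count)
    (h := fun i => ((((i : ℕ) + 1 : ℝ) ^ (-σ) : ℝ) : ℂ)) (l := fun i => RL ((i : ℕ) + 1 : ℝ))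
    Integrable.of_finite (measurable_of_finite _) hT (K := fun _ => Real.sqrt π * T * C) (by
      intro m
      rw [lintegral_count, tsum_fintype, ← ENNReal.ofReal_sum_of_nonneg (fun i _ => by positivity),
        ← mul_sum]
      apply ENNReal.ofReal_le_ofReal
      gcongr
      exact hk T N hT hN m) Integrable.of_finite (fun _ => by positivity)
  refine ⟨this.1, this.2.trans ?_⟩
  rw [integral_fin_count_real, ← sum_mul]
  have h1 : ∑ i : Fin N, ‖((((i : ℕ) + 1 : ℝ) ^ (-σ) : ℝ) : ℂ)‖ ^ 2 ≤ 1 + RL N := by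
    have h2 : ∀ i : Fin N, ‖((((i : ℕ) + 1 : ℝ) ^ (-σ) : ℝ) : ℂ)‖ ^ 2 ≤ (((i : ℕ) + 1 : ℕ) : ℝ)⁻¹ := by
      intro i
      have hp : (0 : ℝ) < (i : ℕ) + 1 := PA
      rw [norm_real, Real.norm_of_nonneg PA, ← Real.rpow_natCast,
        ← Real.rpow_mul hp.le, ← Real.rpow_neg_one]
      push_cast
      apply Real.rpow_le_rpow_of_exponent_le
      · linarith [Nat.cast_nonneg (α := ℝ) (i : ℕ)]
      · linarith
    refine (sum_le_sum fun i _ => h2 i).trans ?_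
    rw [← sum_Icc_eq_fin N (fun m : ℕ => (m : ℝ)⁻¹)]
    have := harmonic_le_one_add_log N
    rw [harmonic_eq_sum_Icc] at this
    push_cast at this
    exact this
  calc _ ≤ (1 + RL N) * (Real.sqrt π * T * C) := by gcongr
    _ = _ := by ring

lemma kernel_int_bound {T : ℝ} (hT : 1 ≤ T) (a : ℝ) (N : ℕ) :
    ∫⁻ v in Set.Ioi (N : ℝ), EO (Real.sqrt π * T *
      RE (-(T * (a - RL v)) ^ 2 / 4)) ≤ EO (100 * RE a) := by
  have hsub : Set.Ioi (N : ℝ) ⊆ RE '' Set.univ := by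
    rw [Set.image_univ, Real.range_exp]
    intro v hv
    exact lt_of_le_of_lt (Nat.cast_nonneg N) (Set.mem_Ioi.1 hv)
  refine (lintegral_mono_set hsub).trans ?_
  rw [lintegral_image_eq_lintegral_abs_deriv_mul (f' := RE) MeasurableSet.univ
    (fun x _ => (Real.hasDerivAt_exp x).hasDerivWithinAt) Real.exp_injective.injOn,
    Measure.restrict_univ]
  have h1 : ∀ y : ℝ, EO |RE y| * EO (Real.sqrt π * T *
      RE (-(T * (a - RL (RE y))) ^ 2 / 4)) ≤
      EO (RE a * RE 2 * Real.sqrt π * T * RE (-(T ^ 2 / 8) * (y - a) ^ 2)) := by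
    intro y
    rw [← ENNReal.ofReal_mul (abs_nonneg _), Real.log_exp, abs_of_pos (Real.exp_pos y)]
    apply ENNReal.ofReal_le_ofReal
    have : RE y * RE (-(T * (a - y)) ^ 2 / 4) ≤
        RE a * RE 2 * RE (-(T ^ 2 / 8) * (y - a) ^ 2) := by
      rw [← Real.exp_add, ← Real.exp_add, ← Real.exp_add]
      apply Real.exp_le_exp.2
      have h2 : (y - a) ^ 2 ≤ T ^ 2 * (y - a) ^ 2 := by
        apply le_mul_of_one_le_left (sq_nonneg _); nlinarith
      nlinarith [sq_nonneg (y - a - 4)]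
    have h3 : 0 ≤ Real.sqrt π * T := PA
    calc _ = Real.sqrt π * T * (RE y * RE (-(T * (a - y)) ^ 2 / 4)) := by ring
      _ ≤ Real.sqrt π * T * (RE a * RE 2 * RE (-(T ^ 2 / 8) * (y - a) ^ 2)) := by
        gcongr
      _ = _ := by ring
  refine (lintegral_mono h1).trans ?_
  have hitg : Integrable (fun y : ℝ => RE a * RE 2 * Real.sqrt π * T *
      RE (-(T ^ 2 / 8) * (y - a) ^ 2)) :=
    ((integrable_exp_neg_mul_sq (b := T ^ 2 / 8) PA).comp_sub_right a).const_mul _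
  rw [← ofReal_integral_eq_lintegral_ofReal hitg (ae_of_all _ fun y => by positivity)]
  apply ENNReal.ofReal_le_ofReal
  rw [integral_const_mul, integral_sub_right_eq_self (fun y => RE (-(T ^ 2 / 8) * y ^ 2)) a,
    integral_gaussian]
  have h4 : Real.sqrt (π / (T ^ 2 / 8)) = Real.sqrt π * Real.sqrt 8 / T := by
    rw [show π / (T ^ 2 / 8) = π * 8 / T ^ 2 by field_simp,
      Real.sqrt_div PA, Real.sqrt_sq LA, Real.sqrt_mul Real.pi_pos.le]
  rw [h4]
  have h5 : RE a * RE 2 * Real.sqrt π * T * (Real.sqrt π * Real.sqrt 8 / T) =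
      (RE 2 * (Real.sqrt π * Real.sqrt π) * Real.sqrt 8) * RE a := by
    field_simp
  rw [h5, Real.mul_self_sqrt Real.pi_pos.le]
  gcongr
  have e2 : RE 2 ≤ 7.4 := by
    have := Real.exp_one_lt_d9
    rw [show (2 : ℝ) = 1 + 1 by norm_num, Real.exp_add]
    nlinarith [Real.exp_pos 1]
  have s8 : Real.sqrt 8 ≤ 2.9 := by
    rw [Real.sqrt_le_left NA]; norm_num
  have hp := Real.pi_lt_d2
  calc RE 2 * π * Real.sqrt 8 ≤ 7.4 * 3.15 * 2.9 := by gcongr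
    _ ≤ 100 := NA

lemma zRem_mv {T σ : ℝ} (hT : 1 ≤ T) (hσ : 1 / 2 ≤ σ) {N : ℕ} (hN : 1 ≤ N) :
    Integrable (fun t : ℝ => RE (-(t / T) ^ 2) * ‖zRem N (σ + t * I)‖ ^ 2) ∧
    ∫ t : ℝ, RE (-(t / T) ^ 2) * ‖zRem N (σ + t * I)‖ ^ 2 ≤ 100 / N := by
  have hN' : (1 : ℝ) ≤ N := by exact_mod_cast hN
  have hA : ∀ t : ℝ, zRem N (σ + t * I) = ∫ u in Set.Ioi (N : ℝ),
      ((Int.fract u * u ^ (-σ - 1) : ℝ) : ℂ) * cexp (-(I * t * (RL u : ℝ))) := by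
    intro t
    rw [zRem]
    refine setIntegral_congr_fun measurableSet_Ioi fun u hu => ?_
    have hu0 : (0 : ℝ) < u := lt_of_lt_of_le LA (le_of_lt hu)
    have := ofReal_cpow_split hu0 (σ + 1) t
    rw [show -(σ + t * I : ℂ) - 1 = -(((σ + 1 : ℝ) : ℂ) + t * I) by push_cast; ring, this]
    push_cast
    rw [show -(σ : ℝ) - 1 = -(σ + 1) by ring]; ring
  simp_rw [hA]
  have hb : ∀ u ∈ Set.Ioi (N : ℝ), ‖((Int.fract u * u ^ (-σ - 1) : ℝ) : ℂ)‖ ≤ u ^ (-σ - 1) := by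
    intro u hu
    have hu0 : (0 : ℝ) < u := lt_of_lt_of_le LA (le_of_lt hu)
    rw [norm_real, Real.norm_of_nonneg (by have := Int.fract_nonneg u; positivity)]
    apply mul_le_of_le_one_left PA (Int.fract_lt_one u).le
  have hm : Measurable (fun u : ℝ => ((Int.fract u * u ^ (-σ - 1) : ℝ) : ℂ)) := by
    have : Measurable (Int.fract : ℝ → ℝ) := measurable_fract
    fun_prop
  have hitg : Integrable (fun u : ℝ => ((Int.fract u * u ^ (-σ - 1) : ℝ) : ℂ))
      (volume.restrict (Set.Ioi (N : ℝ))) := by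
    refine Integrable.mono' (integrableOn_Ioi_rpow_of_lt (a := -σ - 1) LA
      (by linarith : (0 : ℝ) < N)) hm.aestronglyMeasurable ?_
    exact (ae_restrict_iff' measurableSet_Ioi).2 (ae_of_all _ hb)
  have h2i : IntegrableOn (fun u : ℝ => 100 * u ^ (-2 : ℝ)) (Set.Ioi (N : ℝ)) :=
    (integrableOn_Ioi_rpow_of_lt NA LA).const_mul _
  have hbb : ∀ u ∈ Set.Ioi (N : ℝ), ‖((Int.fract u * u ^ (-σ - 1) : ℝ) : ℂ)‖ ^ 2 *
      (100 * RE (RL u)) ≤ 100 * u ^ (-2 : ℝ) := by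
    intro u hu
    have hu1 : (1 : ℝ) ≤ u := le_trans hN' (le_of_lt hu)
    have hu0 : (0 : ℝ) < u := LA
    have h3 := hb u hu
    rw [Real.exp_log hu0]
    calc _ ≤ (u ^ (-σ - 1)) ^ 2 * (100 * u) := by gcongr
      _ = 100 * (u ^ (-2 * σ - 2) * u ^ (1 : ℝ)) := by
        rw [← Real.rpow_natCast, ← Real.rpow_mul hu0.le, Real.rpow_one]
        rw [show (-σ - 1) * ((2 : ℕ) : ℝ) = -2 * σ - 2 by push_cast; ring]; ring
      _ ≤ _ := by
        rw [← Real.rpow_add hu0]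
        gcongr
        linarith
  have hi3 : Integrable (fun u : ℝ => ‖((Int.fract u * u ^ (-σ - 1) : ℝ) : ℂ)‖ ^ 2 *
      (100 * RE (RL u))) (volume.restrict (Set.Ioi (N : ℝ))) := by
    refine Integrable.mono' h2i ?_ ?_
    · apply Measurable.aestronglyMeasurable
      fun_prop
    · refine (ae_restrict_iff' measurableSet_Ioi).2 (ae_of_all _ fun u hu => ?_)
      rw [Real.norm_of_nonneg PA]
      exact hbb u hu
  have := gauss_mv (μ := volume.restrict (Set.Ioi (N : ℝ))) (l := RL)
    (h := fun u => ((Int.fract u * u ^ (-σ - 1) : ℝ) : ℂ)) hitg Real.measurable_log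
    (by linarith : 0 < T) (K := fun u => 100 * RE (RL u))
    (fun x => kernel_int_bound hT (RL x) N) hi3 (fun x => by positivity)
  refine ⟨this.1, this.2.trans ?_⟩
  refine (setIntegral_mono_on hi3 h2i measurableSet_Ioi hbb).trans ?_
  rw [integral_const_mul, integral_Ioi_rpow_of_lt NA LA]
  norm_num
  rw [Real.rpow_neg_one]
  apply le_of_eq; ring

/-- Mean square of zeta on vertical lines. -/
lemma zeta_mean_sq : ∃ C > (0 : ℝ), ∀ T σ : ℝ, 1 ≤ T → 1 / 2 ≤ σ → σ ≤ 3 / 4 →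
    ∫⁻ t in Set.Icc (-T) T, EO (‖ZZ (σ + t * I)‖ ^ 2) ≤
      EO (C * T * (1 + RL T)) := by
  obtain ⟨C, hC, hD⟩ := dirpoly_mv
  refine ⟨3 * RE 1 * C * 2 + 96 * π + 600 * RE 1, by positivity, fun T σ hT hσ hσ2 => ?_⟩
  set N := ⌈T⌉₊ with hN
  have hNT : T ≤ N := Nat.le_ceil T
  have hN2 : (N : ℝ) ≤ 2 * T := by
    have := Nat.ceil_lt_add_one (by linarith : 0 ≤ T)
    linarith
  have hN1 : 1 ≤ N := by
    have : (1 : ℝ) ≤ N := LA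
    exact_mod_cast this
  have hN0 : (0 : ℝ) < N := LA
  obtain ⟨i1, b1⟩ := hD T σ N LA hN2 hσ
  obtain ⟨i2, b2⟩ := zRem_mv hT hσ hN1
  set w : ℝ → ℝ := fun t => RE (-(t / T) ^ 2) with hw
  set D : ℝ → ℂ := fun t => ∑ m ∈ Finset.Icc 1 N, (m : ℂ) ^ (-(σ + t * I : ℂ)) with hDd
  set R : ℝ → ℂ := fun t => zRem N (σ + t * I) with hR
  have i3 : Integrable (fun t : ℝ => (1 + t ^ 2)⁻¹) := integrable_inv_one_add_sq
  set f : ℝ → ℝ := fun t => 3 * RE 1 * (w t * ‖D t‖ ^ 2) + 96 * T * (1 + t ^ 2)⁻¹ +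
    6 * T ^ 2 * RE 1 * (w t * ‖R t‖ ^ 2) with hf
  have hfi : Integrable f := ((i1.const_mul _).add (i3.const_mul _)).add (i2.const_mul _)
  have hf0 : ∀ t, 0 ≤ f t := fun t => by simp only [hf, hw]; positivity
  have hpt : ∀ t ∈ Set.Icc (-T) T, ‖ZZ (σ + t * I)‖ ^ 2 ≤ f t := by
    intro t ht
    set s : ℂ := σ + t * I with hs
    have hre : s.re = σ := by simp [hs]
    have him : s.im = t := by simp [hs]
    have hs1 : s ≠ 1 := by
      intro h; have := congrArg Complex.re h; rw [hre] at this; simp at this; linarith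
    have hz := zeta_formula hN1 (s := s) (by rw [hre]; linarith) hs1
    have ht2 : t ^ 2 ≤ T ^ 2 := by nlinarith [ht.1, ht.2]
    have hw1 : 1 ≤ RE 1 * w t := by
      simp only [hw]
      rw [← Real.exp_add]
      apply Real.one_le_exp
      have : (t / T) ^ 2 ≤ 1 := by rw [div_pow, div_le_one PA]; exact ht2
      linarith
    have hm : ‖(N : ℂ) ^ (1 - s) / (s - 1)‖ ^ 2 ≤ 32 * T * (1 + t ^ 2)⁻¹ := by
      rw [norm_div, div_pow]
      have h1 : ‖(N : ℂ) ^ (1 - s)‖ ^ 2 ≤ 2 * T := by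
        have := norm_natCast_cpow_of_pos (n := N) (by omega) (1 - s)
        rw [this, ← Real.rpow_natCast, ← Real.rpow_mul hN0.le]
        have h2 : (N : ℝ) ^ ((1 - s).re * (2 : ℕ)) ≤ (N : ℝ) ^ (1 : ℝ) := by
          apply Real.rpow_le_rpow_of_exponent_le (by exact_mod_cast hN1)
          simp [hre]; linarith
        rw [Real.rpow_one] at h2
        linarith
      have h3 : (1 + t ^ 2) / 16 ≤ ‖s - 1‖ ^ 2 := by
        rw [Complex.sq_norm, normSq_apply]
        simp [hre, him]; nlinarith
      calc _ ≤ 2 * T / ((1 + t ^ 2) / 16) := by gcongr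
        _ = _ := by field_simp; norm_num
    have hsn : ‖s‖ ^ 2 ≤ 2 * T ^ 2 := by
      rw [Complex.sq_norm, normSq_apply, hre, him]; nlinarith
    have hRm : ‖s * zRem N s‖ ^ 2 ≤ 2 * T ^ 2 * (RE 1 * w t * ‖R t‖ ^ 2) := by
      rw [norm_mul, mul_pow]
      have : ‖zRem N s‖ ^ 2 ≤ RE 1 * w t * ‖R t‖ ^ 2 :=
        le_mul_of_one_le_left PA hw1
      gcongr
    have hDm : ‖D t‖ ^ 2 ≤ RE 1 * w t * ‖D t‖ ^ 2 :=
        le_mul_of_one_le_left PA hw1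
    rw [hz]
    set a := ∑ m ∈ Finset.Icc 1 N, (m : ℂ) ^ (-s) with ha
    set b := (N : ℂ) ^ (1 - s) / (s - 1)
    set c := s * zRem N s
    have haD : a = D t := rfl
    have h4 : ‖a + b - c‖ ≤ ‖a‖ + ‖b‖ + ‖c‖ :=
      (norm_sub_le _ _).trans (by gcongr; exact norm_add_le _ _)
    have h5 : ‖a + b - c‖ ^ 2 ≤ 3 * (‖a‖ ^ 2 + ‖b‖ ^ 2 + ‖c‖ ^ 2) := by
      have : ‖a + b - c‖ ^ 2 ≤ (‖a‖ + ‖b‖ + ‖c‖) ^ 2 := by gcongr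
      nlinarith [sq_nonneg (‖a‖ - ‖b‖), sq_nonneg (‖a‖ - ‖c‖), sq_nonneg (‖b‖ - ‖c‖)]
    rw [haD] at h5 ⊢
    simp only [hf]
    nlinarith
  have hle : ∫⁻ t in Set.Icc (-T) T, EO (‖ZZ (σ + t * I)‖ ^ 2) ≤
      ∫⁻ t, EO (f t) :=
    (setLIntegral_mono' measurableSet_Icc fun t ht => ENNReal.ofReal_le_ofReal (hpt t ht)).trans
      (setLIntegral_le_lintegral _ _)
  refine hle.trans ?_
  rw [← ofReal_integral_eq_lintegral_ofReal hfi (ae_of_all _ hf0)]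
  apply ENNReal.ofReal_le_ofReal
  have j1 : Integrable (fun t => 3 * RE 1 * (w t * ‖D t‖ ^ 2)) := i1.const_mul _
  have j2 : Integrable (fun t : ℝ => 96 * T * (1 + t ^ 2)⁻¹) := i3.const_mul _
  have j3 : Integrable (fun t => 6 * T ^ 2 * RE 1 * (w t * ‖R t‖ ^ 2)) := i2.const_mul _
  have j4 : Integrable (fun t => 3 * RE 1 * (w t * ‖D t‖ ^ 2) + 96 * T * (1 + t ^ 2)⁻¹) := j1.add j2
  simp only [hf]
  rw [integral_add j4 j3, integral_add j1 j2, integral_const_mul, integral_const_mul,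
    integral_const_mul, integral_univ_inv_one_add_sq]
  have hl0 : 0 ≤ RL T := Real.log_nonneg hT
  have hlN : 1 + RL N ≤ 2 * (1 + RL T) := by
    have : RL N ≤ RL (2 * T) := Real.log_le_log hN0 hN2
    rw [Real.log_mul NA LA] at this
    linarith [Real.log_two_lt_d9]
  have c1 : 3 * RE 1 * ∫ t, w t * ‖D t‖ ^ 2 ≤ 3 * RE 1 * (C * T * (2 * (1 + RL T))) := by
    gcongr
    exact b1.trans (by gcongr)
  have c2 : 6 * T ^ 2 * RE 1 * ∫ t, w t * ‖R t‖ ^ 2 ≤ 600 * RE 1 * T := by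
    calc _ ≤ 6 * T ^ 2 * RE 1 * (100 / T) := by
          gcongr
          exact b2.trans (by gcongr)
      _ = _ := by field_simp; norm_num
  have c3 : 96 * T * π + 600 * RE 1 * T ≤ (96 * π + 600 * RE 1) * T * (1 + RL T) := by
    have : (96 * π + 600 * RE 1) * T ≤ (96 * π + 600 * RE 1) * T * (1 + RL T) :=
      le_mul_of_one_le_right PA LA
    linarith
  linarith

lemma zeta_line_ne_one {σ : ℝ} (h : σ ≠ 1) (t : ℝ) : (σ + t * I : ℂ) ≠ 1 := by
  intro h1; apply h; have := congrArg Complex.re h1; simpa using this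

lemma zeta_line_continuous {σ : ℝ} (h : σ ≠ 1) :
    Continuous (fun t : ℝ => ZZ (σ + t * I)) := by
  rw [continuous_iff_continuousAt]
  intro t
  have h1 := (differentiableAt_riemannZeta (zeta_line_ne_one h t)).continuousAt
  exact ContinuousAt.comp (f := fun t : ℝ => (σ + t * I : ℂ)) h1 FA

lemma zeta_mean_sq_int : ∃ C > (0 : ℝ), ∀ T σ : ℝ, 1 ≤ T → 1 / 2 ≤ σ → σ ≤ 3 / 4 →
    ∫ t in (-T)..T, ‖ZZ (σ + t * I)‖ ^ 2 ≤ C * T * (1 + RL T) := by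
  obtain ⟨C, hC, h⟩ := zeta_mean_sq
  refine ⟨C, hC, fun T σ hT h1 h2 => ?_⟩
  have hc : Continuous (fun t : ℝ => ‖ZZ (σ + t * I)‖ ^ 2) :=
    (zeta_line_continuous LA).norm.pow 2
  rw [intervalIntegral.integral_of_le LA, ← integral_Icc_eq_integral_Ioc]
  rw [← ENNReal.ofReal_le_ofReal_iff (by have := Real.log_nonneg hT; positivity),
    ofReal_integral_eq_lintegral_ofReal (hc.continuousOn.integrableOn_Icc)
      (ae_of_all _ fun t => by positivity)]
  exact h T σ hT h1 h2

/-- mean square on a shifted line -/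
lemma zeta_mean_sq_shift : ∃ C > (0 : ℝ), ∀ T σ a : ℝ, 1 ≤ T → 1 / 2 ≤ σ → σ ≤ 3 / 4 → |a| ≤ 1 →
    ∫ t in (-T)..T, ‖ZZ (σ + (t + a : ℝ) * I)‖ ^ 2 ≤ C * T * (1 + RL T) := by
  obtain ⟨C, hC, h⟩ := zeta_mean_sq_int
  refine ⟨C * 4, by positivity, fun T σ a hT h1 h2 ha => ?_⟩
  have hc : Continuous (fun t : ℝ => ‖ZZ (σ + t * I)‖ ^ 2) :=
    (zeta_line_continuous LA).norm.pow 2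
  have h3 := intervalIntegral.integral_comp_add_right (a := -T) (b := T)
    (fun t : ℝ => ‖ZZ (σ + t * I)‖ ^ 2) a
  rw [h3]
  rw [abs_le] at ha
  have h4 := h (T + 1) σ LA h1 h2
  have h5 : ∫ t in (-T + a)..(T + a), ‖ZZ (σ + t * I)‖ ^ 2 ≤
      ∫ t in (-(T + 1))..(T + 1), ‖ZZ (σ + t * I)‖ ^ 2 := by
    apply integral_mono_interval LA LA LA
    · exact ae_of_all _ fun t => by positivity
    · exact hc.intervalIntegrable _ _
  refine h5.trans (h4.trans ?_)
  have h6 : RL (T + 1) ≤ 1 + RL T := by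
    have : RL (T + 1) ≤ RL (2 * T) := Real.log_le_log LA LA
    rw [Real.log_mul NA LA] at this
    linarith [Real.log_two_lt_d9]
  have := Real.log_nonneg hT
  have h7 : 0 ≤ RL (T + 1) := Real.log_nonneg LA
  calc C * (T + 1) * (1 + RL (T + 1)) ≤ C * (2 * T) * (2 * (1 + RL T)) := by
        gcongr <;> linarith
    _ = _ := by ring

lemma zeta_deriv_circle {s : ℂ} {r : ℝ} (hr : 0 < r) (hs : s.re + r < 1) :
    ‖deriv ZZ s‖ ≤ (2 * π * r)⁻¹ *
      ∫ θ in (0 : ℝ)..(2 * π), ‖ZZ (circleMap s r θ)‖ := by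
  have hd : DifferentiableOn ℂ ZZ (CB s r) := by
    intro z hz
    refine (differentiableAt_riemannZeta ?_).differentiableWithinAt
    rintro rfl
    rw [mem_closedBall_iff_norm] at hz
    have := (re_le_norm (1 - s)).trans hz
    simp at this; linarith
  have h := hd.deriv_eq_smul_circleIntegral hr
  have h2 : ‖∮ z in C(s, r), (1 / (z - s) ^ 2) • ZZ z‖ ≤
      r⁻¹ * ∫ θ in (0 : ℝ)..(2 * π), ‖ZZ (circleMap s r θ)‖ := by
    rw [circleIntegral]
    refine (intervalIntegral.norm_integral_le_integral_norm PA).trans ?_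
    rw [← intervalIntegral.integral_const_mul]
    apply le_of_eq
    apply intervalIntegral.integral_congr
    intro θ _
    simp only [norm_smul, deriv_circleMap, norm_mul, norm_div, norm_pow, circleMap_sub_center,
      norm_circleMap_zero, norm_I, norm_one, abs_of_pos hr]
    field_simp
  rw [h, norm_smul] at h2
  have h3 : ‖(2 * π * I : ℂ)‖ = 2 * π := by
    simp [abs_of_pos Real.pi_pos]
  rw [h3] at h2
  rw [mul_inv, mul_assoc, ← div_eq_inv_mul, le_div_iff₀ PA]
  linarith

lemma continuous_deriv_zeta_line {σ : ℝ} (h : σ ≠ 1) (k : ℕ) :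
    Continuous (fun t : ℝ => iteratedDeriv k ZZ (σ + t * I)) := by
  rw [continuous_iff_continuousAt]
  intro t
  have hd : DifferentiableOn ℂ ZZ {1}ᶜ := fun z hz =>
    (differentiableAt_riemannZeta hz).differentiableWithinAt
  have ha : AnalyticAt ℂ ZZ (σ + t * I) :=
    hd.analyticAt (isOpen_compl_singleton.mem_nhds (zeta_line_ne_one h t))
  have h1 : ContinuousAt (iteratedDeriv k ZZ) (σ + t * I) :=
    (ha.iterated_deriv k |> fun h => by rw [iteratedDeriv_eq_iterate]; exact h.continuousAt)
  exact ContinuousAt.comp (f := fun t : ℝ => (σ + t * I : ℂ)) h1 FA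

lemma interval_swap {g : ℝ → ℝ → ℝ} (hg : Continuous (Function.uncurry g)) (a b c d : ℝ) :
    ∫ t in a..b, ∫ θ in c..d, g t θ = ∫ θ in c..d, ∫ t in a..b, g t θ := by
  have := intervalIntegral_integral_swap (a := a) (b := b) (f := g) (μ := volume.restrict (Set.uIoc c d)) (by
    rw [Measure.prod_restrict]
    apply IntegrableOn.mono_set (hg.continuousOn.integrableOn_compact
      (isCompact_uIcc (a := a) (b := b) |>.prod (isCompact_uIcc (a := c) (b := d))))
    exact Set.prod_mono Set.uIoc_subset_uIcc Set.uIoc_subset_uIcc)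
  simp only [intervalIntegral.intervalIntegral_eq_integral_uIoc (a := c) (b := d)] at *
  simp only [intervalIntegral.integral_smul, this]

set_option maxHeartbeats 1000000 in
lemma zeta_deriv_mul_mean : ∃ C > (0 : ℝ), ∀ T L : ℝ, 1 ≤ T → 8 ≤ L →
    ∫ t in (-T)..T, ‖deriv ZZ ((1 / 2 + 1 / L : ℝ) + t * I)‖ *
      ‖ZZ ((1 / 2 + 1 / L : ℝ) + t * I)‖ ≤ C * L * T * (1 + RL T) := by
  obtain ⟨C, hC, h⟩ := zeta_mean_sq_shift
  refine ⟨2 * C, by positivity, fun T L hT hL => ?_⟩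
  set σ : ℝ := 1 / 2 + 1 / L with hσ
  set r : ℝ := 1 / (2 * L) with hr
  have hL0 : 0 < L := LA
  have hr0 : 0 < r := PA
  have hi : 1 / L = 2 * r := by rw [hr]; field_simp
  have hL8 : 1 / L ≤ 1 / 8 := by gcongr
  have hr1 : r ≤ 1 / 16 := LA
  have hσ1 : 1 / 2 + r ≤ σ := LA
  have hσ2 : σ + r ≤ 3 / 4 := LA
  have hσn : σ ≠ 1 := LA
  have hmap : ∀ t θ : ℝ, circleMap (σ + t * I) r θ =
      ((σ + r * Real.cos θ : ℝ) : ℂ) + ((t + r * Real.sin θ : ℝ) : ℂ) * I := by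
    intro t θ
    rw [circleMap, Complex.exp_mul_I]
    push_cast; ring
  have hcos : ∀ θ : ℝ, 1 / 2 ≤ σ + r * Real.cos θ ∧ σ + r * Real.cos θ ≤ 3 / 4 := by
    intro θ
    constructor <;> nlinarith [Real.neg_one_le_cos θ, Real.cos_le_one θ]
  have hsin : ∀ θ : ℝ, |r * Real.sin θ| ≤ 1 := by
    intro θ
    rw [abs_mul, abs_of_pos hr0]
    have := Real.abs_sin_le_one θ
    nlinarith [abs_nonneg (Real.sin θ)]
  set g : ℝ → ℝ → ℝ := fun t θ => ‖ZZ (circleMap (σ + t * I) r θ)‖ with hg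
  have hgc : Continuous (Function.uncurry g) := by
    rw [continuous_iff_continuousAt]
    rintro ⟨t, θ⟩
    have h1 : ContinuousAt ZZ (circleMap (σ + t * I) r θ) := by
      rw [hmap]
      exact (differentiableAt_riemannZeta (zeta_line_ne_one (by linarith [(hcos θ).2]) _)).continuousAt
    have h2 : ContinuousAt (fun p : ℝ × ℝ => circleMap (σ + p.1 * I) r p.2) (t, θ) := by
      unfold circleMap; fun_prop
    exact (ContinuousAt.comp (f := fun p : ℝ × ℝ => circleMap (σ + p.1 * I) r p.2) h1 h2).norm
  have hgc2 : Continuous (Function.uncurry (fun t θ => g t θ ^ 2)) := hgc.pow 2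
  have hgθ : ∀ t, Continuous (g t) := fun t => hgc.comp (by fun_prop : Continuous fun θ => (t, θ))
  set z : ℝ → ℝ := fun t => ‖ZZ (σ + t * I)‖ with hz
  have hzc : Continuous z := (zeta_line_continuous hσn).norm
  have hpt : ∀ t : ℝ, ‖deriv ZZ (σ + t * I)‖ * z t ≤
      (4 * π * r)⁻¹ * (∫ θ in (0 : ℝ)..(2 * π), g t θ ^ 2) + (2 * r)⁻¹ * z t ^ 2 := by
    intro t
    have h1 := zeta_deriv_circle (s := σ + t * I) hr0 (by simp; linarith)
    have h2 : (∫ θ in (0 : ℝ)..(2 * π), g t θ) * z t ≤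
        ∫ θ in (0 : ℝ)..(2 * π), (1 / 2 * g t θ ^ 2 + 1 / 2 * z t ^ 2) := by
      rw [← intervalIntegral.integral_mul_const]
      apply integral_mono_on PA
      · exact ((hgθ t).mul_const _).intervalIntegrable _ _
      · exact ((((hgθ t).pow 2).const_mul _).add_const _).intervalIntegrable _ _
      · intro θ _
        nlinarith [sq_nonneg (g t θ - z t)]
    have hg2 : Continuous (fun θ => 1 / 2 * g t θ ^ 2) := ((hgθ t).pow 2).const_mul _
    rw [intervalIntegral.integral_add (hg2.intervalIntegrable _ _)
      (continuous_const.intervalIntegrable _ _), intervalIntegral.integral_const_mul,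
      intervalIntegral.integral_const] at h2
    have h3 : ‖deriv ZZ (σ + t * I)‖ * z t ≤
      (2 * π * r)⁻¹ * ((∫ θ in (0 : ℝ)..(2 * π), g t θ) * z t) := by
      rw [← mul_assoc]
      gcongr
    refine h3.trans ?_
    calc _ ≤ (2 * π * r)⁻¹ * (1 / 2 * (∫ θ in (0 : ℝ)..(2 * π), g t θ ^ 2) +
          (2 * π - 0) • (1 / 2 * z t ^ 2)) := by gcongr
      _ = _ := by
          have := Real.pi_pos
          simp only [smul_eq_mul]; field_simp; ring
  have hdc : Continuous (fun t : ℝ => deriv ZZ (σ + t * I)) := by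
    have := continuous_deriv_zeta_line hσn 1
    simpa only [iteratedDeriv_one] using this
  have hic : Continuous (fun t => ∫ θ in (0 : ℝ)..(2 * π), g t θ ^ 2) :=
    continuous_parametric_intervalIntegral_of_continuous' hgc2 _ _
  have hswap : ∫ t in (-T)..T, ∫ θ in (0 : ℝ)..(2 * π), g t θ ^ 2 =
      ∫ θ in (0 : ℝ)..(2 * π), ∫ t in (-T)..T, g t θ ^ 2 := interval_swap hgc2 _ _ _ _
  have hθ : ∀ θ, ∫ t in (-T)..T, g t θ ^ 2 ≤ C * T * (1 + RL T) := by
    intro θ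
    have := h T (σ + r * Real.cos θ) (r * Real.sin θ) hT (hcos θ).1 (hcos θ).2 (hsin θ)
    simp only [hg, hmap]
    exact this
  have hz2 : ∫ t in (-T)..T, z t ^ 2 ≤ C * T * (1 + RL T) := by
    have := h T σ 0 hT LA LA (by simp)
    simpa only [add_zero] using this
  have hic2 : Continuous (fun θ => ∫ t in (-T)..T, g t θ ^ 2) :=
    continuous_parametric_intervalIntegral_of_continuous'
      (f := fun θ t => g t θ ^ 2) (hgc2.comp continuous_swap) _ _
  have hin : ∫ θ in (0 : ℝ)..(2 * π), ∫ t in (-T)..T, g t θ ^ 2 ≤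
      2 * π * (C * T * (1 + RL T)) := by
    calc _ ≤ ∫ θ in (0 : ℝ)..(2 * π), C * T * (1 + RL T) := by
          apply integral_mono_on PA (hic2.intervalIntegrable _ _)
            (continuous_const.intervalIntegrable _ _) fun θ _ => hθ θ
      _ = _ := by rw [intervalIntegral.integral_const]; simp
  have hfin : ∫ t in (-T)..T, ‖deriv ZZ (σ + t * I)‖ * z t ≤
      ∫ t in (-T)..T, ((4 * π * r)⁻¹ * (∫ θ in (0 : ℝ)..(2 * π), g t θ ^ 2) +
        (2 * r)⁻¹ * z t ^ 2) := by
    apply integral_mono_on LA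
    · exact (hdc.norm.mul hzc).intervalIntegrable _ _
    · exact ((hic.const_mul _).add ((hzc.pow 2).const_mul _)).intervalIntegrable _ _
    · exact fun t _ => hpt t
  refine hfin.trans ?_
  have hzc2 : Continuous (fun t => (2 * r)⁻¹ * z t ^ 2) := (hzc.pow 2).const_mul _
  rw [intervalIntegral.integral_add ((hic.const_mul _).intervalIntegrable _ _)
    (hzc2.intervalIntegrable _ _), intervalIntegral.integral_const_mul,
    intervalIntegral.integral_const_mul, hswap]
  calc _ ≤ (4 * π * r)⁻¹ * (2 * π * (C * T * (1 + RL T))) +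
        (2 * r)⁻¹ * (C * T * (1 + RL T)) := by gcongr
    _ = 2 * C * L * T * (1 + RL T) := by
        have := Real.pi_pos
        rw [hr]; field_simp; ring

/-- Poisson kernel sum over a multiset of zeros. -/
noncomputable def pkern (Z : Multiset ℂ) (L t : ℝ) : ℝ :=
  (Z.map (fun ρ => L / (1 + (L * (t - ρ.im)) ^ 2))).sum

lemma pkern_cons (ρ : ℂ) (Z : Multiset ℂ) (L t : ℝ) :
    pkern (ρ ::ₘ Z) L t = L / (1 + (L * (t - ρ.im)) ^ 2) + pkern Z L t := by simp [pkern]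

lemma zsm_cons (ρ : ℂ) (Z : Multiset ℂ) (k : ℕ) (s : ℂ) :
    zsm (ρ ::ₘ Z) k s = ((s - ρ) ^ k)⁻¹ + zsm Z k s := by simp [zsm]

lemma pkern_continuous (Z : Multiset ℂ) (L : ℝ) : Continuous (pkern Z L) := by
  induction Z using Multiset.induction with
  | empty => unfold pkern; simp; fun_prop
  | cons ρ Z ih =>
    have : pkern (ρ ::ₘ Z) L = fun t => L / (1 + (L * (t - ρ.im)) ^ 2) + pkern Z L t :=
      funext fun t => pkern_cons ρ Z L t
    rw [this]
    refine Continuous.add (Continuous.div FA FA fun t => ?_) ih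
    positivity

lemma pkern_integral (Z : Multiset ℂ) {L a b : ℝ} (hab : a ≤ b) :
    ∫ t in a..b, pkern Z L t ≤ π * Z.card := by
  induction Z using Multiset.induction with
  | empty => simp [pkern]
  | cons ρ Z ih =>
    simp only [pkern_cons]
    have hc : Continuous (fun t : ℝ => L / (1 + (L * (t - ρ.im)) ^ 2)) :=
      Continuous.div FA FA fun t => by positivity
    rw [intervalIntegral.integral_add (hc.intervalIntegrable _ _)
      ((pkern_continuous Z L).intervalIntegrable _ _)]
    have h1 : ∫ t in a..b, L / (1 + (L * (t - ρ.im)) ^ 2) =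
        Real.arctan (L * (b - ρ.im)) - Real.arctan (L * (a - ρ.im)) := by
      apply integral_eq_sub_of_hasDerivAt (f := fun t => Real.arctan (L * (t - ρ.im)))
      · intro t _
        have h := ((((hasDerivAt_id t).sub_const ρ.im).const_mul L).arctan)
        refine h.congr_deriv ?_
        simp; ring
      · exact hc.intervalIntegrable _ _
    rw [h1, Multiset.card_cons]
    push_cast
    have := Real.arctan_lt_pi_div_two (L * (b - ρ.im))
    have := Real.neg_pi_div_two_lt_arctan (L * (a - ρ.im))
    linarith

lemma zsm_re (Z : Multiset ℂ) {L t : ℝ} (hL : 0 < L) (hZ : ∀ ρ ∈ Z, ρ.re = 1 / 2) :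
    (zsm Z 1 ((1 / 2 + 1 / L : ℝ) + t * I)).re = pkern Z L t := by
  induction Z using Multiset.induction with
  | empty => simp [pkern, zsm]
  | cons ρ Z ih =>
    rw [zsm_cons, pkern_cons, add_re, ih fun ρ h => hZ ρ (Multiset.mem_cons_of_mem h)]
    congr 1
    have h := hZ ρ (Multiset.mem_cons_self _ _)
    rw [pow_one, Complex.inv_re, normSq_apply]
    simp [h]
    field_simp

lemma zsm_norm_le (Z : Multiset ℂ) {L t : ℝ} (hL : 0 < L) (hZ : ∀ ρ ∈ Z, ρ.re = 1 / 2) {n : ℕ} (hn : 1 ≤ n) :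
    ‖zsm Z (n + 1) ((1 / 2 + 1 / L : ℝ) + t * I)‖ ≤ L ^ n * pkern Z L t := by
  induction Z using Multiset.induction with
  | empty => simp [pkern, zsm]
  | cons ρ Z ih =>
    rw [zsm_cons, pkern_cons, mul_add]
    refine (norm_add_le _ _).trans (add_le_add ?_ (ih fun ρ h => hZ ρ (Multiset.mem_cons_of_mem h)))
    have h := hZ ρ (Multiset.mem_cons_self _ _)
    set w : ℂ := ((1 / 2 + 1 / L : ℝ) + t * I : ℂ) - ρ with hw
    have hre : w.re = 1 / L := by simp [hw, h]
    have him : w.im = t - ρ.im := by simp [hw]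
    have h1 : 1 / L ≤ ‖w‖ := by rw [← hre]; exact re_le_norm w
    have h2 : ‖w‖ ^ 2 = (1 / L) ^ 2 + (t - ρ.im) ^ 2 := by
      rw [Complex.sq_norm, normSq_apply, hre, him]; ring
    have hw0 : 0 < ‖w‖ := lt_of_lt_of_le PA h1
    rw [norm_inv, norm_pow]
    obtain ⟨m, rfl⟩ : ∃ m, n = m + 1 := ⟨n - 1, by omega⟩
    have h3 : (‖w‖ ^ m)⁻¹ ≤ L ^ m := by
      rw [inv_le_comm₀ PA PA, ← inv_pow]
      gcongr
      simpa using h1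
    have h4 : (‖w‖ ^ 2)⁻¹ = L * (L / (1 + (L * (t - ρ.im)) ^ 2)) := by
      rw [h2]; field_simp
    calc (‖w‖ ^ (m + 1 + 1))⁻¹ = (‖w‖ ^ m)⁻¹ * (‖w‖ ^ 2)⁻¹ := by
          rw [← mul_inv, ← pow_add]
      _ ≤ L ^ m * (L * (L / (1 + (L * (t - ρ.im)) ^ 2))) := by rw [h4]; gcongr
      _ = _ := by ring

lemma zeta_ne_zero_line (hRH : RiemannHypothesis) {s : ℂ} (hs : 1 / 2 < s.re) : ZZ s ≠ 0 := by
  intro h0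
  by_cases h1 : 1 ≤ s.re
  · exact riemannZeta_ne_zero_of_one_le_re h1 h0
  · have hs1 : s ≠ 1 := by rintro rfl; simp at h1
    have := hRH s h0 (by
      rintro ⟨k, rfl⟩
      have h2 : ((-2 * ((k : ℂ) + 1)).re) = -2 * ((k : ℝ) + 1) := by simp
      rw [h2] at hs
      have : (0 : ℝ) ≤ k := k.cast_nonneg
      linarith) hs1
    linarith

lemma zeta_analyticAt {s : ℂ} (hs : s ≠ 1) : AnalyticAt ℂ ZZ s := by
  have hd : DifferentiableOn ℂ ZZ {1}ᶜ := fun z hz =>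
    (differentiableAt_riemannZeta hz).differentiableWithinAt
  exact hd.analyticAt (isOpen_compl_singleton.mem_nhds hs)

lemma logDeriv_zeta_analyticAt {s : ℂ} (hs : s ≠ 1) (h0 : ZZ s ≠ 0) :
    AnalyticAt ℂ LZ s := by
  unfold logDeriv
  exact (zeta_analyticAt hs).deriv.div (zeta_analyticAt hs) h0

lemma iteratedDeriv_analyticAt {f : ℂ → ℂ} {s : ℂ} (n : ℕ) (h : AnalyticAt ℂ f s) :
    AnalyticAt ℂ (iteratedDeriv n f) s := by
  rw [iteratedDeriv_eq_iterate]; exact h.iterated_deriv n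

/-- The function `(Dζ/ζ)^{(n)} ζ`. -/
noncomputable def zF (n : ℕ) (s : ℂ) : ℂ := iteratedDeriv n LZ s * ZZ s

lemma zF_analyticAt {n : ℕ} {s : ℂ} (hs : s ≠ 1) (h0 : ZZ s ≠ 0) : AnalyticAt ℂ (zF n) s :=
  (iteratedDeriv_analyticAt n (logDeriv_zeta_analyticAt hs h0)).mul (zeta_analyticAt hs)

lemma zF_line_continuous (hRH : RiemannHypothesis) {n : ℕ} {σ : ℝ} (h : 1 / 2 < σ) (h1 : σ ≠ 1) :
    Continuous (fun t : ℝ => zF n (σ + t * I)) := by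
  rw [continuous_iff_continuousAt]
  intro t
  have h1 := (zF_analyticAt (n := n) (zeta_line_ne_one h1 t) (zeta_ne_zero_line hRH (by simpa using h))).continuousAt
  exact ContinuousAt.comp (f := fun t : ℝ => (σ + t * I : ℂ)) h1 FA

/-- Summation over half-unit blocks. -/
lemma block_sum {f g : ℝ → ℝ} (hf : Continuous f) (hg : Continuous g) (hf0 : ∀ t, 0 ≤ f t)
    (hg0 : ∀ t, 0 ≤ g t) {T : ℝ} (hT : 1 ≤ T)
    (h : ∀ a, -T ≤ a → a ≤ T → ∫ t in a..(a + 1 / 2), f t ≤ ∫ t in a..(a + 1 / 2), g t) :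
    ∫ t in (-T)..T, f t ≤ ∫ t in (-(2 * T))..(2 * T), g t := by
  have key : ∀ N : ℕ, (N : ℝ) ≤ 4 * T + 1 → ∫ t in (-T)..(-T + N / 2), f t ≤ ∫ t in (-T)..(-T + N / 2), g t := by
    intro N
    induction N with
    | zero => intro _; simp
    | succ N ih =>
      intro hN
      push_cast at hN ⊢
      have e : -T + ((N : ℝ) + 1) / 2 = (-T + N / 2) + 1 / 2 := by ring
      rw [e, ← integral_add_adjacent_intervals (hf.intervalIntegrable (-T) (-T + N / 2))
        (hf.intervalIntegrable _ _), ← integral_add_adjacent_intervals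
        (hg.intervalIntegrable (-T) (-T + N / 2)) (hg.intervalIntegrable _ _)]
      exact add_le_add (ih LA) (h _ (by linarith [(N.cast_nonneg : (0 : ℝ) ≤ N)]) LA)
  set N := ⌈4 * T⌉₊ with hN
  have h1 : 4 * T ≤ N := Nat.le_ceil _
  have h2 : (N : ℝ) < 4 * T + 1 := Nat.ceil_lt_add_one LA
  calc ∫ t in (-T)..T, f t ≤ ∫ t in (-T)..(-T + N / 2), f t := by
        apply integral_mono_interval le_rfl LA LA
          (ae_of_all _ hf0) (hf.intervalIntegrable _ _)
    _ ≤ ∫ t in (-T)..(-T + N / 2), g t := key N h2.le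
    _ ≤ _ := by
        apply integral_mono_interval LA LA LA
          (ae_of_all _ hg0) (hg.intervalIntegrable _ _)

set_option maxHeartbeats 1000000 in
lemma zF_block (hRH : RiemannHypothesis) (n : ℕ) (hn : 1 ≤ n) : ∃ C > (0 : ℝ), ∀ a L l : ℝ, 8 ≤ L → L ≤ l →
    RL (|a| + 4) ≤ l →
    ∫ t in a..(a + 1 / 2), ‖zF n ((1 / 2 + 1 / L : ℝ) + t * I)‖ ≤
    ∫ t in a..(a + 1 / 2), (C * l ^ n / √l * (‖deriv ZZ ((1 / 2 + 1 / L : ℝ) + t * I)‖ *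
      ‖ZZ ((1 / 2 + 1 / L : ℝ) + t * I)‖) + C * l ^ n * √l * ‖ZZ ((1 / 2 + 1 / L : ℝ) + t * I)‖ ^ 2
        + C * l ^ n * √l * l) := by
  obtain ⟨K, hK, hld⟩ := zeta_ld hRH n
  refine ⟨n.factorial * (1 + K * 8) + K, by positivity, fun a L l hL hLl hl => ?_⟩
  obtain ⟨Z, hZ1, hZ2, hZ3⟩ := hld (a + 1 / 4)
  have hL0 : 0 < L := LA
  have hl0 : 0 < l := LA
  have hL8 : 1 / L ≤ 1 / 8 := by gcongr
  have hLp : 0 < 1 / L := PA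
  set σ : ℝ := 1 / 2 + 1 / L with hσ
  have hσn : σ ≠ 1 := LA
  have hlog : RL (|a + 1 / 4| + 3) ≤ l := by
    refine le_trans (Real.log_le_log PA ?_) hl
    have := abs_add_le a (1 / 4)
    rw [abs_of_pos (by norm_num : (0 : ℝ) < 1 / 4)] at this
    linarith
  have hKl : K * RL (|a + 1 / 4| + 3) ≤ K * l := by gcongr
  set q := √l with hq
  have hq2 : q * q = l := Real.mul_self_sqrt hl0.le
  have hq1 : 1 ≤ q := by rw [hq]; exact Real.one_le_sqrt.mpr LA
  have hq0 : 0 < q := LA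
  have hql : q ≤ l := by nlinarith
  set z : ℝ → ℝ := fun t => ‖ZZ (σ + t * I)‖ with hz
  set z' : ℝ → ℝ := fun t => ‖deriv ZZ (σ + t * I)‖ with hz'
  have hzc : Continuous z := (zeta_line_continuous hσn).norm
  have hzc' : Continuous z' := by
    have := continuous_deriv_zeta_line hσn 1
    simp only [iteratedDeriv_one] at this
    exact this.norm
  set nf : ℝ := (n ! : ℝ) with hnf
  have hnf0 : 0 < nf := PA
  have hpt : ∀ t ∈ Set.Icc a (a + 1 / 2), ‖zF n (σ + t * I)‖ ≤
      nf * l ^ n * (1 / q * (z' t * z t + K * l * z t ^ 2) + q * pkern Z L t) + K * l * (1 + z t ^ 2) := by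
    intro t ht
    set s : ℂ := σ + t * I with hs
    have hre : s.re = σ := by simp [hs]
    have him : s.im = t := by simp [hs]
    have hb : s ∈ CB (2 + ((a + 1 / 4 : ℝ) : ℂ) * I) (31 / 20) := by
      rw [mem_closedBall_iff_norm, ← sq_le_sq₀ PA NA, Complex.sq_norm,
        normSq_apply]
      simp [hre, him]
      nlinarith [ht.1, ht.2]
    have hsZ : s ∉ Z := by
      intro h; have := (hZ1 s h).1; rw [hre] at this; linarith
    have hs1 : 1 / 4 ≤ ‖s - 1‖ := by
      have := abs_re_le_norm (s - 1)
      rw [sub_re, hre, one_re, abs_of_neg LA] at this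
      linarith
    obtain ⟨hz0, h1, h2⟩ := hZ3 s hb hsZ hs1
    have hZre : ∀ ρ ∈ Z, ρ.re = 1 / 2 := fun ρ h => (hZ1 ρ h).1
    have h3 := zsm_re Z (t := t) hL0 hZre
    have h4 := zsm_norm_le Z (t := t) hL0 hZre hn
    rw [← hσ, ← hs] at h3 h4
    set P := pkern Z L t with hP
    have hP0 : 0 ≤ P := by
      rw [hP, pkern]
      apply Multiset.sum_nonneg
      intro x hx
      rw [Multiset.mem_map] at hx
      obtain ⟨ρ, _, rfl⟩ := hx
      positivity
    have hzt : 0 < z t := norm_pos_iff.mpr hz0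
    have h5 : P ≤ z' t / z t + K * l := by
      have e : ‖logDeriv ZZ s‖ = z' t / z t := by simp [logDeriv, hz, hz', norm_div, hs]
      have := (re_le_norm (zsm Z 1 s))
      have h6 : ‖zsm Z 1 s‖ ≤ ‖logDeriv ZZ s‖ + ‖logDeriv ZZ s - zsm Z 1 s‖ := by
        have := norm_sub_le (logDeriv ZZ s) (logDeriv ZZ s - zsm Z 1 s)
        simpa using this
      linarith
    have h6 : P * z t ^ 2 ≤ z' t * z t + K * l * z t ^ 2 := by
      calc P * z t ^ 2 ≤ (z' t / z t + K * l) * z t ^ 2 := by gcongr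
        _ = _ := by field_simp
    have h7 : P * z t ≤ 1 / q * (P * z t ^ 2) + q * P := by
      have : P * z t * q ≤ P * z t ^ 2 + q * q * P := by nlinarith [mul_nonneg hP0 (sq_nonneg (z t - q)), mul_nonneg hP0 (sq_nonneg (z t + q))]
      calc P * z t = (P * z t * q) / q := by field_simp
        _ ≤ (P * z t ^ 2 + q * q * P) / q := by gcongr
        _ = _ := by field_simp
    have h8 : ‖iteratedDeriv n LZ s‖ ≤ nf * (l ^ n * P) + K * l := by
      have e1 : ‖(-1 : ℂ) ^ n * n ! * zsm Z (n + 1) s‖ = nf * ‖zsm Z (n + 1) s‖ := by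
        simp [hnf]
      have e2 := norm_sub_le ((-1 : ℂ) ^ n * n ! * zsm Z (n + 1) s)
        ((-1 : ℂ) ^ n * n ! * zsm Z (n + 1) s - iteratedDeriv n LZ s)
      rw [sub_sub_cancel, e1, norm_sub_rev ((-1 : ℂ) ^ n * n ! * zsm Z (n + 1) s)] at e2
      have e3 : nf * ‖zsm Z (n + 1) s‖ ≤ nf * (l ^ n * P) := by
        gcongr
        refine h4.trans ?_
        gcongr
      linarith
    have h9 : ‖zF n s‖ ≤ (nf * (l ^ n * P) + K * l) * z t := by
      rw [zF, norm_mul]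
      gcongr
    have h10 : z t ≤ 1 + z t ^ 2 := by nlinarith [sq_nonneg (z t - 1 / 2)]
    calc ‖zF n s‖ ≤ nf * l ^ n * (P * z t) + K * l * z t := LA
      _ ≤ nf * l ^ n * (1 / q * (P * z t ^ 2) + q * P) + K * l * (1 + z t ^ 2) := by gcongr
      _ ≤ _ := by gcongr
  have hPc := pkern_continuous Z L
  have hF : Continuous (fun t : ℝ => zF n (σ + t * I)) := zF_line_continuous hRH LA hσn
  have hci : Continuous (fun t => nf * l ^ n * (1 / q * (z' t * z t + K * l * z t ^ 2)) + K * l * (1 + z t ^ 2)) := by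
    fun_prop
  have hcP : Continuous (fun t => nf * l ^ n * q * pkern Z L t) := FA
  have hstep : ∫ t in a..(a + 1 / 2), ‖zF n (σ + t * I)‖ ≤ (∫ t in a..(a + 1 / 2),
      (nf * l ^ n * (1 / q * (z' t * z t + K * l * z t ^ 2)) + K * l * (1 + z t ^ 2))) +
      nf * l ^ n * q * ∫ t in a..(a + 1 / 2), pkern Z L t := by
    rw [← intervalIntegral.integral_const_mul, ← intervalIntegral.integral_add
      (hci.intervalIntegrable _ _) (hcP.intervalIntegrable _ _)]
    apply integral_mono_on LA (hF.norm.intervalIntegrable _ _)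
      ((hci.add hcP).intervalIntegrable _ _)
    intro t ht
    refine (hpt t ht).trans (le_of_eq ?_)
    simp only [Pi.add_apply]
    ring
  have hPi : ∫ t in a..(a + 1 / 2), pkern Z L t ≤ 4 * (K * l) := by
    refine (pkern_integral Z LA).trans ?_
    have := Real.pi_le_four
    have : (Z.card : ℝ) ≤ K * l := hZ2.trans hKl
    gcongr
  have hPi2 : nf * l ^ n * q * ∫ t in a..(a + 1 / 2), pkern Z L t ≤
      ∫ t in a..(a + 1 / 2), 8 * nf * K * l ^ n * q * l := by
    rw [intervalIntegral.integral_const]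
    simp only [add_sub_cancel_left, smul_eq_mul]
    calc _ ≤ nf * l ^ n * q * (4 * (K * l)) := by gcongr
      _ = _ := by ring
  refine hstep.trans ((add_le_add le_rfl hPi2).trans ?_)
  rw [← intervalIntegral.integral_add (hci.intervalIntegrable _ _) (continuous_const.intervalIntegrable _ _)]
  apply integral_mono_on LA
    ((hci.add continuous_const).intervalIntegrable _ _)
  · apply Continuous.intervalIntegrable
    exact ((hzc'.mul hzc).const_mul _).add ((hzc.pow 2).const_mul _) |>.add continuous_const
  intro t ht
  have hln : l ≤ l ^ n := by
    calc l = l ^ 1 := (pow_one l).symm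
      _ ≤ l ^ n := pow_le_pow_right₀ LA hn
  have hzz : 0 ≤ z' t * z t := PA
  have hl1 : l ≤ l ^ n * q := by nlinarith
  have hl2 : l ≤ l ^ n * q * l := by nlinarith
  have e1 : nf * l ^ n * (1 / q * (z' t * z t + K * l * z t ^ 2)) =
      nf * l ^ n / q * (z' t * z t) + nf * K * l ^ n * q * z t ^ 2 := by
    rw [← hq2]; field_simp
  simp only [Pi.add_apply]
  rw [e1]
  have e2 : nf * l ^ n / q * (z' t * z t) ≤ (nf * (1 + K * 8) + K) * l ^ n / q * (z' t * z t) := by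
    gcongr
    nlinarith [mul_pos hnf0 hK]
  have e3 : nf * K * l ^ n * q * z t ^ 2 + K * l * z t ^ 2 ≤ (nf * (1 + K * 8) + K) * l ^ n * q * z t ^ 2 := by
    have h1 : K * l * z t ^ 2 ≤ K * (l ^ n * q) * z t ^ 2 := by gcongr
    have h2 : 0 ≤ nf * (1 + K * 7) * (l ^ n * q) * z t ^ 2 := PA
    nlinarith
  have e4 : K * l + 8 * nf * K * l ^ n * q * l ≤ (nf * (1 + K * 8) + K) * l ^ n * q * l := by
    have h1 : K * l ≤ K * (l ^ n * q * l) := by gcongr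
    have h2 : 0 ≤ nf * (l ^ n * q * l) := PA
    nlinarith
  show _ ≤ (nf * (1 + K * 8) + K) * l ^ n / q * (z' t * z t) + (nf * (1 + K * 8) + K) * l ^ n * q * z t ^ 2 + _
  linarith

lemma zF_mean (hRH : RiemannHypothesis) (n : ℕ) (hn : 1 ≤ n) : ∃ C > (0 : ℝ), ∀ T L l : ℝ, 1 ≤ T → 8 ≤ L → L ≤ l →
    RL (T + 4) ≤ l →
    ∫ t in (-T)..T, ‖zF n ((1 / 2 + 1 / L : ℝ) + t * I)‖ ≤ C * T * l ^ (n + 1) * √l := by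
  obtain ⟨C1, hC1, h1⟩ := zF_block hRH n hn
  obtain ⟨C2, hC2, h2⟩ := zeta_deriv_mul_mean
  obtain ⟨C3, hC3, h3⟩ := zeta_mean_sq_int
  refine ⟨C1 * C2 * 4 + C1 * C3 * 4 + C1 * 4, by positivity, fun T L l hT hL hLl hl => ?_⟩
  have hL0 : 0 < L := LA
  have hl0 : 0 < l := LA
  have hL8 : 1 / L ≤ 1 / 8 := by gcongr
  have hLp : 0 < 1 / L := PA
  have k2 := h2 (2 * T) L LA hL
  have k3 := h3 (2 * T) (1 / 2 + 1 / L) LA LA LA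
  set σ : ℝ := 1 / 2 + 1 / L with hσ
  have hσn : σ ≠ 1 := LA
  set q := √l with hq
  have hq2 : q * q = l := Real.mul_self_sqrt hl0.le
  have hq1 : 1 ≤ q := by rw [hq]; exact Real.one_le_sqrt.mpr LA
  have hq0 : 0 < q := LA
  set z : ℝ → ℝ := fun t => ‖ZZ (σ + t * I)‖ with hz
  set z' : ℝ → ℝ := fun t => ‖deriv ZZ (σ + t * I)‖ with hz'
  have hzc : Continuous z := (zeta_line_continuous hσn).norm
  have hzc' : Continuous z' := by
    have := continuous_deriv_zeta_line hσn 1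
    simp only [iteratedDeriv_one] at this
    exact this.norm
  have c1 : Continuous (fun t => C1 * l ^ n / q * (z' t * z t)) := (hzc'.mul hzc).const_mul _
  have c2 : Continuous (fun t => C1 * l ^ n * q * z t ^ 2) := (hzc.pow 2).const_mul _
  have c3 : Continuous (fun _ : ℝ => C1 * l ^ n * q * l) := continuous_const
  have c12 : Continuous (fun t => C1 * l ^ n / q * (z' t * z t) + C1 * l ^ n * q * z t ^ 2) := c1.add c2
  have hb := block_sum (f := fun t => ‖zF n (σ + t * I)‖)
    (g := fun t => C1 * l ^ n / q * (z' t * z t) + C1 * l ^ n * q * z t ^ 2 + C1 * l ^ n * q * l)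
    (zF_line_continuous hRH LA hσn).norm ((c1.add c2).add c3)
    (fun t => norm_nonneg _) (fun t => by positivity) hT (fun a ha1 ha2 =>
      h1 a L l hL hLl (le_trans (Real.log_le_log PA (by
        have : |a| ≤ T := abs_le.mpr ⟨ha1, ha2⟩
        linarith)) hl))
  refine hb.trans ?_
  rw [intervalIntegral.integral_add (c12.intervalIntegrable _ _) (c3.intervalIntegrable _ _),
    intervalIntegral.integral_add (c1.intervalIntegrable _ _) (c2.intervalIntegrable _ _),
    intervalIntegral.integral_const_mul, intervalIntegral.integral_const_mul,
    intervalIntegral.integral_const]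
  have hlg : 1 + RL (2 * T) ≤ 2 * l := by
    have : RL (2 * T) ≤ RL (2 * (T + 4)) := Real.log_le_log LA LA
    have e := Real.log_mul (by norm_num : (2 : ℝ) ≠ 0) (by linarith : T + 4 ≠ 0)
    linarith [Real.log_two_lt_d9]
  have hlg0 : 0 ≤ 1 + RL (2 * T) := by
    have := Real.log_nonneg (by linarith : 1 ≤ 2 * T); linarith
  have e1 : C1 * l ^ n / q * ∫ t in (-(2 * T))..(2 * T), z' t * z t ≤ C1 * C2 * 4 * T * l ^ (n + 1) * q := by
    calc _ ≤ C1 * l ^ n / q * (C2 * l * (2 * T) * (2 * l)) := by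
          gcongr
          exact k2.trans (by gcongr)
      _ = C1 * C2 * 4 * T * l ^ (n + 1) * (q * q) / q := by rw [hq2]; ring
      _ = _ := by field_simp
  have e2 : C1 * l ^ n * q * ∫ t in (-(2 * T))..(2 * T), z t ^ 2 ≤ C1 * C3 * 4 * T * l ^ (n + 1) * q := by
    calc _ ≤ C1 * l ^ n * q * (C3 * (2 * T) * (2 * l)) := by
          gcongr
          exact k3.trans (by gcongr)
      _ = _ := by ring
  simp only [smul_eq_mul]
  have e3 : (2 * T - -(2 * T)) * (C1 * l ^ n * q * l) = C1 * 4 * T * l ^ (n + 1) * q := by ring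
  rw [e3]
  linarith

lemma zF_weight (hRH : RiemannHypothesis) (n : ℕ) (hn : 1 ≤ n) : ∃ C > (0 : ℝ), ∀ L h : ℝ, 8 ≤ L → 0 < h →
    1 / h ≤ RE (L / 2) →
    ∫⁻ t : ℝ, EO (‖zF n ((1 / 2 + 1 / L : ℝ) + t * I)‖ * min (1 / (1 + |t|)) (1 / (h * (1 + |t|) ^ 2)))
      ≤ EO (C * L ^ (n + 2) * √L) := by
  obtain ⟨C, hC, hm⟩ := zF_mean hRH n hn
  have hS : Summable (fun i : ℕ => ((i : ℝ) + 1) ^ (n + 2) * (1 / 2) ^ i) := by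
    have h0 := summable_pow_mul_geometric_of_norm_lt_one (R := ℝ) (n + 2) (r := 1 / 2) NA
    have h1 := (summable_nat_add_iff 1).mpr h0
    refine (h1.mul_left 2).congr fun i => ?_
    push_cast
    rw [pow_succ (1 / 2 : ℝ) i]; ring
  set S := ∑' i : ℕ, ((i : ℝ) + 1) ^ (n + 2) * (1 / 2) ^ i with hSd
  have hS0 : 0 ≤ S := tsum_nonneg fun i => by positivity
  refine ⟨2 * C * 3 ^ (n + 2) * (2 + S), by positivity, fun L h hL hh hhL => ?_⟩
  have hL0 : 0 < L := LA
  have hL8 : 1 / L ≤ 1 / 8 := by gcongr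
  have hLp : 0 < 1 / L := PA
  have hσn : (1 / 2 + 1 / L : ℝ) ≠ 1 := LA
  set J := ⌈L⌉₊ with hJ
  have hJ1 : L ≤ J := Nat.le_ceil _
  have hJ2 : (J : ℝ) < L + 1 := Nat.ceil_lt_add_one hL0.le
  set f : ℝ → ℝ := fun t => ‖zF n ((1 / 2 + 1 / L : ℝ) + t * I)‖ with hf
  have hfc : Continuous f := (zF_line_continuous hRH LA hσn).norm
  have hf0 : ∀ t, 0 ≤ f t := fun t => norm_nonneg _
  set w : ℕ → ℝ := fun j => (1 / 2) ^ j * (1 / 2) ^ (j - J) with hw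
  have hhJ : 1 / h ≤ 2 ^ J := by
    refine hhL.trans ?_
    have : (2 : ℝ) ^ J = RE (J * RL 2) := by
      rw [Real.exp_nat_mul, Real.exp_log NA]
    rw [this, Real.exp_le_exp]
    nlinarith [Real.log_two_gt_d9]
  have hpt : ∀ t : ℝ, EO (f t * min (1 / (1 + |t|)) (1 / (h * (1 + |t|) ^ 2))) ≤
      ∑' j : ℕ, (Set.Icc (-(2 : ℝ) ^ (j + 1)) (2 ^ (j + 1))).indicator
        (fun t => EO (w j * f t)) t := by
    intro t
    obtain ⟨j, hj1, hj2⟩ := exists_nat_pow_near (x := 1 + |t|) (y := (2 : ℝ)) (by linarith [abs_nonneg t]) NA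
    refine le_trans ?_ (ENNReal.le_tsum j)
    rw [Set.indicator_of_mem (by
      rw [Set.mem_Icc, ← abs_le]; linarith)]
    apply ENNReal.ofReal_le_ofReal
    rw [mul_comm]
    gcongr
    have h2 : (1 / 2 : ℝ) ^ j = 1 / 2 ^ j := by rw [div_pow, one_pow]
    rcases le_total j J with hjJ | hjJ
    · refine (min_le_left _ _).trans ?_
      simp only [hw]
      rw [Nat.sub_eq_zero_of_le hjJ, pow_zero, mul_one, h2]
      gcongr
    · refine (min_le_right _ _).trans ?_
      simp only [hw]
      have e : (1 / 2 : ℝ) ^ (j - J) = 2 ^ J / 2 ^ j := by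
        rw [div_pow, one_pow, div_eq_div_iff PA PA, one_mul, ← pow_add]
        congr 1; omega
      rw [e, h2]
      calc 1 / (h * (1 + |t|) ^ 2) = 1 / h * (1 / (1 + |t|) ^ 2) := by field_simp
        _ ≤ 2 ^ J * (1 / (2 ^ j) ^ 2) := by gcongr
        _ = _ := by field_simp
  have hmeas : ∀ j : ℕ, Measurable ((Set.Icc (-(2 : ℝ) ^ (j + 1)) (2 ^ (j + 1))).indicator
        (fun t => EO (w j * f t))) := fun j =>
    (ENNReal.measurable_ofReal.comp (hfc.measurable.const_mul _)).indicator measurableSet_Icc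
  refine (lintegral_mono hpt).trans ?_
  rw [lintegral_tsum fun j => (hmeas j).aemeasurable]
  set B : ℝ := 2 * C * (3 * L) ^ (n + 1) * √(3 * L) with hB
  have hterm : ∀ j : ℕ, ∫⁻ t, (Set.Icc (-(2 : ℝ) ^ (j + 1)) (2 ^ (j + 1))).indicator
        (fun t => EO (w j * f t)) t ≤
      EO (B * (((j - J : ℕ) + 1 : ℝ) ^ (n + 2) * (1 / 2) ^ (j - J))) := by
    intro j
    have h2p : (1 : ℝ) ≤ 2 ^ (j + 1) := one_le_pow₀ NA
    rw [lintegral_indicator measurableSet_Icc, ← ofReal_integral_eq_lintegral_ofReal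
      ((hfc.const_mul _).continuousOn.integrableOn_Icc) (ae_of_all _ fun t => by
        have := hf0 t; simp only [hw]; positivity), integral_Icc_eq_integral_Ioc,
      ← intervalIntegral.integral_of_le LA, intervalIntegral.integral_const_mul]
    apply ENNReal.ofReal_le_ofReal
    set i : ℕ := j - J with hi
    have hji : (j : ℝ) ≤ J + i := by
      have : j ≤ J + i := by omega
      exact_mod_cast this
    have hi0 : (0 : ℝ) ≤ i := i.cast_nonneg
    set l : ℝ := 3 * L * (i + 1) with hl
    have hl1 : 3 * L ≤ l := by nlinarith
    have hlog : RL (2 ^ (j + 1) + 4) ≤ l := by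
      have h1 : (2 : ℝ) ^ (j + 1) + 4 ≤ 2 ^ (j + 3) := by
        have : (1 : ℝ) ≤ 2 ^ j := one_le_pow₀ NA
        rw [pow_succ, pow_add]; linarith
      refine (Real.log_le_log PA h1).trans ?_
      rw [Real.log_pow]
      push_cast
      have := Real.log_two_lt_d9
      have := Real.log_two_gt_d9
      have : ((j : ℝ) + 3) * RL 2 ≤ (j + 3) * 1 := by gcongr; linarith
      nlinarith
    have hmm := hm (2 ^ (j + 1)) L l h2p hL LA hlog
    have hsq : √l ≤ √(3 * L) * (i + 1) := by
      rw [hl, Real.sqrt_mul PA]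
      gcongr
      rw [Real.sqrt_le_left PA]
      nlinarith
    calc w j * ∫ t in (-(2 : ℝ) ^ (j + 1))..(2 ^ (j + 1)), f t
        ≤ w j * (C * 2 ^ (j + 1) * l ^ (n + 1) * (√(3 * L) * (i + 1))) := by
          have : 0 ≤ w j := by simp only [hw]; positivity
          gcongr
          exact hmm.trans (by gcongr)
      _ = ((1 / 2) ^ j * 2 ^ j) * (B * (((i : ℝ) + 1) ^ (n + 2) * (1 / 2) ^ i)) := by
          simp only [hw, hB, hl, ← hi]; rw [mul_pow (3 * L) ((i : ℝ) + 1)]; ring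
      _ = _ := by rw [← mul_pow]; norm_num
  refine (ENNReal.tsum_le_tsum hterm).trans ?_
  have hB0 : 0 ≤ B := PA
  have hsum : Summable (fun j : ℕ => (((j - J : ℕ) + 1 : ℝ) ^ (n + 2) * (1 / 2) ^ (j - J))) := by
    rw [← summable_nat_add_iff J]
    simpa using hS
  rw [← ENNReal.ofReal_tsum_of_nonneg (fun j => by positivity) (hsum.mul_left B), tsum_mul_left]
  apply ENNReal.ofReal_le_ofReal
  have hval : ∑' j : ℕ, (((j - J : ℕ) + 1 : ℝ) ^ (n + 2) * (1 / 2) ^ (j - J)) = J + S := by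
    rw [← hsum.sum_add_tsum_nat_add J]
    congr 1
    · rw [sum_congr rfl (g := fun _ => (1 : ℝ)) fun j hj => by
        rw [Nat.sub_eq_zero_of_le (Finset.mem_range.mp hj).le]; simp]
      simp
    · simp [hSd]
  rw [hval, hB]
  have hsq3 : √(3 * L) ≤ 3 * √L := by
    rw [Real.sqrt_mul NA]
    gcongr
    rw [Real.sqrt_le_left] <;> norm_num
  calc 2 * C * (3 * L) ^ (n + 1) * √(3 * L) * (J + S) ≤
      2 * C * (3 * L) ^ (n + 1) * (3 * √L) * (L * (2 + S)) := by
        gcongr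
        nlinarith
    _ = _ := by rw [mul_pow]; ring

lemma laurent_local {A : ℕ → ℂ} {ph : ℂ → ℂ}
    (hA : ∀ᶠ s in PN1, HasSum (fun j : ℕ => A j * (s - 1) ^ j) (ph s)) :
    ∃ a : ℂ → ℂ, AnalyticAt ℂ a 1 ∧ (∀ᶠ s in PN1, ph s = a s) ∧
      (∀ k, iteratedDeriv k a 1 = k.factorial * A k) ∧
      ∀ N, (fun w : ℂ => a (1 + w) - ∑ j ∈ range N, A j * w ^ j) =O[𝓝 0] fun w => ‖w‖ ^ N := by
  set p := FormalMultilinearSeries.ofScalars ℂ A with hp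
  have hval : ∀ (n : ℕ) (y : ℂ), (p n fun _ => y) = A n * y ^ n := by
    intro n y; simp [hp, mul_comm]
  have hrad : 0 < p.radius := by
    obtain ⟨s, hs, hs1⟩ := (hA.and self_mem_nhdsWithin).exists
    have hw : 0 < ‖s - 1‖ := norm_pos_iff.mpr (sub_ne_zero.mpr hs1)
    have h1 := (hs.summable.tendsto_atTop_zero).norm
    have h2 : (‖s - 1‖₊ : ENNReal) ≤ p.radius := by
      apply p.le_radius_of_tendsto (l := ‖(0 : ℂ)‖)
      refine h1.congr fun n => ?_
      rw [norm_mul, norm_pow, hp, FormalMultilinearSeries.ofScalars_norm]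
      rfl
    exact lt_of_lt_of_le (by simpa using hw) h2
  have hb := p.hasFPowerSeriesOnBall hrad
  have hb1 : HasFPowerSeriesOnBall (fun z => p.sum (z - 1)) p 1 p.radius := by
    have := hb.comp_sub 1
    simpa using this
  have hat : HasFPowerSeriesAt (fun z => p.sum (z - 1)) p 1 := hb1.hasFPowerSeriesAt
  refine ⟨fun z => p.sum (z - 1), hat.analyticAt, ?_, ?_, ?_⟩
  · filter_upwards [hA] with s hs
    simp only [FormalMultilinearSeries.sum, hval]
    exact hs.tsum_eq.symm
  · intro k
    have h1 := hat.analyticAt.hasFPowerSeriesAt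
    have h2 := hat.eq_formalMultilinearSeries h1
    rw [hp] at h2
    have h3 := FormalMultilinearSeries.ofScalars_series_injective ℂ ℂ h2
    have h4 := congrFun h3 k
    rw [h4]
    have : (k ! : ℂ) ≠ 0 := by exact_mod_cast k.factorial_ne_zero
    field_simp
    rfl
  · intro N
    have := hat.isBigO_sub_partialSum_pow N
    refine this.congr_left fun w => ?_
    simp only [FormalMultilinearSeries.partialSum, hval]

/-- The polar part of `(-1)^{n+1} (Dζ/ζ)^{(n)} ζ` at `s = 1`. -/
noncomputable def zPP (C A : ℕ → ℂ) (n : ℕ) (s : ℂ) : ℂ :=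
  n.factorial * ((s - 1) ^ (n + 2))⁻¹ +
    ∑ j ∈ range (n + 1), n.factorial * C j * ((s - 1) ^ (n - j + 1))⁻¹ +
    (-1) ^ (n + 1) * n ! * A n * (s - 1)⁻¹

lemma zPP_analyticAt (C A : ℕ → ℂ) (n : ℕ) {s : ℂ} (hs : s ≠ 1) : DifferentiableAt ℂ (zPP C A n) s := by
  have h : s - 1 ≠ 0 := sub_ne_zero.mpr hs
  unfold zPP
  have h1 : ∀ k : ℕ, DifferentiableAt ℂ (fun s : ℂ => ((s - 1) ^ k)⁻¹) s := fun k =>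
    ((differentiableAt_id.sub_const 1).pow k).inv (pow_ne_zero k h)
  refine (((h1 _).const_mul _).add (DifferentiableAt.fun_sum fun j _ => (h1 _).const_mul _)).add ?_
  have := (h1 1).const_mul ((-1) ^ (n + 1) * n ! * A n)
  simpa using this

lemma zF_local {C A : ℕ → ℂ} (n : ℕ)
    (hC : HC(C))
    (hA : HA(A)) :
    ∃ B : ℝ, ∀ᶠ s in PN1, ‖(-1) ^ (n + 1) * zF n s - zPP C A n s‖ ≤ B := by
  obtain ⟨c, hc1, hc2, -, hc4⟩ := laurent_local hC
  obtain ⟨a, ha1, ha2, ha3, -⟩ := laurent_local hA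
  -- the derivative
  have hGn : ∀ᶠ s in PN1, iteratedDeriv n LZ s =
      iteratedDeriv n a s - (-1) ^ n * n ! * ((s - 1) ^ (n + 1))⁻¹ := by
    have e1 : ∀ᶠ s in PN1, logDeriv ZZ =ᶠ[𝓝 s] fun s => a s - (s - 1)⁻¹ := by
      have h1 := eventually_eventually_nhdsWithin.mpr ha2
      filter_upwards [h1, self_mem_nhdsWithin] with s hs hs1
      have : nhdsWithin s {(1 : ℂ)}ᶜ = 𝓝 s := isOpen_compl_singleton.nhdsWithin_eq hs1
      rw [this] at hs
      filter_upwards [hs] with z hz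
      rw [← hz, logDeriv_apply]; ring
    have e2 : ∀ᶠ s in PN1, AnalyticAt ℂ a s :=
      ha1.eventually_analyticAt.filter_mono nhdsWithin_le_nhds
    filter_upwards [e1, e2, self_mem_nhdsWithin] with s h1 h2 h3
    rw [h1.iteratedDeriv_eq n]
    have h4 : AnalyticAt ℂ (fun s : ℂ => (s - 1)⁻¹) s :=
      (analyticAt_id.sub analyticAt_const).inv (sub_ne_zero.mpr h3)
    rw [← iteratedDeriv_inv_sub n 1 s]
    exact iteratedDeriv_sub h2.contDiffAt h4.contDiffAt
  -- bounds
  have hcb : ∃ B1 : ℝ, ∀ᶠ s in PN1, ‖c s‖ ≤ B1 := by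
    refine ⟨‖c 1‖ + 1, ?_⟩
    have := (hc1.continuousAt.norm).eventually (ge_mem_nhds (lt_add_one ‖c 1‖))
    exact this.filter_mono nhdsWithin_le_nhds
  have hab : ∃ B1 : ℝ, ∀ᶠ s in PN1, ‖iteratedDeriv n a s‖ ≤ B1 := by
    refine ⟨‖iteratedDeriv n a 1‖ + 1, ?_⟩
    have := ((iteratedDeriv_analyticAt n ha1).continuousAt.norm).eventually (ge_mem_nhds (lt_add_one _))
    exact this.filter_mono nhdsWithin_le_nhds
  have hrb : ∃ B1 : ℝ, ∀ᶠ s in PN1,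
      ‖c s - ∑ j ∈ range (n + 1), C j * (s - 1) ^ j‖ ≤ B1 * ‖s - 1‖ ^ (n + 1) := by
    obtain ⟨B1, hB⟩ := (hc4 (n + 1)).bound
    refine ⟨B1, ?_⟩
    have ht : Tendsto (fun s : ℂ => s - 1) (𝓝 1) (𝓝 0) := by
      have : Continuous (fun s : ℂ => s - 1) := FA
      simpa using this.tendsto 1
    filter_upwards [(ht.eventually hB).filter_mono nhdsWithin_le_nhds] with s hs
    simpa using hs
  have hdb : ∃ B1 : ℝ, ∀ᶠ s in PN1,
      ‖iteratedDeriv n a s - n.factorial * A n‖ ≤ B1 * ‖s - 1‖ := by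
    have h1 := ((iteratedDeriv_analyticAt n ha1).differentiableAt.isBigO_sub)
    rw [ha3] at h1
    obtain ⟨B1, hB⟩ := h1.bound
    exact ⟨B1, hB.filter_mono nhdsWithin_le_nhds⟩
  obtain ⟨B1, hB1⟩ := hcb
  obtain ⟨B2, hB2⟩ := hab
  obtain ⟨B3, hB3⟩ := hrb
  obtain ⟨B4, hB4⟩ := hdb
  refine ⟨n.factorial * B3 + (B2 * B1 + B4), ?_⟩
  filter_upwards [hGn, hB1, hB2, hB3, hB4, hc2, self_mem_nhdsWithin] with s g1 b1 b2 b3 b4 z1 hs1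
  have hw : s - 1 ≠ 0 := sub_ne_zero.mpr hs1
  have hz : ZZ s = (s - 1)⁻¹ + c s := by rw [← z1]; ring
  set w := s - 1 with hwd
  have hwn : 0 < ‖w‖ := norm_pos_iff.mpr hw
  have e : (-1) ^ (n + 1) * zF n s - zPP C A n s =
      n.factorial * ((c s - ∑ j ∈ range (n + 1), C j * w ^ j) * (w ^ (n + 1))⁻¹) +
      (-1) ^ (n + 1) * (iteratedDeriv n a s * c s + (iteratedDeriv n a s - n.factorial * A n) * w⁻¹) := by
    have hsum : ∑ j ∈ range (n + 1), (n ! : ℂ) * C j * (w ^ (n - j + 1))⁻¹ =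
        n.factorial * ((∑ j ∈ range (n + 1), C j * w ^ j) * (w ^ (n + 1))⁻¹) := by
      rw [sum_mul, mul_sum]
      refine sum_congr rfl fun j hj => ?_
      have : n + 1 = (n - j + 1) + j := by have := Finset.mem_range.mp hj; omega
      have h2 : w ^ (n + 1) = w ^ (n - j + 1) * w ^ j := by rw [← pow_add, ← this]
      rw [h2]
      field_simp
    have hsg : ((-1 : ℂ) ^ (n + 1)) * (-1) ^ n = -1 := by
      rw [← pow_add]; exact Odd.neg_one_pow ⟨n, by ring⟩
    rw [zPP, ← hwd, hsum, zF, g1, hz]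
    have e1 : (-1) ^ (n + 1) * ((iteratedDeriv n a s - (-1) ^ n * n ! * (w ^ (n + 1))⁻¹) * (w⁻¹ + c s)) =
      (-1) ^ (n + 1) * iteratedDeriv n a s * (w⁻¹ + c s) -
        ((-1) ^ (n + 1) * (-1) ^ n) * n ! * (w ^ (n + 1))⁻¹ * (w⁻¹ + c s) := by ring
    rw [e1, hsg, show (w ^ (n + 2))⁻¹ = (w ^ (n + 1))⁻¹ * w⁻¹ by rw [← mul_inv, ← pow_succ]]
    ring
  rw [e]
  refine (norm_add_le _ _).trans (add_le_add ?_ ?_)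
  · rw [norm_mul, norm_mul, norm_inv, norm_pow, Complex.norm_natCast]
    gcongr
    rw [← div_eq_mul_inv, div_le_iff₀ PA]
    exact b3
  · rw [norm_mul, norm_pow, norm_neg, norm_one, one_pow, one_mul]
    refine (norm_add_le _ _).trans (add_le_add ?_ ?_)
    · rw [norm_mul]
      exact mul_le_mul b2 b1 (norm_nonneg _) ((norm_nonneg _).trans b2)
    · rw [norm_mul, norm_inv, ← div_eq_mul_inv, div_le_iff₀ hwn]
      exact b4

lemma zsm_norm_le_card (Z : Multiset ℂ) {d : ℝ} (hd : 0 < d) {s : ℂ} (k : ℕ) (h : ∀ ρ ∈ Z, d ≤ ‖s - ρ‖) :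
    ‖zsm Z k s‖ ≤ Z.card * (d ^ k)⁻¹ := by
  induction Z using Multiset.induction with
  | empty => simp [zsm]
  | cons ρ Z ih =>
    rw [zsm_cons, Multiset.card_cons]
    push_cast
    rw [add_mul, one_mul, add_comm (_ * _)]
    refine (norm_add_le _ _).trans (add_le_add ?_ (ih fun ρ h' => h ρ (Multiset.mem_cons_of_mem h')))
    rw [norm_inv, norm_pow]
    have := h ρ (Multiset.mem_cons_self _ _)
    gcongr

/-- The bound for `(Dζ/ζ)^{(n)}` at distance `d` from the zeros. -/
lemma G_bound_dist (hRH : RiemannHypothesis) (n : ℕ) : ∃ K > (0 : ℝ), ∀ (s : ℂ) (d : ℝ), 0 < d → d ≤ 1 →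
    1 / 2 ≤ s.re → s.re ≤ 7 / 2 → 1 / 4 ≤ ‖s - 1‖ → (∀ ρ, ZZ ρ = 0 → ρ.re = 1 / 2 → d ≤ ‖s - ρ‖) →
    ZZ s ≠ 0 ∧ ‖iteratedDeriv n LZ s‖ ≤ K * RL (|s.im| + 3) * (d ^ (n + 1))⁻¹ := by
  obtain ⟨K, hK, h⟩ := zeta_ld hRH n
  refine ⟨K * (1 + n !), by positivity, fun s d hd hd1 h1 h2 h3 h4 => ?_⟩
  obtain ⟨Z, hZ1, hZ2, hZ3⟩ := h s.im
  have hb : s ∈ CB (2 + ((s.im : ℝ) : ℂ) * I) (31 / 20) := by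
    rw [mem_closedBall_iff_norm, ← sq_le_sq₀ PA NA, Complex.sq_norm,
      normSq_apply]
    simp
    nlinarith
  have hZd : ∀ ρ ∈ Z, d ≤ ‖s - ρ‖ := fun ρ hρ => h4 ρ (hZ1 ρ hρ).2.2 (hZ1 ρ hρ).1
  have hsZ : s ∉ Z := by
    intro hs; have := hZd s hs; simp at this; linarith
  obtain ⟨e1, -, e3⟩ := hZ3 s hb hsZ h3
  refine ⟨e1, ?_⟩
  have e4 := zsm_norm_le_card Z hd (n + 1) hZd
  set lg := RL (|s.im| + 3) with hlg
  have hlg1 := one_le_log_add_three s.im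
  rw [← hlg] at hlg1
  have hdi : 1 ≤ (d ^ (n + 1))⁻¹ := by
    rw [one_le_inv₀ PA]; exact pow_le_one₀ hd.le hd1
  have e5 := norm_sub_le ((-1 : ℂ) ^ n * n ! * zsm Z (n + 1) s)
    ((-1 : ℂ) ^ n * n ! * zsm Z (n + 1) s - iteratedDeriv n LZ s)
  rw [sub_sub_cancel, norm_sub_rev ((-1 : ℂ) ^ n * n ! * zsm Z (n + 1) s)] at e5
  have e6 : ‖(-1 : ℂ) ^ n * n ! * zsm Z (n + 1) s‖ = n.factorial * ‖zsm Z (n + 1) s‖ := by simp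
  rw [e6] at e5
  have e7 : (n ! : ℝ) * ‖zsm Z (n + 1) s‖ ≤ n.factorial * (K * lg * (d ^ (n + 1))⁻¹) := by
    gcongr
    exact e4.trans (by gcongr)
  have e8 : K * lg ≤ K * lg * (d ^ (n + 1))⁻¹ := le_mul_of_one_le_right PA hdi
  calc _ ≤ n.factorial * (K * lg * (d ^ (n + 1))⁻¹) + K * lg * (d ^ (n + 1))⁻¹ := LA
    _ = _ := by ring

lemma zPP_bound (C A : ℕ → ℂ) (n : ℕ) : ∃ B > (0 : ℝ), ∀ s : ℂ, 1 / 4 ≤ ‖s - 1‖ → ‖zPP C A n s‖ ≤ B * ‖s - 1‖⁻¹ := by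
  refine ⟨n.factorial * 4 ^ (n + 1) + ∑ j ∈ range (n + 1), ‖(n ! : ℂ) * C j‖ * 4 ^ (n - j) +
    ‖(-1 : ℂ) ^ (n + 1) * n ! * A n‖, by positivity, fun s hs => ?_⟩
  have hw : 0 < ‖s - 1‖ := LA
  have h1 : ∀ k : ℕ, ‖((s - 1) ^ (k + 1))⁻¹‖ ≤ 4 ^ k * ‖s - 1‖⁻¹ := by
    intro k
    rw [norm_inv, norm_pow, pow_succ, mul_inv]
    gcongr
    rw [← inv_pow]
    gcongr
    rw [inv_le_comm₀ hw NA]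
    linarith
  rw [zPP, add_mul, add_mul, sum_mul]
  refine (norm_add_le _ _).trans (add_le_add ((norm_add_le _ _).trans (add_le_add ?_ ?_)) ?_)
  · rw [norm_mul, Complex.norm_natCast, mul_assoc]
    gcongr
    exact h1 _
  · refine (norm_sum_le _ _).trans (sum_le_sum fun j _ => ?_)
    rw [norm_mul, mul_assoc]
    gcongr
    exact h1 _
  · rw [norm_mul, norm_inv]

lemma zH_exists (hRH : RiemannHypothesis) {C A : ℕ → ℂ} (n : ℕ)
    (hC : HC(C))
    (hA : HA(A)) :
    ∃ H : ℂ → ℂ, DifferentiableOn ℂ H {s | 1 / 2 < s.re} ∧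
      (∀ s, s ≠ 1 → H s = (-1) ^ (n + 1) * zF n s - zPP C A n s) ∧
      ∀ σ : ℝ, 1 / 2 < σ → ∃ B > (0 : ℝ), ∀ s : ℂ, σ ≤ s.re → s.re ≤ 2 → ‖H s‖ ≤ B * (1 + |s.im|) ^ (3 / 4 : ℝ) := by
  obtain ⟨B, hB⟩ := zF_local n hC hA
  set f : ℂ → ℂ := fun s => (-1) ^ (n + 1) * zF n s - zPP C A n s with hf
  have hfd : ∀ s : ℂ, 1 / 2 < s.re → s ≠ 1 → DifferentiableAt ℂ f s := fun s h1 h2 =>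
    ((zF_analyticAt h2 (zeta_ne_zero_line hRH h1)).differentiableAt.const_mul _).sub (zPP_analyticAt C A n h2)
  rw [eventually_nhdsWithin_iff, Metric.eventually_nhds_iff_ball] at hB
  obtain ⟨ε, hε, hB⟩ := hB
  set ε' := min ε (1 / 2) with hε'
  have hε'0 : 0 < ε' := lt_min hε NA
  have hball : ∀ s ∈ Metric.ball (1 : ℂ) ε', 1 / 2 < s.re := by
    intro s hs
    rw [mem_ball_iff_norm] at hs
    have h1 := (abs_re_le_norm (s - 1)).trans_lt (hs.trans_le (min_le_right _ _))
    rw [abs_lt] at h1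
    simp at h1; linarith [h1.1]
  have hupd := Complex.differentiableOn_update_limUnder_of_bddAbove (f := f) (c := 1)
    (Metric.ball_mem_nhds 1 hε'0)
    (fun s hs => (hfd s (hball s hs.1) hs.2).differentiableWithinAt)
    ⟨B, by
      rintro _ ⟨s, hs, rfl⟩
      exact hB s (Metric.ball_subset_ball (min_le_left _ _) hs.1) hs.2⟩
  set H := Function.update f 1 (limUnder (𝓝[≠] 1) f) with hH
  have hHe : ∀ s, s ≠ 1 → H s = f s := fun s hs => Function.update_of_ne hs _ _
  have hHd : DifferentiableOn ℂ H {s | 1 / 2 < s.re} := by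
    intro s hs
    by_cases h1 : s = 1
    · subst h1
      exact (hupd.differentiableAt (Metric.ball_mem_nhds 1 hε'0)).differentiableWithinAt
    · refine DifferentiableAt.differentiableWithinAt ?_
      refine (hfd s hs h1).congr_of_eventuallyEq ?_
      filter_upwards [isOpen_compl_singleton.mem_nhds h1] with z hz
      exact hHe z hz
  refine ⟨H, hHd, hHe, fun σ hσ => ?_⟩
  -- compact part
  have hcomp : IsCompact (Set.Icc σ 2 ×ℂ Set.Icc (-1) 1) := isCompact_Icc.reProdIm isCompact_Icc
  obtain ⟨B1, hB1⟩ := hcomp.exists_bound_of_continuousOn (f := H) (hHd.continuousOn.mono (by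
    intro s hs
    rw [Complex.mem_reProdIm] at hs
    exact lt_of_lt_of_le hσ hs.1.1))
  obtain ⟨K, hK, hG⟩ := G_bound_dist hRH n
  obtain ⟨B2, hB2, hPP⟩ := zPP_bound C A n
  set d := min (σ - 1 / 2) 1 with hd
  have hd0 : 0 < d := lt_min LA NA
  refine ⟨|B1| + B2 + K * 12 * (d ^ (n + 1))⁻¹ * 12, by positivity, fun s hs1 hs2 => ?_⟩
  set t := |s.im| with ht
  have ht0 : 0 ≤ t := abs_nonneg _
  have hp1 : 1 ≤ (1 + t) ^ (3 / 4 : ℝ) := Real.one_le_rpow LA NA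
  have hpos : 0 < K * 12 * (d ^ (n + 1))⁻¹ * 12 := PA
  by_cases h1 : t ≤ 1
  · have h2 := hB1 s (by
      rw [Complex.mem_reProdIm]
      exact ⟨⟨hs1, hs2⟩, abs_le.mp h1⟩)
    calc ‖H s‖ ≤ B1 := h2
      _ ≤ |B1| := le_abs_self _
      _ ≤ |B1| + B2 + K * 12 * (d ^ (n + 1))⁻¹ * 12 := LA
      _ ≤ _ := le_mul_of_one_le_right PA hp1
  · push Not at h1
    have hsn : 1 ≤ ‖s - 1‖ := by
      have := abs_im_le_norm (s - 1)
      simp only [sub_im, one_im, sub_zero] at this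
      linarith
    have hs1' : s ≠ 1 := by rintro rfl; simp at hsn; linarith
    rw [hHe s hs1']
    obtain ⟨-, g⟩ := hG s d hd0 (min_le_right _ _) LA LA LA (by
      intro ρ _ hρ
      have := re_le_norm (s - ρ)
      simp only [sub_re, hρ] at this
      exact (min_le_left _ _).trans LA)
    have z := zeta_bound_half (s := s) LA h1.le
    have p := hPP s LA
    have p2 : ‖zPP C A n s‖ ≤ B2 := p.trans (mul_le_of_le_one_right hB2.le (inv_le_one_of_one_le₀ hsn))
    have hlog : RL (t + 3) ≤ 12 * (1 + t) ^ (1 / 4 : ℝ) := by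
      have e1 := Real.log_le_rpow_div (x := t + 3) LA (ε := 1 / 4) NA
      have e2 : (t + 3) ^ (1 / 4 : ℝ) ≤ (3 * (1 + t)) ^ (1 / 4 : ℝ) :=
        Real.rpow_le_rpow LA LA NA
      rw [Real.mul_rpow NA LA] at e2
      have e3 : (3 : ℝ) ^ (1 / 4 : ℝ) ≤ 3 ^ (1 : ℝ) := Real.rpow_le_rpow_of_exponent_le NA NA
      rw [Real.rpow_one] at e3
      have e4 : 0 ≤ (1 + t) ^ (1 / 4 : ℝ) := PA
      have e5 : (3 : ℝ) ^ (1 / 4 : ℝ) * (1 + t) ^ (1 / 4 : ℝ) ≤ 3 * (1 + t) ^ (1 / 4 : ℝ) := by gcongr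
      rw [div_eq_mul_inv] at e1
      norm_num at e1 e2 e5 ⊢
      linarith
    have hsq : √t ≤ (1 + t) ^ (1 / 2 : ℝ) := by
      rw [← Real.sqrt_eq_rpow]; exact Real.sqrt_le_sqrt LA
    have hmul : (1 + t) ^ (1 / 4 : ℝ) * (1 + t) ^ (1 / 2 : ℝ) = (1 + t) ^ (3 / 4 : ℝ) := by
      rw [← Real.rpow_add LA]; norm_num
    have hF : ‖zF n s‖ ≤ K * 12 * (d ^ (n + 1))⁻¹ * 12 * (1 + t) ^ (3 / 4 : ℝ) := by
      rw [zF, norm_mul]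
      calc _ ≤ (K * (12 * (1 + t) ^ (1 / 4 : ℝ)) * (d ^ (n + 1))⁻¹) * (12 * (1 + t) ^ (1 / 2 : ℝ)) := by
            gcongr
            · exact g.trans (by gcongr)
            · exact z.trans (by gcongr)
        _ = _ := by rw [← hmul]; ring
    have h3 : ‖f s‖ ≤ ‖zF n s‖ + ‖zPP C A n s‖ := by
      refine (norm_sub_le _ _).trans (by simp)
    have h4 : B2 ≤ B2 * (1 + t) ^ (3 / 4 : ℝ) := le_mul_of_one_le_right hB2.le hp1
    have h5 : 0 ≤ |B1| * (1 + t) ^ (3 / 4 : ℝ) := PA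
    nlinarith

/-! ### Perron kernel -/

lemma pow_exp_integrableOn (k : ℕ) {a : ℝ} (ha : 0 < a) :
    IntegrableOn (fun u : ℝ => u ^ k * RE (-(a * u))) (Set.Ioi 0) := by
  have h := integrableOn_rpow_mul_exp_neg_mul_rpow (p := 1) (s := (k : ℝ)) (b := a)
    (by have : (0 : ℝ) ≤ k := PA
        linarith) one_pos ha
  refine h.congr_fun (fun u _ => ?_) measurableSet_Ioi
  simp [Real.rpow_natCast]

lemma norm_pow_cexp (k : ℕ) (z : ℂ) {u : ℝ} (hu : 0 ≤ u) :
    ‖(u : ℂ) ^ k * cexp (-(z * u))‖ = u ^ k * RE (-(z.re * u)) := by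
  rw [norm_mul, norm_pow, norm_real, Real.norm_of_nonneg hu, norm_exp]
  simp

lemma pow_cexp_integrableOn (k : ℕ) {z : ℂ} (hz : 0 < z.re) :
    IntegrableOn (fun u : ℝ => (u : ℂ) ^ k * cexp (-(z * u))) (Set.Ioi 0) := by
  refine (pow_exp_integrableOn k hz).mono' FA ?_
  filter_upwards [ae_restrict_mem measurableSet_Ioi] with u hu
  exact (norm_pow_cexp k z (le_of_lt hu)).le

lemma laplace_pow (k : ℕ) {z : ℂ} (hz : 0 < z.re) :
    ∫ u in Set.Ioi (0 : ℝ), (u : ℂ) ^ k * cexp (-(z * u)) = (k ! : ℂ) * (z ^ (k + 1))⁻¹ := by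
  have hz0 : z ≠ 0 := fun h => by simp [h] at hz
  have lim : ∀ k : ℕ, Tendsto (fun u : ℝ => (u : ℂ) ^ k * cexp (-(z * u))) atTop (𝓝 0) := by
    intro k
    rw [tendsto_zero_iff_norm_tendsto_zero]
    have h := tendsto_rpow_mul_exp_neg_mul_atTop_nhds_zero (k : ℝ) z.re hz
    refine h.congr' ?_
    filter_upwards [eventually_ge_atTop 0] with u hu
    rw [norm_pow_cexp k z hu, Real.rpow_natCast, neg_mul]
  induction k with
  | zero =>
    have hd : ∀ u ∈ Set.Ici (0 : ℝ), HasDerivAt (fun u : ℝ => -(cexp (-(z * u)) / z))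
        ((u : ℂ) ^ 0 * cexp (-(z * u))) u := by
      intro u _
      have h1 : HasDerivAt (fun u : ℝ => -(z * (u : ℂ))) (-(z * 1)) u :=
        ((Complex.ofRealCLM.hasDerivAt (x := u)).const_mul z).neg
      have h2 := ((h1.cexp).div_const z).neg
      refine h2.congr_deriv ?_
      field_simp
    have := integral_Ioi_of_hasDerivAt_of_tendsto' hd (pow_cexp_integrableOn 0 hz)
      (m := 0) (by simpa using ((lim 0).div_const z).neg)
    rw [this]; simp
  | succ k ih =>
    have hd : ∀ u ∈ Set.Ici (0 : ℝ), HasDerivAt (fun u : ℝ => (u : ℂ) ^ (k + 1) * cexp (-(z * u)))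
        (((k : ℂ) + 1) * ((u : ℂ) ^ k * cexp (-(z * u)))
          - z * ((u : ℂ) ^ (k + 1) * cexp (-(z * u)))) u := by
      intro u _
      have h1 : HasDerivAt (fun u : ℝ => -(z * (u : ℂ))) (-(z * 1)) u :=
        ((Complex.ofRealCLM.hasDerivAt (x := u)).const_mul z).neg
      have h3 : HasDerivAt (fun u : ℝ => (u : ℂ) ^ (k + 1)) (((k + 1 : ℕ) : ℂ) * (u : ℂ) ^ k * 1) u := by
        have := (Complex.ofRealCLM.hasDerivAt (x := u)).fun_pow (k + 1)
        simpa using this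
      have h2 := h3.mul h1.cexp
      refine h2.congr_deriv ?_
      push_cast; ring
    have hi1 := (pow_cexp_integrableOn k hz).const_mul ((k : ℂ) + 1)
    have hi2 := (pow_cexp_integrableOn (k + 1) hz).const_mul z
    have := integral_Ioi_of_hasDerivAt_of_tendsto' hd (hi1.sub hi2) (m := 0) (lim (k + 1))
    rw [integral_sub hi1 hi2, integral_const_mul, integral_const_mul, ih] at this
    have h4 : z * ∫ u in Set.Ioi (0 : ℝ), (u : ℂ) ^ (k + 1) * cexp (-(z * u)) =
      ((k : ℂ) + 1) * ((k ! : ℂ) * (z ^ (k + 1))⁻¹) := by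
      have h5 : ((0 : ℝ) : ℂ) ^ (k + 1) * cexp (-(z * ((0 : ℝ) : ℂ))) = 0 := by simp
      rw [h5, sub_zero] at this
      linear_combination -this
    rw [← mul_right_inj' hz0, h4, Nat.factorial_succ]
    push_cast
    field_simp
    ring

lemma inv_sq_integrable {a : ℝ} (ha : 0 < a) :
    Integrable (fun v : ℝ => (aI(a,v) ^ 2)⁻¹) := by
  have h : Integrable (fun v : ℝ => (a ^ 2)⁻¹ * (1 + (v / a) ^ 2)⁻¹) :=
    (integrable_inv_one_add_sq.comp_div ha.ne').const_mul _
  have hne : ∀ v : ℝ, aI(a,v) ≠ 0 := by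
    intro v hv
    have := congrArg Complex.re hv
    simp at this; exact ha.ne' this
  refine h.mono' ?_ (ae_of_all _ fun v => ?_)
  · refine Continuous.aestronglyMeasurable ?_
    exact Continuous.inv₀ FA (fun v => pow_ne_zero _ (hne v))
  · rw [norm_inv, norm_pow, ← Complex.normSq_eq_norm_sq]
    have : Complex.normSq aI(a,v) = a ^ 2 + v ^ 2 := by
      rw [Complex.normSq_add_mul_I]
    rw [this, ← mul_inv]
    apply le_of_eq; congr 1; field_simp

open scoped FourierTransform in
lemma perron_kernel {a : ℝ} (ha : 0 < a) (y : ℝ) :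
    ∫ v : ℝ, cexp (y * aI(a,v)) * (aI(a,v) ^ 2)⁻¹ =
      2 * π * ((max y 0 : ℝ) : ℂ) := by
  set g : ℝ → ℂ := fun u => ((max u 0 : ℝ) : ℂ) * cexp (-(a * u)) with hg
  have hgc : Continuous g := FA
  have hind : ∀ w : ℂ, (fun u : ℝ => ((max u 0 : ℝ) : ℂ) * cexp (-(w * u))) =
      (Set.Ioi (0 : ℝ)).indicator (fun u : ℝ => (u : ℂ) ^ 1 * cexp (-(w * u))) := by
    intro w; ext u
    by_cases hu : 0 < u
    · rw [Set.indicator_of_mem (by simpa using hu), max_eq_left hu.le]; simp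
    · rw [Set.indicator_of_notMem (by simpa using hu), max_eq_right (not_lt.1 hu)]; simp
  have hgi : Integrable g := by
    rw [hg, hind]
    exact (integrable_indicator_iff measurableSet_Ioi).2 (pow_cexp_integrableOn 1 (by simpa using ha))
  have hF : ∀ v : ℝ, 𝓕 g v = (((a : ℂ) + (2 * π * v : ℝ) * I) ^ 2)⁻¹ := by
    intro v
    rw [Real.fourier_real_eq_integral_exp_smul]
    have : (fun u : ℝ => cexp ((-2 * π * u * v : ℝ) * I) • g u) =
        (fun u : ℝ => ((max u 0 : ℝ) : ℂ) * cexp (-(((a : ℂ) + (2 * π * v : ℝ) * I) * u))) := by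
      ext u
      rw [hg, smul_eq_mul, mul_left_comm, ← Complex.exp_add]
      congr 2; push_cast; ring
    rw [this, hind, integral_indicator measurableSet_Ioi, laplace_pow 1 (by simpa using ha)]
    simp
  have hFi : Integrable (𝓕 g) := by
    have := (inv_sq_integrable ha).comp_mul_left' (show (2 * π) ≠ 0 by positivity)
    refine this.congr (ae_of_all _ fun v => ?_)
    rw [hF v]
  have hinv := hgc.fourierInv_fourier_eq hgi hFi
  have h1 := congrFun hinv y
  rw [Real.fourierInv_eq', ] at h1
  have h2 : (fun v : ℝ => cexp ((2 * π * inner ℝ v y : ℝ) * I) • 𝓕 g v) =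
      fun v : ℝ => (fun w : ℝ => cexp (y * (w * I)) * (aI(a,w) ^ 2)⁻¹) ((2 * π) * v) := by
    ext v
    rw [hF v, smul_eq_mul]
    congr 2
    simp; ring
  have h3 : ∫ v : ℝ, cexp (y * (v * I)) * (aI(a,v) ^ 2)⁻¹ = 2 * π * g y := by
    rw [← h1]
    rw [h2, Measure.integral_comp_mul_left
      (fun w : ℝ => cexp (y * (w * I)) * (aI(a,w) ^ 2)⁻¹) (2 * π)]
    rw [abs_of_pos PA]
    rw [Complex.real_smul]
    push_cast
    rw [← mul_assoc, mul_inv_cancel₀, one_mul]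
    exact_mod_cast (by positivity : (2 * π) ≠ 0)
  have h5 : (fun v : ℝ => cexp (y * aI(a,v)) * (aI(a,v) ^ 2)⁻¹) =
      fun v : ℝ => cexp (y * a) * (cexp (y * (v * I)) * (aI(a,v) ^ 2)⁻¹) := by
    ext v
    rw [mul_add, Complex.exp_add]; ring
  rw [h5, integral_const_mul, h3, hg]
  have : cexp (y * a) * cexp (-(a * y)) = 1 := by
    rw [← Complex.exp_add]; ring_nf; simp
  linear_combination (2 * π * ((max y 0 : ℝ) : ℂ)) * this

lemma perron_general {α : Type*} [MeasurableSpace α] (μ : Measure α) [SFinite μ]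
    (g : α → ℂ) (l : α → ℝ) (hl : Measurable l) {a : ℝ} (ha : 0 < a)
    (hg : Integrable (fun x => g x * cexp (-(a * l x))) μ) (X : ℝ) :
    Integrable (fun x => g x * ((max (X - l x) 0 : ℝ) : ℂ)) μ ∧
    Integrable (fun v : ℝ => (∫ x, g x * cexp (-(aI(a,v) * l x)) ∂μ) *
      (cexp (X * aI(a,v)) * (aI(a,v) ^ 2)⁻¹)) ∧
    ∫ v : ℝ, (∫ x, g x * cexp (-(aI(a,v) * l x)) ∂μ) *
      (cexp (X * aI(a,v)) * (aI(a,v) ^ 2)⁻¹) =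
      2 * π * ∫ x, g x * ((max (X - l x) 0 : ℝ) : ℂ) ∂μ := by
  have hprod := (inv_sq_integrable ha).mul_prod hg
  have hbd : Integrable (fun p : ℝ × α => cexp (X * ((a : ℂ) + p.1 * I)) * cexp (-(p.1 * I * l p.2)) *
      ((((a : ℂ) + p.1 * I) ^ 2)⁻¹ * (g p.2 * cexp (-(a * l p.2))))) (volume.prod μ) := by
    refine hprod.bdd_mul (c := RE (X * a)) ?_ (ae_of_all _ fun p => ?_)
    · have : Measurable (fun p : ℝ × α => l p.2) := hl.comp measurable_snd
      refine Measurable.aestronglyMeasurable ?_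
      fun_prop
    · rw [norm_mul, norm_exp, norm_exp]
      simp
  have heq : ∀ v : ℝ, ∀ x : α, cexp (X * aI(a,v)) * cexp (-(v * I * l x)) *
      ((aI(a,v) ^ 2)⁻¹ * (g x * cexp (-(a * l x)))) =
      g x * (cexp ((X - l x : ℝ) * aI(a,v)) * (aI(a,v) ^ 2)⁻¹) := by
    intro v x
    have : cexp ((X - l x : ℝ) * aI(a,v)) = cexp (X * aI(a,v)) *
        cexp (-(v * I * l x)) * cexp (-(a * l x)) := by
      rw [← Complex.exp_add, ← Complex.exp_add]; congr 1; push_cast; ring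
    rw [this]; ring
  have heq2 : ∀ v : ℝ, ∀ x : α, cexp (X * aI(a,v)) * cexp (-(v * I * l x)) *
      ((aI(a,v) ^ 2)⁻¹ * (g x * cexp (-(a * l x)))) =
      (g x * cexp (-(aI(a,v) * l x))) *
       (cexp (X * aI(a,v)) * (aI(a,v) ^ 2)⁻¹) := by
    intro v x
    have : cexp (-(aI(a,v) * l x)) = 
        cexp (-(v * I * l x)) * cexp (-(a * l x)) := by
      rw [← Complex.exp_add]; congr 1; push_cast; ring
    rw [this]; ring
  have e1 : ∀ x, ∫ v : ℝ, cexp (X * aI(a,v)) * cexp (-(v * I * l x)) *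
      ((aI(a,v) ^ 2)⁻¹ * (g x * cexp (-(a * l x)))) =
      2 * π * (g x * ((max (X - l x) 0 : ℝ) : ℂ)) := by
    intro x
    simp_rw [heq]
    rw [integral_const_mul, perron_kernel ha]; ring
  have e2 : ∀ v : ℝ, ∫ x, cexp (X * aI(a,v)) * cexp (-(v * I * l x)) *
      ((aI(a,v) ^ 2)⁻¹ * (g x * cexp (-(a * l x)))) ∂μ =
      (∫ x, g x * cexp (-(aI(a,v) * l x)) ∂μ) *
      (cexp (X * aI(a,v)) * (aI(a,v) ^ 2)⁻¹) := by
    intro v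
    simp_rw [heq2]
    rw [integral_mul_const]
  refine ⟨?_, ?_, ?_⟩
  · have := hbd.integral_prod_right
    simp only [e1] at this
    have h2 := this.const_mul ((2 * π : ℂ)⁻¹)
    refine h2.congr (ae_of_all _ fun x => ?_)
    have : (2 * π : ℂ) ≠ 0 := by exact_mod_cast (by positivity : (2 * π) ≠ 0)
    simp only []
    rw [← mul_assoc, inv_mul_cancel₀ this, one_mul]
  · have := hbd.integral_prod_left
    simp only [e2] at this
    exact this
  · have := integral_integral_swap (f := fun (v : ℝ) (x : α) =>
      cexp (X * aI(a,v)) * cexp (-(v * I * l x)) *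
      ((aI(a,v) ^ 2)⁻¹ * (g x * cexp (-(a * l x))))) hbd
    simp only [e2, e1] at this
    rw [this, integral_const_mul]

/-! ### Line shift -/

lemma line_shift (Φ : ℂ → ℂ) {a b B : ℝ} (hab : a ≤ b) (hB : 0 ≤ B)
    (hd : DifferentiableOn ℂ Φ {s | a ≤ s.re})
    (hb : ∀ s : ℂ, a ≤ s.re → s.re ≤ b → ‖Φ s‖ ≤ B * (1 + |s.im|) ^ (-(5 / 4) : ℝ)) :
    Integrable (fun t : ℝ => Φ (a + t * I)) ∧ Integrable (fun t : ℝ => Φ (b + t * I)) ∧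
    ∫ t : ℝ, Φ (a + t * I) = ∫ t : ℝ, Φ (b + t * I) := by
  have hI : ∀ c : ℝ, a ≤ c → c ≤ b → Integrable (fun t : ℝ => Φ (c + t * I)) := by
    intro c h1 h2
    have h0 : Integrable (fun t : ℝ => (1 + ‖t‖) ^ (-(5 / 4) : ℝ)) :=
      integrable_one_add_norm (by simp; norm_num)
    refine (h0.const_mul B).mono' ?_ (ae_of_all _ fun t => ?_)
    · refine Continuous.aestronglyMeasurable ?_
      exact hd.continuousOn.comp_continuous FA (fun t => by simpa using h1)
    · simpa using hb (c + t * I) (by simpa using h1) (by simpa using h2)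
  have ha := hI a le_rfl hab
  have hb' := hI b hab le_rfl
  refine ⟨ha, hb', ?_⟩
  have ta := intervalIntegral_tendsto_integral ha (tendsto_neg_atTop_atBot (G := ℝ)) tendsto_id
  have tb := intervalIntegral_tendsto_integral hb' (tendsto_neg_atTop_atBot (G := ℝ)) tendsto_id
  have hz : Tendsto (fun T : ℝ => (∫ t in (-T)..T, Φ (a + t * I)) - ∫ t in (-T)..T, Φ (b + t * I))
      atTop (𝓝 0) := by
    have hlim : Tendsto (fun T : ℝ => 2 * (B * (b - a)) * (1 + T) ^ (-(5 / 4) : ℝ)) atTop (𝓝 0) := by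
      have := (tendsto_rpow_neg_atTop (show (0 : ℝ) < 5 / 4 by norm_num)).comp
        (tendsto_atTop_add_const_left atTop (1 : ℝ) tendsto_id)
      simpa using this.const_mul (2 * (B * (b - a)))
    refine squeeze_zero_norm' ?_ hlim
    filter_upwards [eventually_ge_atTop 0] with T hT
    have hc := Complex.integral_boundary_rect_eq_zero_of_differentiableOn Φ
      cI(a,T) aI(b,T) (hd.mono (by
        intro s hs
        have := hs.1
        simp [Set.uIcc_of_le hab] at this
        exact this.1))
    simp only [add_re, ofReal_re, mul_re, I_re, mul_zero, ofReal_im, I_im, mul_one, sub_self,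
      add_zero, add_im, mul_im, zero_add, smul_eq_mul] at hc
    have e : (∫ t in (-T)..T, Φ (a + t * I)) - ∫ t in (-T)..T, Φ (b + t * I) =
      -I * ((∫ x in a..b, Φ (x + mI(T))) - ∫ x in a..b, Φ (x + T * I)) := by
      linear_combination I * hc + ((∫ t in (-T)..T, Φ (a + t * I)) - ∫ t in (-T)..T, Φ (b + t * I)) * Complex.I_mul_I
    have hbd : ∀ τ : ℝ, |τ| = T → ‖∫ x in a..b, Φ (x + τ * I)‖ ≤ B * (1 + T) ^ (-(5 / 4) : ℝ) * (b - a) := by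
      intro τ hτ
      have := intervalIntegral.norm_integral_le_of_norm_le_const (a := a) (b := b)
        (f := fun x : ℝ => Φ (x + τ * I)) (C := B * (1 + T) ^ (-(5 / 4) : ℝ)) (by
          intro x hx
          rw [Set.uIoc_of_le hab] at hx
          have := hb (x + τ * I) (by simpa using hx.1.le) (by simpa using hx.2)
          simpa [hτ] using this)
      rwa [abs_of_nonneg LA] at this
    rw [e, norm_mul, norm_neg, Complex.norm_I, one_mul]
    refine (norm_sub_le _ _).trans ?_
    have h1 := hbd (-T) (by rw [abs_neg, abs_of_nonneg hT])
    have h2 := hbd T (abs_of_nonneg hT)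
    linarith
  have := tendsto_nhds_unique hz (ta.sub tb)
  exact (sub_eq_zero.1 this.symm)

/-! ### The arithmetic function -/

/-- The coefficients `∑_{d ∣ m} Λ(d) log^n d`. -/
noncomputable def fc (n m : ℕ) : ℝ :=
  ∑ d ∈ m.divisors, ArithmeticFunction.vonMangoldt d * RL d ^ n

lemma fc_nonneg (n m : ℕ) : 0 ≤ fc n m :=
  Finset.sum_nonneg fun d _ => mul_nonneg ArithmeticFunction.vonMangoldt_nonneg
    (pow_nonneg (Real.log_natCast_nonneg d) n)

lemma fc_zero (n : ℕ) : fc n 0 = 0 := by simp [fc]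

lemma fc_one (n : ℕ) : fc n 1 = 0 := by simp [fc]

lemma fc_le (n m : ℕ) : fc n m ≤ RL m ^ (n + 1) := by
  calc fc n m ≤ ∑ d ∈ m.divisors, ArithmeticFunction.vonMangoldt d * RL m ^ n := by
        refine sum_le_sum fun d hd => ?_
        refine mul_le_mul_of_nonneg_left ?_ ArithmeticFunction.vonMangoldt_nonneg
        have h1 : 1 ≤ d := Nat.pos_of_mem_divisors hd
        have h2 : d ≤ m := Nat.divisor_le hd
        refine pow_le_pow_left₀ (Real.log_natCast_nonneg d) ?_ n
        exact Real.log_le_log (by exact_mod_cast h1) (by exact_mod_cast h2)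
    _ = RL m ^ (n + 1) := by
        rw [← sum_mul, ArithmeticFunction.vonMangoldt_sum]; ring

lemma logMul_iter (f : ℕ → ℂ) (n d : ℕ) :
    (LSeries.logMul^[n] f) d = (RL d : ℂ) ^ n * f d := by
  induction n generalizing f with
  | zero => simp
  | succ n ih =>
    rw [Function.iterate_succ, Function.comp_apply, ih, LSeries.logMul, pow_succ, mul_assoc,
      Complex.ofReal_log PA]
    simp

lemma logDeriv_zeta_iter (n : ℕ) {s : ℂ} (hs : 1 < s.re) :
    LSeriesSummable (LSeries.logMul^[n] (fun m => (ArithmeticFunction.vonMangoldt m : ℂ))) s ∧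
    LSeries (LSeries.logMul^[n] (fun m => (ArithmeticFunction.vonMangoldt m : ℂ))) s =
      (-1) ^ (n + 1) * iteratedDeriv n LZ s := by
  have habs : LSeries.abscissaOfAbsConv (fun m => (ArithmeticFunction.vonMangoldt m : ℂ)) < s.re := by
    refine lt_of_le_of_lt (LSeries.abscissaOfAbsConv_le_of_forall_lt_LSeriesSummable (x := 1)
      fun y hy => ArithmeticFunction.LSeriesSummable_vonMangoldt (by simpa using hy)) ?_
    exact_mod_cast hs
  constructor
  · refine LSeriesSummable_of_abscissaOfAbsConv_lt_re ?_
    rwa [LSeries.absicssaOfAbsConv_logPowMul]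
  · have h1 := LSeries_iteratedDeriv n habs
    have h2 : (LSeries fun m => (ArithmeticFunction.vonMangoldt m : ℂ)) =ᶠ[𝓝 s]
        fun z => -logDeriv ZZ z := by
      filter_upwards [(isOpen_lt continuous_const continuous_re).mem_nhds hs] with z hz
      rw [ArithmeticFunction.LSeries_vonMangoldt_eq_deriv_riemannZeta_div hz, logDeriv_apply]; ring
    rw [h2.iteratedDeriv_eq n] at h1
    have h3 : iteratedDeriv n (fun z => -logDeriv ZZ z) s =
        - iteratedDeriv n LZ s := by
      exact iteratedDeriv_neg n LZ s
    rw [h3] at h1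
    have h4 : ((-1 : ℂ) ^ n) * (-1) ^ n = 1 := by rw [← mul_pow]; simp
    linear_combination (-(-1 : ℂ) ^ n) * h1 - (LSeries (LSeries.logMul^[n] (fun m => (ArithmeticFunction.vonMangoldt m : ℂ))) s) * h4

lemma fc_hasSum (n : ℕ) {s : ℂ} (hs : 1 < s.re) :
    HasSum (fun m : ℕ => (fc n m : ℂ) * cexp (-(s * RL m))) ((-1) ^ (n + 1) * zF n s) := by
  obtain ⟨h1, h2⟩ := logDeriv_zeta_iter n hs
  have h3 := (LSeriesHasSum.convolution h1.LSeriesHasSum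
    (LSeriesSummable_one_iff.2 hs).LSeriesHasSum)
  rw [h2, LSeries_one_eq_riemannZeta hs] at h3
  have h4 : ((-1 : ℂ)) ^ (n + 1) * iteratedDeriv n LZ s * ZZ s =
    (-1) ^ (n + 1) * zF n s := by rw [zF]; ring
  rw [h4] at h3
  refine HasSum.congr_fun h3 (fun m => ?_)
  by_cases hm : m = 0
  · subst hm; simp [fc_zero]
  rw [LSeries.term_of_ne_zero hm, LSeries.convolution_def, div_eq_mul_inv]
  congr 1
  · rw [fc]
    push_cast
    rw [← Nat.map_div_right_divisors, Finset.sum_map]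
    refine sum_congr rfl fun d _ => ?_
    rw [logMul_iter]
    simp only [Pi.one_apply, mul_one, Complex.natCast_log]
    exact mul_comm _ _
  · rw [← Complex.cpow_neg, cpow_def_of_ne_zero (by exact_mod_cast hm),
      Complex.natCast_log]
    congr 1; ring

/-! ### The main-term polynomial -/

noncomputable def pp (C A : ℕ → ℂ) (n : ℕ) (v : ℝ) : ℂ :=
  (n ! : ℂ) * (((n + 1).factorial : ℂ)⁻¹ * (v : ℂ) ^ (n + 1)) +
    (∑ j ∈ range (n + 1), (n ! : ℂ) * C j * (((n - j).factorial : ℂ)⁻¹ * (v : ℂ) ^ (n - j)))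
    + (-1) ^ (n + 1) * (n ! : ℂ) * A n

lemma pp_continuous (C A : ℕ → ℂ) (n : ℕ) : Continuous (pp C A n) := by
  unfold pp; fun_prop

lemma pp_laplace (C A : ℕ → ℂ) (n : ℕ) {s : ℂ} (hs : 1 < s.re) :
    IntegrableOn (fun v : ℝ => (pp C A n v * cexp v) * cexp (-(s * v))) (Set.Ioi 0) ∧
    ∫ v in Set.Ioi (0 : ℝ), (pp C A n v * cexp v) * cexp (-(s * v)) = zPP C A n s := by
  have hz : 0 < (s - 1).re := by simpa using hs
  have e : (fun v : ℝ => (pp C A n v * cexp v) * cexp (-(s * v))) = fun v : ℝ =>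
      ((n ! : ℂ) * ((n + 1).factorial : ℂ)⁻¹) * ((v : ℂ) ^ (n + 1) * cexp (-((s - 1) * v))) +
      (∑ j ∈ range (n + 1), ((n ! : ℂ) * C j * ((n - j).factorial : ℂ)⁻¹) *
        ((v : ℂ) ^ (n - j) * cexp (-((s - 1) * v)))) +
      ((-1) ^ (n + 1) * (n ! : ℂ) * A n) * ((v : ℂ) ^ 0 * cexp (-((s - 1) * v))) := by
    ext v
    have : cexp (-((s - 1) * v)) = cexp v * cexp (-(s * v)) := by
      rw [← Complex.exp_add]; congr 1; ring
    rw [this, pp, mul_assoc, add_mul, add_mul, sum_mul]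
    congr 1
    · congr 1
      · ring
      · exact sum_congr rfl fun j _ => by ring
    · ring
  have hi : ∀ k : ℕ, ∀ c : ℂ, Integrable (fun v : ℝ => c * ((v : ℂ) ^ k * cexp (-((s - 1) * v))))
      (volume.restrict (Set.Ioi 0)) := fun k c => (pow_cexp_integrableOn k hz).const_mul c
  have hsum : Integrable (fun v : ℝ => ∑ j ∈ range (n + 1),
      ((n ! : ℂ) * C j * ((n - j).factorial : ℂ)⁻¹) *
        ((v : ℂ) ^ (n - j) * cexp (-((s - 1) * v)))) (volume.restrict (Set.Ioi 0)) :=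
    integrable_finsetSum _ fun j _ => hi _ _
  rw [e]
  refine ⟨((hi _ _).add hsum).add (hi _ _), ?_⟩
  have hadd : Integrable (fun v : ℝ =>
      ((n ! : ℂ) * ((n + 1).factorial : ℂ)⁻¹) * ((v : ℂ) ^ (n + 1) * cexp (-((s - 1) * v))) +
      (∑ j ∈ range (n + 1), ((n ! : ℂ) * C j * ((n - j).factorial : ℂ)⁻¹) *
        ((v : ℂ) ^ (n - j) * cexp (-((s - 1) * v))))) (volume.restrict (Set.Ioi 0)) :=
    (hi _ _).add hsum
  rw [integral_add hadd (hi _ _), integral_add (hi _ _) hsum,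
    integral_finsetSum _ (fun j _ => hi _ _)]
  simp_rw [integral_const_mul, laplace_pow _ hz]
  rw [zPP]
  have hf : ∀ k : ℕ, (k ! : ℂ) ≠ 0 := fun k => by exact_mod_cast k.factorial_ne_zero
  congr 1
  · congr 1
    · have := hf (n + 1); field_simp
    · refine sum_congr rfl fun j _ => ?_
      have := hf (n - j); field_simp
  · simp

lemma pp_bound (C A : ℕ → ℂ) (n : ℕ) : ∃ B > (0 : ℝ), ∀ v : ℝ, 0 ≤ v →
    ‖pp C A n v‖ ≤ B * (1 + v) ^ (n + 1) := by
  refine ⟨‖(n ! : ℂ) * ((n + 1).factorial : ℂ)⁻¹‖ + (∑ j ∈ range (n + 1),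
    ‖(n ! : ℂ) * C j * ((n - j).factorial : ℂ)⁻¹‖) + ‖(-1) ^ (n + 1) * (n ! : ℂ) * A n‖ + 1,
    by positivity, fun v hv => ?_⟩
  have hp : ∀ k ≤ n + 1, ‖(v : ℂ) ^ k‖ ≤ (1 + v) ^ (n + 1) := by
    intro k hk
    rw [norm_pow, norm_real, Real.norm_of_nonneg hv]
    calc v ^ k ≤ (1 + v) ^ k := pow_le_pow_left₀ hv LA k
      _ ≤ _ := pow_le_pow_right₀ LA hk
  have h1 : (1 : ℝ) ≤ (1 + v) ^ (n + 1) := one_le_pow₀ LA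
  rw [pp, add_mul, add_mul, add_mul]
  refine (norm_add₃_le).trans ?_
  have a1 : ‖(n ! : ℂ) * (((n + 1).factorial : ℂ)⁻¹ * (v : ℂ) ^ (n + 1))‖ ≤
    ‖(n ! : ℂ) * ((n + 1).factorial : ℂ)⁻¹‖ * (1 + v) ^ (n + 1) := by
    rw [← mul_assoc, norm_mul]
    exact mul_le_mul_of_nonneg_left (hp _ le_rfl) (norm_nonneg _)
  have a2 : ‖∑ j ∈ range (n + 1), (n ! : ℂ) * C j * (((n - j).factorial : ℂ)⁻¹ * (v : ℂ) ^ (n - j))‖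
    ≤ (∑ j ∈ range (n + 1), ‖(n ! : ℂ) * C j * ((n - j).factorial : ℂ)⁻¹‖) * (1 + v) ^ (n + 1) := by
    refine (norm_sum_le _ _).trans ?_
    rw [sum_mul]
    refine sum_le_sum fun j _ => ?_
    rw [← mul_assoc, norm_mul]
    exact mul_le_mul_of_nonneg_left (hp _ (by omega)) (norm_nonneg _)
  have a3 : ‖(-1) ^ (n + 1) * (n ! : ℂ) * A n‖ ≤ ‖(-1) ^ (n + 1) * (n ! : ℂ) * A n‖ * (1 + v) ^ (n + 1) :=
    le_mul_of_one_le_right (norm_nonneg _) h1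
  linarith

/-- smoothed sum -/
noncomputable def fR (n : ℕ) (X : ℝ) : ℝ := ∑' m : ℕ, fc n m * max (X - RL m) 0

noncomputable def pM (C A : ℕ → ℂ) (n : ℕ) (X : ℝ) : ℂ :=
  ∫ v in Set.Ioi (0 : ℝ), (pp C A n v * cexp v) * ((max (X - v) 0 : ℝ) : ℂ)

lemma fR_perron (n : ℕ) (X : ℝ) :
    Summable (fun m : ℕ => fc n m * max (X - RL m) 0) ∧
    Integrable (fun v : ℝ => ((-1) ^ (n + 1) * zF n ((2 : ℝ) + v * I)) *
      (cexp (X * (((2 : ℝ) : ℂ) + v * I)) * ((((2 : ℝ) : ℂ) + v * I) ^ 2)⁻¹)) ∧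
    ∫ v : ℝ, ((-1) ^ (n + 1) * zF n ((2 : ℝ) + v * I)) *
      (cexp (X * (((2 : ℝ) : ℂ) + v * I)) * ((((2 : ℝ) : ℂ) + v * I) ^ 2)⁻¹) =
      2 * π * (fR n X : ℂ) := by
  have hs : ∀ v : ℝ, 1 < (((2 : ℝ) : ℂ) + v * I).re := by intro v; simp
  have hsm := (fc_hasSum n (hs 0)).summable
  have hitg : Integrable (fun m : ℕ => (fc n m : ℂ) * cexp (-(((2 : ℝ) : ℂ) * RL m))) Measure.count := by
    rw [integrable_count_iff]
    simpa using hsm.norm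
  obtain ⟨h1, h2, h3⟩ := perron_general Measure.count (fun m : ℕ => (fc n m : ℂ)) (fun m : ℕ => RL m)
    (measurable_of_countable _) (by norm_num : (0 : ℝ) < 2) hitg X
  have e : ∀ v : ℝ, ∫ m : ℕ, (fc n m : ℂ) * cexp (-((((2 : ℝ) : ℂ) + v * I) * RL m)) ∂Measure.count =
      (-1) ^ (n + 1) * zF n ((2 : ℝ) + v * I) := by
    intro v
    have hh := fc_hasSum n (hs v)
    rw [integral_countable (integrable_count_iff.2 hh.summable.norm), ← hh.tsum_eq]
    simp
  simp only [e] at h2 h3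
  have hsum : Summable (fun m : ℕ => fc n m * max (X - RL m) 0) := by
    rw [integrable_count_iff] at h1
    refine Summable.of_norm (h1.congr fun m => ?_)
    rw [← Complex.ofReal_mul, norm_real]
  refine ⟨hsum, h2, ?_⟩
  rw [h3, fR, integral_countable h1]
  congr 1
  push_cast
  simp

lemma pM_perron (C A : ℕ → ℂ) (n : ℕ) (X : ℝ) :
    IntegrableOn (fun v : ℝ => (pp C A n v * cexp v) * ((max (X - v) 0 : ℝ) : ℂ)) (Set.Ioi 0) ∧
    Integrable (fun v : ℝ => zPP C A n ((2 : ℝ) + v * I) *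
      (cexp (X * (((2 : ℝ) : ℂ) + v * I)) * ((((2 : ℝ) : ℂ) + v * I) ^ 2)⁻¹)) ∧
    ∫ v : ℝ, zPP C A n ((2 : ℝ) + v * I) *
      (cexp (X * (((2 : ℝ) : ℂ) + v * I)) * ((((2 : ℝ) : ℂ) + v * I) ^ 2)⁻¹) =
      2 * π * pM C A n X := by
  have hs : ∀ v : ℝ, 1 < (((2 : ℝ) : ℂ) + v * I).re := by intro v; simp
  obtain ⟨h1, h2, h3⟩ := perron_general (volume.restrict (Set.Ioi (0 : ℝ)))
    (fun v : ℝ => pp C A n v * cexp v) (fun v : ℝ => v)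
    measurable_id (by norm_num : (0 : ℝ) < 2)
    (by have := (pp_laplace C A n (hs 0)).1
        rw [IntegrableOn] at this
        simpa using this) X
  simp only [fun v : ℝ => (pp_laplace C A n (hs v)).2] at h2 h3
  exact ⟨h1, h2, h3⟩

lemma exp_diff_bound {h : ℝ} (h0 : 0 < h) (h1 : h ≤ 1) {s : ℂ} (hs : s.re ≤ 1) :
    ‖cexp (h * s) - 1‖ ≤ 4 * min 1 (h * ‖s‖) := by
  have hn : ‖(h : ℂ) * s‖ = h * ‖s‖ := by rw [norm_mul, norm_real, Real.norm_of_nonneg h0.le]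
  have hp : 0 ≤ h * ‖s‖ := PA
  by_cases hc : h * ‖s‖ ≤ 1
  · rw [min_eq_right hc]
    have := Complex.norm_exp_sub_one_le (x := h * s) (by rw [hn]; exact hc)
    rw [hn] at this; linarith
  · rw [min_eq_left (le_of_not_ge hc)]
    refine (norm_sub_le _ _).trans ?_
    rw [norm_exp]
    have : ((h : ℂ) * s).re ≤ 1 := by
      simp
      nlinarith
    have h2 := Real.exp_le_exp.2 this
    have h3 := Real.exp_one_lt_d9
    simp only [norm_one]
    linarith

lemma norm_lower {σ t : ℝ} (hσ : 1 / 2 ≤ σ) : (1 + |t|) / 4 ≤ ‖(σ : ℂ) + t * I‖ := by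
  have h1 : |σ| ≤ ‖(σ : ℂ) + t * I‖ := by
    simpa using abs_re_le_norm aI(σ,t)
  have h2 : |t| ≤ ‖(σ : ℂ) + t * I‖ := by
    simpa using abs_im_le_norm aI(σ,t)
  have := le_abs_self σ
  linarith

lemma norm_lower' {σ t : ℝ} (hσ : σ ≤ 5 / 8) : (1 + |t|) / 4 ≤ ‖(σ : ℂ) + t * I - 1‖ := by
  have h1 : |σ - 1| ≤ ‖(σ : ℂ) + t * I - 1‖ := by
    simpa using abs_re_le_norm ((σ : ℂ) + t * I - 1)
  have h2 : |t| ≤ ‖(σ : ℂ) + t * I - 1‖ := by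
    simpa using abs_im_le_norm ((σ : ℂ) + t * I - 1)
  have := neg_abs_le (σ - 1)
  linarith

lemma D_line {C A : ℕ → ℂ} (n : ℕ) {H : ℂ → ℂ}
    (hH1 : DifferentiableOn ℂ H {s | 1 / 2 < s.re})
    (hH2 : ∀ s, s ≠ 1 → H s = (-1) ^ (n + 1) * zF n s - zPP C A n s)
    (hH3 : ∀ σ : ℝ, 1 / 2 < σ → ∃ B > (0 : ℝ), ∀ s : ℂ, σ ≤ s.re → s.re ≤ 2 →
      ‖H s‖ ≤ B * (1 + |s.im|) ^ (3 / 4 : ℝ)) {σ : ℝ} (hσ : 1 / 2 < σ) (hσ2 : σ ≤ 2) (X : ℝ) :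
    Integrable (fun v : ℝ => H (σ + v * I) *
      (cexp (X * aI(σ,v)) * (aI(σ,v) ^ 2)⁻¹)) ∧
    ∫ v : ℝ, H (σ + v * I) * (cexp (X * aI(σ,v)) * (aI(σ,v) ^ 2)⁻¹) =
      2 * π * ((fR n X : ℂ) - pM C A n X) := by
  obtain ⟨B, hB, hHB⟩ := hH3 σ hσ
  have hshift := line_shift (fun s => H s * (cexp (X * s) * (s ^ 2)⁻¹)) (a := σ) (b := 2)
    (B := B * (RE (2 * |X|) * 16)) hσ2 PA ?_ ?_
  · refine ⟨hshift.1, ?_⟩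
    rw [hshift.2.2]
    obtain ⟨_, a2, a3⟩ := fR_perron n X
    obtain ⟨_, b2, b3⟩ := pM_perron C A n X
    rw [mul_sub, ← a3, ← b3, ← integral_sub a2 b2]
    refine integral_congr_ae (ae_of_all _ fun v => ?_)
    simp only []
    rw [hH2 _ (zeta_line_ne_one NA v), sub_mul]
  · intro s hs
    have hs' : 1 / 2 < s.re := lt_of_lt_of_le hσ hs
    have hs0 : s ≠ 0 := fun h => by rw [h] at hs'; simp at hs'; linarith
    have h1 : DifferentiableAt ℂ H s :=
      (hH1 s hs').differentiableAt ((isOpen_lt continuous_const continuous_re).mem_nhds hs')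
    refine DifferentiableAt.differentiableWithinAt ?_
    have h2 : s ^ 2 ≠ 0 := pow_ne_zero _ hs0
    fun_prop (disch := assumption)
  · intro s h1 h2
    have e := Complex.re_add_im s
    have hp : 0 < 1 + |s.im| := PA
    have hn := norm_lower (σ := s.re) (t := s.im) LA
    rw [e] at hn
    have i1 : ‖(s ^ 2)⁻¹‖ ≤ 16 * (1 + |s.im|) ^ (-2 : ℝ) := by
      rw [norm_inv, norm_pow, Real.rpow_neg hp.le, ← div_eq_mul_inv]
      rw [show (2 : ℝ) = ((2 : ℕ) : ℝ) by norm_num, Real.rpow_natCast]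
      calc (‖s‖ ^ 2)⁻¹ ≤ (((1 + |s.im|) / 4) ^ 2)⁻¹ := by gcongr
        _ = _ := by field_simp; norm_num
    have i2 : ‖cexp (X * s)‖ ≤ RE (2 * |X|) := by
      rw [norm_exp]
      apply Real.exp_le_exp.2
      simp
      have := le_abs_self X
      have := neg_abs_le X
      have : 0 ≤ |X| := abs_nonneg X
      nlinarith
    calc ‖H s * (cexp (X * s) * (s ^ 2)⁻¹)‖ = ‖H s‖ * (‖cexp (X * s)‖ * ‖(s ^ 2)⁻¹‖) := by
          rw [norm_mul, norm_mul]
      _ ≤ (B * (1 + |s.im|) ^ (3 / 4 : ℝ)) * (RE (2 * |X|) * (16 * (1 + |s.im|) ^ (-2 : ℝ))) := by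
          have := hHB s h1 h2
          gcongr
      _ = B * (RE (2 * |X|) * 16) * ((1 + |s.im|) ^ (3 / 4 : ℝ) * (1 + |s.im|) ^ (-2 : ℝ)) := by ring
      _ = _ := by rw [← Real.rpow_add hp]; norm_num

lemma D_diff (hRH : RiemannHypothesis) {C A : ℕ → ℂ} (n : ℕ) (hn : 1 ≤ n)
    (hC : HC(C))
    (hA : HA(A)) :
    ∃ K > (0 : ℝ), ∀ L Y h : ℝ, 8 ≤ L → Y ≤ L → 0 < h → h ≤ 1 → 1 / h ≤ RE (L / 2) →
      ‖((fR n (Y + h) : ℂ) - pM C A n (Y + h)) - ((fR n Y : ℂ) - pM C A n Y)‖ ≤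
        K * (h * (RE (L / 2) * (L ^ (n + 2) * √L))) := by
  obtain ⟨H, hH1, hH2, hH3⟩ := zH_exists hRH n hC hA
  obtain ⟨K1, hK1, hw⟩ := zF_weight hRH n hn
  obtain ⟨B, hB, hP⟩ := zPP_bound C A n
  refine ⟨RE 1 * 64 * (K1 + 4 * B * π), by positivity, fun L Y h hL hY h0 h1 hh => ?_⟩
  set σ : ℝ := 1 / 2 + 1 / L with hσd
  have hL0 : 0 < L := LA
  have hLi : 1 / L ≤ 1 / 8 := one_div_le_one_div_of_le NA hL
  have hLp : 0 < 1 / L := PA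
  have hσ : 1 / 2 < σ := LA
  have hσ2 : σ ≤ 5 / 8 := LA
  obtain ⟨i1, e1⟩ := D_line n hH1 hH2 hH3 hσ LA (Y + h)
  obtain ⟨i2, e2⟩ := D_line n hH1 hH2 hH3 hσ LA Y
  set w : ℝ → ℝ := fun t => min (1 / (1 + |t|)) (1 / (h * (1 + |t|) ^ 2)) with hw'
  have hsq : Integrable (fun t : ℝ => 4 * B * (1 + t ^ 2)⁻¹) := integrable_inv_one_add_sq.const_mul _
  have hexp : RE (Y * σ) ≤ RE 1 * RE (L / 2) := by
    rw [← Real.exp_add]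
    apply Real.exp_le_exp.2
    have : Y * σ ≤ L * σ := by gcongr
    have : L * σ = L / 2 + 1 := by rw [hσd]; field_simp
    linarith
  have key : ∀ t : ℝ, ‖H (σ + t * I) *
      (cexp ((Y + h : ℝ) * aI(σ,t)) * (aI(σ,t) ^ 2)⁻¹) - H (σ + t * I) *
      (cexp (Y * aI(σ,t)) * (aI(σ,t) ^ 2)⁻¹)‖ ≤
      (RE 1 * 64 * (h * RE (L / 2))) * (‖zF n (σ + t * I)‖ * w t + 4 * B * (1 + t ^ 2)⁻¹) := by
    intro t
    set s : ℂ := (σ : ℂ) + t * I with hs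
    have hre : s.re = σ := by simp [hs]
    have hp : 0 < 1 + |t| := PA
    have hnl := norm_lower (σ := σ) (t := t) hσ.le
    have hnl' := norm_lower' (σ := σ) (t := t) hσ2
    rw [← hs] at hnl hnl'
    have hspos : 0 < ‖s‖ := by linarith [hp]
    have ee : H s * (cexp ((Y + h : ℝ) * s) * (s ^ 2)⁻¹) - H s * (cexp (Y * s) * (s ^ 2)⁻¹) =
      H s * (cexp (Y * s) * ((cexp (h * s) - 1) * (s ^ 2)⁻¹)) := by
      have : cexp ((Y + h : ℝ) * s) = cexp (Y * s) * cexp (h * s) := by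
        rw [← Complex.exp_add]; congr 1; push_cast; ring
      rw [this]; ring
    have b1 : ‖cexp (Y * s)‖ ≤ RE 1 * RE (L / 2) := by
      rw [norm_exp]
      refine le_trans (le_of_eq ?_) hexp
      simp [hre]
    have b2 : ‖(cexp (h * s) - 1) * (s ^ 2)⁻¹‖ ≤ 64 * (h * w t) := by
      rw [norm_mul, norm_inv, norm_pow]
      have c1 := exp_diff_bound h0 h1 (s := s) (by rw [hre]; linarith)
      have c2 : ‖s‖⁻¹ ≤ 4 * (1 / (1 + |t|)) := by
        calc ‖s‖⁻¹ ≤ ((1 + |t|) / 4)⁻¹ := by gcongr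
          _ = _ := by field_simp
      have hw0 : h * w t = min (h * (1 / (1 + |t|))) (1 / (1 + |t|) ^ 2) := by
        rw [hw']
        simp only []
        rw [mul_min_of_nonneg _ _ h0.le]
        congr 1
        field_simp
      rw [hw0]
      have hi0 : 0 ≤ ‖s‖⁻¹ := PA
      have hi2 : (‖s‖ ^ 2)⁻¹ = ‖s‖⁻¹ * ‖s‖⁻¹ := by rw [sq, mul_inv]
      have hss : ‖s‖ * ‖s‖⁻¹ = 1 := mul_inv_cancel₀ hspos.ne'
      rw [← div_le_iff₀' (by norm_num : (0 : ℝ) < 64)]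
      apply le_min
      · have : ‖cexp (h * s) - 1‖ * (‖s‖ ^ 2)⁻¹ ≤ 4 * (h * ‖s‖) * (‖s‖ ^ 2)⁻¹ := by
          gcongr
          exact c1.trans (by gcongr; exact min_le_right _ _)
        have e3 : 4 * (h * ‖s‖) * (‖s‖ ^ 2)⁻¹ = 4 * h * ‖s‖⁻¹ := by
          rw [hi2]; linear_combination 4 * h * ‖s‖⁻¹ * hss
        have e4 : 4 * h * ‖s‖⁻¹ ≤ 4 * h * (4 * (1 / (1 + |t|))) := by gcongr
        have e5 : 0 ≤ h * (1 / (1 + |t|)) := PA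
        linarith
      · have : ‖cexp (h * s) - 1‖ * (‖s‖ ^ 2)⁻¹ ≤ 4 * 1 * (‖s‖ ^ 2)⁻¹ := by
          gcongr
          exact c1.trans (by gcongr; exact min_le_left _ _)
        have e4 : (‖s‖ ^ 2)⁻¹ ≤ (4 * (1 / (1 + |t|))) * (4 * (1 / (1 + |t|))) := by
          rw [hi2]; gcongr
        have e5 : 1 / (1 + |t|) ^ 2 = (1 / (1 + |t|)) * (1 / (1 + |t|)) := by field_simp
        rw [e5]
        linarith
    have b3 : ‖H s‖ ≤ ‖zF n s‖ + B * (4 * (1 / (1 + |t|))) := by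
      rw [hH2 s (zeta_line_ne_one LA t)]
      refine (norm_sub_le _ _).trans ?_
      have c1 : ‖zPP C A n s‖ ≤ B * (4 * (1 / (1 + |t|))) := by
        refine (hP s (by linarith [abs_nonneg t])).trans ?_
        gcongr
        calc ‖s - 1‖⁻¹ ≤ ((1 + |t|) / 4)⁻¹ := by gcongr
          _ = _ := by field_simp
      simp only [norm_mul, norm_pow, norm_neg, norm_one, one_pow, one_mul]
      linarith
    have hwp : 0 ≤ w t := by rw [hw']; positivity
    have hw1 : (1 / (1 + |t|)) * w t ≤ (1 + t ^ 2)⁻¹ := by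
      have : w t ≤ 1 / (1 + |t|) := min_le_left _ _
      calc (1 / (1 + |t|)) * w t ≤ (1 / (1 + |t|)) * (1 / (1 + |t|)) := by gcongr
        _ = ((1 + |t|) ^ 2)⁻¹ := by field_simp
        _ ≤ (1 + t ^ 2)⁻¹ := by
          gcongr
          nlinarith [sq_abs t, abs_nonneg t]
    rw [ee, norm_mul, norm_mul]
    calc ‖H s‖ * (‖cexp (Y * s)‖ * ‖(cexp (h * s) - 1) * (s ^ 2)⁻¹‖) ≤
        (‖zF n s‖ + B * (4 * (1 / (1 + |t|)))) * ((RE 1 * RE (L / 2)) * (64 * (h * w t))) := by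
          gcongr
      _ = (RE 1 * 64 * (h * RE (L / 2))) * (‖zF n s‖ * w t + 4 * B * ((1 / (1 + |t|)) * w t)) := by ring
      _ ≤ _ := by gcongr
  have ediff : 2 * π * (((fR n (Y + h) : ℂ) - pM C A n (Y + h)) - ((fR n Y : ℂ) - pM C A n Y)) =
      ∫ t : ℝ, (H (σ + t * I) *
      (cexp ((Y + h : ℝ) * aI(σ,t)) * (aI(σ,t) ^ 2)⁻¹) - H (σ + t * I) *
      (cexp (Y * aI(σ,t)) * (aI(σ,t) ^ 2)⁻¹)) := by
    rw [integral_sub i1 i2, e1, e2]; ring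
  set c0 : ℝ := RE 1 * 64 * (h * RE (L / 2)) with hc0
  have hc0p : 0 ≤ c0 := PA
  have hbound : ‖∫ t : ℝ, (H (σ + t * I) *
      (cexp ((Y + h : ℝ) * aI(σ,t)) * (aI(σ,t) ^ 2)⁻¹) - H (σ + t * I) *
      (cexp (Y * aI(σ,t)) * (aI(σ,t) ^ 2)⁻¹))‖ₑ ≤
      EO (c0 * (K1 * L ^ (n + 2) * √L + 4 * B * π)) := by
    refine (enorm_integral_le_lintegral_enorm _).trans ?_
    have m1 : ∀ t : ℝ, 0 ≤ ‖zF n (σ + t * I)‖ * w t := fun t => by rw [hw']; positivity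
    have m2 : ∀ t : ℝ, 0 ≤ 4 * B * (1 + t ^ 2)⁻¹ := fun t => by positivity
    calc _ ≤ ∫⁻ t : ℝ, EO c0 * (EO (‖zF n (σ + t * I)‖ * w t) + EO (4 * B * (1 + t ^ 2)⁻¹)) := by
          refine lintegral_mono fun t => ?_
          rw [← ofReal_norm, ← ENNReal.ofReal_add (m1 t) (m2 t), ← ENNReal.ofReal_mul hc0p]
          exact ENNReal.ofReal_le_ofReal (key t)
      _ = EO c0 * ((∫⁻ t : ℝ, EO (‖zF n (σ + t * I)‖ * w t)) + ∫⁻ t : ℝ, EO (4 * B * (1 + t ^ 2)⁻¹)) := by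
          rw [lintegral_const_mul', lintegral_add_right]
          · fun_prop
          · exact ENNReal.ofReal_ne_top
      _ ≤ EO c0 * (EO (K1 * L ^ (n + 2) * √L) + EO (4 * B * π)) := by
          gcongr
          · exact hw L h hL h0 hh
          · rw [← ofReal_integral_eq_lintegral_ofReal hsq (ae_of_all _ m2), integral_const_mul,
              integral_univ_inv_one_add_sq]
      _ = _ := by
          rw [← ENNReal.ofReal_add PA PA, ← ENNReal.ofReal_mul hc0p]
  rw [← ofReal_norm, ENNReal.ofReal_le_ofReal_iff PA, ← ediff, norm_mul] at hbound
  have hpi : (1 : ℝ) ≤ ‖(2 * π : ℂ)‖ := by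
    rw [norm_mul, norm_real, Real.norm_of_nonneg Real.pi_pos.le]
    simp
    linarith [Real.pi_gt_three]
  have h1L : 1 ≤ L ^ (n + 2) * √L := by
    have a1 : 1 ≤ L ^ (n + 2) := one_le_pow₀ LA
    have a2 : 1 ≤ √L := Real.one_le_sqrt.2 LA
    nlinarith
  calc _ ≤ ‖(2 * π : ℂ)‖ * ‖((fR n (Y + h) : ℂ) - pM C A n (Y + h)) - ((fR n Y : ℂ) - pM C A n Y)‖ :=
        le_mul_of_one_le_left (norm_nonneg _) hpi
    _ ≤ _ := hbound
    _ ≤ c0 * (K1 * (L ^ (n + 2) * √L) + 4 * B * π * (L ^ (n + 2) * √L)) := by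
        have q1 : 4 * B * π ≤ 4 * B * π * (L ^ (n + 2) * √L) :=
          le_mul_of_one_le_right PA h1L
        refine mul_le_mul_of_nonneg_left ?_ hc0p
        linarith
    _ = _ := by rw [hc0]; ring

noncomputable def pM0 (C A : ℕ → ℂ) (n : ℕ) (X : ℝ) : ℂ := ∫ v in (0 : ℝ)..X, pp C A n v * cexp v

lemma pM_eq (C A : ℕ → ℂ) (n : ℕ) {Y : ℝ} (hY : 0 ≤ Y) :
    pM C A n Y = ∫ v in (0 : ℝ)..Y, (pp C A n v * cexp v) * ((Y - v : ℝ) : ℂ) := by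
  rw [pM, intervalIntegral.integral_of_le hY]
  rw [setIntegral_eq_of_subset_of_forall_sdiff_eq_zero (s := Set.Ioc (0 : ℝ) Y) (t := Set.Ioi 0)
    measurableSet_Ioi (fun v hv => hv.1)]
  · refine setIntegral_congr_fun measurableSet_Ioc fun v hv => ?_
    rw [max_eq_left (by linarith [hv.2])]
  · intro v hv
    have h1 : (0 : ℝ) < v := hv.1
    have h2 : Y < v := by
      by_contra h
      exact hv.2 ⟨h1, not_lt.1 h⟩
    rw [max_eq_right LA]; simp

lemma pM_diff (C A : ℕ → ℂ) (n : ℕ) {B : ℝ}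
    (hB : ∀ v : ℝ, 0 ≤ v → ‖pp C A n v‖ ≤ B * (1 + v) ^ (n + 1)) {a h c X : ℝ} (ha : 0 ≤ a)
    (hh : 0 < h) (hc : c = a ∨ c = a + h) (hX : a + h ≤ X) :
    ‖pM C A n (a + h) - pM C A n a - h * pM0 C A n c‖ ≤
      h * (h * (B * (1 + X) ^ (n + 1) * RE X)) := by
  set q : ℝ → ℂ := fun v => pp C A n v * cexp v with hq
  have hqc : Continuous q := by
    have := pp_continuous C A n
    fun_prop
  have hB0 : 0 ≤ B := by
    have := (norm_nonneg _).trans (hB 0 le_rfl)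
    simpa using this
  have bd : ∀ w : ℝ → ℝ, Continuous w → (∀ v, a ≤ v → v ≤ a + h → |w v| ≤ h) →
      ‖∫ v in a..(a + h), q v * (w v : ℂ)‖ ≤ h * (h * (B * (1 + X) ^ (n + 1) * RE X)) := by
    intro w _ hw
    have := intervalIntegral.norm_integral_le_of_norm_le_const (a := a) (b := a + h)
      (f := fun v => q v * (w v : ℂ)) (C := h * (B * (1 + X) ^ (n + 1) * RE X)) (by
        intro v hv
        rw [Set.uIoc_of_le LA] at hv
        rw [norm_mul, norm_real, Real.norm_eq_abs, mul_comm, hq]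
        simp only []
        have h1 := hw v hv.1.le hv.2
        have hv0 : 0 ≤ v := by linarith [hv.1]
        have h2 := hB v hv0
        have h3 : ‖cexp v‖ ≤ RE X := by
          rw [norm_exp]
          exact Real.exp_le_exp.2 (by simp; linarith [hv.2])
        rw [norm_mul]
        have hvX : v ≤ X := by linarith [hv.2]
        have hX1 : 0 ≤ 1 + X := LA
        have hX2 : 0 ≤ B * (1 + X) ^ (n + 1) := PA
        have h4 : ‖pp C A n v‖ ≤ B * (1 + X) ^ (n + 1) := h2.trans (by gcongr)
        gcongr)
    rw [show a + h - a = h by ring, abs_of_pos hh] at this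
    linarith
  have hi : ∀ (w : ℝ → ℝ), Continuous w → ∀ u v : ℝ, IntervalIntegrable (fun v => q v * (w v : ℂ)) volume u v :=
    fun w hw u v => Continuous.intervalIntegrable FA _ _
  have e1 : pM C A n (a + h) - pM C A n a =
      h * pM0 C A n a + ∫ v in a..(a + h), q v * ((a + h - v : ℝ) : ℂ) := by
    rw [pM_eq C A n LA, pM_eq C A n ha,
      ← integral_add_adjacent_intervals
        (hi (fun v => a + h - v) FA 0 a) (hi (fun v => a + h - v) FA a (a + h)),
      pM0, ← intervalIntegral.integral_const_mul]
    have : ∫ v in (0 : ℝ)..a, q v * ((a + h - v : ℝ) : ℂ) =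
      (∫ v in (0 : ℝ)..a, (h : ℂ) * q v) + ∫ v in (0 : ℝ)..a, q v * ((a - v : ℝ) : ℂ) := by
      rw [← intervalIntegral.integral_add]
      · refine intervalIntegral.integral_congr fun v _ => ?_
        push_cast; ring
      · exact Continuous.intervalIntegrable FA _ _
      · exact hi (fun v => a - v) FA _ _
    rw [this]; ring
  rcases hc with rfl | rfl
  · rw [e1, add_sub_cancel_left]
    refine bd (fun v => c + h - v) FA fun v h1 h2 => ?_
    rw [abs_of_nonneg LA]; linarith
  · have e2 : pM0 C A n (a + h) = pM0 C A n a + ∫ v in a..(a + h), q v := by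
      rw [pM0, pM0, integral_add_adjacent_intervals] <;>
      exact hqc.intervalIntegrable _ _
    have e3 : pM C A n (a + h) - pM C A n a - h * pM0 C A n (a + h) =
        ∫ v in a..(a + h), q v * ((a - v : ℝ) : ℂ) := by
      rw [e1, e2, mul_add, ← intervalIntegral.integral_const_mul]
      have : ∫ v in a..(a + h), q v * ((a + h - v : ℝ) : ℂ) =
        (∫ v in a..(a + h), (h : ℂ) * q v) + ∫ v in a..(a + h), q v * ((a - v : ℝ) : ℂ) := by
        rw [← intervalIntegral.integral_add]
        · refine intervalIntegral.integral_congr fun v _ => ?_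
          push_cast; ring
        · exact Continuous.intervalIntegrable FA _ _
        · exact hi (fun v => a - v) FA _ _
      rw [this]; ring
    rw [e3]
    refine bd (fun v => a - v) FA fun v h1 h2 => ?_
    rw [abs_of_nonpos LA]; linarith

lemma fR_sandwich (n : ℕ) {x h : ℝ} (hx : 1 ≤ x) (hh : 0 < h) :
    fR n (RL x) - fR n (RL x - h) ≤ h * ∑ m ∈ Icc 1 ⌊x⌋₊, fc n m ∧
    h * ∑ m ∈ Icc 1 ⌊x⌋₊, fc n m ≤ fR n (RL x + h) - fR n (RL x) := by
  have hs : ∀ X, HasSum (fun m : ℕ => fc n m * max (X - RL m) 0) (fR n X) :=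
    fun X => (fR_perron n X).1.hasSum
  have hS : HasSum (fun m : ℕ => if m ∈ Icc 1 ⌊x⌋₊ then h * fc n m else 0) (h * ∑ m ∈ Icc 1 ⌊x⌋₊, fc n m) := by
    have h1 : HasSum (fun m : ℕ => if m ∈ Icc 1 ⌊x⌋₊ then h * fc n m else 0)
        (∑ m ∈ Icc 1 ⌊x⌋₊, if m ∈ Icc 1 ⌊x⌋₊ then h * fc n m else 0) :=
      hasSum_sum_of_ne_finset_zero (by intro m hm; rw [if_neg hm])
    convert! h1 using 1
    rw [mul_sum]
    exact sum_congr rfl fun m hm => by rw [if_pos hm]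
  have hin : ∀ m ∈ Icc 1 ⌊x⌋₊, RL m ≤ RL x := by
    intro m hm
    rw [mem_Icc] at hm
    refine Real.log_le_log (by exact_mod_cast hm.1) ?_
    exact (Nat.le_floor_iff LA).1 hm.2
  have hout : ∀ m ∉ Icc 1 ⌊x⌋₊, m ≠ 0 → RL x ≤ RL m := by
    intro m hm h0
    rw [mem_Icc] at hm
    have : ⌊x⌋₊ < m := by
      by_contra hc
      exact hm ⟨by omega, by omega⟩
    have h2 := (Nat.floor_lt LA).1 this
    exact Real.log_le_log LA h2.le
  constructor
  · refine hasSum_le (fun m => ?_) ((hs (RL x)).sub (hs (RL x - h))) hS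
    have hf := fc_nonneg n m
    by_cases h0 : m = 0
    · subst h0; simp [fc_zero]
    split_ifs with hm
    · have := hin m hm
      rw [← mul_sub, mul_comm h]
      refine mul_le_mul_of_nonneg_left ?_ hf
      rw [max_eq_left LA]
      have := le_max_left (RL x - h - RL m) 0
      linarith
    · have := hout m hm h0
      rw [max_eq_right LA, max_eq_right LA]; simp
  · refine hasSum_le (fun m => ?_) hS ((hs (RL x + h)).sub (hs (RL x)))
    have hf := fc_nonneg n m
    by_cases h0 : m = 0
    · subst h0; simp [fc_zero]
    split_ifs with hm
    · have := hin m hm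
      rw [← mul_sub, mul_comm h]
      refine mul_le_mul_of_nonneg_left ?_ hf
      rw [max_eq_left LA, max_eq_left LA]
      linarith
    · rw [← mul_sub]
      refine mul_nonneg hf ?_
      rw [sub_nonneg]
      exact max_le_max LA le_rfl

lemma S_asymp (hRH : RiemannHypothesis) {C A : ℕ → ℂ} (n : ℕ) (hn : 1 ≤ n)
    (hC : HC(C))
    (hA : HA(A)) :
    ∃ K > (0 : ℝ), ∀ x : ℝ, RE 9 ≤ x →
      ‖((∑ m ∈ Icc 1 ⌊x⌋₊, fc n m : ℝ) : ℂ) - pM0 C A n (RL x)‖ ≤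
        K * (√x * (RL x ^ (n + 2) * √(RL x))) := by
  obtain ⟨K, hK, hD⟩ := D_diff hRH n hn hC hA
  obtain ⟨B, hB, hBb⟩ := pp_bound C A n
  refine ⟨3 * (K + B * 2 ^ (n + 1) * RE 1), by positivity, fun x hx => ?_⟩
  have hx0 : 0 < x := (Real.exp_pos 9).trans_le hx
  have hx1 : 1 ≤ x := le_trans (Real.one_le_exp NA) hx
  set L := RL x with hLd
  have hL : 9 ≤ L := (Real.le_log_iff_exp_le hx0).2 hx
  have hexp : RE (L / 2) = √x := by
    rw [← Real.exp_log (Real.sqrt_pos.2 hx0), Real.log_sqrt hx0.le]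
  set h := RE (-(L / 2)) with hhd
  have hh : 0 < h := Real.exp_pos _
  have hh1 : h ≤ 1 := Real.exp_le_one_iff.2 LA
  have hinv : 1 / h ≤ RE (L / 2) := by rw [hhd, Real.exp_neg]; simp
  have hhx : h * RE L = √x := by
    rw [← hexp, hhd, ← Real.exp_add]; congr 1; ring
  set M : ℝ := L ^ (n + 2) * √L with hM
  have hM1 : L ^ (n + 1) ≤ M := by
    have a2 : 1 ≤ √L := Real.one_le_sqrt.2 LA
    calc L ^ (n + 1) ≤ L ^ (n + 2) := pow_le_pow_right₀ LA (by omega)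
      _ ≤ M := le_mul_of_one_le_right PA a2
  have hpoly : h * (B * (1 + (L + 1)) ^ (n + 1) * RE (L + 1)) ≤
      (B * 2 ^ (n + 1) * RE 1) * (√x * M) := by
    have a1 : (1 + (L + 1)) ^ (n + 1) ≤ 2 ^ (n + 1) * M := by
      calc (1 + (L + 1)) ^ (n + 1) ≤ (2 * L) ^ (n + 1) := by gcongr; linarith
        _ = 2 ^ (n + 1) * L ^ (n + 1) := mul_pow _ _ _
        _ ≤ _ := by gcongr
    rw [Real.exp_add]
    calc h * (B * (1 + (L + 1)) ^ (n + 1) * (RE L * RE 1)) =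
        B * (1 + (L + 1)) ^ (n + 1) * RE 1 * (h * RE L) := by ring
      _ ≤ B * (2 ^ (n + 1) * M) * RE 1 * (h * RE L) := by gcongr
      _ = _ := by rw [hhx]; ring
  set S : ℝ := ∑ m ∈ Icc 1 ⌊x⌋₊, fc n m with hS
  obtain ⟨s1, s2⟩ := fR_sandwich n hx1 hh
  rw [← hLd, ← hS] at s1 s2
  set M0 := pM0 C A n L with hM0
  set E : ℝ := (K + B * 2 ^ (n + 1) * RE 1) * (√x * M) with hE
  have d1 : ‖((fR n (L + h) - fR n L : ℝ) : ℂ) - h * M0‖ ≤ h * E := by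
    have t1 := hD L L h LA le_rfl hh hh1 hinv
    have t2 := pM_diff C A n hBb (a := L) (h := h) (c := L) (X := L + 1) LA hh (Or.inl rfl)
      LA
    have t3 := mul_le_mul_of_nonneg_left hpoly hh.le
    have e : ((fR n (L + h) - fR n L : ℝ) : ℂ) - h * M0 =
      (((fR n (L + h) : ℂ) - pM C A n (L + h)) - ((fR n L : ℂ) - pM C A n L)) +
      (pM C A n (L + h) - pM C A n L - h * pM0 C A n L) := by push_cast; ring
    rw [e]
    refine (norm_add_le _ _).trans ?_
    rw [hexp] at t1
    have : h * E = K * (h * (√x * M)) + h * ((B * 2 ^ (n + 1) * RE 1) * (√x * M)) := by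
      rw [hE]; ring
    linarith
  have d2 : ‖((fR n L - fR n (L - h) : ℝ) : ℂ) - h * M0‖ ≤ h * E := by
    have t1 := hD L (L - h) h LA LA hh hh1 hinv
    have t2 := pM_diff C A n hBb (a := L - h) (h := h) (c := L) (X := L + 1) LA hh
      (Or.inr (by ring)) LA
    have t3 := mul_le_mul_of_nonneg_left hpoly hh.le
    rw [sub_add_cancel] at t1 t2
    have e : ((fR n L - fR n (L - h) : ℝ) : ℂ) - h * M0 =
      (((fR n L : ℂ) - pM C A n L) - ((fR n (L - h) : ℂ) - pM C A n (L - h))) +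
      (pM C A n L - pM C A n (L - h) - h * pM0 C A n L) := by push_cast; ring
    rw [e]
    refine (norm_add_le _ _).trans ?_
    rw [hexp] at t1
    have : h * E = K * (h * (√x * M)) + h * ((B * 2 ^ (n + 1) * RE 1) * (√x * M)) := by
      rw [hE]; ring
    linarith
  have d3 : (fR n (L + h) - fR n L) - (fR n L - fR n (L - h)) ≤ 2 * (h * E) := by
    have : ‖(((fR n (L + h) - fR n L) - (fR n L - fR n (L - h)) : ℝ) : ℂ)‖ ≤ h * E + h * E := by
      have e : (((fR n (L + h) - fR n L) - (fR n L - fR n (L - h)) : ℝ) : ℂ) =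
        (((fR n (L + h) - fR n L : ℝ) : ℂ) - h * M0) - (((fR n L - fR n (L - h) : ℝ) : ℂ) - h * M0) := by
        push_cast; ring
      rw [e]
      exact (norm_sub_le _ _).trans (add_le_add d1 d2)
    rw [norm_real] at this
    have := (le_abs_self _).trans this
    linarith
  have d4 : ‖(h : ℂ) * ((S : ℂ) - M0)‖ ≤ 3 * (h * E) := by
    have e : (h : ℂ) * ((S : ℂ) - M0) = ((h * S - (fR n L - fR n (L - h)) : ℝ) : ℂ) +
      (((fR n L - fR n (L - h) : ℝ) : ℂ) - h * M0) := by push_cast; ring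
    rw [e]
    refine (norm_add_le _ _).trans ?_
    rw [norm_real, Real.norm_of_nonneg LA]
    linarith
  rw [norm_mul, norm_real, Real.norm_of_nonneg hh.le] at d4
  have : h * ‖(S : ℂ) - M0‖ ≤ h * (3 * E) := LA
  have := le_of_mul_le_mul_left this hh
  rw [hE] at this
  linarith

/-! ### Identification with the main term -/

lemma pM0_eq (C A : ℕ → ℂ) (n : ℕ) : ∃ c0 : ℂ, ∀ X : ℝ, pM0 C A n X =
    cexp X * ((1 / ((n : ℂ) + 1)) * (X : ℂ) ^ (n + 1) + (∑ k ∈ range (n + 1),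
        (n.choose k : ℂ) * (-1 : ℂ) ^ k * (k ! : ℂ) *
          (-1 + ∑ j ∈ range (k + 1), (-1 : ℂ) ^ j * C j) * (X : ℂ) ^ (n - k)) +
        (-1) ^ (n + 1) * (n ! : ℂ) * A n) + c0 := by
  set c : ℕ → ℂ := fun k => -1 + ∑ j ∈ range (k + 1), (-1 : ℂ) ^ j * C j with hc
  set D : ℕ → ℂ := fun k => (n.descFactorial k : ℂ) with hD
  have hDc : ∀ k, (n.choose k : ℂ) * (k ! : ℂ) = D k := by
    intro k
    rw [hD]; simp only []
    rw [Nat.descFactorial_eq_factorial_mul_choose]; push_cast; ring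
  have hDf : ∀ k ∈ range (n + 1), (n ! : ℂ) * ((n - k).factorial : ℂ)⁻¹ = D k := by
    intro k hk
    have hk' : k ≤ n := by rw [mem_range] at hk; omega
    have h1 := Nat.factorial_mul_descFactorial hk'
    have h2 : ((n - k).factorial : ℂ) ≠ 0 := by exact_mod_cast (n - k).factorial_ne_zero
    rw [← h1]; push_cast; field_simp; rfl
  have hDs : ∀ k, D k * ((n - k : ℕ) : ℂ) = D (k + 1) := by
    intro k
    rw [hD]; simp only []
    rw [Nat.descFactorial_succ]; push_cast; ring
  set q : ℝ → ℂ := fun X => (1 / ((n : ℂ) + 1)) * (X : ℂ) ^ (n + 1) + (∑ k ∈ range (n + 1),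
        D k * (-1 : ℂ) ^ k * c k * (X : ℂ) ^ (n - k)) + (-1) ^ (n + 1) * (n ! : ℂ) * A n with hq
  have hn1 : (n : ℂ) + 1 ≠ 0 := by exact_mod_cast (Nat.succ_ne_zero n)
  have hpow : ∀ (k : ℕ) (X : ℝ), HasDerivAt (fun X : ℝ => (X : ℂ) ^ k) ((k : ℂ) * (X : ℂ) ^ (k - 1)) X := by
    intro k X
    have := (Complex.ofRealCLM.hasDerivAt (x := X)).fun_pow k
    simpa using this
  have hqd : ∀ X : ℝ, HasDerivAt q ((1 / ((n : ℂ) + 1)) * (((n + 1 : ℕ) : ℂ) * (X : ℂ) ^ (n + 1 - 1)) +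
      ∑ k ∈ range (n + 1), D k * (-1 : ℂ) ^ k * c k * (((n - k : ℕ) : ℂ) * (X : ℂ) ^ (n - k - 1))) X := by
    intro X
    refine HasDerivAt.add_const _ (HasDerivAt.add ((hpow _ X).const_mul _) ?_)
    exact HasDerivAt.fun_sum fun k _ => (hpow _ X).const_mul _
  have hsum : ∀ X : ℝ, q X + ((1 / ((n : ℂ) + 1)) * (((n + 1 : ℕ) : ℂ) * (X : ℂ) ^ (n + 1 - 1)) +
      ∑ k ∈ range (n + 1), D k * (-1 : ℂ) ^ k * c k * (((n - k : ℕ) : ℂ) * (X : ℂ) ^ (n - k - 1))) =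
      pp C A n X := by
    intro X
    have e1 : ∑ k ∈ range (n + 1), D k * (-1 : ℂ) ^ k * c k * (((n - k : ℕ) : ℂ) * (X : ℂ) ^ (n - k - 1)) =
      ∑ k ∈ range n, D (k + 1) * (-1 : ℂ) ^ k * c k * (X : ℂ) ^ (n - (k + 1)) := by
      rw [sum_range_succ]
      simp only [Nat.sub_self, Nat.cast_zero, zero_mul, mul_zero, add_zero]
      refine sum_congr rfl fun k _ => ?_
      rw [← hDs k, Nat.sub_sub]; ring
    have e2 : ∑ j ∈ range (n + 1), (n ! : ℂ) * C j * (((n - j).factorial : ℂ)⁻¹ * (X : ℂ) ^ (n - j))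
      = ∑ j ∈ range (n + 1), D j * C j * (X : ℂ) ^ (n - j) := by
      refine sum_congr rfl fun j hj => ?_
      rw [← hDf j hj]; ring
    have hf : (n ! : ℂ) * ((n + 1).factorial : ℂ)⁻¹ = 1 / ((n : ℂ) + 1) := by
      have : (n ! : ℂ) ≠ 0 := by exact_mod_cast n.factorial_ne_zero
      rw [Nat.factorial_succ]; push_cast; field_simp
    have hD0 : D 0 = 1 := by simp [hD]
    have hc0 : c 0 = -1 + C 0 := by simp [hc]
    have e3 : ∑ k ∈ range n, (D (k + 1) * (-1 : ℂ) ^ (k + 1) * c (k + 1) * (X : ℂ) ^ (n - (k + 1)) +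
       D (k + 1) * (-1 : ℂ) ^ k * c k * (X : ℂ) ^ (n - (k + 1))) =
       ∑ k ∈ range n, D (k + 1) * C (k + 1) * (X : ℂ) ^ (n - (k + 1)) := by
      refine sum_congr rfl fun k _ => ?_
      have hcs : c (k + 1) = c k + (-1) ^ (k + 1) * C (k + 1) := by
        rw [hc]; simp only []
        rw [sum_range_succ _ (k + 1)]; ring
      have hs : ((-1 : ℂ) ^ k) * (-1) ^ k = 1 := by rw [← mul_pow]; simp
      rw [hcs, pow_succ]
      linear_combination (D (k + 1) * C (k + 1) * (X : ℂ) ^ (n - (k + 1))) * hs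
    rw [hq]
    simp only []
    rw [pp, e1, e2, ← mul_assoc (n ! : ℂ) (((n + 1).factorial : ℂ)⁻¹), hf, sum_range_succ', sum_range_succ' _ n, ← e3, sum_add_distrib, hD0, hc0]
    have h5 : (1 / ((n : ℂ) + 1)) * (((n + 1 : ℕ) : ℂ) * (X : ℂ) ^ (n + 1 - 1)) = (X : ℂ) ^ n := by
      push_cast; field_simp
    rw [h5]
    simp only [Nat.sub_zero, pow_zero]
    ring
  have hd : ∀ X : ℝ, HasDerivAt (fun X : ℝ => cexp X * q X) (pp C A n X * cexp X) X := by
    intro X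
    have h1 : HasDerivAt (fun X : ℝ => cexp (X : ℂ)) (cexp X * 1) X :=
      (Complex.ofRealCLM.hasDerivAt (x := X)).cexp
    refine (h1.mul (hqd X)).congr_deriv ?_
    rw [← hsum X]; ring
  refine ⟨-(cexp (0 : ℝ) * q 0), fun X => ?_⟩
  have hcont : Continuous (fun X : ℝ => pp C A n X * cexp X) := by
    have := pp_continuous C A n
    fun_prop
  rw [pM0, integral_eq_sub_of_hasDerivAt (fun X _ => hd X)
    (hcont.intervalIntegrable _ _), sub_eq_add_neg]
  congr 2
  rw [hq]; simp only []
  congr 2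
  refine sum_congr rfl fun k _ => ?_
  rw [← hDc k]; ring

lemma S_mainTerm (hRH : RiemannHypothesis) {C A : ℕ → ℂ} (n : ℕ) (hn : 1 ≤ n)
    (hC : HC(C))
    (hA : HA(A)) :
    ∃ K > (0 : ℝ), ∀ T : ℝ, RE 12 ≤ T →
      ‖(-1) ^ (n + 1) * ((∑ m ∈ Icc 1 ⌊T / (2 * π)⌋₊, fc n m : ℝ) : ℂ) - mainTerm C A n T‖ ≤
        K * (√T * (RL T ^ (n + 2) * √(RL T))) := by
  obtain ⟨K, hK, hS⟩ := S_asymp hRH n hn hC hA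
  obtain ⟨c0, hc0⟩ := pM0_eq C A n
  refine ⟨K + ‖c0‖, by positivity, fun T hT => ?_⟩
  set x := T / (2 * π) with hx
  have hT0 : 0 < T := (Real.exp_pos _).trans_le hT
  have hpi := Real.pi_gt_three
  have hpi4 := Real.pi_lt_four
  have hx9 : RE 9 ≤ x := by
    rw [hx, le_div_iff₀ PA]
    refine le_trans ?_ hT
    rw [show (12 : ℝ) = 9 + 3 by norm_num, Real.exp_add]
    have : (8 : ℝ) ≤ RE 3 := by
      have h1 : (2 : ℝ) ≤ RE 1 := by have := Real.add_one_le_exp (1 : ℝ); linarith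
      calc (8 : ℝ) = 2 ^ 3 := NA
        _ ≤ (RE 1) ^ 3 := by gcongr
        _ = RE 3 := by rw [← Real.exp_nat_mul]; norm_num
    gcongr
    linarith
  have hx0 : 0 < x := (Real.exp_pos _).trans_le hx9
  have hxT : x ≤ T := div_le_self hT0.le LA
  have hlog : RL x ≤ RL T := Real.log_le_log hx0 hxT
  have hlx : 9 ≤ RL x := (Real.le_log_iff_exp_le hx0).2 hx9
  have hmain : mainTerm C A n T = (-1) ^ (n + 1) * (pM0 C A n (RL x) - c0) := by
    have hex : cexp ((RL x : ℝ) : ℂ) = (x : ℂ) := by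
      rw [← Complex.ofReal_exp, Real.exp_log hx0]
    rw [hc0, hex, mainTerm, ← hx]
    have hs : ((-1 : ℂ) ^ (n + 1)) * (-1) ^ (n + 1) = 1 := by rw [← mul_pow]; simp
    have hxe : ((T / (2 * π) : ℝ) : ℂ) = (x : ℂ) := by rw [hx]
    have e : ∀ k : ℕ, (((T / (2 * π)) * RL x ^ k : ℝ) : ℂ) = (x : ℂ) * ((RL x : ℝ) : ℂ) ^ k := by
      intro k; rw [← hx]; push_cast; ring
    have es : ∑ k ∈ range (n + 1), (n.choose k : ℂ) * (-1 : ℂ) ^ k * (k ! : ℂ) *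
          (-1 + ∑ j ∈ range (k + 1), (-1 : ℂ) ^ j * C j) *
          ((x * RL x ^ (n - k) : ℝ) : ℂ) = (x : ℂ) * ∑ k ∈ range (n + 1), (n.choose k : ℂ) * (-1 : ℂ) ^ k * (k ! : ℂ) *
          (-1 + ∑ j ∈ range (k + 1), (-1 : ℂ) ^ j * C j) * ((RL x : ℝ) : ℂ) ^ (n - k) := by
      rw [mul_sum]
      refine sum_congr rfl fun k _ => ?_
      push_cast; ring
    rw [es]
    push_cast
    linear_combination (-(n ! : ℂ) * A n * x) * hs
  have h1 := hS x hx9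
  have hbig : (1 : ℝ) ≤ √T * (RL T ^ (n + 2) * √(RL T)) := by
    have a0 : 1 ≤ √T := Real.one_le_sqrt.2 (by linarith [Real.one_le_exp (show (0 : ℝ) ≤ 12 by norm_num)])
    have a1 : 1 ≤ RL T ^ (n + 2) := one_le_pow₀ LA
    have a2 : 1 ≤ √(RL T) := Real.one_le_sqrt.2 LA
    have a3 : 1 ≤ RL T ^ (n + 2) * √(RL T) := by nlinarith
    nlinarith
  have h2 : √x * (RL x ^ (n + 2) * √(RL x)) ≤ √T * (RL T ^ (n + 2) * √(RL T)) := by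
    have l1 : 0 ≤ RL T := LA
    have l2 : 0 ≤ RL x := LA
    gcongr
  rw [hmain]
  have e : (-1 : ℂ) ^ (n + 1) * ((∑ m ∈ Icc 1 ⌊x⌋₊, fc n m : ℝ) : ℂ) - (-1) ^ (n + 1) * (pM0 C A n (RL x) - c0) =
    (-1) ^ (n + 1) * ((((∑ m ∈ Icc 1 ⌊x⌋₊, fc n m : ℝ) : ℂ) - pM0 C A n (RL x)) + c0) := by ring
  rw [e]
  simp only [norm_mul, norm_pow, norm_neg, norm_one, one_pow, one_mul]
  refine (norm_add_le _ _).trans ?_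
  rw [add_mul]
  refine add_le_add (h1.trans (by gcongr)) ?_
  exact le_mul_of_one_le_right (norm_nonneg _) hbig

/-- integral over the boundary of a rectangle -/
noncomputable def RI (f : ℂ → ℂ) (a b t₀ T : ℝ) : ℂ :=
  (∫ x in a..b, f (x + t₀ * I)) - (∫ x in a..b, f (x + T * I)) +
    I * (∫ y in t₀..T, f (b + y * I)) - I * (∫ y in t₀..T, f (a + y * I))

/-- closed rectangle -/
def RR (a b t₀ T : ℝ) : Set ℂ := {s | (a ≤ s.re ∧ s.re ≤ b) ∧ t₀ ≤ s.im ∧ s.im ≤ T}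

/-- its boundary -/
def RB (a b t₀ T : ℝ) : Set ℂ :=
  {s | ((a ≤ s.re ∧ s.re ≤ b) ∧ t₀ ≤ s.im ∧ s.im ≤ T) ∧ (s.re = a ∨ s.re = b ∨ s.im = t₀ ∨ s.im = T)}

lemma RB_h {a b t₀ T t : ℝ} (htT : t₀ ≤ T) (ht : t = t₀ ∨ t = T) {x : ℝ} (hx : x ∈ Set.Icc a b) :
    (x + t * I : ℂ) ∈ RB a b t₀ T := by
  rcases ht with rfl | rfl <;> simp [RB, hx.1, hx.2, htT]

lemma RB_v {a b t₀ T u : ℝ} (hab : a ≤ b) (hu : u = a ∨ u = b) {y : ℝ} (hy : y ∈ Set.Icc t₀ T) :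
    (u + y * I : ℂ) ∈ RB a b t₀ T := by
  rcases hu with rfl | rfl <;> simp [RB, hy.1, hy.2, hab]

lemma RC_h {f : ℂ → ℂ} {a b t₀ T t : ℝ} (hab : a ≤ b) (htT : t₀ ≤ T) (ht : t = t₀ ∨ t = T)
    (hf : ContinuousOn f (RB a b t₀ T)) :
    ContinuousOn (fun x : ℝ => f (x + t * I)) (Set.uIcc a b) := by
  rw [Set.uIcc_of_le hab]
  exact hf.comp FA fun x hx => RB_h htT ht hx

lemma RC_v {f : ℂ → ℂ} {a b t₀ T u : ℝ} (hab : a ≤ b) (htT : t₀ ≤ T) (hu : u = a ∨ u = b)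
    (hf : ContinuousOn f (RB a b t₀ T)) :
    ContinuousOn (fun y : ℝ => f (u + y * I)) (Set.uIcc t₀ T) := by
  rw [Set.uIcc_of_le htT]
  exact hf.comp FA fun x hx => RB_v hab hu hx

lemma RI_congr {f g : ℂ → ℂ} {a b t₀ T : ℝ} (hab : a ≤ b) (htT : t₀ ≤ T)
    (h : ∀ s ∈ RB a b t₀ T, f s = g s) : RI f a b t₀ T = RI g a b t₀ T := by
  unfold RI
  congr 1; congr 1; congr 1
  · refine intervalIntegral.integral_congr fun x hx => ?_
    rw [Set.uIcc_of_le hab] at hx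
    exact h _ (RB_h htT (Or.inl rfl) hx)
  · refine intervalIntegral.integral_congr fun x hx => ?_
    rw [Set.uIcc_of_le hab] at hx
    exact h _ (RB_h htT (Or.inr rfl) hx)
  · congr 1
    refine intervalIntegral.integral_congr fun x hx => ?_
    rw [Set.uIcc_of_le htT] at hx
    exact h _ (RB_v hab (Or.inr rfl) hx)
  · congr 1
    refine intervalIntegral.integral_congr fun x hx => ?_
    rw [Set.uIcc_of_le htT] at hx
    exact h _ (RB_v hab (Or.inl rfl) hx)

lemma RI_add {f g : ℂ → ℂ} {a b t₀ T : ℝ} (hab : a ≤ b) (htT : t₀ ≤ T)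
    (hf : ContinuousOn f (RB a b t₀ T)) (hg : ContinuousOn g (RB a b t₀ T)) :
    RI (fun s => f s + g s) a b t₀ T = RI f a b t₀ T + RI g a b t₀ T := by
  unfold RI
  rw [intervalIntegral.integral_add (RC_h hab htT (Or.inl rfl) hf).intervalIntegrable
      (RC_h hab htT (Or.inl rfl) hg).intervalIntegrable,
    intervalIntegral.integral_add (RC_h hab htT (Or.inr rfl) hf).intervalIntegrable
      (RC_h hab htT (Or.inr rfl) hg).intervalIntegrable,
    intervalIntegral.integral_add (RC_v hab htT (Or.inl rfl) hf).intervalIntegrable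
      (RC_v hab htT (Or.inl rfl) hg).intervalIntegrable,
    intervalIntegral.integral_add (RC_v hab htT (Or.inr rfl) hf).intervalIntegrable
      (RC_v hab htT (Or.inr rfl) hg).intervalIntegrable]
  ring

lemma RI_const_mul (k : ℂ) (f : ℂ → ℂ) (a b t₀ T : ℝ) :
    RI (fun s => k * f s) a b t₀ T = k * RI f a b t₀ T := by
  simp only [RI, intervalIntegral.integral_const_mul]
  ring

lemma hasDerivAt_hline {U : ℂ → ℂ} {u : ℂ} {t x : ℝ} (h : HasDerivAt U u (x + t * I)) :
    HasDerivAt (fun x : ℝ => U (x + t * I)) u x := by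
  have h1 : HasDerivAt (fun x : ℝ => (x + t * I : ℂ)) 1 x :=
    (Complex.ofRealCLM.hasDerivAt (x := x)).add_const _
  exact (HasDerivAt.comp x h h1).congr_deriv (mul_one u)

lemma hasDerivAt_vline {U : ℂ → ℂ} {u : ℂ} {σ y : ℝ} (h : HasDerivAt U u (σ + y * I)) :
    HasDerivAt (fun y : ℝ => U (σ + y * I)) (I * u) y := by
  have h1 : HasDerivAt (fun y : ℝ => (σ + y * I : ℂ)) (1 * I) y :=
    ((Complex.ofRealCLM.hasDerivAt (x := y)).mul_const I).const_add _
  have := HasDerivAt.comp y h h1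
  refine this.congr_deriv (by ring)

lemma RI_deriv {U u : ℂ → ℂ} {a b t₀ T : ℝ} (hab : a ≤ b) (htT : t₀ ≤ T)
    (hU : ∀ s ∈ RB a b t₀ T, HasDerivAt U (u s) s) (hu : ContinuousOn u (RB a b t₀ T)) :
    RI u a b t₀ T = 0 := by
  have h1 : ∀ t, t = t₀ ∨ t = T → ∫ x in a..b, u (x + t * I) = U (b + t * I) - U (a + t * I) := by
    intro t ht
    refine integral_eq_sub_of_hasDerivAt (f := fun x : ℝ => U (x + t * I)) (fun x hx => ?_)
      (RC_h hab htT ht hu).intervalIntegrable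
    rw [Set.uIcc_of_le hab] at hx
    exact hasDerivAt_hline (hU _ (RB_h htT ht hx))
  have h2 : ∀ v, v = a ∨ v = b → I * ∫ y in t₀..T, u (v + y * I) = U (v + T * I) - U (v + t₀ * I) := by
    intro v hv
    rw [← intervalIntegral.integral_const_mul]
    refine integral_eq_sub_of_hasDerivAt (f := fun y : ℝ => U (v + y * I)) (fun x hx => ?_)
      (ContinuousOn.intervalIntegrable ((RC_v hab htT hv hu).const_smul I))
    rw [Set.uIcc_of_le htT] at hx
    exact hasDerivAt_vline (hU _ (RB_v hab hv hx))
  rw [RI, h1 t₀ (Or.inl rfl), h1 T (Or.inr rfl), h2 a (Or.inl rfl), h2 b (Or.inr rfl)]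
  ring

lemma RI_zero {f : ℂ → ℂ} {a b t₀ T : ℝ} (hab : a ≤ b) (htT : t₀ ≤ T)
    (hf : DifferentiableOn ℂ f (RR a b t₀ T)) : RI f a b t₀ T = 0 := by
  have := Complex.integral_boundary_rect_eq_zero_of_differentiableOn f (a + t₀ * I) (b + T * I) (by
    refine hf.mono fun s hs => ?_
    rw [Complex.mem_reProdIm] at hs
    simpa [RR, Set.uIcc_of_le hab, Set.uIcc_of_le htT] using hs)
  simpa [RI] using this

lemma RI_inv {a b t₀ T : ℝ} {ρ : ℂ} (h1 : a < ρ.re) (h2 : ρ.re < b) (h3 : t₀ < ρ.im) (h4 : ρ.im < T) :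
    RI (fun s => (s - ρ)⁻¹) a b t₀ T = 2 * π * I := by
  have hd : ∀ s : ℂ, s - ρ ∈ slitPlane → HasDerivAt (fun s => Complex.log (s - ρ)) (s - ρ)⁻¹ s := by
    intro s hs
    have := ((hasDerivAt_id s).sub_const ρ).clog (by simpa using hs)
    simpa using this
  have hd' : ∀ s : ℂ, -(s - ρ) ∈ slitPlane → HasDerivAt (fun s => Complex.log (-(s - ρ))) (s - ρ)⁻¹ s := by
    intro s hs
    have := (((hasDerivAt_id s).sub_const ρ).neg).clog (by simpa using hs)
    refine this.congr_deriv ?_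
    simp only [id]
    change -1 / -(s - ρ) = _
    rw [neg_div_neg_eq, one_div]
  have hne : ∀ s : ℂ, s.re ≠ ρ.re ∨ s.im ≠ ρ.im → s - ρ ≠ 0 := by
    intro s hs h0
    rw [sub_eq_zero] at h0
    subst h0; simp at hs
  have hc : ∀ g : ℝ → ℂ, Continuous g → ∀ u v : ℝ, (∀ x, (g x).re ≠ ρ.re ∨ (g x).im ≠ ρ.im) →
      IntervalIntegrable (fun x => (g x - ρ)⁻¹) volume u v := by
    intro g hg u v h
    refine Continuous.intervalIntegrable ?_ _ _
    exact Continuous.inv₀ FA fun x => hne _ (h x)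
  have e1 : ∀ t : ℝ, t ≠ ρ.im → ∫ x in a..b, ((x + t * I : ℂ) - ρ)⁻¹ =
      Complex.log ((b + t * I : ℂ) - ρ) - Complex.log ((a + t * I : ℂ) - ρ) := by
    intro t ht
    refine integral_eq_sub_of_hasDerivAt
      (f := fun x : ℝ => Complex.log ((x + t * I : ℂ) - ρ)) (fun x hx => ?_) (hc _ FA _ _ (by
        intro x; right; simpa using ht))
    refine hasDerivAt_hline (U := fun s => Complex.log (s - ρ)) (hd _ ?_)
    rw [mem_slitPlane_iff]; right; simpa [sub_eq_zero] using ht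
  have e2 : I * ∫ y in t₀..T, ((b + y * I : ℂ) - ρ)⁻¹ =
      Complex.log ((b + T * I : ℂ) - ρ) - Complex.log ((b + t₀ * I : ℂ) - ρ) := by
    rw [← intervalIntegral.integral_const_mul]
    refine integral_eq_sub_of_hasDerivAt
      (f := fun x : ℝ => Complex.log ((b + x * I : ℂ) - ρ)) (fun x hx => ?_)
      (IntervalIntegrable.const_mul (hc _ FA _ _ (by
        intro x; left; simpa using h2.ne')) I)
    refine hasDerivAt_vline (U := fun s => Complex.log (s - ρ)) (hd _ ?_)
    rw [mem_slitPlane_iff]; left; simpa using h2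
  have e3 : I * ∫ y in t₀..T, ((a + y * I : ℂ) - ρ)⁻¹ =
      Complex.log (-((a + T * I : ℂ) - ρ)) - Complex.log (-((a + t₀ * I : ℂ) - ρ)) := by
    rw [← intervalIntegral.integral_const_mul]
    refine integral_eq_sub_of_hasDerivAt
      (f := fun x : ℝ => Complex.log (-((a + x * I : ℂ) - ρ))) (fun x hx => ?_)
      (IntervalIntegrable.const_mul (hc _ FA _ _ (by
        intro x; left; simpa using h1.ne)) I)
    refine hasDerivAt_vline (U := fun s => Complex.log (-(s - ρ))) (hd' _ ?_)
    rw [mem_slitPlane_iff]; left; simpa using h1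
  have f1 : Complex.log (-((a + T * I : ℂ) - ρ)) = Complex.log ((a + T * I : ℂ) - ρ) - π * I := by
    rw [Complex.log, Complex.log, norm_neg, Complex.arg_neg_eq_arg_sub_pi_of_im_pos (by simpa using h4)]
    push_cast; ring
  have f2 : Complex.log (-((a + t₀ * I : ℂ) - ρ)) = Complex.log ((a + t₀ * I : ℂ) - ρ) + π * I := by
    rw [Complex.log, Complex.log, norm_neg, Complex.arg_neg_eq_arg_add_pi_of_im_neg (by simpa using h3)]
    push_cast; ring
  rw [RI, e1 _ h3.ne, e1 _ h4.ne', e2, e3, f1, f2]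
  ring

/-- Cauchy for one pole -/
lemma RI_pole {f : ℂ → ℂ} {a b t₀ T : ℝ} {ρ : ℂ} (hf : DifferentiableOn ℂ f {s | 0 < s.im}) (h0 : 0 < t₀)
    (h1 : a < ρ.re)
    (h2 : ρ.re < b) (h3 : t₀ < ρ.im) (h4 : ρ.im < T) :
    RI (fun s => f s * (s - ρ)⁻¹) a b t₀ T = 2 * π * I * f ρ := by
  have hne : ∀ s ∈ RB a b t₀ T, s - ρ ≠ 0 := by
    rintro s ⟨_, h⟩ h9
    rw [sub_eq_zero] at h9; subst h9
    rcases h with h | h | h | h <;> linarith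
  have ho : IsOpen {s : ℂ | 0 < s.im} := isOpen_lt continuous_const Complex.continuous_im
  have hdd : DifferentiableOn ℂ (dslope f ρ) {s | 0 < s.im} := by
    rwa [Complex.differentiableOn_dslope]
    exact ho.mem_nhds (h0.trans h3)
  have hsR : RR a b t₀ T ⊆ {s : ℂ | 0 < s.im} := fun s hs => h0.trans_le hs.2.1
  have hsB : RB a b t₀ T ⊆ {s : ℂ | 0 < s.im} := fun s hs => h0.trans_le hs.1.2.1
  have hab : a ≤ b := LA
  have htT : t₀ ≤ T := LA
  rw [RI_congr (g := fun s => dslope f ρ s + f ρ * (s - ρ)⁻¹) hab htT, RI_add hab htT, RI_const_mul,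
    RI_inv h1 h2 h3 h4, RI_zero hab htT (hdd.mono hsR)]
  · ring
  · exact (hdd.mono hsB).continuousOn
  · exact continuousOn_const.mul (ContinuousOn.inv₀ FA hne)
  · intro s hs
    have := hne s hs
    have h5 := sub_smul_dslope f ρ s
    rw [smul_eq_mul] at h5
    field_simp
    linear_combination -h5

lemma zprod_split (Z : Multiset ℂ) (ρ : ℂ) :
    ∃ W : Multiset ℂ, ρ ∉ W ∧ ∀ s, zprod Z s = (s - ρ) ^ (Z.count ρ) * zprod W s := by
  induction Z using Multiset.induction with
  | empty => exact ⟨0, by simp, by simp⟩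
  | cons a Z ih =>
    obtain ⟨W, h1, h2⟩ := ih
    by_cases ha : ρ = a
    · refine ⟨W, h1, fun s => ?_⟩
      rw [zprod_cons, h2, ← ha, Multiset.count_cons_self, pow_succ]; ring
    · refine ⟨a ::ₘ W, by simp [ha, h1], fun s => ?_⟩
      rw [zprod_cons, h2, zprod_cons, Multiset.count_cons_of_ne ha]; ring

lemma zeta_zero_im (hRH : RiemannHypothesis) {s : ℂ} (h : ZZ s = 0) (hi : s.im ≠ 0) :
    s.re = 1 / 2 := by
  refine hRH s h ?_ ?_
  · rintro ⟨n, rfl⟩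
    simp at hi
  · rintro rfl; simp at hi

lemma zero_order_count {Z : Multiset ℂ} {g : ℂ → ℂ} (hg : Differentiable ℂ g) {ρ : ℂ} (hρ : ρ ≠ 1)
    (h : ∀ s, riemannZeta₁ s = zprod Z s * g s) (hg0 : g ρ ≠ 0) : zetaZeroOrder ρ = Z.count ρ := by
  have han : AnalyticAt ℂ ZZ ρ := zeta_analyticAt hρ
  obtain ⟨W, h1, h2⟩ := zprod_split Z ρ
  have ho : analyticOrderAt ZZ ρ = (Z.count ρ : ℕ) := by
    rw [han.analyticOrderAt_eq_natCast]
    refine ⟨fun s => zprod W s * g s / (s - 1), ?_, ?_, ?_⟩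
    · have a1 := (differentiable_zprod W).analyticAt ρ
      have a2 := hg.analyticAt ρ
      exact (a1.mul a2).div (analyticAt_id.sub analyticAt_const) (sub_ne_zero.2 hρ)
    · exact div_ne_zero (mul_ne_zero (zprod_ne_zero h1) hg0) (sub_ne_zero.2 hρ)
    · filter_upwards [isOpen_ne.mem_nhds hρ] with s hs
      have h3 := h s
      rw [zeta1_eq hs, h2] at h3
      have : s - 1 ≠ 0 := sub_ne_zero.2 hs
      rw [smul_eq_mul]
      field_simp
      linear_combination h3
  rw [analyticOrderAt_eq_nat_iff_iteratedDeriv_eq_zero han] at ho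
  refine le_antisymm (Nat.sInf_le ho.2) ?_
  refine le_csInf ⟨_, ho.2⟩ fun k hk => ?_
  by_contra hlt
  exact hk (ho.1 k (not_le.1 hlt))

lemma RI_zsm {f : ℂ → ℂ} {a b t₀ T : ℝ} (hf : DifferentiableOn ℂ f {s | 0 < s.im}) (h0 : 0 < t₀)
    (h1 : a < 1 / 2) (h2 : 1 / 2 < b) (hT : t₀ < T) (Z : Multiset ℂ)
    (hZ : ∀ ρ ∈ Z, (ρ.im < t₀ ∨ T < ρ.im) ∨ (ρ.re = 1 / 2 ∧ t₀ < ρ.im ∧ ρ.im < T)) :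
    ContinuousOn (fun s => f s * zsm Z 1 s) (RB a b t₀ T) ∧
    RI (fun s => f s * zsm Z 1 s) a b t₀ T =
      2 * π * I * (Z.map (fun ρ => if t₀ < ρ.im ∧ ρ.im < T then f ρ else 0)).sum := by
  have hsR : RR a b t₀ T ⊆ {s : ℂ | 0 < s.im} := fun s hs => h0.trans_le hs.2.1
  have hsB : RB a b t₀ T ⊆ {s : ℂ | 0 < s.im} := fun s hs => h0.trans_le hs.1.2.1
  induction Z using Multiset.induction with
  | empty => simp [zsm, RI, continuousOn_const]
  | cons ρ Z ih =>
    obtain ⟨ih1, ih2⟩ := ih fun x hx => hZ x (Multiset.mem_cons_of_mem hx)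
    have hρ := hZ ρ (Multiset.mem_cons_self _ _)
    have e : (fun s => f s * zsm (ρ ::ₘ Z) 1 s) = fun s => f s * (s - ρ)⁻¹ + f s * zsm Z 1 s := by
      funext s; rw [zsm_cons, pow_one]; ring
    have hne : ∀ s ∈ RB a b t₀ T, s - ρ ≠ 0 := by
      rintro s ⟨h8, h⟩ h9
      rw [sub_eq_zero] at h9; subst h9
      rcases hρ with (h' | h') | h'
      · linarith [h8.2.1]
      · linarith [h8.2.2]
      · rcases h with h | h | h | h <;> linarith
    have c1 : ContinuousOn (fun s => f s * (s - ρ)⁻¹) (RB a b t₀ T) :=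
      (hf.continuousOn.mono hsB).mul (ContinuousOn.inv₀ FA hne)
    rw [e]
    refine ⟨c1.add ih1, ?_⟩
    rw [RI_add LA hT.le c1 ih1, ih2, Multiset.map_cons, Multiset.sum_cons, mul_add]
    congr 1
    rcases hρ with h' | ⟨h', h''⟩
    · rw [if_neg (by rintro ⟨a1, a2⟩; rcases h' with h' | h' <;> linarith), mul_zero]
      refine RI_zero LA hT.le ((hf.mono hsR).mul (DifferentiableOn.inv FA ?_))
      intro s hs h9
      rw [sub_eq_zero] at h9; subst h9
      rcases h' with h' | h'
      · linarith [hs.2.1]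
      · linarith [hs.2.2]
    · rw [if_pos h'']
      exact RI_pole hf h0 LA LA h''.1 h''.2

lemma RB_zeta_ne (hRH : RiemannHypothesis) {a b t₀ T : ℝ} (h0 : 0 < t₀)
    (h1 : a < 1 / 2) (h2 : 1 / 2 < b) (hz : ∀ ρ, ZZ ρ = 0 → ρ.im ≠ t₀ ∧ ρ.im ≠ T) :
    ∀ s ∈ RB a b t₀ T, s ≠ 1 ∧ ZZ s ≠ 0 := by
  rintro s ⟨h8, h⟩
  have him : 0 < s.im := h0.trans_le h8.2.1
  refine ⟨?_, fun h9 => ?_⟩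
  · rintro rfl; simp at him
  · have := zeta_zero_im hRH h9 him.ne'
    rcases h with h | h | h | h
    · linarith
    · linarith
    · exact (hz s h9).1 h
    · exact (hz s h9).2 h

lemma RI_parts (hRH : RiemannHypothesis) (n : ℕ) {a b t₀ T : ℝ} (h0 : 0 < t₀)
    (h1 : a < 1 / 2) (h2 : 1 / 2 < b) (hT : t₀ < T)
    (hz : ∀ ρ, ZZ ρ = 0 → ρ.im ≠ t₀ ∧ ρ.im ≠ T) :
    RI (fun s => logDeriv ZZ s * iteratedDeriv n ZZ s) a b t₀ T =
      (-1) ^ n * RI (zF n) a b t₀ T := by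
  have hb := RB_zeta_ne hRH h0 h1 h2 hz
  have hA : ∀ k, ∀ s ∈ RB a b t₀ T, AnalyticAt ℂ (iteratedDeriv k LZ) s :=
    fun k s hs => iteratedDeriv_analyticAt k (logDeriv_zeta_analyticAt (hb s hs).1 (hb s hs).2)
  have hB : ∀ k, ∀ s ∈ RB a b t₀ T, AnalyticAt ℂ (iteratedDeriv k ZZ) s :=
    fun k s hs => iteratedDeriv_analyticAt k (zeta_analyticAt (hb s hs).1)
  have hc : ∀ j k, ContinuousOn (fun s => iteratedDeriv j LZ s *
      iteratedDeriv k ZZ s) (RB a b t₀ T) := fun j k s hs =>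
    ((hA j s hs).continuousAt.mul (hB k s hs).continuousAt).continuousWithinAt
  have step : ∀ j k, RI (fun s => iteratedDeriv j LZ s *
      iteratedDeriv (k + 1) ZZ s) a b t₀ T =
      - RI (fun s => iteratedDeriv (j + 1) LZ s *
      iteratedDeriv k ZZ s) a b t₀ T := by
    intro j k
    rw [eq_neg_iff_add_eq_zero, ← RI_add LA hT.le (hc _ _) (hc _ _)]
    refine RI_deriv (U := fun s => iteratedDeriv j LZ s *
      iteratedDeriv k ZZ s) LA hT.le (fun s hs => ?_) ((hc _ _).add (hc _ _))
    have d1 := (hA j s hs).differentiableAt.hasDerivAt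
    have d2 := (hB k s hs).differentiableAt.hasDerivAt
    rw [← iteratedDeriv_succ] at d1 d2
    exact (d1.mul d2).congr_deriv (by ring)
  have key : ∀ j, ∀ k, RI (fun s => iteratedDeriv k LZ s *
      iteratedDeriv j ZZ s) a b t₀ T = (-1) ^ j * RI (fun s => iteratedDeriv (k + j)
        LZ s * iteratedDeriv 0 ZZ s) a b t₀ T := by
    intro j
    induction j with
    | zero => intro k; simp
    | succ j ih =>
      intro k
      rw [step, ih, pow_succ, show k + 1 + j = k + (j + 1) by ring]; ring
  have := key n 0
  simp only [iteratedDeriv_zero, zero_add] at this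
  exact this

lemma zero_sum_contour (hRH : RiemannHypothesis) (n : ℕ) {a b t₀ T : ℝ} (h0 : 0 < t₀)
    (h1 : a < 1 / 2) (h2 : 1 / 2 < b) (hT : t₀ < T)
    (hz : ∀ ρ, ZZ ρ = 0 → ρ.im ≠ t₀ ∧ ρ.im ≠ T) :
    2 * π * I * (zetaZeroSum n T - zetaZeroSum n t₀) = (-1) ^ n * RI (zF n) a b t₀ T := by
  classical
  set f := iteratedDeriv n ZZ with hf
  have hsR : RR a b t₀ T ⊆ {s : ℂ | 0 < s.im} := fun s hs => h0.trans_le hs.2.1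
  have hsB : RB a b t₀ T ⊆ {s : ℂ | 0 < s.im} := fun s hs => h0.trans_le hs.1.2.1
  have hone : ∀ s : ℂ, 0 < s.im → s ≠ 1 := by rintro s hs rfl; simp at hs
  have hfd : DifferentiableOn ℂ f {s | 0 < s.im} := fun s hs =>
    (iteratedDeriv_analyticAt n (zeta_analyticAt (hone s hs))).differentiableAt.differentiableWithinAt
  have hc2 : riemannZeta₁ 2 ≠ 0 := by
    rw [zeta1_eq NA]
    exact mul_ne_zero NA (riemannZeta_ne_zero_of_one_le_re NA)
  obtain ⟨Z, g, hg, hZ, hfac, hg0⟩ := exists_factor differentiable_riemannZeta₁ hc2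
    (r := |a| + |b| + T + 4) (by linarith [abs_nonneg a, abs_nonneg b])
  have hball : ∀ s : ℂ, |s.re| ≤ |a| + |b| + 1 → |s.im| ≤ T →
      s ∈ CB (2 : ℂ) (|a| + |b| + T + 4) := by
    intro s h3 h4
    rw [mem_closedBall_iff_norm]
    refine (norm_le_abs_re_add_abs_im _).trans ?_
    have : |(s - 2).re| ≤ |s.re| + 2 := by
      simpa using abs_sub s.re 2
    have h5 : (s - 2).im = s.im := by simp
    rw [h5]; linarith
  have hRball : ∀ s ∈ RR a b t₀ T, s ∈ CB (2 : ℂ) (|a| + |b| + T + 4) := by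
    intro s hs
    refine hball s ?_ (abs_le.2 ⟨by linarith [hs.2.1], hs.2.2⟩)
    have h5 := hs.1
    rw [abs_le]
    constructor
    · linarith [neg_abs_le a, abs_nonneg b]
    · linarith [le_abs_self b, abs_nonneg a]
  have hZ0 : ∀ ρ ∈ Z, riemannZeta₁ ρ = 0 := by
    intro ρ hρ
    rw [hfac, zprod, Multiset.prod_eq_zero, zero_mul]
    exact Multiset.mem_map.2 ⟨ρ, hρ, sub_self ρ⟩
  have hZz : ∀ ρ ∈ Z, ρ.im ≠ 0 → ZZ ρ = 0 := by
    intro ρ hρ hi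
    have h3 := hZ0 ρ hρ
    have h4 : ρ ≠ 1 := by rintro rfl; simp at hi
    rw [zeta1_eq h4] at h3
    exact (mul_eq_zero.1 h3).resolve_left (sub_ne_zero.2 h4)
  have hcase : ∀ ρ ∈ Z, (ρ.im < t₀ ∨ T < ρ.im) ∨ (ρ.re = 1 / 2 ∧ t₀ < ρ.im ∧ ρ.im < T) := by
    intro ρ hρ
    by_cases hlt : ρ.im < t₀
    · exact Or.inl (Or.inl hlt)
    by_cases hgt : T < ρ.im
    · exact Or.inl (Or.inr hgt)
    push Not at hlt hgt
    have hi : ρ.im ≠ 0 := LA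
    have h3 := hZz ρ hρ hi
    have h4 := hz ρ h3
    exact Or.inr ⟨zeta_zero_im hRH h3 hi, lt_of_le_of_ne hlt h4.1.symm, lt_of_le_of_ne hgt h4.2⟩
  have hb := RB_zeta_ne hRH h0 h1 h2 hz
  obtain ⟨c1, e1⟩ := RI_zsm hfd h0 h1 h2 hT Z hcase
  -- the sums
  have hset : ∀ t, t ≤ T → zetaZeroSum n t =
      ∑ ρ ∈ Z.toFinset with (0 < ρ.im ∧ ρ.im ≤ t), (Z.count ρ : ℂ) * f ρ := by
    intro t ht
    have : {ρ : ℂ | IsNontrivialZero ρ ∧ 0 < ρ.im ∧ ρ.im ≤ t} =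
        ↑(Z.toFinset.filter (fun ρ => 0 < ρ.im ∧ ρ.im ≤ t)) := by
      ext ρ
      simp only [Set.mem_ofPred_eq, coe_filter, Multiset.mem_toFinset]
      constructor
      · rintro ⟨h3, h4⟩
        refine ⟨?_, h4⟩
        by_contra hn
        have h5 := zeta_zero_im hRH h3.1 h4.1.ne'
        have h6 : ρ ∈ CB (2 : ℂ) (|a| + |b| + T + 4) := by
          refine hball ρ ?_ (abs_le.2 ⟨by linarith [h4.1], by linarith [h4.2]⟩)
          rw [h5, abs_of_pos NA]
          linarith [abs_nonneg a, abs_nonneg b]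
        have h7 := hfac ρ
        rw [zeta1_eq (hone ρ h4.1), h3.1, mul_zero] at h7
        exact mul_ne_zero (zprod_ne_zero hn) (hg0 ρ h6) h7.symm
      · rintro ⟨h3, h4⟩
        have h5 := hZz ρ h3 h4.1.ne'
        have h6 := zeta_zero_im hRH h5 h4.1.ne'
        exact ⟨⟨h5, by rw [h6]; norm_num, by rw [h6]; norm_num⟩, h4⟩
    rw [zetaZeroSum, this, finsum_mem_coe_finset]
    refine sum_congr rfl fun ρ hρ => ?_
    rw [Finset.mem_filter, Multiset.mem_toFinset] at hρ
    rw [zero_order_count hg (hone ρ hρ.2.1) hfac (hg0 ρ (hZ ρ hρ.1))]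
  have hsum : zetaZeroSum n T - zetaZeroSum n t₀ =
      (Z.map (fun ρ => if t₀ < ρ.im ∧ ρ.im < T then f ρ else 0)).sum := by
    rw [hset T le_rfl, hset t₀ hT.le, Finset.sum_multiset_map_count, Finset.sum_filter,
      Finset.sum_filter, ← Finset.sum_sub_distrib]
    refine sum_congr rfl fun ρ hρ => ?_
    rw [Multiset.mem_toFinset] at hρ
    rw [nsmul_eq_mul]
    rcases hcase ρ hρ with (h' | h') | ⟨_, h3, h4⟩
    · rw [if_neg (c := t₀ < ρ.im ∧ ρ.im < T) (by rintro ⟨_, _⟩; linarith)]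
      by_cases hp : 0 < ρ.im
      · rw [if_pos ⟨hp, by linarith⟩, if_pos ⟨hp, h'.le⟩]; ring
      · rw [if_neg (by tauto), if_neg (by tauto)]; ring
    · rw [if_neg (c := t₀ < ρ.im ∧ ρ.im < T) (by rintro ⟨_, _⟩; linarith),
        if_neg (by rintro ⟨_, _⟩; linarith), if_neg (by rintro ⟨_, _⟩; linarith)]; ring
    · rw [if_pos (c := t₀ < ρ.im ∧ ρ.im < T) ⟨h3, h4⟩, if_pos ⟨by linarith, h4.le⟩,
        if_neg (by rintro ⟨_, _⟩; linarith)]; ring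
  have hgd : DifferentiableOn ℂ (fun s => f s * (logDeriv g s - (s - 1)⁻¹)) (RR a b t₀ T) := by
    refine (hfd.mono hsR).mul (DifferentiableOn.sub ?_ (DifferentiableOn.inv FA ?_))
    · intro s hs
      have : AnalyticAt ℂ g s := hg.analyticAt s
      exact (this.deriv.div this (hg0 s (hRball s hs))).differentiableAt.differentiableWithinAt
    · exact fun s hs => sub_ne_zero.2 (hone s (hsR hs))
  have hBR : RB a b t₀ T ⊆ RR a b t₀ T := fun s hs => hs.1
  rw [hsum, ← e1, ← RI_parts hRH n h0 h1 h2 hT hz,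
    RI_congr (f := fun s => logDeriv ZZ s * iteratedDeriv n ZZ s)
      (g := fun s => f s * zsm Z 1 s + f s * (logDeriv g s - (s - 1)⁻¹)) LA hT.le,
    RI_add LA hT.le c1 (hgd.continuousOn.mono hBR), RI_zero LA hT.le hgd, add_zero]
  intro s hs
  have hs1 := (hb s hs).1
  have hs0 := (hb s hs).2
  have hsZ : s ∉ Z := by
    intro h
    exact hs0 (hZz s h (by have := hsB hs; exact ne_of_gt this))
  have hgs := hg0 s (hRball s (hBR hs))
  have hm1 : logDeriv riemannZeta₁ s = (s - 1)⁻¹ + logDeriv ZZ s := by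
    have : riemannZeta₁ =ᶠ[𝓝 s] fun s => (s - 1) * ZZ s := by
      filter_upwards [isOpen_ne.mem_nhds hs1] with w hw
      exact zeta1_eq hw
    rw [logDeriv_apply, this.deriv_eq, this.eq_of_nhds, ← logDeriv_apply,
      logDeriv_mul (f := fun s : ℂ => s - 1) (g := ZZ) s (sub_ne_zero.2 hs1) hs0 FA (differentiableAt_riemannZeta hs1)]
    congr 1
    rw [logDeriv_apply]
    simp
  have hm2 : logDeriv riemannZeta₁ s = zsm Z 1 s + logDeriv g s := by
    have : riemannZeta₁ = fun s => zprod Z s * g s := funext hfac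
    rw [this, logDeriv_mul s (zprod_ne_zero hsZ) hgs (differentiable_zprod Z s) (hg s), logDeriv_zprod hsZ]
    simp [zsm]
  have hm3 : logDeriv ZZ s = zsm Z 1 s + logDeriv g s - (s - 1)⁻¹ := by
    rw [← hm2, hm1]; ring
  rw [hm3]; ring

/-- the factor in the functional equation -/
noncomputable def XX (w : ℂ) : ℂ :=
  2 * (2 * (π : ℂ)) ^ (-w) * Gamma w * Complex.cos (π * w / 2)

lemma cos_lower (z : ℂ) (hz : z.im < 0) : -z.im ≤ ‖Complex.cos z‖ := by
  have h1 : Real.sinh (-z.im) ≤ ‖Complex.cos z‖ := by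
    have e : Complex.cos z = (cexp (z * I) + cexp (-z * I)) / 2 := rfl
    rw [e, norm_div, Real.sinh_eq]
    have h2 := norm_sub_norm_le (cexp (z * I)) (-cexp (-z * I))
    rw [norm_neg, sub_neg_eq_add, norm_exp, norm_exp] at h2
    have h3 : (z * I).re = -z.im := by simp
    have h4 : (-z * I).re = z.im := by simp
    rw [h3, h4] at h2
    simp only [Complex.norm_ofNat, neg_neg]
    linarith
  exact (Real.self_le_sinh_iff.2 LA).trans h1

lemma cos_half_ne {w : ℂ} (hw : w.im < 0) : Complex.cos (π * w / 2) ≠ 0 := by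
  have h : (π * w / 2 : ℂ).im = π * w.im / 2 := by
    rw [show (π * w / 2 : ℂ) = ((π / 2 : ℝ) : ℂ) * w by push_cast; ring, Complex.im_ofReal_mul]
    ring
  have hneg : (π * w / 2 : ℂ).im < 0 := by
    rw [h]; nlinarith [Real.pi_pos]
  intro h0
  have := cos_lower _ hneg
  rw [h0, norm_zero] at this
  linarith

lemma two_pi_ne : (2 * (π : ℂ)) ≠ 0 := by
  simp [Real.pi_ne_zero]

lemma XX_ne {w : ℂ} (hr : 0 < w.re) (hi : w.im < 0) : XX w ≠ 0 := by
  unfold XX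
  refine mul_ne_zero (mul_ne_zero (mul_ne_zero two_ne_zero ?_) (Complex.Gamma_ne_zero_of_re_pos hr)) (cos_half_ne hi)
  rw [Complex.cpow_ne_zero_iff]
  exact Or.inl two_pi_ne

lemma XX_diff {w : ℂ} (hr : 0 < w.re) : DifferentiableAt ℂ XX w := by
  unfold XX
  have h1 := differentiableAt_Gamma w (gamma_ne_neg hr)
  have h2 : DifferentiableAt ℂ (fun w : ℂ => (2 * (π : ℂ)) ^ (-w)) w :=
    DifferentiableAt.const_cpow FA (Or.inl two_pi_ne)
  have h3 : DifferentiableAt ℂ (fun w : ℂ => Complex.cos (π * w / 2)) w := FA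
  exact (((differentiableAt_const _).mul h2).mul h1).mul h3

lemma zeta_reflect {w : ℂ} (hr : 0 < w.re) (hi : w.im < 0) :
    ZZ (1 - w) = XX w * ZZ w := by
  rw [riemannZeta_one_sub (gamma_ne_neg hr) (by rintro rfl; simp at hi), XX]

lemma quad_open : IsOpen {w : ℂ | 0 < w.re ∧ w.im < 0} :=
  (isOpen_lt continuous_const continuous_re).inter (isOpen_lt Complex.continuous_im continuous_const)

lemma XX_logDeriv_analyticAt {w : ℂ} (hr : 0 < w.re) (hi : w.im < 0) :
    AnalyticAt ℂ (logDeriv XX) w := by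
  have : AnalyticAt ℂ XX w := by
    refine DifferentiableOn.analyticAt (s := {w : ℂ | 0 < w.re ∧ w.im < 0}) (fun u hu => ?_)
      (quad_open.mem_nhds ⟨hr, hi⟩)
    exact (XX_diff hu.1).differentiableWithinAt
  exact this.deriv.div this (XX_ne hr hi)

lemma zF_reflect (n : ℕ) {w : ℂ} (hr : 0 < w.re) (hi : w.im < 0) (hz : ZZ w ≠ 0) :
    zF n (1 - w) = (-1) ^ (n + 1) * XX w * (iteratedDeriv n (logDeriv XX) w * ZZ w + zF n w) := by
  have hone : ∀ u : ℂ, u.im < 0 → u ≠ 1 := by rintro u hu rfl; simp at hu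
  have hev : (fun u => logDeriv ZZ (1 - u)) =ᶠ[𝓝 w]
      fun u => -(logDeriv XX u + logDeriv ZZ u) := by
    have hc : ContinuousAt ZZ w := (zeta_analyticAt (hone w hi)).continuousAt
    filter_upwards [quad_open.mem_nhds ⟨hr, hi⟩, hc.eventually_ne hz] with u hu hu0
    have e : (fun v => ZZ (1 - v)) =ᶠ[𝓝 u] fun v => XX v * ZZ v := by
      filter_upwards [quad_open.mem_nhds hu] with v hv
      exact zeta_reflect hv.1 hv.2
    have h1 : logDeriv (fun v => ZZ (1 - v)) u = -logDeriv ZZ (1 - u) := by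
      rw [logDeriv_apply, logDeriv_apply, deriv_comp_const_sub]; ring
    have h2 : logDeriv (fun v => ZZ (1 - v)) u = logDeriv XX u + logDeriv ZZ u := by
      rw [logDeriv_apply, e.deriv_eq, e.eq_of_nhds, ← logDeriv_apply (fun v => XX v * ZZ v),
        logDeriv_mul (f := XX) (g := ZZ) u (XX_ne hu.1 hu.2) hu0 (XX_diff hu.1)
        (differentiableAt_riemannZeta (hone u hu.2))]
    rw [← h2, h1, neg_neg]
  have hd := hev.iteratedDeriv_eq n
  rw [congrFun (iteratedDeriv_comp_const_sub n LZ 1) w] at hd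
  have a1 := XX_logDeriv_analyticAt hr hi
  have a2 := logDeriv_zeta_analyticAt (hone w hi) hz
  rw [iteratedDeriv_fun_neg, iteratedDeriv_fun_add a1.contDiffAt a2.contDiffAt, smul_eq_mul] at hd
  rw [zF, zF, zeta_reflect hr hi]
  have hs : ((-1 : ℂ) ^ n) * (-1) ^ n = 1 := by rw [← mul_pow]; simp
  rw [pow_succ]
  linear_combination (XX w * ZZ w * (-1) ^ n) * hd -
    (iteratedDeriv n LZ (1 - w) * (XX w * ZZ w)) * hs

lemma XX_bound {w : ℂ} (h1 : 1 / 2 ≤ w.re) (h2 : w.re ≤ 7 / 2) (hi : 1 ≤ |w.im|) :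
    ‖XX w‖ ≤ 4000 * |w.im| ^ (w.re - 1 / 2) := by
  unfold XX
  rw [norm_mul, norm_mul, norm_mul]
  have hg := gamma_bound h1 h2 hi
  have hp : ‖(2 * (π : ℂ)) ^ (-w)‖ ≤ 1 := by
    rw [show (2 * (π : ℂ)) = ((2 * π : ℝ) : ℂ) by push_cast; ring,
      norm_ofReal_cpow_pos PA]
    refine Real.rpow_le_one_of_one_le_of_nonpos (by linarith [Real.pi_gt_three]) ?_
    simp; linarith
  have hc : ‖Complex.cos (π * w / 2)‖ ≤ RE (π * |w.im| / 2) := by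
    have e : Complex.cos (π * w / 2) = (cexp (π * w / 2 * I) + cexp (-(π * w / 2) * I)) / 2 := rfl
    rw [e, norm_div, Complex.norm_ofNat, div_le_iff₀ NA]
    refine (norm_add_le _ _).trans ?_
    rw [norm_exp, norm_exp]
    have e1 : (π * w / 2 * I : ℂ).re = -(π * w.im / 2) := by
      rw [show (π * w / 2 * I : ℂ) = ((π / 2 : ℝ) : ℂ) * (w * I) by push_cast; ring, Complex.re_ofReal_mul]
      simp; ring
    have e2 : (-(π * w / 2) * I : ℂ).re = (π * w.im / 2) := by
      rw [neg_mul, Complex.neg_re, e1]; ring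
    rw [e1, e2]
    have := Real.exp_le_exp.2 (show -(π * w.im / 2) ≤ π * |w.im| / 2 by
      nlinarith [neg_abs_le w.im, Real.pi_pos])
    have := Real.exp_le_exp.2 (show (π * w.im / 2) ≤ π * |w.im| / 2 by
      nlinarith [le_abs_self w.im, Real.pi_pos])
    linarith
  calc _ ≤ ‖(2 : ℂ)‖ * 1 * (2000 * |w.im| ^ (w.re - 1 / 2) * RE (-(π * |w.im| / 2))) *
        RE (π * |w.im| / 2) := by gcongr
    _ = 4000 * |w.im| ^ (w.re - 1 / 2) * (RE (-(π * |w.im| / 2)) *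
        RE (π * |w.im| / 2)) := by
      rw [Complex.norm_ofNat]; ring
    _ = _ := by rw [← Real.exp_add, neg_add_cancel, Real.exp_zero, mul_one]

lemma XX_logDeriv_eq {w : ℂ} (hr : 0 < w.re) (hi : w.im < 0) :
    logDeriv XX w = (-(Complex.log (2 * π)) + π / 2 * I) + (digamma w +
      (-(π / 2 : ℂ)) * (I * cexp (-(π * w / 2) * I) / Complex.cos (π * w / 2))) := by
  have hc := cos_half_ne hi
  have h1 : HasDerivAt (fun w : ℂ => (2 * (π : ℂ)) ^ (-w)) ((2 * (π : ℂ)) ^ (-w) * Complex.log (2 * π) * (-1)) w :=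
    ((hasDerivAt_id w).neg).const_cpow (Or.inl two_pi_ne)
  have h2 : HasDerivAt Gamma (digamma w * Gamma w) w := by
    have := (differentiableAt_Gamma w (gamma_ne_neg hr)).hasDerivAt
    refine this.congr_deriv ?_
    rw [digamma, logDeriv_apply, div_mul_cancel₀ _ (Complex.Gamma_ne_zero_of_re_pos hr)]
  have h3 : HasDerivAt (fun w : ℂ => Complex.cos (π * w / 2)) (-Complex.sin (π * w / 2) * (π * 1 / 2)) w :=
    (((hasDerivAt_id w).const_mul (π : ℂ)).div_const 2).ccos
  have h4 := ((h1.const_mul 2).mul h2).mul h3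
  have hX : HasDerivAt XX _ w := h4
  have hg := Complex.Gamma_ne_zero_of_re_pos hr
  have hp : (2 * (π : ℂ)) ^ (-w) ≠ 0 := by
    rw [Complex.cpow_ne_zero_iff]; exact Or.inl two_pi_ne
  have he : cexp (-(π * w / 2) * I) = Complex.cos (π * w / 2) - Complex.sin (π * w / 2) * I := by
    rw [Complex.exp_mul_I, Complex.cos_neg, Complex.sin_neg]; ring
  rw [logDeriv_apply, hX.deriv, he]
  simp only [XX, Pi.mul_apply]
  field_simp
  linear_combination (-(π : ℂ) * Complex.sin (π * w / 2)) * I_sq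

lemma XX_polygamma (m : ℕ) : ∃ K > 0, ∀ w : ℂ, 1 / 2 ≤ w.re → w.re ≤ 5 / 2 → w.im ≤ -2 →
    ‖iteratedDeriv (m + 1) (logDeriv XX) w‖ ≤ K / |w.im| := by
  obtain ⟨K, hK, hpg⟩ := polygamma_bound m
  refine ⟨K + 2 * ((m + 1).factorial * 2 / (1 / 4) ^ (m + 1)), by positivity, fun w h1 h2 hi => ?_⟩
  set E : ℂ → ℂ := fun w => I * cexp (-(π * w / 2) * I) / Complex.cos (π * w / 2) with hE
  have hr : 0 < w.re := LA
  have hi' : w.im < 0 := LA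
  have habs : |w.im| = -w.im := abs_of_neg hi'
  have hEd : ∀ u : ℂ, u.im < 0 → DifferentiableAt ℂ E u := by
    intro u hu
    exact DifferentiableAt.div FA FA (cos_half_ne hu)
  have hbi : ∀ u ∈ CB w (1 / 4), u.im ≤ w.im * (7 / 8) := by
    intro u hu
    rw [mem_closedBall_iff_norm] at hu
    have := (abs_im_le_norm (u - w)).trans hu
    rw [Complex.sub_im, abs_le] at this
    linarith [this.2]
  have hEb := cauchy_bound (f := E) (c := w) (r := 1 / 4) (M := 2 / |w.im|) (m + 1) NA
    (fun u hu => (hEd u (by linarith [hbi u hu])).differentiableWithinAt) (by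
      intro u hu
      have hu1 := hbi u hu
      have e0 : (π * u / 2 : ℂ) = ((π / 2 : ℝ) : ℂ) * u := by push_cast; ring
      have e1 : (π * u / 2 : ℂ).im = π / 2 * u.im := by
        rw [e0, Complex.im_ofReal_mul]
      have hpi := Real.pi_gt_three
      have hneg : (π * u / 2 : ℂ).im < 0 := by rw [e1]; nlinarith
      have h5 := cos_lower _ hneg
      rw [e1] at h5
      rw [hE]
      simp only [norm_div, norm_mul, Complex.norm_I, one_mul, norm_exp]
      have h6 : (-(π * u / 2) * I : ℂ).re = π / 2 * u.im := by
        rw [neg_mul, Complex.neg_re, Complex.mul_I_re, e1]; ring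
      rw [h6, habs]
      refine div_le_div₀ NA ?_ LA ?_
      · have : RE (π / 2 * u.im) ≤ 1 := Real.exp_le_one_iff.2 (by nlinarith)
        linarith
      · refine le_trans ?_ h5
        nlinarith)
  have hev : logDeriv XX =ᶠ[𝓝 w] fun u => (-(Complex.log (2 * π)) + π / 2 * I) +
      (digamma u + (-(π / 2 : ℂ)) * E u) := by
    filter_upwards [quad_open.mem_nhds ⟨hr, hi'⟩] with u hu
    exact XX_logDeriv_eq hu.1 hu.2
  have a1 : AnalyticAt ℂ digamma w := by
    refine DifferentiableOn.analyticAt (s := {w : ℂ | 0 < w.re ∧ w.im < 0}) (fun u hu => ?_)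
      (quad_open.mem_nhds ⟨hr, hi'⟩)
    exact (differentiableAt_digamma hu.1).differentiableWithinAt
  have a2 : AnalyticAt ℂ (fun u => (-(π / 2 : ℂ)) * E u) w := by
    refine DifferentiableOn.analyticAt (s := {w : ℂ | 0 < w.re ∧ w.im < 0}) (fun u hu => ?_)
      (quad_open.mem_nhds ⟨hr, hi'⟩)
    exact ((hEd u hu.2).const_mul _).differentiableWithinAt
  have a3 : AnalyticAt ℂ (fun u => digamma u + (-(π / 2 : ℂ)) * E u) w := a1.add a2
  rw [hev.iteratedDeriv_eq (m + 1), iteratedDeriv_fun_add contDiffAt_const a3.contDiffAt,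
    iteratedDeriv_fun_add a1.contDiffAt a2.contDiffAt, iteratedDeriv_const, if_neg (by omega), zero_add,
    iteratedDeriv_const_mul_field]
  refine (norm_add_le _ _).trans ?_
  rw [add_div, norm_mul, norm_neg]
  refine add_le_add (hpg w h1 h2 (by rw [habs]; linarith)) ?_
  have hp2 : ‖(π / 2 : ℂ)‖ ≤ 2 := by
    rw [norm_div, norm_real, Real.norm_of_nonneg Real.pi_pos.le, Complex.norm_ofNat]
    linarith [Real.pi_lt_four]
  have hw0 : 0 < |w.im| := by rw [habs]; linarith
  calc _ ≤ 2 * (((m + 1).factorial : ℝ) * (2 / |w.im|) / (1 / 4) ^ (m + 1)) := by gcongr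
    _ = _ := by field_simp

/-- `Γ(w) y^{-w} e^{iθw}` -/
noncomputable def hh (y θ : ℝ) (w : ℂ) : ℂ := Gamma w * cexp (w * (θ * I - RL y))

lemma hh_norm (y θ : ℝ) (w : ℂ) :
    ‖hh y θ w‖ = ‖Gamma w‖ * (RE (-(w.re * RL y)) * RE (-(θ * w.im))) := by
  rw [hh, norm_mul, norm_exp, ← Real.exp_add]
  congr 2
  simp
  ring

lemma gamma_ne_neg_im {w : ℂ} (hw : w.im ≠ 0) (m : ℕ) : w ≠ -(m : ℂ) := by
  rintro rfl; simp at hw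

lemma hh_diff (y θ : ℝ) {w : ℂ} (hw : w.im ≠ 0 ∨ 0 < w.re) : DifferentiableAt ℂ (hh y θ) w := by
  unfold hh
  refine DifferentiableAt.mul (differentiableAt_Gamma w ?_) FA
  rcases hw with hw | hw
  · exact gamma_ne_neg_im hw
  · exact gamma_ne_neg hw

lemma hh_succ (y θ : ℝ) {w : ℂ} (hw : w ≠ 0) :
    hh y θ (w + 1) = w * cexp (θ * I - RL y) * hh y θ w := by
  rw [hh, hh, Complex.Gamma_add_one w hw, add_mul, Complex.exp_add, one_mul]; ring

lemma hh_left {y : ℝ} (hy : 0 < y) (θ : ℝ) {w : ℂ} (hw : w.im ≠ 0) :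
    ‖hh y θ (w - 1)‖ ≤ y / |w.im| * ‖hh y θ w‖ := by
  have hne : w - 1 ≠ 0 := by
    intro h
    have := congrArg Complex.im h
    simp at this; exact hw this
  have h1 := hh_succ y θ hne
  rw [sub_add_cancel] at h1
  have h2 : ‖hh y θ w‖ = ‖w - 1‖ * y⁻¹ * ‖hh y θ (w - 1)‖ := by
    rw [h1, norm_mul, norm_mul, norm_exp]
    congr 2
    have : ((θ : ℂ) * I - RL y).re = -RL y := by simp
    rw [this, Real.exp_neg, Real.exp_log hy]
  have h3 : |w.im| ≤ ‖w - 1‖ := by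
    simpa using abs_im_le_norm (w - 1)
  have h4 : 0 < |w.im| := abs_pos.2 hw
  rw [h2]
  have : y / |w.im| * (‖w - 1‖ * y⁻¹ * ‖hh y θ (w - 1)‖) = ‖w - 1‖ / |w.im| * ‖hh y θ (w - 1)‖ := by
    field_simp
  rw [this]
  exact le_mul_of_one_le_left (norm_nonneg _) ((one_le_div h4).2 h3)

lemma exp_log_rpow {y : ℝ} (hy : 0 < y) (σ : ℝ) : RE (-(σ * RL y)) = y ^ (-σ) := by
  rw [Real.rpow_def_of_pos hy]; congr 1; ring

lemma hh_bound0 {y : ℝ} (hy : 0 < y) (θ : ℝ) {w : ℂ} (h1 : 1 / 2 ≤ w.re) (h2 : w.re ≤ 7 / 2)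
    (hi : 1 ≤ |w.im|) : ‖hh y θ w‖ ≤ 2000 * |w.im| ^ (w.re - 1 / 2) * y ^ (-w.re) *
      RE (-(π * |w.im| / 2) - θ * w.im) := by
  rw [hh_norm, exp_log_rpow hy]
  have := gamma_bound h1 h2 hi
  calc _ ≤ (2000 * |w.im| ^ (w.re - 1 / 2) * RE (-(π * |w.im| / 2))) *
        (y ^ (-w.re) * RE (-(θ * w.im))) := by gcongr
    _ = 2000 * |w.im| ^ (w.re - 1 / 2) * y ^ (-w.re) *
        (RE (-(π * |w.im| / 2)) * RE (-(θ * w.im))) := by ring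
    _ = _ := by rw [← Real.exp_add]; congr 2

lemma hh_bound {y : ℝ} (hy : 0 < y) (θ : ℝ) {σ t : ℝ} (h1 : -1 / 2 ≤ σ) (h2 : σ ≤ 5 / 2)
    (ht : 1 ≤ t) : ‖hh y θ (σ + mI(t))‖ ≤
      2000 * (t ^ (-(1 / 2) : ℝ) * (t / y) ^ σ * RE (-((π / 2 - θ) * t))) := by
  have ht0 : 0 < t := LA
  have key : ∀ σ : ℝ, 1 / 2 ≤ σ → σ ≤ 7 / 2 → ‖hh y θ (σ + mI(t))‖ ≤
      2000 * (t ^ (-(1 / 2) : ℝ) * (t / y) ^ σ * RE (-((π / 2 - θ) * t))) := by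
    intro σ h1 h2
    have hre : cI(σ,t).re = σ := by simp
    have him : cI(σ,t).im = -t := by simp
    have := hh_bound0 hy θ (w := σ + mI(t)) (by rwa [hre]) (by rwa [hre]) (by
      rw [him, abs_neg, abs_of_pos ht0]; exact ht)
    rw [hre, him, abs_neg, abs_of_pos ht0] at this
    refine this.trans (le_of_eq ?_)
    rw [Real.div_rpow ht0.le hy.le, Real.rpow_neg hy.le, sub_eq_add_neg, Real.rpow_add ht0,
      show -(π * t / 2) - θ * -t = -((π / 2 - θ) * t) by ring]
    ring
  by_cases hσ : 1 / 2 ≤ σ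
  · exact key σ hσ LA
  push Not at hσ
  have h3 := key (σ + 1) LA LA
  have him : (((σ + 1 : ℝ) : ℂ) + mI(t)).im = -t := by simp
  have h4 := hh_left hy θ (w := ((σ + 1 : ℝ) : ℂ) + mI(t)) (by rw [him]; linarith)
  rw [him, abs_neg, abs_of_pos ht0] at h4
  have e : (((σ + 1 : ℝ) : ℂ) + mI(t)) - 1 = σ + mI(t) := by push_cast; ring
  rw [e] at h4
  refine h4.trans ((mul_le_mul_of_nonneg_left h3 PA).trans (le_of_eq ?_))
  rw [Real.rpow_add PA, Real.rpow_one]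
  field_simp

lemma hh_cont (y θ : ℝ) (σ : ℝ) {a b : ℝ} (h : 0 < a ∨ 0 < σ) :
    ContinuousOn (fun t : ℝ => hh y θ (σ + mI(t))) (Set.Icc a b) := by
  intro t ht
  refine ContinuousAt.continuousWithinAt ?_
  refine ContinuousAt.comp (f := fun t : ℝ => (σ : ℂ) + mI(t)) (g := hh y θ) (hh_diff y θ ?_).continuousAt FA
  rcases h with h | h
  · left
    have : cI(σ,t).im = -t := by simp
    rw [this]; linarith [ht.1]
  · right; simpa using h

/-- Cauchy: difference of vertical integrals. -/
lemma hh_rect (y θ : ℝ) {a b t₁ t₂ M₁ M₂ : ℝ} (hab : b = a + 1) (h1 : 0 < t₁) (h2 : t₁ ≤ t₂)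
    (hM₁ : ∀ σ ∈ Set.Icc a b, ‖hh y θ (σ + (-t₁ : ℝ) * I)‖ ≤ M₁)
    (hM₂ : ∀ σ ∈ Set.Icc a b, ‖hh y θ (σ + (-t₂ : ℝ) * I)‖ ≤ M₂) :
    ‖(∫ t in t₁..t₂, hh y θ (b + mI(t))) - ∫ t in t₁..t₂, hh y θ (a + mI(t))‖ ≤ M₁ + M₂ := by
  have hab' : a ≤ b := LA
  have := RI_zero (f := hh y θ) (a := a) (b := b) (t₀ := -t₂) (T := -t₁) hab' LA
    (fun s hs => (hh_diff y θ (Or.inl (by linarith [hs.2.2]))).differentiableWithinAt)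
  rw [RI] at this
  have e1 : ∀ v : ℝ, ∫ t in t₁..t₂, hh y θ (v + mI(t)) = ∫ t in (-t₂)..(-t₁), hh y θ (v + t * I) := by
    intro v
    rw [← intervalIntegral.integral_comp_neg (fun t : ℝ => hh y θ (v + t * I))]
  have bd : ∀ t M : ℝ, (∀ σ ∈ Set.Icc a b, ‖hh y θ (σ + t * I)‖ ≤ M) →
      ‖∫ x in a..b, hh y θ (x + t * I)‖ ≤ M := by
    intro t M h
    have := intervalIntegral.norm_integral_le_of_norm_le_const (a := a) (b := b)
      (f := fun x : ℝ => hh y θ (x + t * I)) (C := M) (by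
        intro x hx
        rw [Set.uIoc_of_le hab'] at hx
        exact h x ⟨hx.1.le, hx.2⟩)
    rwa [hab, add_sub_cancel_left, abs_one, mul_one, ← hab] at this
  have b1 := bd _ _ hM₁
  have b2 := bd _ _ hM₂
  rw [e1, e1]
  set P := ∫ t in (-t₂)..(-t₁), hh y θ (b + t * I)
  set Q := ∫ t in (-t₂)..(-t₁), hh y θ (a + t * I)
  have e : P - Q = I * ((∫ x in a..b, hh y θ (x + (-t₂ : ℝ) * I)) - ∫ x in a..b, hh y θ (x + (-t₁ : ℝ) * I)) := by
    linear_combination (-I) * this + (P - Q) * I_sq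
  rw [e, norm_mul, Complex.norm_I, one_mul]
  exact (norm_sub_le _ _).trans LA

lemma gonek_a {c t₀ T y : ℝ} (hc : 1 ≤ c) (hc2 : c ≤ 3 / 2) (ht₀ : 1 ≤ t₀) (hT : t₀ ≤ T) (hy : T < y) :
    ‖∫ t in t₀..T, hh y (π / 2) (c + mI(t))‖ ≤
      8000 * (T ^ (-(1 / 2) : ℝ) * (T / y) ^ c * (y / (y - T))) := by
  have hy0 : 0 < y := LA
  have hT0 : 0 < T := LA
  set M := 2000 * (T ^ (-(1 / 2) : ℝ) * (T / y) ^ c) with hM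
  have hM0 : 0 ≤ M := PA
  have hb : ∀ t, t₀ ≤ t → t ≤ T → ∀ σ ∈ Set.Icc c (c + 1), ‖hh y (π / 2) (σ + mI(t))‖ ≤ M := by
    intro t h1 h2 σ hσ
    have ht0 : 0 < t := LA
    refine (hh_bound hy0 (π / 2) (by linarith [hσ.1]) (by linarith [hσ.2]) LA).trans ?_
    rw [sub_self, zero_mul, neg_zero, Real.exp_zero, mul_one, hM]
    have e : ∀ t : ℝ, 0 < t → t ^ (-(1 / 2) : ℝ) * (t / y) ^ σ = t ^ (σ - 1 / 2) * y ^ (-σ) := by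
      intro t ht
      rw [Real.div_rpow ht.le hy0.le, Real.rpow_neg hy0.le, sub_eq_add_neg, Real.rpow_add ht]
      ring
    have h3 : t ^ (-(1 / 2) : ℝ) * (t / y) ^ σ ≤ T ^ (-(1 / 2) : ℝ) * (T / y) ^ σ := by
      rw [e t ht0, e T hT0]
      have : 0 ≤ σ - 1 / 2 := by linarith [hσ.1]
      gcongr
    have h4 : (T / y) ^ σ ≤ (T / y) ^ c :=
      Real.rpow_le_rpow_of_exponent_ge PA ((div_le_one hy0).2 hy.le) hσ.1
    calc _ ≤ 2000 * (T ^ (-(1 / 2) : ℝ) * (T / y) ^ σ) := by gcongr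
      _ ≤ _ := by gcongr
  set ph : ℝ → ℂ := fun t => hh y (π / 2) ((c + 1 : ℝ) + mI(t)) - hh y (π / 2) (c + mI(t)) with hph
  have hphc : ContinuousOn ph (Set.Icc t₀ T) :=
    (hh_cont y _ (c + 1) (Or.inl LA)).sub (hh_cont y _ c (Or.inl LA))
  have hphcAt : ∀ t ∈ Set.Ioo t₀ T, ContinuousAt ph t := fun t ht =>
    hphc.continuousAt (Icc_mem_nhds ht.1 ht.2)
  have hphi : ∀ t ∈ Set.Icc t₀ T, IntervalIntegrable ph volume t₀ t := fun t ht =>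
    ContinuousOn.intervalIntegrable (by
      rw [Set.uIcc_of_le ht.1]; exact hphc.mono (Set.Icc_subset_Icc le_rfl ht.2))
  set Ψ : ℝ → ℂ := fun t => ∫ s in t₀..t, ph s with hΨ
  have hΨb : ∀ t ∈ Set.Icc t₀ T, ‖Ψ t‖ ≤ 2 * M := by
    intro t ht
    have h1 := hh_rect y (π / 2) (a := c) (b := c + 1) (t₁ := t₀) (t₂ := t) rfl LA ht.1
      (hb t₀ le_rfl hT) (hb t ht.1 ht.2)
    rw [← intervalIntegral.integral_sub] at h1
    · rw [two_mul]; exact h1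
    · exact ContinuousOn.intervalIntegrable (by
        rw [Set.uIcc_of_le ht.1]; exact hh_cont y _ (c + 1) (Or.inl LA))
    · exact ContinuousOn.intervalIntegrable (by
        rw [Set.uIcc_of_le ht.1]; exact hh_cont y _ c (Or.inl LA))
  have hden : ∀ t : ℝ, ((t : ℂ) - y + c * I) ≠ 0 := by
    intro t h
    have := congrArg Complex.im h
    simp at this; linarith
  set v : ℝ → ℂ := fun t => y / ((t : ℂ) - y + c * I) with hv
  set v' : ℝ → ℂ := fun t => -y / ((t : ℂ) - y + c * I) ^ 2 with hv'
  have hvd : ∀ t : ℝ, HasDerivAt v (v' t) t := by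
    intro t
    have h1 : HasDerivAt (fun t : ℝ => (t : ℂ) - y + c * I) 1 t :=
      ((Complex.ofRealCLM.hasDerivAt (x := t)).sub_const _).add_const _
    have := (hasDerivAt_const t (y : ℂ)).div h1 (hden t)
    refine this.congr_deriv ?_
    rw [hv']; simp
  have hnd : ∀ t ∈ Set.Icc t₀ T, y - t ≤ ‖(t : ℂ) - y + c * I‖ := by
    intro t ht
    have := abs_re_le_norm ((t : ℂ) - y + c * I)
    simp only [Complex.add_re, Complex.sub_re, Complex.ofReal_re, Complex.mul_re, Complex.I_re, mul_zero,
      Complex.I_im, Complex.ofReal_im, mul_one, sub_self, add_zero] at this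
    rw [abs_of_neg (by linarith [ht.2])] at this
    linarith
  have hvc' : Continuous v' := by
    refine Continuous.div FA FA fun t => pow_ne_zero 2 (hden t)
  have hpt : ∀ t ∈ Set.Icc t₀ T, hh y (π / 2) (c + mI(t)) = v t * ph t := by
    intro t ht
    have hw : cI(c,t) ≠ 0 := by
      intro h
      have := congrArg Complex.re h
      simp at this; linarith
    have h1 := hh_succ y (π / 2) hw
    have h2 : cexp (((π / 2 : ℝ) : ℂ) * I - RL y) = I / y := by
      rw [Complex.exp_sub, ← Complex.ofReal_exp, Real.exp_log hy0]
      congr 1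
      push_cast
      exact Complex.exp_pi_div_two_mul_I
    have h3 : cI(c,t) + 1 = (c + 1 : ℝ) + mI(t) := by push_cast; ring
    rw [h3, h2] at h1
    have hyc : (y : ℂ) ≠ 0 := by exact_mod_cast hy0.ne'
    rw [hph, hv]
    simp only
    rw [h1, div_mul_eq_mul_div, eq_div_iff (hden t)]
    have h4 : (y : ℂ) * (cI(c,t) * (I / y)) = c * I + t := by
      field_simp
      push_cast
      linear_combination (-(t : ℂ)) * I_sq
    linear_combination (-hh y (π / 2) (c + mI(t))) * h4
  have hibp := intervalIntegral.integral_mul_deriv_eq_deriv_mul_of_hasDeriv_right (a := t₀) (b := T) (u := v) (v := Ψ) (u' := v') (v' := ph)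
    (fun t _ => (hvd t).continuousAt.continuousWithinAt)
    (by
      rw [Set.uIcc_of_le hT]
      have := intervalIntegral.continuousOn_primitive_interval' (hphi T ⟨hT, le_rfl⟩) (a := t₀) (by simp)
      rwa [Set.uIcc_of_le hT] at this)
    (fun t _ => (hvd t).hasDerivWithinAt)
    (by
      intro t ht
      rw [min_eq_left hT, max_eq_right hT] at ht
      refine HasDerivAt.hasDerivWithinAt ?_
      exact intervalIntegral.integral_hasDerivAt_right (hphi t ⟨ht.1.le, ht.2.le⟩)
        (ContinuousOn.stronglyMeasurableAtFilter isOpen_Ioo (hphc.mono Set.Ioo_subset_Icc_self) t ht) (hphcAt t ht))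
    (hvc'.intervalIntegrable _ _) (hphi T ⟨hT, le_rfl⟩)
  rw [intervalIntegral.integral_congr (g := fun t => v t * ph t) (fun t ht => hpt t (by rwa [Set.uIcc_of_le hT] at ht)), hibp]
  have hΨ0 : Ψ t₀ = 0 := by simp [hΨ]
  rw [hΨ0, mul_zero, sub_zero]
  have b1 : ‖v T * Ψ T‖ ≤ y / (y - T) * (2 * M) := by
    rw [norm_mul]
    refine mul_le_mul ?_ (hΨb T ⟨hT, le_rfl⟩) (norm_nonneg _) (div_nonneg hy0.le LA)
    rw [hv]
    simp only [norm_div, norm_real, Real.norm_of_nonneg hy0.le]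
    exact div_le_div_of_nonneg_left hy0.le LA (hnd T ⟨hT, le_rfl⟩)
  have hder : ∀ t ∈ Set.uIcc t₀ T, HasDerivAt (fun t => 2 * M * (y / (y - t))) (2 * M * (y / (y - t) ^ 2)) t := by
    intro t ht
    rw [Set.uIcc_of_le hT] at ht
    have hne : y - t ≠ 0 := by linarith [ht.2]
    have h1 : HasDerivAt (fun t : ℝ => y - t) (-1) t := by simpa using (hasDerivAt_id t).const_sub y
    have := ((hasDerivAt_const t y).div h1 hne).const_mul (2 * M)
    refine this.congr_deriv ?_
    simp
  have hcd : ContinuousOn (fun t => 2 * M * (y / (y - t) ^ 2)) (Set.uIcc t₀ T) := by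
    rw [Set.uIcc_of_le hT]
    refine continuousOn_const.mul (continuousOn_const.div FA fun t ht => pow_ne_zero 2 ?_)
    linarith [ht.2]
  have b2 : ‖∫ t in t₀..T, v' t * Ψ t‖ ≤ ∫ t in t₀..T, 2 * M * (y / (y - t) ^ 2) := by
    refine intervalIntegral.norm_integral_le_of_norm_le hT (ae_of_all _ fun t ht => ?_) hcd.intervalIntegrable
    have ht' : t ∈ Set.Icc t₀ T := ⟨ht.1.le, ht.2⟩
    have hp : 0 < y - t := by linarith [ht.2]
    rw [norm_mul, mul_comm]
    refine mul_le_mul (hΨb t ht') ?_ (norm_nonneg _) PA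
    rw [hv']
    simp only [norm_div, norm_neg, norm_pow, norm_real, Real.norm_of_nonneg hy0.le]
    have := hnd t ht'
    gcongr
  rw [integral_eq_sub_of_hasDerivAt hder hcd.intervalIntegrable] at b2
  have b3 : 0 ≤ 2 * M * (y / (y - t₀)) := mul_nonneg PA (div_nonneg hy0.le LA)
  refine (norm_sub_le _ _).trans ?_
  have e : 8000 * (T ^ (-(1 / 2) : ℝ) * (T / y) ^ c * (y / (y - T))) = 4 * (M * (y / (y - T))) := by rw [hM]; ring
  rw [e]
  linarith

lemma hh_left_iter {y : ℝ} (hy : 0 < y) (θ : ℝ) {σ t : ℝ} (ht : 0 < t) (k : ℕ) :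
    ‖hh y θ ((σ - k : ℝ) + mI(t))‖ ≤ (y / t) ^ k * ‖hh y θ (σ + mI(t))‖ := by
  induction k with
  | zero => simp
  | succ k ih =>
    have him : (((σ - k : ℝ) : ℂ) + mI(t)).im = -t := by simp
    have h := hh_left hy θ (w := ((σ - k : ℝ) : ℂ) + mI(t)) (by rw [him]; linarith)
    rw [him, abs_neg, abs_of_pos ht] at h
    have e : (((σ - k : ℝ) : ℂ) + mI(t)) - 1 = ((σ - (k + 1 : ℕ) : ℝ) : ℂ) + mI(t) := by
      push_cast; ring
    rw [e] at h
    refine h.trans ?_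
    rw [pow_succ', mul_assoc]
    exact mul_le_mul_of_nonneg_left ih PA

lemma gonek_tail {c y θ T B M₁ M₂ : ℝ} (hy : 0 < y) (hT : y < T) (hB : T ≤ B)
    (hM₁ : ∀ σ ∈ Set.Icc (c - 1) c, ‖hh y θ (σ + mI(T))‖ ≤ M₁)
    (hM₂ : ∀ σ ∈ Set.Icc (c - 1) c, ‖hh y θ (σ + mI(B))‖ ≤ M₂) :
    ‖∫ t in T..B, hh y θ (c + mI(t))‖ ≤ T / (T - y) * (M₁ + M₂) := by
  have hT0 : 0 < T := LA
  have hM0 : 0 ≤ M₁ + M₂ := add_nonneg ((norm_nonneg _).trans (hM₁ c ⟨by linarith, le_rfl⟩))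
    ((norm_nonneg _).trans (hM₂ c ⟨by linarith, le_rfl⟩))
  set q := y / T with hq
  have hq0 : 0 ≤ q := PA
  have hq1 : q < 1 := (div_lt_one hT0).2 hT
  have hql : ∀ t, T ≤ t → y / t ≤ q := fun t ht => div_le_div_of_nonneg_left hy.le hT0 ht
  have step : ∀ k : ℕ, ‖∫ t in T..B, hh y θ (c + mI(t))‖ ≤
      (∑ j ∈ range k, q ^ j) * (M₁ + M₂) + ‖∫ t in T..B, hh y θ ((c - k : ℝ) + mI(t))‖ := by
    intro k
    induction k with
    | zero => simp
    | succ k ih =>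
      have hseg : ∀ t M, T ≤ t → (∀ σ ∈ Set.Icc (c - 1) c, ‖hh y θ (σ + mI(t))‖ ≤ M) →
          ∀ σ ∈ Set.Icc (c - (k + 1 : ℕ)) (c - k), ‖hh y θ (σ + mI(t))‖ ≤ q ^ k * M := by
        intro t M ht hM σ hσ
        have h1 := hh_left_iter hy θ (σ := σ + k) (t := t) LA k
        rw [add_sub_cancel_right] at h1
        refine h1.trans ?_
        have h2 := hM (σ + k) ⟨by have := hσ.1; push_cast at this; linarith, by linarith [hσ.2]⟩
        have h3 := hql t ht
        have h4 : 0 ≤ y / t := div_nonneg hy.le LA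
        gcongr
      have := hh_rect y θ (a := c - (k + 1 : ℕ)) (b := c - k) (by push_cast; ring) hT0 hB
        (hseg T M₁ le_rfl hM₁) (hseg B M₂ hB hM₂)
      have h5 := norm_sub_norm_le (∫ t in T..B, hh y θ ((c - k : ℝ) + mI(t)))
        (∫ t in T..B, hh y θ ((c - (k + 1 : ℕ) : ℝ) + mI(t)))
      rw [sum_range_succ, add_mul]
      linarith
  obtain ⟨D, hD⟩ := isCompact_Icc.exists_bound_of_continuousOn (hh_cont y θ c (a := T) (b := B) (Or.inl hT0))
  have hD0 : 0 ≤ D := (norm_nonneg _).trans (hD T ⟨le_rfl, hB⟩)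
  have fin : ∀ k : ℕ, ‖∫ t in T..B, hh y θ (c + mI(t))‖ ≤
      (1 - q)⁻¹ * (M₁ + M₂) + q ^ k * (D * |B - T|) := by
    intro k
    refine (step k).trans (add_le_add ?_ ?_)
    · refine mul_le_mul_of_nonneg_right ?_ hM0
      rw [← tsum_geometric_of_lt_one hq0 hq1]
      exact (summable_geometric_of_lt_one hq0 hq1).sum_le_tsum _ (fun _ _ => by positivity)
    · rw [← mul_assoc]
      refine intervalIntegral.norm_integral_le_of_norm_le_const fun t ht => ?_
      rw [Set.uIoc_of_le hB] at ht
      refine (hh_left_iter hy θ (by linarith [ht.1]) k).trans ?_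
      have h2 := hD t ⟨ht.1.le, ht.2⟩
      have h3 := hql t ht.1.le
      have h4 : 0 ≤ y / t := div_nonneg hy.le (by linarith [ht.1])
      gcongr
  have lim : Tendsto (fun k : ℕ => (1 - q)⁻¹ * (M₁ + M₂) + q ^ k * (D * |B - T|)) atTop
      (𝓝 ((1 - q)⁻¹ * (M₁ + M₂) + 0 * (D * |B - T|))) :=
    tendsto_const_nhds.add ((tendsto_pow_atTop_nhds_zero_of_lt_one hq0 hq1).mul_const _)
  have := ge_of_tendsto' lim fin
  rw [zero_mul, add_zero] at this
  have e : (1 - q)⁻¹ = T / (T - y) := by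
    rw [hq]
    have : T - y ≠ 0 := LA
    field_simp
  rwa [e] at this

lemma hh_dec {a : ℝ} (ha : 0 < a) : ∃ K > 0, ∀ c y θ t E : ℝ, 1 ≤ c → c ≤ 3 / 2 → 0 < y →
    θ * t ≤ (π / 2 - a) * |t| + E →
    ‖hh y θ (c + mI(t))‖ ≤ K * RE E * y ^ (-c) * (1 + t ^ 2)⁻¹ := by
  have hG : ContinuousOn Real.Gamma (Set.Icc 1 (3 / 2)) := by
    intro x hx
    refine (Real.differentiableAt_Gamma fun m => ?_).continuousAt.continuousWithinAt
    have : (0 : ℝ) ≤ m := PA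
    linarith [hx.1]
  obtain ⟨G, hG⟩ := isCompact_Icc.exists_bound_of_continuousOn hG
  have hG0 : 0 ≤ G := (norm_nonneg _).trans (hG 1 ⟨le_rfl, by norm_num⟩)
  refine ⟨2 * G * RE 2 + 24000 / a ^ 3, by positivity, ?_⟩
  intro c y θ t E hc hc2 hy ht
  have hre : cI(c,t).re = c := by simp
  have him : cI(c,t).im = -t := by simp
  have hy' : 0 < y ^ (-c) := Real.rpow_pos_of_pos hy _
  rcases le_total |t| 1 with h | h
  · rw [hh_norm, hre, him, exp_log_rpow hy]
    have h1 : ‖Gamma (c + mI(t))‖ ≤ G := by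
      refine (norm_Gamma_le_Gamma_re (by rw [hre]; linarith)).trans ?_
      rw [hre]
      exact (le_abs_self _).trans (hG c ⟨hc, hc2⟩)
    have h2 : RE (-(θ * -t)) ≤ RE 2 * RE E := by
      rw [← Real.exp_add]
      apply Real.exp_le_exp.2
      nlinarith [Real.pi_lt_four, abs_nonneg t, mul_nonneg ha.le (abs_nonneg t)]
    have h3 : 1 ≤ 2 * (1 + t ^ 2)⁻¹ := by
      have : t ^ 2 ≤ 1 := by rw [← sq_abs]; nlinarith [abs_nonneg t]
      rw [← div_eq_mul_inv, le_div_iff₀ PA]; linarith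
    calc _ ≤ G * (y ^ (-c) * (RE 2 * RE E)) * 1 := by rw [mul_one]; gcongr
      _ ≤ G * (y ^ (-c) * (RE 2 * RE E)) * (2 * (1 + t ^ 2)⁻¹) := by gcongr
      _ = (2 * G * RE 2) * RE E * y ^ (-c) * (1 + t ^ 2)⁻¹ := by ring
      _ ≤ _ := by
        have : 0 ≤ 24000 / a ^ 3 := PA
        gcongr
        linarith
  · have h0 : 0 < |t| := LA
    have := hh_bound0 hy θ (w := c + mI(t)) (by rw [hre]; linarith) (by rw [hre]; linarith)
      (by rwa [him, abs_neg])
    rw [hre, him, abs_neg] at this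
    have h1 : |t| ^ (c - 1 / 2) ≤ |t| := by
      conv_rhs => rw [← Real.rpow_one |t|]
      exact Real.rpow_le_rpow_of_exponent_le h LA
    have h2 : RE (-(π * |t| / 2) - θ * -t) ≤ RE E * RE (-(a * |t|)) := by
      rw [← Real.exp_add]
      apply Real.exp_le_exp.2
      linarith
    have h3 : RE (-(a * |t|)) ≤ 6 / (a * |t|) ^ 3 := by
      have := Real.pow_div_factorial_le_exp (a * |t|) PA 3
      rw [Real.exp_neg, inv_eq_one_div, div_le_div_iff₀ (Real.exp_pos _) PA]
      norm_num [Nat.factorial] at this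
      linarith
    have h4 : 1 / |t| ^ 2 ≤ 2 * (1 + t ^ 2)⁻¹ := by
      rw [← div_eq_mul_inv, div_le_div_iff₀ PA PA, sq_abs]
      have : 1 ≤ t ^ 2 := by rw [← sq_abs]; nlinarith
      linarith
    calc _ ≤ 2000 * |t| ^ (c - 1 / 2) * y ^ (-c) * RE (-(π * |t| / 2) - θ * -t) := this
      _ ≤ 2000 * |t| * y ^ (-c) * (RE E * (6 / (a * |t|) ^ 3)) := by
        gcongr
        exact h2.trans (by gcongr)
      _ = 12000 / a ^ 3 * RE E * y ^ (-c) * (1 / |t| ^ 2) := by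
        field_simp; ring
      _ ≤ 12000 / a ^ 3 * RE E * y ^ (-c) * (2 * (1 + t ^ 2)⁻¹) := by gcongr
      _ = (24000 / a ^ 3) * RE E * y ^ (-c) * (1 + t ^ 2)⁻¹ := by ring
      _ ≤ _ := by
        have : 0 ≤ 2 * G * RE 2 := PA
        gcongr
        linarith

lemma hh_cont' (y θ : ℝ) {σ : ℝ} (h : 0 < σ) : Continuous (fun t : ℝ => hh y θ (σ + mI(t))) := by
  refine continuous_iff_continuousAt.2 fun t => ?_
  exact (hh_cont y θ σ (a := t - 1) (b := t + 1) (Or.inr h)).continuousAt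
    (Icc_mem_nhds LA LA)

lemma hh_integrable {c y θ : ℝ} (hc : 1 ≤ c) (hc2 : c ≤ 3 / 2) (hy : 0 < y) (h0 : 0 ≤ θ)
    (h1 : θ < π / 2) : Integrable (fun t : ℝ => hh y θ (c + mI(t))) := by
  obtain ⟨K, hK, h⟩ := hh_dec (a := π / 2 - θ) LA
  refine (integrable_inv_one_add_sq.const_mul (K * RE 0 * y ^ (-c))).mono'
    (hh_cont' y θ LA).aestronglyMeasurable (ae_of_all _ fun t => ?_)
  exact h c y θ t 0 hc hc2 hy (by
    rw [sub_sub_cancel, add_zero]; exact mul_le_mul_of_nonneg_left (le_abs_self t) h0)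

lemma rpow_exp_integrableOn {p a : ℝ} (hp : -1 < p) (ha : 0 < a) :
    IntegrableOn (fun u : ℝ => u ^ p * RE (-(a * u))) (Set.Ioi 0) := by
  have h := integrableOn_rpow_mul_exp_neg_mul_rpow (p := 1) (s := p) (b := a) hp one_pos ha
  refine h.congr_fun (fun u hu => ?_) measurableSet_Ioi
  simp

lemma laplace_cpow_meas (s r : ℂ) :
    AEStronglyMeasurable (fun u : ℝ => (u : ℂ) ^ s * cexp (-(r * u))) (volume.restrict (Set.Ioi 0)) := by
  refine ContinuousOn.aestronglyMeasurable (fun u hu => ?_) measurableSet_Ioi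
  have hce : ContinuousAt (fun u : ℝ => cexp (-(r * u))) u := FA
  have hcp : ContinuousAt (fun u : ℝ => (u : ℂ) ^ s) u :=
    ContinuousAt.cpow FA FA (Or.inl (by simpa using hu))
  exact (hcp.mul hce).continuousWithinAt

lemma laplace_cpow_norm (s r : ℂ) {u : ℝ} (hu : 0 < u) :
    ‖(u : ℂ) ^ s * cexp (-(r * u))‖ = u ^ s.re * RE (-(r.re * u)) := by
  rw [norm_mul, Complex.norm_cpow_eq_rpow_re_of_pos hu, norm_exp]
  simp

lemma laplace_cpow {s r : ℂ} (hs : 0 < s.re) (hr : 0 < r.re) :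
    ∫ u : ℝ in Set.Ioi 0, (u : ℂ) ^ (s - 1) * cexp (-(r * u)) = (1 / r) ^ s * Gamma s := by
  have hs1 : (s - 1).re = s.re - 1 := by simp
  set F : ℂ → ℂ := fun r => ∫ u : ℝ in Set.Ioi 0, (u : ℂ) ^ (s - 1) * cexp (-(r * u)) with hF
  set U : Set ℂ := {z | 0 < z.re} with hU
  have hUo : IsOpen U := isOpen_lt continuous_const continuous_re
  have hFd : DifferentiableOn ℂ F U := by
    intro z hz
    have hz' : 0 < z.re := hz
    have hd := hasDerivAt_integral_of_dominated_loc_of_deriv_le (𝕜 := ℂ) (μ := volume.restrict (Set.Ioi (0 : ℝ)))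
      (F := fun (r : ℂ) (u : ℝ) => (u : ℂ) ^ (s - 1) * cexp (-(r * u)))
      (F' := fun (r : ℂ) (u : ℝ) => (u : ℂ) ^ (s - 1) * (cexp (-(r * u)) * (-u)))
      (x₀ := z) (s := Metric.ball z (z.re / 2)) (bound := fun u => u ^ s.re * RE (-(z.re / 2 * u)))
      (Metric.ball_mem_nhds _ PA)
      (Eventually.of_forall fun w => laplace_cpow_meas _ _)
      (by
        refine (rpow_exp_integrableOn (p := s.re - 1) LA hz').mono' (laplace_cpow_meas _ _) ?_
        filter_upwards [ae_restrict_mem measurableSet_Ioi] with u hu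
        rw [laplace_cpow_norm _ _ hu, hs1])
      (by
        have : Continuous (fun u : ℝ => (-(u : ℂ))) := FA
        refine ((laplace_cpow_meas (s - 1) z).mul this.aestronglyMeasurable).congr (ae_of_all _ fun u => ?_)
        simp only [Pi.mul_apply]; ring)
      (by
        filter_upwards [ae_restrict_mem measurableSet_Ioi] with u hu w hw
        have hu' : 0 < u := hu
        rw [← mul_assoc, norm_mul, laplace_cpow_norm _ _ hu', hs1, norm_neg, norm_real,
          Real.norm_of_nonneg hu'.le, mul_right_comm, Real.rpow_sub_one hu'.ne', div_mul_cancel₀ _ hu'.ne']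
        have : z.re / 2 ≤ w.re := by
          have h1 := (abs_re_le_norm (w - z)).trans (le_of_lt (by simpa [dist_eq_norm] using hw))
          rw [abs_le, Complex.sub_re] at h1
          linarith [h1.1]
        gcongr)
      (rpow_exp_integrableOn LA PA)
      (by
        refine ae_of_all _ fun u w _ => ?_
        have h1 : HasDerivAt (fun r : ℂ => -(r * u)) (-(1 * (u : ℂ))) w := ((hasDerivAt_id w).mul_const _).neg
        rw [one_mul] at h1
        exact h1.cexp.const_mul _)
    exact hd.2.differentiableAt.differentiableWithinAt
  have hRd : DifferentiableOn ℂ (fun r : ℂ => (1 / r) ^ s * Gamma s) U := by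
    intro z hz
    have hz' : 0 < z.re := hz
    have hz0 : z ≠ 0 := by rintro rfl; simp at hz'
    have hsl : (1 / z) ∈ Complex.slitPlane := by
      left
      rw [one_div, Complex.inv_re]
      exact div_pos hz' (Complex.normSq_pos.2 hz0)
    refine DifferentiableAt.differentiableWithinAt (DifferentiableAt.mul_const ?_ _)
    exact DifferentiableAt.cpow_const (DifferentiableAt.div FA FA hz0) hsl
  have hpre : IsPreconnected U := (convex_halfSpace_re_gt 0).isPreconnected
  have hfreq : ∃ᶠ z in 𝓝[≠] (1 : ℂ), F z = (1 / z) ^ s * Gamma s := by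
    have hseq : Tendsto (fun k : ℕ => (((1 + 1 / ((k : ℝ) + 1) : ℝ)) : ℂ)) atTop (𝓝[≠] (1 : ℂ)) := by
      rw [tendsto_nhdsWithin_iff]
      constructor
      · have h1 := tendsto_one_div_add_atTop_nhds_zero_nat (𝕜 := ℝ)
        have h2 := (Complex.continuous_ofReal.tendsto _).comp (h1.const_add 1)
        rw [add_zero, Complex.ofReal_one] at h2
        exact h2
      · refine Eventually.of_forall fun k => ?_
        rw [Set.mem_compl_iff, Set.mem_singleton_iff]
        intro h
        have h3 : (1 + 1 / ((k : ℝ) + 1) : ℝ) = 1 := by exact_mod_cast h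
        have : 0 < 1 / ((k : ℝ) + 1) := PA
        linarith
    refine hseq.frequently (Eventually.frequently (Eventually.of_forall fun k => ?_))
    exact Complex.integral_cpow_mul_exp_neg_mul_Ioi hs PA
  have := (hFd.analyticOnNhd hUo).eqOn_of_preconnected_of_frequently_eq (hRd.analyticOnNhd hUo) hpre
    (z₀ := 1) (by simp [hU]) hfreq
  exact this hr

lemma hh_full {c y θ : ℝ} (hc : 1 ≤ c) (hc2 : c ≤ 3 / 2) (hy : 0 < y) (h0 : 0 ≤ θ)
    (h1 : θ < π / 2) :
    ∫ t : ℝ, hh y θ (c + mI(t)) = 2 * π * cexp (-(cexp (-(θ * I)) * y)) := by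
  set r : ℂ := cexp (-(θ * I)) with hr
  have hrr : 0 < r.re := by
    rw [hr, Complex.exp_re]
    simp
    exact Real.cos_pos_of_mem_Ioo ⟨by linarith [Real.pi_pos], h1⟩
  have hm : ∀ s : ℂ, 0 < s.re → mellin (fun u : ℝ => cexp (-(r * u))) s = hh 1 θ s := by
    intro s hs
    rw [mellin]
    simp only [smul_eq_mul]
    rw [laplace_cpow hs hrr, hh, mul_comm]
    congr 1
    rw [hr, one_div, ← Complex.exp_neg, neg_neg, cpow_def_of_ne_zero (Complex.exp_ne_zero _),
      Complex.log_exp]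
    · simp [mul_comm]
    · simp; linarith [Real.pi_pos]
    · simp; linarith [Real.pi_pos]
  have hconv : MellinConvergent (fun u : ℝ => cexp (-(r * u))) c := by
    rw [MellinConvergent]
    refine (pow_exp_integrableOn 0 (a := r.re) hrr |>.add (pow_exp_integrableOn 1 (a := r.re) hrr)).mono' ?_ ?_
    · refine ContinuousOn.aestronglyMeasurable (fun u hu => ?_) measurableSet_Ioi
      have hce : ContinuousAt (fun u : ℝ => cexp (-(r * u))) u := FA
      have hcp : ContinuousAt (fun u : ℝ => (u : ℂ) ^ ((c : ℂ) - 1)) u :=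
        ContinuousAt.cpow FA FA (Or.inl (by simpa using hu))
      exact (hcp.mul hce).continuousWithinAt
    · filter_upwards [ae_restrict_mem measurableSet_Ioi] with u hu
      have hu' : 0 < u := hu
      rw [smul_eq_mul, norm_mul, Complex.norm_cpow_eq_rpow_re_of_pos hu', norm_exp]
      simp only [Pi.add_apply, pow_zero, one_mul, pow_one]
      have e : (-(r * (u : ℂ))).re = -(r.re * u) := by simp
      rw [e, ← one_add_mul]
      have e2 : ((c : ℂ) - 1).re = c - 1 := by simp
      rw [e2]
      have : u ^ (c - 1) ≤ 1 + u := by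
        rcases le_total u 1 with h | h
        · linarith [Real.rpow_le_one hu'.le h (by linarith : 0 ≤ c - 1)]
        · have := Real.rpow_le_rpow_of_exponent_le h (by linarith : c - 1 ≤ 1)
          rw [Real.rpow_one] at this; linarith
      have e3 : ((fun u : ℝ => RE (-(r.re * u))) + fun u : ℝ => u * RE (-(r.re * u))) u =
        (1 + u) * RE (-(r.re * u)) := by simp only [Pi.add_apply]; ring
      gcongr
  have hitg : ∀ y, 0 < y → Integrable (fun t : ℝ => hh y θ (c + t * I)) := by
    intro y hy
    have := (hh_integrable hc hc2 hy h0 h1).comp_neg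
    refine this.congr (ae_of_all _ fun t => ?_)
    simp
  have hvert : VerticalIntegrable (mellin (fun u : ℝ => cexp (-(r * u)))) c := by
    refine (hitg 1 one_pos).congr (ae_of_all _ fun t => ?_)
    exact (hm _ (by simp; linarith)).symm
  have := mellinInv_mellin_eq c (fun u : ℝ => cexp (-(r * u))) hy hconv hvert FA
  rw [mellinInv] at this
  have e : ∀ t : ℝ, (y : ℂ) ^ (-aI(c,t)) • mellin (fun u : ℝ => cexp (-(r * u))) (c + t * I) =
      hh y θ (c + t * I) := by
    intro t
    rw [hm _ (by simp; linarith), smul_eq_mul, hh, hh, cpow_def_of_ne_zero (by exact_mod_cast hy.ne'),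
      mul_left_comm, ← Complex.exp_add, ← Complex.ofReal_log hy.le]
    congr 2
    simp
    ring
  simp only [e] at this
  have e2 : ∫ t : ℝ, hh y θ (c + mI(t)) = ∫ t : ℝ, hh y θ (c + t * I) :=
    integral_neg_eq_self (fun t : ℝ => hh y θ (c + t * I)) volume
  rw [e2, ← this, Complex.real_smul]
  have h2 : (π : ℂ) ≠ 0 := by exact_mod_cast Real.pi_ne_zero
  have h3 : (2 * (π : ℂ)) * (((1 / (2 * π) : ℝ)) : ℂ) = 1 := by
    push_cast; field_simp
  rw [← mul_assoc, h3, one_mul]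

lemma interval_inv_sq_le {a b : ℝ} (hab : a ≤ b) : ∫ t in a..b, (1 + t ^ 2)⁻¹ ≤ π := by
  rw [intervalIntegral.integral_of_le hab, ← integral_univ_inv_one_add_sq]
  exact setIntegral_le_integral integrable_inv_one_add_sq (ae_of_all _ fun t => by positivity)

lemma inv_sq_intervalIntegrable (a b C : ℝ) :
    IntervalIntegrable (fun t : ℝ => C * (1 + t ^ 2)⁻¹) volume a b :=
  (integrable_inv_one_add_sq.const_mul C).intervalIntegrable

lemma norm_int_inv_sq {f : ℝ → ℂ} {a b C : ℝ} (hab : a ≤ b) (hC : 0 ≤ C)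
    (h : ∀ t ∈ Set.Icc a b, ‖f t‖ ≤ C * (1 + t ^ 2)⁻¹) : ‖∫ t in a..b, f t‖ ≤ C * π := by
  refine (intervalIntegral.norm_integral_le_of_norm_le hab
    (ae_of_all _ fun t ht => h t ⟨ht.1.le, ht.2⟩) (inv_sq_intervalIntegrable a b C)).trans ?_
  rw [intervalIntegral.integral_const_mul]
  exact mul_le_mul_of_nonneg_left (interval_inv_sq_le hab) hC

lemma gonek_b0 : ∃ D > 0, ∀ c y θ t₀ T : ℝ, 1 ≤ c → c ≤ 3 / 2 → 1 ≤ t₀ → t₀ ≤ 5 → t₀ ≤ T → 0 < y → y < T →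
    0 ≤ θ → θ < π / 2 →
    ‖(∫ t in t₀..T, hh y θ (c + mI(t))) - 2 * π * cexp (-(cexp (-(θ * I)) * y))‖ ≤
      D * y ^ (-c) + T / (T - y) * (2000 * (T ^ (-(1 / 2) : ℝ) * (T / y) ^ c)) := by
  obtain ⟨K, hK, hdec⟩ := hh_dec (a := π / 2) PA
  refine ⟨K * RE 8 * π, by positivity, ?_⟩
  intro c y θ t₀ T hc hc2 ht₀ ht₅ hT hy hyT h0 h1
  have hT0 : 0 < T := LA
  have ha : 0 < π / 2 - θ := LA
  set M : ℝ → ℝ := fun t => 2000 * (t ^ (-(1 / 2) : ℝ) * (t / y) ^ c * RE (-((π / 2 - θ) * t))) with hM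
  have hMb : ∀ t, T ≤ t → ∀ σ ∈ Set.Icc (c - 1) c, ‖hh y θ (σ + mI(t))‖ ≤ M t := by
    intro t ht σ hσ
    have ht0 : 0 < t := LA
    refine (hh_bound hy θ (by linarith [hσ.1]) (by linarith [hσ.2]) LA).trans ?_
    have : (t / y) ^ σ ≤ (t / y) ^ c :=
      Real.rpow_le_rpow_of_exponent_le ((one_le_div hy).2 LA) hσ.2
    rw [hM]
    simp only
    gcongr
  have hMT : M T ≤ 2000 * (T ^ (-(1 / 2) : ℝ) * (T / y) ^ c) := by
    rw [hM]
    have : RE (-((π / 2 - θ) * T)) ≤ 1 := Real.exp_le_one_iff.2 (by nlinarith)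
    have h2 : 0 ≤ T ^ (-(1 / 2) : ℝ) * (T / y) ^ c := PA
    simp only
    nlinarith
  have hitg := hh_integrable hc hc2 hy h0 h1
  have hii : ∀ a b, IntervalIntegrable (fun t : ℝ => hh y θ (c + mI(t))) volume a b :=
    fun a b => hitg.intervalIntegrable
  have hlow : ∀ B, T ≤ B → ‖∫ t in (-B)..t₀, hh y θ (c + mI(t))‖ ≤ K * RE 8 * y ^ (-c) * π := by
    intro B hB
    refine norm_int_inv_sq LA PA fun t ht => ?_
    refine hdec c y θ t 8 hc hc2 hy ?_
    rw [sub_self, zero_mul, zero_add]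
    have := Real.pi_lt_d2
    rcases le_total t 0 with h | h
    · nlinarith
    · nlinarith [ht.2]
  have hfin : ∀ B, T ≤ B → ‖(∫ t in t₀..T, hh y θ (c + mI(t))) - ∫ t in (-B)..B, hh y θ (c + mI(t))‖ ≤
      K * RE 8 * y ^ (-c) * π + T / (T - y) * (M T + M B) := by
    intro B hB
    have e1 := integral_add_adjacent_intervals (hii (-B) t₀) (hii t₀ T)
    have e2 := integral_add_adjacent_intervals (hii (-B) T) (hii T B)
    have h3 := gonek_tail hy hyT hB (hMb T le_rfl) (hMb B hB)
    have h4 := hlow B hB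
    rw [← e2, ← e1]
    set P := ∫ t in (-B)..t₀, hh y θ (c + mI(t))
    set Q := ∫ t in t₀..T, hh y θ (c + mI(t))
    set R := ∫ t in T..B, hh y θ (c + mI(t))
    have e3 : Q - (P + Q + R) = -(P + R) := by ring
    rw [e3, norm_neg]
    exact (norm_add_le _ _).trans (add_le_add h4 h3)
  have l1 : Tendsto (fun B : ℝ => ‖(∫ t in t₀..T, hh y θ (c + mI(t))) - ∫ t in (-B)..B, hh y θ (c + mI(t))‖)
      atTop (𝓝 ‖(∫ t in t₀..T, hh y θ (c + mI(t))) - ∫ t : ℝ, hh y θ (c + mI(t))‖) :=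
    (tendsto_const_nhds.sub (intervalIntegral_tendsto_integral hitg tendsto_neg_atTop_atBot tendsto_id)).norm
  have lM : Tendsto M atTop (𝓝 0) := by
    have h2 := (tendsto_rpow_mul_exp_neg_mul_atTop_nhds_zero (c - 1 / 2) _ ha).const_mul (2000 * y ^ (-c))
    rw [mul_zero] at h2
    refine h2.congr' ?_
    filter_upwards [eventually_gt_atTop 0] with t ht
    rw [hM]
    simp only
    rw [Real.div_rpow ht.le hy.le, Real.rpow_neg hy.le, sub_eq_add_neg, Real.rpow_add ht, neg_mul]
    ring
  have l2 : Tendsto (fun B : ℝ => K * RE 8 * y ^ (-c) * π + T / (T - y) * (M T + M B)) atTop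
      (𝓝 (K * RE 8 * y ^ (-c) * π + T / (T - y) * (M T + 0))) :=
    tendsto_const_nhds.add ((tendsto_const_nhds.add lM).const_mul _)
  have := le_of_tendsto_of_tendsto l1 l2 (by
    filter_upwards [eventually_ge_atTop T] with B hB using hfin B hB)
  rw [hh_full hc hc2 hy h0 h1, add_zero] at this
  refine this.trans (add_le_add (le_of_eq (by ring)) ?_)
  exact mul_le_mul_of_nonneg_left hMT (div_nonneg hT0.le LA)

lemma hh_theta_cont (y : ℝ) {c : ℝ} (hc : 0 < c) (t₀ T : ℝ) :
    Continuous (fun θ : ℝ => ∫ t in t₀..T, hh y θ (c + mI(t))) := by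
  apply continuous_parametric_intervalIntegral_of_continuous'
  have h1 : Continuous (fun t : ℝ => Gamma (c + mI(t))) := by
    refine continuous_iff_continuousAt.2 fun t => ?_
    refine ContinuousAt.comp (f := fun t : ℝ => (c : ℂ) + mI(t)) (g := Gamma)
      (differentiableAt_Gamma _ (gamma_ne_neg (by simpa using hc))).continuousAt FA
  have h2 : Continuous (fun p : ℝ × ℝ => Gamma (c + (-p.2 : ℝ) * I)) := h1.comp continuous_snd
  unfold Function.uncurry hh
  exact h2.mul FA

lemma gonek_b : ∃ D > 0, ∀ (c t₀ T : ℝ) (m : ℕ), 1 ≤ c → c ≤ 3 / 2 → 1 ≤ t₀ → t₀ ≤ 5 → t₀ ≤ T → 1 ≤ m →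
    2 * π * m < T →
    ‖(∫ t in t₀..T, hh (2 * π * m) (π / 2) (c + mI(t))) - 2 * π‖ ≤
      D * (2 * π * m) ^ (-c) + T / (T - 2 * π * m) * (2000 * (T ^ (-(1 / 2) : ℝ) * (T / (2 * π * m)) ^ c)) := by
  obtain ⟨D, hD, h⟩ := gonek_b0
  refine ⟨D, hD, ?_⟩
  intro c t₀ T m hc hc2 ht₀ ht₅ hT hm hyT
  have hm' : (1 : ℝ) ≤ m := by exact_mod_cast hm
  set y := 2 * π * m with hy
  have hy0 : 0 < y := PA
  have hcl : IsClosed {θ : ℝ | ‖(∫ t in t₀..T, hh y θ (c + mI(t))) - 2 * π * cexp (-(cexp (-(θ * I)) * y))‖ ≤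
      D * y ^ (-c) + T / (T - y) * (2000 * (T ^ (-(1 / 2) : ℝ) * (T / y) ^ c))} := by
    refine isClosed_le (((hh_theta_cont y LA t₀ T).sub FA).norm) continuous_const
  have hsub : Set.Ico 0 (π / 2) ⊆ _ := fun θ hθ => h c y θ t₀ T hc hc2 ht₀ ht₅ hT hy0 hyT hθ.1 hθ.2
  have := hcl.closure_subset_iff.2 hsub
  rw [closure_Ico PA] at this
  have h2 := this (⟨by positivity, le_rfl⟩ : π / 2 ∈ Set.Icc 0 (π / 2))
  rw [Set.mem_ofPred_eq] at h2
  have e : cexp (-(cexp (-(((π / 2 : ℝ) : ℂ) * I)) * y)) = 1 := by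
    rw [Complex.exp_neg (((π / 2 : ℝ) : ℂ) * I)]
    push_cast
    rw [Complex.exp_pi_div_two_mul_I, Complex.inv_I, hy]
    rw [Complex.exp_eq_one_iff]
    exact ⟨m, by push_cast; ring⟩
  rwa [e, mul_one] at h2

/-- decomposition of `XX w m^{-w}`. -/
lemma XX_hh {m : ℕ} (hm : 1 ≤ m) (w : ℂ) :
    XX w * cexp (-(w * RL m)) =
      hh (2 * π * m) (π / 2) w + hh (2 * π * m) (-(π / 2)) w := by
  have hm0 : (0 : ℝ) < m := by exact_mod_cast hm
  rw [XX, hh, hh, Real.log_mul PA PA, Complex.cos,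
    cpow_def_of_ne_zero two_pi_ne]
  have e : Complex.log (2 * (π : ℂ)) = (RL (2 * π) : ℂ) := by
    rw [Complex.ofReal_log PA]; push_cast; rfl
  rw [e]
  have e1 : w * (((π / 2 : ℝ) : ℂ) * I - ((RL (2 * π) + RL m : ℝ) : ℂ)) =
    (RL (2 * π) : ℂ) * -w + (π * w / 2 * I) + (-(w * RL m)) := by push_cast; ring
  have e2 : w * (((-(π / 2) : ℝ) : ℂ) * I - ((RL (2 * π) + RL m : ℝ) : ℂ)) =
    (RL (2 * π) : ℂ) * -w + (-(π * w / 2) * I) + (-(w * RL m)) := by push_cast; ring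
  rw [e1, e2]
  simp only [Complex.exp_add]
  ring

lemma zsum_le {ε : ℝ} (hε : 0 < ε) (M : ℕ) :
    ∑ m ∈ range (M + 1), RE (-((1 + ε) * RL ((m + 1 : ℕ) : ℝ))) ≤
      1 + 1 / ε - RE (-(ε * RL ((M + 1 : ℕ) : ℝ))) / ε := by
  induction M with
  | zero => simp
  | succ M ih =>
    rw [sum_range_succ]
    have hM : (0 : ℝ) < ((M + 1 : ℕ) : ℝ) := PA
    have hM2 : (0 : ℝ) < ((M + 1 + 1 : ℕ) : ℝ) := PA
    set p := RL ((M + 1 : ℕ) : ℝ) with hp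
    set q := RL ((M + 1 + 1 : ℕ) : ℝ) with hq
    have hqp : RE (-q) ≤ q - p := by
      have h := Real.one_sub_inv_le_log_of_pos (x := ((M + 1 + 1 : ℕ) : ℝ) / ((M + 1 : ℕ) : ℝ)) PA
      rw [Real.log_div hM2.ne' hM.ne'] at h
      refine le_trans (le_of_eq ?_) h
      rw [Real.exp_neg, hq, Real.exp_log hM2, inv_div]
      push_cast
      field_simp
      ring
    have h2 : RE (-(ε * p)) ≥ RE (-(ε * q)) * (1 + ε * RE (-q)) := by
      have e : RE (-(ε * p)) = RE (-(ε * q)) * RE (ε * (q - p)) := by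
        rw [← Real.exp_add]; congr 1; ring
      rw [e]
      refine mul_le_mul_of_nonneg_left ?_ (Real.exp_pos _).le
      have := Real.add_one_le_exp (ε * (q - p))
      nlinarith
    have e3 : RE (-((1 + ε) * q)) = RE (-(ε * q)) * RE (-q) := by
      rw [← Real.exp_add]; congr 1; ring
    have h4 : RE (-((1 + ε) * q)) ≤ (RE (-(ε * p)) - RE (-(ε * q))) / ε := by
      rw [le_div_iff₀ hε, e3]; nlinarith
    rw [sub_div] at h4
    linarith

lemma fc_sum (n : ℕ) : ∃ K > 0, ∀ L : ℝ, 1 ≤ L →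
    Summable (fun m : ℕ => fc n m * RE (-((1 + 1 / L) * RL m))) ∧
    ∑' m : ℕ, fc n m * RE (-((1 + 1 / L) * RL m)) ≤ K * L ^ (n + 2) := by
  refine ⟨(n + 1).factorial * 2 ^ (n + 1) * 3, by positivity, ?_⟩
  intro L hL
  have hL0 : 0 < L := LA
  have hterm : ∀ m : ℕ, fc n (m + 1) * RE (-((1 + 1 / L) * RL ((m + 1 : ℕ) : ℝ))) ≤
      ((n + 1).factorial * (2 * L) ^ (n + 1)) * RE (-((1 + 1 / (2 * L)) * RL ((m + 1 : ℕ) : ℝ))) := by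
    intro m
    set l := RL ((m + 1 : ℕ) : ℝ) with hl
    have hl0 : 0 ≤ l := Real.log_natCast_nonneg _
    have h1 : fc n (m + 1) ≤ l ^ (n + 1) := fc_le n (m + 1)
    have h2 := Real.pow_div_factorial_le_exp (l / (2 * L)) PA (n + 1)
    rw [div_pow, div_div, div_le_iff₀ PA] at h2
    have e : RE (-((1 + 1 / (2 * L)) * l)) = RE (l / (2 * L)) * RE (-((1 + 1 / L) * l)) := by
      rw [← Real.exp_add]; congr 1; field_simp; ring
    rw [e]
    calc _ ≤ l ^ (n + 1) * RE (-((1 + 1 / L) * l)) := by gcongr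
      _ ≤ (RE (l / (2 * L)) * ((2 * L) ^ (n + 1) * ((n + 1).factorial : ℝ))) * RE (-((1 + 1 / L) * l)) := by
        gcongr
      _ = _ := by ring
  have hnn : ∀ m : ℕ, 0 ≤ fc n m * RE (-((1 + 1 / L) * RL m)) := fun m =>
    mul_nonneg (fc_nonneg n m) (Real.exp_pos _).le
  have hpart : ∀ M : ℕ, ∑ m ∈ range M, fc n m * RE (-((1 + 1 / L) * RL m)) ≤
      (n + 1).factorial * 2 ^ (n + 1) * 3 * L ^ (n + 2) := by
    intro M
    calc _ ≤ ∑ m ∈ range (M + 1 + 1), fc n m * RE (-((1 + 1 / L) * RL m)) :=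
          sum_le_sum_of_subset_of_nonneg (range_mono (by omega)) fun m _ _ => hnn m
      _ = ∑ m ∈ range (M + 1), fc n (m + 1) * RE (-((1 + 1 / L) * RL ((m + 1 : ℕ) : ℝ))) := by
          rw [sum_range_succ', fc_zero, zero_mul, add_zero]
      _ ≤ ∑ m ∈ range (M + 1), ((n + 1).factorial * (2 * L) ^ (n + 1)) *
            RE (-((1 + 1 / (2 * L)) * RL ((m + 1 : ℕ) : ℝ))) := sum_le_sum fun m _ => hterm m
      _ ≤ ((n + 1).factorial * (2 * L) ^ (n + 1)) * (3 * L) := by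
          rw [← mul_sum]
          refine mul_le_mul_of_nonneg_left ?_ PA
          have h1 := zsum_le (ε := 1 / (2 * L)) PA M
          have h2 : 0 ≤ RE (-(1 / (2 * L) * RL ((M + 1 : ℕ) : ℝ))) / (1 / (2 * L)) := PA
          rw [one_div_one_div] at h1
          linarith
      _ = _ := by rw [mul_pow]; ring
  have hs := summable_of_sum_range_le hnn hpart
  exact ⟨hs, hs.tsum_le_of_sum_range_le hpart⟩

lemma dirichlet_int (n : ℕ) {c : ℝ} (hc : 1 < c) {w g : ℝ → ℂ} (hw : Continuous w) (hwr : ∀ t, (w t).re = c)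
    (hg : Continuous g) (a b : ℝ) :
    HasSum (fun m : ℕ => (fc n m : ℂ) * ∫ t in a..b, g t * cexp (-(w t * RL m)))
      ((-1) ^ (n + 1) * ∫ t in a..b, g t * zF n (w t)) := by
  have hnorm : ∀ (t : ℝ) (m : ℕ), ‖cexp (-(w t * RL m))‖ = RE (-(c * RL m)) := by
    intro t m
    rw [norm_exp]
    congr 1
    rw [Complex.neg_re, Complex.re_mul_ofReal, hwr]
  have hsum : Summable (fun m : ℕ => fc n m * RE (-(c * RL m))) := by
    have h1 := (fc_hasSum n (s := (c : ℂ)) (by simpa using hc)).summable.norm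
    refine h1.congr fun m => ?_
    rw [norm_mul, norm_real, Real.norm_of_nonneg (fc_nonneg n m), norm_exp]
    rw [Complex.neg_re, Complex.re_mul_ofReal, Complex.ofReal_re]
  have key := intervalIntegral.hasSum_integral_of_dominated_convergence (μ := volume) (a := a) (b := b)
    (F := fun (m : ℕ) (t : ℝ) => (fc n m : ℂ) * (g t * cexp (-(w t * RL m))))
    (f := fun t => (-1) ^ (n + 1) * (g t * zF n (w t)))
    (fun m t => fc n m * RE (-(c * RL m)) * ‖g t‖)
    (fun m => (by fun_prop : Continuous fun t : ℝ => (fc n m : ℂ) * (g t * cexp (-(w t * RL m)))).aestronglyMeasurable)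
    (fun m => ae_of_all _ fun t _ => by
      rw [norm_mul, norm_mul, hnorm, norm_real, Real.norm_of_nonneg (fc_nonneg n m)]
      exact le_of_eq (by ring))
    (ae_of_all _ fun t _ => hsum.mul_right _)
    (by
      simp only [tsum_mul_right]
      exact (continuous_const.mul hg.norm).intervalIntegrable _ _)
    (ae_of_all _ fun t _ => by
      have h1 := (fc_hasSum n (s := w t) (by rw [hwr]; exact hc)).mul_left (g t)
      have e : g t * ((-1) ^ (n + 1) * zF n (w t)) = (-1) ^ (n + 1) * (g t * zF n (w t)) := by ring
      rw [e] at h1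
      refine h1.congr_fun fun m => ?_
      ring)
  rw [intervalIntegral.integral_const_mul] at key
  refine key.congr_fun fun m => ?_
  rw [intervalIntegral.integral_const_mul]

/-- right edge -/
lemma right_edge (n : ℕ) : ∃ K > 0, ∀ L a b : ℝ, 1 ≤ L →
    ‖∫ t in a..b, zF n ((1 + 1 / L : ℝ) + t * I)‖ ≤ K * L ^ (n + 2) := by
  obtain ⟨K, hK, h⟩ := fc_sum n
  refine ⟨4 * K, by positivity, ?_⟩
  intro L a b hL
  obtain ⟨h1, h2⟩ := h L hL
  have hL0 : 0 < L := LA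
  set c := 1 + 1 / L with hc
  have hc1 : 1 < c := by rw [hc]; have : 0 < 1 / L := PA
                         linarith
  have hsum := dirichlet_int n hc1 (w := fun t : ℝ => (c : ℂ) + t * I) (g := fun _ => 1) FA
    (by intro t; simp) continuous_const a b
  simp only [one_mul] at hsum
  have hb : ∀ m : ℕ, ‖(fc n m : ℂ) * ∫ t in a..b, cexp (-(aI(c,t) * RL m))‖ ≤
      4 * (fc n m * RE (-(c * RL m))) := by
    intro m
    rw [norm_mul, norm_real, Real.norm_of_nonneg (fc_nonneg n m)]
    rcases Nat.lt_or_ge m 2 with hm | hm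
    · have : fc n m = 0 := by interval_cases m; exacts [fc_zero n, fc_one n]
      rw [this]; simp
    have hm' : (2 : ℝ) ≤ m := by exact_mod_cast hm
    have hl : 1 / 2 ≤ RL m := by
      have := Real.log_le_log NA hm'
      linarith [Real.log_two_gt_d9]
    set l := RL m with hll
    have hlc : (-(l : ℂ) * I) ≠ 0 := by
      refine mul_ne_zero (neg_ne_zero.2 ?_) I_ne_zero
      exact_mod_cast (by linarith : l ≠ 0)
    have e : ∀ t : ℝ, cexp (-(aI(c,t) * l)) = cexp (-(c * l)) * cexp ((-(l : ℂ) * I) * t) := by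
      intro t; rw [← Complex.exp_add]; congr 1; ring
    simp only [e]
    rw [intervalIntegral.integral_const_mul, integral_exp_mul_complex hlc, norm_mul, norm_div]
    have n1 : ∀ t : ℝ, ‖cexp ((-(l : ℂ) * I) * t)‖ = 1 := by
      intro t
      rw [norm_exp]; simp
    have n2 : ‖-(l : ℂ) * I‖ = l := by
      rw [norm_mul, norm_neg, Complex.norm_I, mul_one, norm_real, Real.norm_of_nonneg LA]
    have n3 : ‖cexp (-((c : ℂ) * l))‖ = RE (-(c * l)) := by
      rw [norm_exp]; congr 1; simp
    rw [n2, n3]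
    have n4 : ‖cexp ((-(l : ℂ) * I) * b) - cexp ((-(l : ℂ) * I) * a)‖ ≤ 2 := by
      refine (norm_sub_le _ _).trans ?_
      rw [n1, n1]; norm_num
    have n5 : ‖cexp ((-(l : ℂ) * I) * b) - cexp ((-(l : ℂ) * I) * a)‖ / l ≤ 4 := by
      rw [div_le_iff₀ LA]; linarith
    calc _ ≤ fc n m * (RE (-(c * l)) * 4) := by
          have := fc_nonneg n m
          gcongr
      _ = _ := by ring
  have h3 := tsum_of_norm_bounded (h1.mul_left 4).hasSum hb
  rw [hsum.tsum_eq, norm_mul, norm_pow, norm_neg, norm_one, one_pow, one_mul, tsum_mul_left] at h3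
  calc _ ≤ _ := h3
    _ ≤ 4 * (K * L ^ (n + 2)) := by gcongr
    _ = _ := by ring

lemma pw_bound {T y t : ℝ} (hT : RE 12 ≤ T) (hy : 0 < y) (ht : 0 < t) (ht2 : t ≤ 2 * T) :
    t ^ (-(1 / 2) : ℝ) * (t / y) ^ (1 + 1 / RL T) ≤ 6 * (√T * y ^ (-(1 + 1 / RL T))) := by
  have hT0 : 0 < T := (Real.exp_pos _).trans_le hT
  have hL : 12 ≤ RL T := (Real.le_log_iff_exp_le hT0).2 hT
  set L := RL T with hLd
  have hL0 : 0 < L := LA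
  set c := 1 + 1 / L with hc
  have hc1 : 1 / L ≤ 1 / 12 := by gcongr
  have hc0 : 0 < 1 / L := PA
  have e : t ^ (-(1 / 2) : ℝ) * (t / y) ^ c = t ^ (c - 1 / 2) * y ^ (-c) := by
    rw [Real.div_rpow ht.le hy.le, Real.rpow_neg hy.le, sub_eq_add_neg, Real.rpow_add ht c (-(1 / 2))]; ring
  have hTc : T ^ (c - 1 / 2) = √T * RE 1 := by
    rw [show c - 1 / 2 = 1 / 2 + 1 / L by rw [hc]; ring, Real.rpow_add hT0, ← Real.sqrt_eq_rpow]
    congr 1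
    rw [Real.rpow_def_of_pos hT0, ← hLd, mul_one_div_cancel hL0.ne']
  have h2 : (2 : ℝ) ^ (c - 1 / 2) ≤ 2 := by
    conv_rhs => rw [← Real.rpow_one 2]
    exact Real.rpow_le_rpow_of_exponent_le NA LA
  have h3 : t ^ (c - 1 / 2) ≤ 6 * √T := by
    calc t ^ (c - 1 / 2) ≤ (2 * T) ^ (c - 1 / 2) := Real.rpow_le_rpow ht.le ht2 LA
      _ = 2 ^ (c - 1 / 2) * (√T * RE 1) := by rw [Real.mul_rpow NA hT0.le, hTc]
      _ ≤ 2 * (√T * 3) := by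
        have := Real.exp_one_lt_d9
        gcongr
        linarith
      _ = _ := by ring
  rw [e, ← mul_assoc]
  gcongr

lemma hh_seg {T y a b : ℝ} (hT : RE 12 ≤ T) (hy : 0 < y) (ha : 1 ≤ a) (hab : b = a + 7) (hb : b ≤ 2 * T) :
    ‖∫ t in a..b, hh y (π / 2) ((1 + 1 / RL T : ℝ) + mI(t))‖ ≤
      84000 * (√T * y ^ (-(1 + 1 / RL T))) := by
  have hT0 : 0 < T := (Real.exp_pos _).trans_le hT
  have hL : 12 ≤ RL T := (Real.le_log_iff_exp_le hT0).2 hT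
  have hc1 : 1 / RL T ≤ 1 / 12 := by gcongr
  have hc0 : 0 < 1 / RL T := PA
  have := intervalIntegral.norm_integral_le_of_norm_le_const (a := a) (b := b)
    (f := fun t : ℝ => hh y (π / 2) ((1 + 1 / RL T : ℝ) + mI(t)))
    (C := 2000 * (6 * (√T * y ^ (-(1 + 1 / RL T))))) (by
      intro t ht
      rw [Set.uIoc_of_le LA] at ht
      refine (hh_bound hy _ LA LA (by linarith [ht.1])).trans ?_
      rw [sub_self, zero_mul, neg_zero, Real.exp_zero, mul_one]
      have := pw_bound hT hy (t := t) (by linarith [ht.1]) (by linarith [ht.2])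
      gcongr)
  rw [hab, add_sub_cancel_left, abs_of_pos (by norm_num : (0 : ℝ) < 7), ← hab] at this
  exact this.trans (le_of_eq (by ring))

lemma pw_y {T y : ℝ} (hT : RE 12 ≤ T) (hy : 1 ≤ y) : y ^ (-(1 + 1 / RL T)) * y ≤ 1 := by
  have hT0 : 0 < T := (Real.exp_pos _).trans_le hT
  have hL : 12 ≤ RL T := (Real.le_log_iff_exp_le hT0).2 hT
  have hy0 : 0 < y := LA
  have : y ^ (-(1 + 1 / RL T)) * y = y ^ (-(1 / RL T)) := by
    rw [← Real.rpow_add_one hy0.ne']; congr 1; ring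
  rw [this]
  have hc0 : 0 < 1 / RL T := PA
  exact Real.rpow_le_one_of_one_le_of_nonpos hy LA

/-- Gonek lemma for one frequency, with `y = 2π m`. -/
lemma gonek_y : ∃ K > 0, ∀ (T t₀ : ℝ) (m : ℕ), RE 12 ≤ T → 1 ≤ t₀ → t₀ ≤ 5 → 1 ≤ m →
    ‖(∫ t in t₀..T, hh (2 * π * m) (π / 2) ((1 + 1 / RL T : ℝ) + mI(t))) -
      (if 2 * π * m ≤ T then 2 * (π : ℂ) else 0)‖ ≤
      K * (√T * ((2 * π * m) ^ (-(1 + 1 / RL T)) +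
        if 2 * π * m ≤ 2 * T then (|2 * π * m - T| + 7)⁻¹ else 0)) := by
  obtain ⟨D, hD, hb⟩ := gonek_b
  refine ⟨D + 180000, by positivity, ?_⟩
  intro T t₀ m hT ht₀ ht₅ hm
  have hT0 : 0 < T := (Real.exp_pos _).trans_le hT
  have hL : 12 ≤ RL T := (Real.le_log_iff_exp_le hT0).2 hT
  have hc1 : 1 / RL T ≤ 1 / 12 := by gcongr
  have hc0 : 0 < 1 / RL T := PA
  have hT13 : 13 ≤ T := by have := Real.add_one_le_exp 12; linarith
  have hm' : (1 : ℝ) ≤ m := by exact_mod_cast hm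
  have hsq1 : 1 ≤ √T := Real.one_le_sqrt.2 LA
  have hy1 : 1 ≤ 2 * π * m := by nlinarith [Real.pi_gt_three]
  have hyc := pw_y hT hy1
  have hbm := hb (1 + 1 / RL T) t₀ (T + 7) m LA LA ht₀ ht₅ LA hm
  set y := 2 * π * m with hy
  have hy0 : 0 < y := LA
  set c := 1 + 1 / RL T with hc
  set Y := y ^ (-c) with hY
  have hY0 : 0 < Y := by rw [hY]; positivity
  have hYs : 0 ≤ √T * Y := PA
  have hii : ∀ a b, IntervalIntegrable (fun t : ℝ => hh y (π / 2) (c + mI(t))) volume a b :=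
    fun a b => (hh_cont' y _ LA).intervalIntegrable _ _
  by_cases hyT : y ≤ T
  · rw [if_pos hyT, if_pos LA]
    have h1 := hbm LA
    have h2 := hh_seg hT hy0 (a := T) (b := T + 7) LA rfl LA
    have h3 := pw_bound hT hy0 (t := T + 7) LA LA
    rw [← hc] at h2 h3
    rw [← integral_add_adjacent_intervals (hii t₀ T) (hii T (T + 7))] at h1
    have habs : |y - T| + 7 = T + 7 - y := by rw [abs_of_nonpos LA]; ring
    rw [habs]
    set P := ∫ t in t₀..T, hh y (π / 2) (c + mI(t))
    set Q := ∫ t in T..(T + 7), hh y (π / 2) (c + mI(t))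
    have e1 : P - 2 * (π : ℂ) = (P + Q - 2 * π) - Q := by ring
    rw [e1]
    have hd : 0 < T + 7 - y := LA
    have h4 : (T + 7) / (T + 7 - y) * (2000 * ((T + 7) ^ (-(1 / 2) : ℝ) * ((T + 7) / y) ^ c)) ≤
        12000 * (√T * (Y + (T + 7 - y)⁻¹)) := by
      calc _ ≤ (T + 7) / (T + 7 - y) * (2000 * (6 * (√T * Y))) := by
            have : 0 ≤ (T + 7) / (T + 7 - y) := PA
            gcongr
        _ = 12000 * (√T * (Y + (Y * y) * (T + 7 - y)⁻¹)) := by field_simp; ring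
        _ ≤ 12000 * (√T * (Y + 1 * (T + 7 - y)⁻¹)) := by gcongr
        _ = _ := by rw [one_mul]
    have h5 : D * Y ≤ D * (√T * Y) := by
      have : Y ≤ √T * Y := le_mul_of_one_le_left hY0.le hsq1
      gcongr
    have h6 : 0 ≤ √T * (T + 7 - y)⁻¹ := PA
    refine (norm_sub_le _ _).trans ?_
    have h7 := h1.trans (add_le_add h5 h4)
    nlinarith
  · rw [if_neg hyT, sub_zero]
    push Not at hyT
    have h1 := gonek_a (c := c) (t₀ := t₀) (T := T - 7) (y := y) LA LA ht₀ LA LA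
    have h2 := hh_seg hT hy0 (a := T - 7) (b := T) LA (by ring) LA
    have h3 := pw_bound hT hy0 (t := T - 7) LA LA
    rw [← hc] at h2 h3
    rw [← integral_add_adjacent_intervals (hii t₀ (T - 7)) (hii (T - 7) T)]
    refine (norm_add_le _ _).trans ?_
    have hd : 0 < y - (T - 7) := LA
    have h4 : ‖∫ t in t₀..(T - 7), hh y (π / 2) (c + mI(t))‖ ≤ 48000 * (√T * (Y * (y / (y - (T - 7))))) := by
      refine h1.trans ?_
      calc _ ≤ 8000 * (6 * (√T * Y) * (y / (y - (T - 7)))) := by gcongr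
        _ = _ := by ring
    by_cases hy2 : y ≤ 2 * T
    · rw [if_pos hy2]
      have habs : |y - T| + 7 = y - (T - 7) := by rw [abs_of_nonneg LA]; ring
      rw [habs]
      have h5 : Y * (y / (y - (T - 7))) ≤ (y - (T - 7))⁻¹ := by
        rw [div_eq_mul_inv, ← mul_assoc]
        exact mul_le_of_le_one_left PA hyc
      have h6 : √T * (Y * (y / (y - (T - 7)))) ≤ √T * (y - (T - 7))⁻¹ := by gcongr
      have h8 : 0 ≤ √T * (y - (T - 7))⁻¹ := PA
      have h9 : 0 ≤ D * (√T * (Y + (y - (T - 7))⁻¹)) := PA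
      linarith
    · rw [if_neg hy2, add_zero]
      push Not at hy2
      have h5 : y / (y - (T - 7)) ≤ 2 := by
        rw [div_le_iff₀ hd]; linarith
      have h6 : √T * (Y * (y / (y - (T - 7)))) ≤ √T * (Y * 2) := by gcongr
      have h9 : 0 ≤ D * (√T * Y) := PA
      linarith

lemma gonek_err : ∃ K > 0, ∀ (T t₀ : ℝ) (m : ℕ), RE 12 ≤ T → 1 ≤ t₀ → t₀ ≤ 5 → 1 ≤ m →
    ‖(∫ t in t₀..T, XX ((1 + 1 / RL T : ℝ) + mI(t)) *
        cexp (-(((1 + 1 / RL T : ℝ) + mI(t)) * RL m))) -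
      (if m ≤ ⌊T / (2 * π)⌋₊ then 2 * (π : ℂ) else 0)‖ ≤
      K * (√T * (RE (-((1 + 1 / RL T) * RL m)) +
        if m < 2 * ⌊T / (2 * π)⌋₊ + 3 then (1 + |(m : ℝ) - ⌊T / (2 * π)⌋₊|)⁻¹ else 0)) := by
  obtain ⟨K, hK, hg⟩ := gonek_y
  obtain ⟨K', hK', hdec⟩ := hh_dec (a := π / 2) PA
  refine ⟨K + K' * π, by positivity, ?_⟩
  intro T t₀ m hT ht₀ ht₅ hm
  have hT0 : 0 < T := (Real.exp_pos _).trans_le hT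
  have hL : 12 ≤ RL T := (Real.le_log_iff_exp_le hT0).2 hT
  have hc1 : 1 / RL T ≤ 1 / 12 := by gcongr
  have hc0 : 0 < 1 / RL T := PA
  have hT13 : 13 ≤ T := by have := Real.add_one_le_exp 12; linarith
  have hm' : (1 : ℝ) ≤ m := by exact_mod_cast hm
  have hsq1 : 1 ≤ √T := Real.one_le_sqrt.2 LA
  have hpi := Real.pi_gt_three
  have h1 := hg T t₀ m hT ht₀ ht₅ hm
  set c := 1 + 1 / RL T with hc
  set y := 2 * π * m with hy
  have hy0 : 0 < y := PA
  set x := T / (2 * π) with hx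
  have hx0 : 0 ≤ x := PA
  have hTx : T = 2 * π * x := by rw [hx]; field_simp
  set N := ⌊x⌋₊ with hN
  have hN1 : (N : ℝ) ≤ x := Nat.floor_le hx0
  have hN2 : x < N + 1 := Nat.lt_floor_add_one x
  have hiff : (m ≤ N) ↔ y ≤ T := by
    rw [hN, Nat.le_floor_iff hx0, hTx, hy]
    exact (mul_le_mul_iff_right₀ PA).symm
  have hYm : y ^ (-c) ≤ RE (-(c * RL m)) := by
    rw [exp_log_rpow LA c]
    refine Real.rpow_le_rpow_of_nonpos LA ?_ LA
    rw [hy]; nlinarith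
  have h2 : ‖∫ t in t₀..T, hh y (-(π / 2)) (c + mI(t))‖ ≤ K' * RE 0 * y ^ (-c) * π := by
    refine norm_int_inv_sq LA PA fun t ht => ?_
    refine hdec c y _ t 0 LA LA hy0 ?_
    have : 0 ≤ t := by linarith [ht.1]
    rw [sub_self, zero_mul, zero_add]
    nlinarith
  rw [Real.exp_zero, mul_one] at h2
  have e : ∫ t in t₀..T, XX (c + mI(t)) * cexp (-((c + mI(t)) * RL m)) =
      (∫ t in t₀..T, hh y (π / 2) (c + mI(t))) + ∫ t in t₀..T, hh y (-(π / 2)) (c + mI(t)) := by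
    rw [← intervalIntegral.integral_add ((hh_cont' y _ LA).intervalIntegrable _ _)
      ((hh_cont' y _ LA).intervalIntegrable _ _)]
    congr 1
    funext t
    exact XX_hh hm _
  rw [e, add_sub_right_comm]
  have hQ : (if y ≤ 2 * T then (|y - T| + 7)⁻¹ else 0) ≤
      if m < 2 * N + 3 then (1 + |(m : ℝ) - N|)⁻¹ else 0 := by
    by_cases h : y ≤ 2 * T
    · have hm2 : (m : ℝ) ≤ 2 * x := by
        have h' : 2 * π * m ≤ 2 * π * (2 * x) := by
          rw [hy, hTx] at h; linarith
        exact le_of_mul_le_mul_left h' PA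
      have hmN : m < 2 * N + 3 := by
        have : (m : ℝ) < 2 * N + 3 := LA
        exact_mod_cast this
      rw [if_pos h, if_pos hmN]
      apply inv_anti₀ PA
      have e1 : |y - T| = 2 * π * |(m : ℝ) - x| := by
        rw [hy, hTx, ← mul_sub, abs_mul, abs_of_pos PA]
      have h3 : |(m : ℝ) - N| ≤ |(m : ℝ) - x| + 1 := by
        have := abs_sub_le (m : ℝ) x N
        have h4 : |x - N| ≤ 1 := by rw [abs_of_nonneg LA]; linarith
        linarith
      rw [e1]
      nlinarith [abs_nonneg ((m : ℝ) - x)]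
    · rw [if_neg h]
      split_ifs
      · positivity
      · exact le_rfl
  have hif : (if m ≤ N then 2 * (π : ℂ) else 0) = if y ≤ T then 2 * (π : ℂ) else 0 := by
    simp only [hiff]
  rw [hif]
  refine (norm_add_le _ _).trans ?_
  set Q := if m < 2 * N + 3 then (1 + |(m : ℝ) - N|)⁻¹ else 0 with hQd
  have hQ0 : 0 ≤ Q := by
    rw [hQd]; split_ifs
    · positivity
    · exact le_rfl
  set Em := RE (-(c * RL m)) with hEm
  have hE0 : 0 < Em := Real.exp_pos _
  calc _ ≤ K * (√T * (Em + Q)) + K' * Em * π := by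
        refine add_le_add (h1.trans ?_) (h2.trans ?_)
        · gcongr
        · gcongr
    _ ≤ K * (√T * (Em + Q)) + K' * (√T * (Em + Q)) * π := by
        have : Em ≤ √T * (Em + Q) := by nlinarith
        gcongr
    _ = _ := by ring

lemma harm_le (M : ℕ) : ∑ i ∈ range M, (1 + (i : ℝ))⁻¹ ≤ 1 + RL M := by
  refine le_trans (le_of_eq ?_) (harmonic_le_one_add_log M)
  rw [harmonic]
  push_cast
  exact sum_congr rfl fun i _ => by rw [add_comm]

lemma near_sum (N : ℕ) : ∑ m ∈ range (2 * N + 3), (1 + |(m : ℝ) - N|)⁻¹ ≤ 2 * (1 + RL ((N : ℝ) + 2)) := by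
  have e : 2 * N + 3 = (N + 1) + (N + 2) := by ring
  rw [e, sum_range_add]
  have h1 : ∑ m ∈ range (N + 1), (1 + |(m : ℝ) - N|)⁻¹ = ∑ i ∈ range (N + 1), (1 + (i : ℝ))⁻¹ := by
    rw [← sum_range_reflect]
    refine sum_congr rfl fun i hi => ?_
    have hi' : i ≤ N := by have := mem_range.1 hi; omega
    have : N + 1 - 1 - i = N - i := by omega
    rw [this, Nat.cast_sub hi']
    have hi'' : (i : ℝ) ≤ N := by exact_mod_cast hi'
    rw [sub_sub_cancel_left, abs_neg, abs_of_nonneg PA]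
  have h2 : ∑ i ∈ range (N + 2), (1 + |((N + 1 + i : ℕ) : ℝ) - N|)⁻¹ ≤ ∑ i ∈ range (N + 2), (1 + (i : ℝ))⁻¹ := by
    refine sum_le_sum fun i _ => ?_
    apply inv_anti₀ PA
    have : ((N + 1 + i : ℕ) : ℝ) - N = 1 + i := by push_cast; ring
    rw [this, abs_of_nonneg PA]
    linarith
  have h3 : ∑ i ∈ range (N + 1), (1 + (i : ℝ))⁻¹ ≤ ∑ i ∈ range (N + 2), (1 + (i : ℝ))⁻¹ :=
    sum_le_sum_of_subset_of_nonneg (range_mono (by omega)) fun i _ _ => by positivity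
  have h4 := harm_le (N + 2)
  push_cast at h4
  rw [h1]
  linarith

lemma left_main (n : ℕ) : ∃ K > 0, ∀ T t₀ : ℝ, RE 12 ≤ T → 1 ≤ t₀ → t₀ ≤ 5 →
    ‖(-1) ^ (n + 1) * (∫ t in t₀..T, XX ((1 + 1 / RL T : ℝ) + mI(t)) *
        zF n ((1 + 1 / RL T : ℝ) + mI(t))) -
      2 * π * ((∑ m ∈ Icc 1 ⌊T / (2 * π)⌋₊, fc n m : ℝ) : ℂ)‖ ≤ K * (√T * RL T ^ (n + 2)) := by
  obtain ⟨K₁, hK₁, hg⟩ := gonek_err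
  obtain ⟨K₂, hK₂, hf⟩ := fc_sum n
  refine ⟨K₁ * (K₂ + 4), by positivity, ?_⟩
  intro T t₀ hT ht₀ ht₅
  have hT0 : 0 < T := (Real.exp_pos _).trans_le hT
  have hL : 12 ≤ RL T := (Real.le_log_iff_exp_le hT0).2 hT
  have hT13 : 13 ≤ T := by have := Real.add_one_le_exp 12; linarith
  have hg' := hg T t₀
  obtain ⟨hs, hst⟩ := hf (RL T) LA
  set L := RL T with hLd
  have hL0 : 0 < L := LA
  have hc0 : 0 < 1 / L := PA
  set c := 1 + 1 / L with hc
  set x := T / (2 * π) with hx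
  have hx0 : 0 ≤ x := PA
  have hxT : 6 * x ≤ T := by
    have h1 : T = 2 * π * x := by rw [hx]; field_simp
    nlinarith [Real.pi_gt_three]
  set N := ⌊x⌋₊ with hN
  have hN1 : (N : ℝ) ≤ x := Nat.floor_le hx0
  have hXc : Continuous (fun t : ℝ => XX cI(c,t)) := by
    refine continuous_iff_continuousAt.2 fun t => ?_
    exact ContinuousAt.comp (f := fun t : ℝ => (c : ℂ) + mI(t)) (g := XX)
      (XX_diff (by simp; linarith)).continuousAt FA
  have h1 := dirichlet_int n (c := c) LA (w := fun t : ℝ => (c : ℂ) + mI(t))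
    (g := fun t : ℝ => XX cI(c,t)) FA (by intro t; simp) hXc t₀ T
  have h2 : HasSum (fun m : ℕ => (fc n m : ℂ) * (if m ≤ N then 2 * (π : ℂ) else 0))
      (∑ m ∈ Icc 1 N, (fc n m : ℂ) * (if m ≤ N then 2 * (π : ℂ) else 0)) := by
    refine hasSum_sum_of_ne_finset_zero fun m hm => ?_
    rcases Nat.eq_zero_or_pos m with rfl | h0
    · rw [fc_zero]; simp
    · rw [if_neg, mul_zero]
      intro h; exact hm (mem_Icc.2 ⟨h0, h⟩)
  have e2 : ∑ m ∈ Icc 1 N, (fc n m : ℂ) * (if m ≤ N then 2 * (π : ℂ) else 0) =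
      2 * π * ((∑ m ∈ Icc 1 N, fc n m : ℝ) : ℂ) := by
    push_cast
    rw [mul_sum]
    refine sum_congr rfl fun m hm => ?_
    rw [if_pos (mem_Icc.1 hm).2]; ring
  rw [e2] at h2
  have h3 := h1.sub h2
  have hb : ∀ m : ℕ, ‖(fc n m : ℂ) * (∫ t in t₀..T, XX cI(c,t) *
      cexp (-(cI(c,t) * RL m))) - (fc n m : ℂ) * (if m ≤ N then 2 * (π : ℂ) else 0)‖ ≤
      K₁ * √T * (fc n m * RE (-(c * RL m))) +
        K₁ * √T * (if m < 2 * N + 3 then L ^ (n + 1) * (1 + |(m : ℝ) - N|)⁻¹ else 0) := by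
    intro m
    rcases Nat.eq_zero_or_pos m with rfl | h0
    · have : 0 ≤ (if 0 < 2 * N + 3 then L ^ (n + 1) * (1 + |((0 : ℕ) : ℝ) - N|)⁻¹ else 0) := by
        rw [if_pos (by omega)]; positivity
      rw [fc_zero]
      simp only [Complex.ofReal_zero, zero_mul, sub_zero, norm_zero, mul_zero, zero_add]
      exact mul_nonneg PA this
    rw [← mul_sub, norm_mul, norm_real, Real.norm_of_nonneg (fc_nonneg n m)]
    have h4 := hg' m hT ht₀ ht₅ h0
    refine (mul_le_mul_of_nonneg_left h4 (fc_nonneg n m)).trans ?_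
    have h5 : fc n m * (if m < 2 * N + 3 then (1 + |(m : ℝ) - N|)⁻¹ else 0) ≤
        (if m < 2 * N + 3 then L ^ (n + 1) * (1 + |(m : ℝ) - N|)⁻¹ else 0) := by
      by_cases h : m < 2 * N + 3
      · rw [if_pos h, if_pos h]
        refine mul_le_mul_of_nonneg_right ?_ PA
        refine (fc_le n m).trans ?_
        have hm0 : (0 : ℝ) < m := by exact_mod_cast h0
        have hmT : (m : ℝ) ≤ T := by
          have h' : m ≤ 2 * N + 2 := by omega
          have : (m : ℝ) ≤ 2 * N + 2 := by exact_mod_cast h'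
          linarith
        have := Real.log_le_log hm0 hmT
        have h6 : 0 ≤ RL m := Real.log_natCast_nonneg m
        gcongr
      · rw [if_neg h, if_neg h, mul_zero]
    have h6 : 0 ≤ K₁ * √T := PA
    have h7 := mul_le_mul_of_nonneg_left h5 h6
    refine le_trans (le_of_eq ?_) (add_le_add_right h7 _)
    ring
  have hfin : HasSum (fun m : ℕ => (if m < 2 * N + 3 then L ^ (n + 1) * (1 + |(m : ℝ) - N|)⁻¹ else 0))
      (∑ m ∈ range (2 * N + 3), (if m < 2 * N + 3 then L ^ (n + 1) * (1 + |(m : ℝ) - N|)⁻¹ else 0)) := by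
    refine hasSum_sum_of_ne_finset_zero fun m hm => ?_
    rw [if_neg]
    intro h; exact hm (mem_range.2 h)
  have e3 : ∑ m ∈ range (2 * N + 3), (if m < 2 * N + 3 then L ^ (n + 1) * (1 + |(m : ℝ) - N|)⁻¹ else 0) ≤
      L ^ (n + 1) * (4 * L) := by
    have : ∑ m ∈ range (2 * N + 3), (if m < 2 * N + 3 then L ^ (n + 1) * (1 + |(m : ℝ) - N|)⁻¹ else 0) =
        L ^ (n + 1) * ∑ m ∈ range (2 * N + 3), (1 + |(m : ℝ) - N|)⁻¹ := by
      rw [mul_sum]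
      exact sum_congr rfl fun m hm => by rw [if_pos (mem_range.1 hm)]
    rw [this]
    refine mul_le_mul_of_nonneg_left ((near_sum N).trans ?_) PA
    have := Real.log_le_log PA (by linarith : (N : ℝ) + 2 ≤ T)
    linarith
  have h8 := tsum_of_norm_bounded ((hs.hasSum.mul_left (K₁ * √T)).add (hfin.mul_left (K₁ * √T))) hb
  rw [h3.tsum_eq] at h8
  refine h8.trans ?_
  calc _ ≤ K₁ * √T * (K₂ * L ^ (n + 2)) + K₁ * √T * (L ^ (n + 1) * (4 * L)) := by gcongr
    _ = _ := by ring

/-- Left edge of the contour. -/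
lemma left_edge (hRH : RiemannHypothesis) (n : ℕ) (hn : 1 ≤ n) : ∃ K > 0, ∀ T t₀ : ℝ, RE 12 ≤ T → 4 ≤ t₀ → t₀ ≤ 5 →
    ‖(∫ t in t₀..T, zF n ((1 - (1 + 1 / RL T) : ℝ) + t * I)) -
      2 * π * ((∑ m ∈ Icc 1 ⌊T / (2 * π)⌋₊, fc n m : ℝ) : ℂ)‖ ≤
      K * (√T * RL T ^ (n + 2)) := by
  obtain ⟨K₁, hK₁, h1⟩ := left_main n
  obtain ⟨K₂, hK₂, h2⟩ := XX_polygamma (n - 1)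
  rw [Nat.sub_add_cancel hn] at h2
  refine ⟨K₁ + K₂ * 24000 * 120, by positivity, fun T t₀ hT ht₀ ht₅ => ?_⟩
  have h3 := h1 T t₀ hT LA ht₅
  have hT0 : 0 < T := (Real.exp_pos 12).trans_le hT
  have hL : 12 ≤ RL T := (Real.le_log_iff_exp_le hT0).2 hT
  have hT13 : 13 ≤ T := by linarith [Real.add_one_le_exp (12 : ℝ)]
  set L := RL T with hLdef
  set c : ℝ := 1 + 1 / L with hc
  have hc1 : 1 < c := by rw [hc]; linarith [show 0 < 1 / L by positivity]
  have hc2 : c ≤ 2 := by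
    have : 1 / L ≤ 1 := by rw [div_le_one LA]; linarith
    linarith
  have htT : t₀ ≤ T := LA
  have hwre : ∀ t : ℝ, cI(c,t).re = c := fun t => by simp
  have hwim : ∀ t : ℝ, cI(c,t).im = -t := fun t => by simp
  have hz : ∀ t : ℝ, ZZ cI(c,t) ≠ 0 := fun t =>
    riemannZeta_ne_zero_of_one_le_re (by rw [hwre]; exact hc1.le)
  have hw1 : ∀ t : ℝ, ((1 - c : ℝ) : ℂ) + t * I = 1 - cI(c,t) := fun t => by push_cast; ring
  have hpt : ∀ t ∈ Set.Icc t₀ T, ‖zF n ((1 - c : ℝ) + t * I) - (-1) ^ (n + 1) * (XX cI(c,t) * zF n cI(c,t))‖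
      ≤ K₂ * 24000 * 120 * √T * L * t⁻¹ := by
    intro t ht
    have ht0 : 0 < t := by linarith [ht.1]
    have hat : |cI(c,t).im| = t := by rw [hwim, abs_neg, abs_of_pos ht0]
    rw [hw1, zF_reflect n (by rw [hwre]; linarith) (by rw [hwim]; linarith) (hz t)]
    have e : (-1 : ℂ) ^ (n + 1) * XX cI(c,t) * (iteratedDeriv n (logDeriv XX) cI(c,t) * ZZ cI(c,t) + zF n cI(c,t)) - (-1) ^ (n + 1) * (XX cI(c,t) * zF n cI(c,t)) =
      (-1 : ℂ) ^ (n + 1) * (XX cI(c,t) * (iteratedDeriv n (logDeriv XX) cI(c,t) * ZZ cI(c,t))) := by ring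
    rw [e, norm_mul, norm_pow, norm_neg, norm_one, one_pow, one_mul, norm_mul, norm_mul]
    have b1 := XX_bound (w := (c : ℂ) + mI(t)) (by rw [hwre]; linarith) (by rw [hwre]; linarith) (by rw [hat]; linarith [ht.1])
    have b2 := h2 cI(c,t) (by rw [hwre]; linarith) (by rw [hwre]; linarith) (by rw [hwim]; linarith [ht.1])
    have b3 := zeta_bound_strip (s := (c : ℂ) + mI(t)) (by rw [hwre]; linarith) (by rw [hat]; linarith [ht.1]) (T := T) (by rw [hat]; exact ht.2) (by rw [hwre])
    rw [hat, hwre] at b1 b3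
    rw [hat] at b2
    have b4 := pw_bound hT one_pos ht0 (by linarith [ht.2])
    rw [← hLdef, ← hc, div_one, Real.one_rpow, mul_one, ← Real.rpow_add ht0] at b4
    have b5 : t ^ (c - 1 / 2) = t ^ (-(1 / 2) + c) := by congr 1; ring
    have b6 : t ^ (1 - c) ≤ 1 := Real.rpow_le_one_of_one_le_of_nonpos (by linarith [ht.1]) LA
    have b7 : RL t ≤ L := Real.log_le_log ht0 ht.2
    have b8 : 0 ≤ RL t := Real.log_nonneg (by linarith [ht.1])
    have b1' : ‖XX cI(c,t)‖ ≤ 24000 * √T := by rw [b5] at b1; linarith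
    have b3' : ‖ZZ cI(c,t)‖ ≤ 120 * L := by
      calc _ ≤ 60 * t ^ (1 - c) * (1 + RL t) := b3
        _ ≤ 60 * 1 * (1 + L) := by gcongr
        _ ≤ _ := LA
    calc _ ≤ (24000 * √T) * ((K₂ / t) * (120 * L)) := by gcongr
      _ = _ := by rw [div_eq_mul_inv]; ring
  have i1 : IntervalIntegrable (fun t : ℝ => zF n ((1 - c : ℝ) + t * I)) volume t₀ T := by
    apply ContinuousOn.intervalIntegrable
    rw [Set.uIcc_of_le htT]
    intro t ht
    apply ContinuousAt.continuousWithinAt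
    have ht0 : 0 < t := by linarith [ht.1]
    have : ContinuousAt (zF n) (((1 - c : ℝ) : ℂ) + t * I) := by
      apply AnalyticAt.continuousAt (𝕜 := ℂ)
      apply zF_analyticAt
      · intro h
        have := congrArg Complex.im h
        simp at this; linarith
      · rw [hw1, zeta_reflect (by rw [hwre]; linarith) (by rw [hwim]; linarith)]
        exact mul_ne_zero (XX_ne (by rw [hwre]; linarith) (by rw [hwim]; linarith)) (hz t)
    exact ContinuousAt.comp (f := fun t : ℝ => (((1 - c : ℝ) : ℂ) + t * I)) this FA
  have i2 : IntervalIntegrable (fun t : ℝ => (-1 : ℂ) ^ (n + 1) * (XX cI(c,t) * zF n cI(c,t))) volume t₀ T := by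
    apply Continuous.intervalIntegrable
    refine continuous_const.mul (Continuous.mul ?_ ?_)
    · rw [continuous_iff_continuousAt]
      intro t
      have := (XX_diff (w := (c : ℂ) + mI(t)) (by rw [hwre]; linarith)).continuousAt
      exact ContinuousAt.comp (f := fun t : ℝ => cI(c,t)) this FA
    · exact (zF_line_continuous hRH (n := n) (σ := c) LA LA).comp continuous_neg
  have e1 : (∫ t in t₀..T, zF n ((1 - c : ℝ) + t * I)) - (-1) ^ (n + 1) * (∫ t in t₀..T, XX cI(c,t) * zF n cI(c,t)) =
      ∫ t in t₀..T, (zF n ((1 - c : ℝ) + t * I) - (-1) ^ (n + 1) * (XX cI(c,t) * zF n cI(c,t))) := by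
    rw [intervalIntegral.integral_sub i1 i2, intervalIntegral.integral_const_mul]
  have hne : ∀ t ∈ Set.uIcc t₀ T, t ≠ 0 := by
    intro t ht; rw [Set.uIcc_of_le htT] at ht; linarith [ht.1]
  have e2 : ‖∫ t in t₀..T, (zF n ((1 - c : ℝ) + t * I) - (-1) ^ (n + 1) * (XX cI(c,t) * zF n cI(c,t)))‖ ≤
      K₂ * 24000 * 120 * (√T * L ^ (n + 2)) := by
    refine (intervalIntegral.norm_integral_le_of_norm_le htT (ae_of_all _ fun t ht => hpt t ⟨ht.1.le, ht.2⟩) ?_).trans ?_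
    · refine (ContinuousOn.intervalIntegrable ?_)
      exact ContinuousOn.mul continuousOn_const (continuousOn_inv₀.mono hne)
    · rw [intervalIntegral.integral_const_mul, integral_inv_of_pos LA hT0]
      have : RL (T / t₀) ≤ L := Real.log_le_log PA (div_le_self hT0.le LA)
      have hp : L * L ≤ L ^ (n + 2) := by
        rw [← sq]; exact pow_le_pow_right₀ LA (by omega)
      calc _ ≤ K₂ * 24000 * 120 * √T * L * L := by gcongr
        _ = K₂ * 24000 * 120 * (√T * (L * L)) := by ring
        _ ≤ _ := by gcongr
  calc _ = ‖((-1) ^ (n + 1) * (∫ t in t₀..T, XX cI(c,t) * zF n cI(c,t)) - 2 * π * ((∑ m ∈ Icc 1 ⌊T / (2 * π)⌋₊, fc n m : ℝ) : ℂ)) +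
        ((∫ t in t₀..T, zF n ((1 - c : ℝ) + t * I)) - (-1) ^ (n + 1) * (∫ t in t₀..T, XX cI(c,t) * zF n cI(c,t)))‖ := by congr 1; ring
    _ ≤ K₁ * (√T * L ^ (n + 2)) + K₂ * 24000 * 120 * (√T * L ^ (n + 2)) := by
      refine (norm_add_le _ _).trans (add_le_add h3 ?_)
      rw [e1]; exact e2
    _ = _ := by ring

lemma sum_rpow_neg_three_quarter (N : ℕ) : ∑ m ∈ Icc 1 N, (m : ℝ) ^ (-(3 / 4) : ℝ) ≤ 4 * (N : ℝ) ^ (1 / 4 : ℝ) := by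
  induction N with
  | zero => simp
  | succ N ih =>
    rw [sum_Icc_succ_top (by omega)]
    have ha0 : (0 : ℝ) < ((N + 1 : ℕ) : ℝ) := PA
    set a := ((N + 1 : ℕ) : ℝ) ^ (1 / 4 : ℝ) with ha
    set b := (N : ℝ) ^ (1 / 4 : ℝ) with hb
    have hapos : 0 < a := PA
    have hb0 : 0 ≤ b := PA
    have hab : b ≤ a := by rw [ha, hb]; gcongr; simp
    have h4 : a ^ 4 = N + 1 := by
      rw [ha, ← Real.rpow_natCast, ← Real.rpow_mul ha0.le]; norm_num
    have h5 : b ^ 4 = N := by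
      rw [hb, ← Real.rpow_natCast, ← Real.rpow_mul PA]; norm_num
    have h3 : ((N + 1 : ℕ) : ℝ) ^ (-(3 / 4) : ℝ) = (a ^ 3)⁻¹ := by
      rw [ha, ← Real.rpow_natCast, ← Real.rpow_mul ha0.le, ← Real.rpow_neg ha0.le]; norm_num
    rw [h3]
    have h6 : (a ^ 3)⁻¹ ≤ 4 * (a - b) := by
      rw [inv_le_iff_one_le_mul₀ PA]
      have e : 1 = (a - b) * (a ^ 3 + a ^ 2 * b + a * b ^ 2 + b ^ 3) := by linear_combination h5 - h4
      have q1 : a ^ 2 * b ≤ a ^ 2 * a := by gcongr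
      have q2 : a * b ^ 2 ≤ a * a ^ 2 := by gcongr
      have q3 : b ^ 3 ≤ a ^ 3 := by gcongr
      have : (a - b) * (a ^ 3 + a ^ 2 * b + a * b ^ 2 + b ^ 3) ≤ (a - b) * (4 * a ^ 3) :=
        mul_le_mul_of_nonneg_left (by nlinarith) LA
      linarith
    linarith

/-- `ζ(σ+it) ≪ |t|^{1-σ}` for `1/2 ≤ σ ≤ 3/4`. -/
lemma zeta_bound_no_log {s : ℂ} (hs : 1 / 2 ≤ s.re) (hs2 : s.re ≤ 3 / 4) (ht : 1 ≤ |s.im|) :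
    ‖ZZ s‖ ≤ 12 * |s.im| ^ (1 - s.re) := by
  set T := |s.im| with hT
  have hT0 : 0 < T := LA
  set N := ⌊T⌋₊ with hN
  have hN1 : 1 ≤ N := by rw [hN, Nat.one_le_floor_iff]; exact ht
  have hNT : (N : ℝ) ≤ T := Nat.floor_le hT0.le
  have hN1' : (1 : ℝ) ≤ N := by exact_mod_cast hN1
  have hTN : T ≤ 2 * N := by
    have := Nat.lt_floor_add_one T
    linarith
  have hN0 : (0 : ℝ) < N := LA
  have hs0 : 0 < s.re := LA
  have hs1 : s ≠ 1 := by rintro rfl; simp at hT; linarith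
  have hsT : T ≤ ‖s - 1‖ := by
    have := abs_im_le_norm (s - 1); simpa using this
  have hNp : (N : ℝ) ^ (1 - s.re) ≤ T ^ (1 - s.re) := Real.rpow_le_rpow hN0.le hNT LA
  have hTp : 0 ≤ T ^ (1 - s.re) := PA
  rw [zeta_formula hN1 hs0 hs1]
  have a1 : ‖∑ m ∈ Icc 1 N, (m : ℂ) ^ (-s)‖ ≤ 4 * T ^ (1 - s.re) := by
    calc _ ≤ ∑ m ∈ Icc 1 N, ‖(m : ℂ) ^ (-s)‖ := norm_sum_le _ _
      _ ≤ ∑ m ∈ Icc 1 N, (N : ℝ) ^ (3 / 4 - s.re) * (m : ℝ) ^ (-(3/4) : ℝ) := by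
          apply sum_le_sum
          intro m hm
          have hm1 := (mem_Icc.1 hm).1
          have hm0 : (0 : ℝ) < m := by exact_mod_cast hm1
          rw [norm_natCast_cpow_pos hm1]
          have e : (m : ℝ) ^ (-s).re = (m : ℝ) ^ (3 / 4 - s.re) * (m : ℝ) ^ (-(3/4) : ℝ) := by
            rw [← Real.rpow_add hm0, neg_re]; congr 1; ring
          rw [e]
          refine mul_le_mul_of_nonneg_right ?_ PA
          exact Real.rpow_le_rpow hm0.le (by exact_mod_cast (mem_Icc.1 hm).2) LA
      _ ≤ (N : ℝ) ^ (3 / 4 - s.re) * (4 * (N : ℝ) ^ (1 / 4 : ℝ)) := by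
          rw [← mul_sum]; exact mul_le_mul_of_nonneg_left (sum_rpow_neg_three_quarter N) PA
      _ = 4 * (N : ℝ) ^ (1 - s.re) := by
          rw [show 1 - s.re = (3 / 4 - s.re) + 1 / 4 by ring, Real.rpow_add hN0]; ring
      _ ≤ _ := LA
  have a2 : ‖(N : ℂ) ^ (1 - s) / (s - 1)‖ ≤ T ^ (1 - s.re) := by
    rw [norm_div, norm_natCast_cpow_pos hN1, div_le_iff₀ LA, sub_re, one_re]
    nlinarith
  have a3 : ‖s * zRem N s‖ ≤ 6 * T ^ (1 - s.re) := by
    rw [norm_mul]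
    have h1 := zRem_norm_le hN1 hs0
    have h2 : ‖s‖ ≤ s.re + T := by
      have := norm_le_abs_re_add_abs_im s
      rwa [abs_of_pos hs0] at this
    have h3 : T * (N : ℝ) ^ (-s.re) ≤ 2 * T ^ (1 - s.re) := by
      calc T * (N : ℝ) ^ (-s.re) ≤ 2 * N * (N : ℝ) ^ (-s.re) := by gcongr
        _ = 2 * (N : ℝ) ^ (1 - s.re) := by
          rw [sub_eq_add_neg, Real.rpow_add hN0, Real.rpow_one]; ring
        _ ≤ _ := LA
    calc ‖s‖ * ‖zRem N s‖ ≤ (s.re + T) * ((N : ℝ) ^ (-s.re) / s.re) := by gcongr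
      _ = ((s.re + T) / s.re) * (N : ℝ) ^ (-s.re) := by ring
      _ ≤ (3 * T) * (N : ℝ) ^ (-s.re) := by
          gcongr
          rw [div_le_iff₀ hs0]; nlinarith
      _ ≤ _ := LA
  calc _ ≤ ‖∑ m ∈ Icc 1 N, (m : ℂ) ^ (-s)‖ + ‖(N : ℂ) ^ (1 - s) / (s - 1)‖ + ‖s * zRem N s‖ :=
        (norm_sub_le _ _).trans (add_le_add_left (norm_add_le _ _) _)
    _ ≤ _ := LA

lemma log_add_three_le {T : ℝ} (hT : RE 12 ≤ T) : RL (T + 3) ≤ 2 * RL T := by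
  have hT13 : 13 ≤ T := by linarith [Real.add_one_le_exp (12 : ℝ)]
  have : 2 * RL T = RL (T ^ 2) := by rw [Real.log_pow]; norm_num
  rw [this]
  exact Real.log_le_log LA (by nlinarith)

/-- `(Dζ/ζ)^{(n)}` at admissible heights. -/
lemma G_adm (hRH : RiemannHypothesis) (n : ℕ) {δ : ℝ} (hδ : 0 < δ) : ∃ K > 0, ∀ (T : ℝ) (s : ℂ), RE 12 ≤ T →
    AdmissibleHeight δ T → |s.im| = T → 1 / 2 ≤ s.re → s.re ≤ 7 / 2 → ZZ s ≠ 0 ∧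
      ‖iteratedDeriv n LZ s‖ ≤ K * RL T ^ (n + 2) := by
  obtain ⟨K, hK, h⟩ := G_bound_dist hRH n
  set e := min δ 1 with he
  have he0 : 0 < e := lt_min hδ one_pos
  refine ⟨K * 2 * (e ^ (n + 1))⁻¹, by positivity, fun T s hT hadm hs h1 h2 => ?_⟩
  have hT0 : 0 < T := (Real.exp_pos 12).trans_le hT
  have hL : 12 ≤ RL T := (Real.le_log_iff_exp_le hT0).2 hT
  have hT13 : 13 ≤ T := by linarith [Real.add_one_le_exp (12 : ℝ)]
  have hlog := log_add_three_le hT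
  set L := RL T with hLdef
  have hd : e / L ≤ δ / L := by gcongr; exact min_le_left _ _
  have hd1 : e / L ≤ 1 := by
    rw [div_le_one LA]; linarith [min_le_right δ 1]
  have := h s (e / L) PA hd1 h1 h2 ?_ ?_
  · refine ⟨this.1, this.2.trans ?_⟩
    rw [hs, div_pow, inv_div]
    calc _ ≤ K * (2 * L) * (L ^ (n + 1) / e ^ (n + 1)) := by gcongr
      _ = _ := by rw [div_eq_mul_inv]; ring
  · have := abs_im_le_norm (s - 1)
    simp only [sub_im, one_im, sub_zero] at this
    linarith
  · intro ρ hρ hre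
    refine hd.trans ?_
    have hi : |s.im - ρ.im| ≤ ‖s - ρ‖ := by
      have := abs_im_le_norm (s - ρ); rwa [sub_im] at this
    refine le_trans ?_ hi
    rcases abs_choice s.im with h | h
    · rw [hs] at h; rw [← h]
      exact hadm ρ ⟨hρ, by rw [hre]; norm_num, by rw [hre]; norm_num⟩
    · rw [hs] at h
      have h' : s.im = -T := LA
      have := hadm (CJ ρ) ⟨by rw [riemannZeta_conj, hρ, map_zero], by rw [conj_re, hre]; norm_num, by rw [conj_re, hre]; norm_num⟩
      rw [conj_im] at this
      have e3 : -T - ρ.im = -(T - -ρ.im) := by ring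
      rwa [h', e3, abs_neg]

lemma top_edge_point (hRH : RiemannHypothesis) (n : ℕ) (hn : 1 ≤ n) {δ : ℝ} (hδ : 0 < δ) : ∃ K > 0, ∀ T σ : ℝ, RE 12 ≤ T →
    AdmissibleHeight δ T → 1 - (1 + 1 / RL T) ≤ σ → σ ≤ 1 + 1 / RL T →
      ‖zF n (σ + T * I)‖ ≤ K * (√T * RL T ^ (n + 2)) := by
  obtain ⟨K₁, hK₁, h1⟩ := G_adm hRH n hδ
  obtain ⟨K₂, hK₂, h2⟩ := XX_polygamma (n - 1)
  rw [Nat.sub_add_cancel hn] at h2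
  obtain ⟨K₃, hK₃, h3⟩ := G_bound_dist hRH n
  have hq : 0 < K₃ * 2 * (((1 : ℝ) / 4) ^ (n + 1))⁻¹ := PA
  set q := K₃ * 2 * (((1 : ℝ) / 4) ^ (n + 1))⁻¹ with hqdef
  refine ⟨480000 * (K₁ + K₂ + q), by positivity, fun T σ hT hadm hσ1 hσ2 => ?_⟩
  have hT0 : 0 < T := (Real.exp_pos 12).trans_le hT
  have hL : 12 ≤ RL T := (Real.le_log_iff_exp_le hT0).2 hT
  have hT13 : 13 ≤ T := by linarith [Real.add_one_le_exp (12 : ℝ)]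
  have hlog := log_add_three_le hT
  have hLdef : RL T = RL T := rfl
  set L := RL T
  have hL1 : 1 / L ≤ 1 := by rw [div_le_one LA]; linarith
  have hsq : 0 < √T := Real.sqrt_pos.2 hT0
  have hL2 : 1 ≤ L ^ (n + 2) := one_le_pow₀ LA
  have hLL : L * L ≤ L ^ (n + 2) := by
    rw [← sq]; exact pow_le_pow_right₀ LA (by omega)
  have hLL1 : L ≤ L * L := by nlinarith
  rcases le_or_gt (1 / 2) σ with hσ | hσ
  · have hre : aI(σ,T).re = σ := by simp
    have him : |aI(σ,T).im| = T := by simp [abs_of_pos hT0]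
    have b1 := (h1 T (σ + T * I) hT hadm him (by rw [hre]; exact hσ) (by rw [hre]; linarith)).2
    have b2 := zeta_bound_half (s := σ + T * I) (by rw [hre]; exact hσ) (by rw [him]; linarith)
    rw [him] at b2
    rw [zF, norm_mul]
    calc _ ≤ (K₁ * L ^ (n + 2)) * (12 * √T) := by gcongr
      _ = 12 * K₁ * (√T * L ^ (n + 2)) := by ring
      _ ≤ _ := by gcongr <;> linarith
  · set w : ℂ := ((1 - σ : ℝ) : ℂ) + mI(T) with hw
    have hre : w.re = 1 - σ := by rw [hw]; simp
    have him : w.im = -T := by rw [hw]; simp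
    have hab : |w.im| = T := by rw [him, abs_neg, abs_of_pos hT0]
    have e : (σ : ℂ) + T * I = 1 - w := by rw [hw]; push_cast; ring
    have hw1 : 1 / 2 ≤ w.re := by rw [hre]; linarith
    have hw2 : w.re ≤ 1 + 1 / L := by rw [hre]; linarith
    clear_value w
    obtain ⟨hz, b1⟩ := h1 T w hT hadm hab hw1 LA
    rw [e, zF_reflect n LA (by rw [him]; linarith) hz, zF]
    have b2 := h2 w hw1 LA (by rw [him]; linarith)
    rw [hab] at b2
    have b2' : ‖iteratedDeriv n (logDeriv XX) w‖ ≤ K₂ := b2.trans (div_le_self hK₂.le LA)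
    have b3 := XX_bound hw1 LA (by rw [hab]; linarith)
    rw [hab] at b3
    have hpw : T ^ (w.re - 1 / 2) * T ^ (1 - w.re) = √T := by
      rw [← Real.rpow_add hT0, Real.sqrt_eq_rpow]; congr 1; ring
    have e2 : (-1 : ℂ) ^ (n + 1) * XX w * (iteratedDeriv n (logDeriv XX) w * ZZ w + iteratedDeriv n LZ w * ZZ w) =
      (-1 : ℂ) ^ (n + 1) * ((XX w * ZZ w) * (iteratedDeriv n (logDeriv XX) w + iteratedDeriv n LZ w)) := by ring
    rw [e2, norm_mul, norm_pow, norm_neg, norm_one, one_pow, one_mul, norm_mul, norm_mul]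
    rcases le_or_gt w.re (3 / 4) with h34 | h34
    · have b4 := zeta_bound_no_log hw1 h34 (by rw [hab]; linarith)
      rw [hab] at b4
      have b5 : ‖XX w‖ * ‖ZZ w‖ ≤ 48000 * √T := by
        calc _ ≤ (4000 * T ^ (w.re - 1 / 2)) * (12 * T ^ (1 - w.re)) := by gcongr
          _ = 48000 * (T ^ (w.re - 1 / 2) * T ^ (1 - w.re)) := by ring
          _ = _ := by rw [hpw]
      have b6 : ‖iteratedDeriv n (logDeriv XX) w + iteratedDeriv n LZ w‖ ≤ (K₁ + K₂) * L ^ (n + 2) := by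
        refine (norm_add_le _ _).trans ?_
        nlinarith
      calc _ ≤ (48000 * √T) * ((K₁ + K₂) * L ^ (n + 2)) := by gcongr
        _ = 48000 * (K₁ + K₂) * (√T * L ^ (n + 2)) := by ring
        _ ≤ _ := mul_le_mul_of_nonneg_right LA PA
    · have b4 := zeta_bound_strip hw1 (by rw [hab]; linarith) (T := T) (by rw [hab]) hw2
      rw [hab] at b4
      have b5 : ‖XX w‖ * ‖ZZ w‖ ≤ 480000 * (√T * L) := by
        calc _ ≤ (4000 * T ^ (w.re - 1 / 2)) * (60 * T ^ (1 - w.re) * (1 + L)) := by gcongr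
          _ = 240000 * ((T ^ (w.re - 1 / 2) * T ^ (1 - w.re)) * (1 + L)) := by ring
          _ ≤ _ := by rw [hpw]; nlinarith
      have b7 := (h3 w (1 / 4) NA NA hw1 LA ?_ ?_).2
      · rw [hab] at b7
        have b8 : ‖iteratedDeriv n LZ w‖ ≤ q * L := by
          refine b7.trans ?_
          calc _ ≤ K₃ * (2 * L) * (((1 : ℝ) / 4) ^ (n + 1))⁻¹ := by gcongr
            _ = _ := by rw [hqdef]; ring
        have b6 : ‖iteratedDeriv n (logDeriv XX) w + iteratedDeriv n LZ w‖ ≤ (K₂ + q) * L := by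
          refine (norm_add_le _ _).trans ?_
          nlinarith
        calc _ ≤ (480000 * (√T * L)) * ((K₂ + q) * L) := by gcongr
          _ = 480000 * (K₂ + q) * (√T * (L * L)) := by ring
          _ ≤ 480000 * (K₁ + K₂ + q) * (√T * L ^ (n + 2)) := by gcongr; linarith
      · have := abs_im_le_norm (w - 1)
        simp only [sub_im, one_im, sub_zero] at this
        linarith
      · intro ρ hρ hr
        have := (le_abs_self _).trans (abs_re_le_norm (w - ρ))
        rw [sub_re, hr] at this
        linarith

lemma exists_good_t₀ : ∃ t₀ : ℝ, 4 ≤ t₀ ∧ t₀ ≤ 5 ∧ ∀ ρ : ℂ, ZZ ρ = 0 → ρ.re ∈ Set.Icc (-1) 2 → ρ.im ≠ t₀ := by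
  have hc : IsCompact (Set.Icc (-1 : ℝ) 2 ×ℂ Set.Icc (4 : ℝ) 5) := isCompact_Icc.reProdIm isCompact_Icc
  have hf := hc.inter_riemannZetaZeros_finite
  have hinf : (Set.Icc (4 : ℝ) 5).Infinite := Set.Icc_infinite NA
  obtain ⟨t, ht, h⟩ := hinf.exists_notMem_finite (hf.image Complex.im)
  refine ⟨t, ht.1, ht.2, fun ρ hρ hr hi => h ⟨ρ, ⟨?_, ?_⟩, hi⟩⟩
  · rw [Complex.mem_reProdIm]; exact ⟨hr, hi ▸ ht⟩
  · exact hρ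

theorem conditional_full_asymptotic (n : ℕ) (hn : 1 ≤ n)
    (hRH : RiemannHypothesis) (C A : ℕ → ℂ)
    (hC : ∀ᶠ s in nhdsWithin (1 : ℂ) {(1 : ℂ)}ᶜ,
      HasSum (fun j : ℕ => C j * (s - 1) ^ j) (riemannZeta s - 1 / (s - 1)))
    (hA : ∀ᶠ s in nhdsWithin (1 : ℂ) {(1 : ℂ)}ᶜ,
      HasSum (fun j : ℕ => A j * (s - 1) ^ j)
        (deriv riemannZeta s / riemannZeta s + 1 / (s - 1)))
    (δ : ℝ) (hδ : 0 < δ) :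
    ∃ K > (0 : ℝ), ∃ T₀ : ℝ, ∀ T ≥ T₀, AdmissibleHeight δ T →
      ‖zetaZeroSum n T - mainTerm C A n T‖ ≤
        K * T ^ ((1 : ℝ) / 2) * Real.log T ^ ((n : ℝ) + 5 / 2) := by
  obtain ⟨K₁, hK₁, h1⟩ := S_mainTerm hRH n hn hC hA
  obtain ⟨K₂, hK₂, h2⟩ := left_edge hRH n hn
  obtain ⟨K₃, hK₃, h3⟩ := right_edge n
  obtain ⟨K₄, hK₄, h4⟩ := top_edge_point hRH n hn hδ
  obtain ⟨t₀, ht4, ht5, hgood⟩ := exists_good_t₀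
  have hgood' : ∀ ρ : ℂ, ZZ ρ = 0 → ρ.im ≠ t₀ := by
    intro ρ hρ hi
    have hr := zeta_zero_im hRH hρ (by rw [hi]; linarith)
    exact hgood ρ hρ (by rw [hr]; constructor <;> norm_num) hi
  have hcont : ContinuousOn (fun x : ℝ => zF n (x + t₀ * I)) (Set.Icc (-1) 2) := by
    intro x hx
    apply ContinuousAt.continuousWithinAt
    have him : ((x : ℂ) + t₀ * I).im = t₀ := by simp
    have : ContinuousAt (zF n) ((x : ℂ) + t₀ * I) := by
      apply AnalyticAt.continuousAt (𝕜 := ℂ)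
      apply zF_analyticAt
      · intro h
        rw [h] at him; simp at him; linarith
      · intro h; exact hgood' _ h him
    exact ContinuousAt.comp (f := fun x : ℝ => ((x : ℂ) + t₀ * I)) this FA
  obtain ⟨B, hB⟩ := isCompact_Icc.exists_bound_of_continuousOn hcont
  have hB0 : 0 ≤ B := (norm_nonneg _).trans (hB 0 (by constructor <;> norm_num))
  set Z := ‖zetaZeroSum n t₀‖ with hZ
  have hZ0 : 0 ≤ Z := norm_nonneg _
  refine ⟨K₁ + K₂ + K₃ + 3 * K₄ + 3 * B + Z, by positivity, RE 12, fun T hT hadm => ?_⟩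
  have hT0 : 0 < T := (Real.exp_pos 12).trans_le hT
  have hL : 12 ≤ RL T := (Real.le_log_iff_exp_le hT0).2 hT
  have hT13 : 13 ≤ T := by linarith [Real.add_one_le_exp (12 : ℝ)]
  have q1 := h1 T hT
  have q2 := h2 T t₀ hT ht4 ht5
  have q3 := h3 (RL T) t₀ T LA
  have q4 := fun σ => h4 T σ hT hadm
  have hzT : ∀ ρ : ℂ, ZZ ρ = 0 → ρ.im ≠ t₀ ∧ ρ.im ≠ T := by
    intro ρ hρ
    refine ⟨hgood' ρ hρ, fun hi => ?_⟩
    have hr := zeta_zero_im hRH hρ (by rw [hi]; linarith)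
    have := hadm ρ ⟨hρ, by rw [hr]; norm_num, by rw [hr]; norm_num⟩
    rw [hi, sub_self, abs_zero] at this
    have : 0 < δ / RL T := PA
    linarith
  have hR : T ^ ((1 : ℝ) / 2) * RL T ^ ((n : ℝ) + 5 / 2) = √T * (RL T ^ (n + 2) * √(RL T)) := by
    rw [← Real.sqrt_eq_rpow, show (n : ℝ) + 5 / 2 = ((n + 2 : ℕ) : ℝ) + 1 / 2 by push_cast; ring,
      Real.rpow_add LA, Real.rpow_natCast, ← Real.sqrt_eq_rpow]
  have hLdef : RL T = RL T := rfl
  set L := RL T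
  have hL1 : 1 / L ≤ 1 := by rw [div_le_one LA]; linarith
  have hL0 : 0 < 1 / L := PA
  set c : ℝ := 1 + 1 / L with hc
  have hct := zero_sum_contour hRH n (t₀ := t₀) (T := T) (a := 1 - c) (b := c) LA LA LA LA hzT
  rw [RI] at hct
  have bot : ‖∫ x in (1 - c)..c, zF n (x + t₀ * I)‖ ≤ 3 * B := by
    refine (intervalIntegral.norm_integral_le_of_norm_le_const (C := B) fun x hx => ?_).trans ?_
    · rw [Set.uIoc_of_le LA] at hx
      exact hB x ⟨by linarith [hx.1], by linarith [hx.2]⟩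
    · rw [abs_of_nonneg LA]; nlinarith
  have top : ‖∫ x in (1 - c)..c, zF n (x + T * I)‖ ≤ 3 * (K₄ * (√T * L ^ (n + 2))) := by
    refine (intervalIntegral.norm_integral_le_of_norm_le_const (C := K₄ * (√T * L ^ (n + 2))) fun x hx => ?_).trans ?_
    · rw [Set.uIoc_of_le LA] at hx
      exact q4 x hx.1.le hx.2
    · rw [abs_of_nonneg LA]
      have : 0 ≤ K₄ * (√T * L ^ (n + 2)) := PA
      nlinarith
  have hI : (2 * π * I : ℂ) ≠ 0 := by
    simp [Real.pi_ne_zero]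
  set b1 := ∫ x in (1 - c)..c, zF n (x + t₀ * I)
  set b2 := ∫ x in (1 - c)..c, zF n (x + T * I)
  set b3 := ∫ y in t₀..T, zF n (c + y * I)
  set b4 := ∫ y in t₀..T, zF n ((1 - c : ℝ) + y * I)
  set S := ((∑ m ∈ Icc 1 ⌊T / (2 * π)⌋₊, fc n m : ℝ) : ℂ)
  have key : 2 * π * I * (zetaZeroSum n T - mainTerm C A n T) =
      2 * π * I * zetaZeroSum n t₀ + (-1) ^ n * (b1 - b2 + I * b3 - I * (b4 - 2 * π * S)) +
      2 * π * I * ((-1) ^ (n + 1) * S - mainTerm C A n T) := by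
    linear_combination hct
  set M := √T * (L ^ (n + 2) * √L) with hM
  have hsT : 1 ≤ √T := Real.one_le_sqrt.2 LA
  have hsL : 1 ≤ √L := Real.one_le_sqrt.2 LA
  have hLp : 1 ≤ L ^ (n + 2) := one_le_pow₀ LA
  have m1 : √T * L ^ (n + 2) ≤ M := by
    rw [hM]; gcongr; exact le_mul_of_one_le_right PA hsL
  have m2 : L ^ (n + 2) ≤ √T * L ^ (n + 2) := le_mul_of_one_le_left PA hsT
  have m3 : 1 ≤ M := LA
  have hpi : (1 : ℝ) ≤ 2 * π := by linarith [Real.pi_gt_three]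
  have hn2 : ‖(2 * π * I : ℂ)‖ = 2 * π := by simp [abs_of_pos Real.pi_pos]
  have hneg : ‖((-1) ^ n : ℂ)‖ = 1 := by rw [norm_pow, norm_neg, norm_one, one_pow]
  have k2 : ‖b1 - b2 + I * b3 - I * (b4 - 2 * π * S)‖ ≤ (K₂ + K₃ + 3 * K₄ + 3 * B) * M := by
    calc _ ≤ ‖b1‖ + ‖b2‖ + ‖I * b3‖ + ‖I * (b4 - 2 * π * S)‖ :=
          (norm_sub_le _ _).trans (add_le_add_left ((norm_add_le _ _).trans (add_le_add_left (norm_sub_le _ _) _)) _)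
      _ ≤ 3 * B + 3 * (K₄ * (√T * L ^ (n + 2))) + K₃ * L ^ (n + 2) + K₂ * (√T * L ^ (n + 2)) := by
          rw [norm_mul, norm_mul, norm_I, one_mul, one_mul]
          gcongr
      _ ≤ 3 * B * M + 3 * (K₄ * M) + K₃ * M + K₂ * M := by
          have g1 : 3 * B ≤ 3 * B * M := le_mul_of_one_le_right PA m3
          have g2 : L ^ (n + 2) ≤ M := LA
          gcongr
      _ = _ := by ring
  have k3 : 2 * π * ‖zetaZeroSum n T - mainTerm C A n T‖ ≤
      2 * π * Z + (K₂ + K₃ + 3 * K₄ + 3 * B) * M + 2 * π * (K₁ * M) := by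
    rw [← hn2, ← norm_mul, key]
    refine (norm_add_le _ _).trans (add_le_add ((norm_add_le _ _).trans (add_le_add ?_ ?_)) ?_)
    · rw [norm_mul]
    · rw [norm_mul, hneg, one_mul]; exact k2
    · rw [norm_mul]; gcongr
  rw [mul_assoc, hR]
  have k4 : (K₂ + K₃ + 3 * K₄ + 3 * B) * M ≤ 2 * π * ((K₂ + K₃ + 3 * K₄ + 3 * B) * M) :=
    le_mul_of_one_le_left PA hpi
  have k5 : Z ≤ Z * M := le_mul_of_one_le_right hZ0 m3
  have k6 : 2 * π * Z ≤ 2 * π * (Z * M) := by gcongr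
  have hp0 : 0 < 2 * π := PA
  refine le_of_mul_le_mul_left ?_ hp0
  refine k3.trans ?_
  linarith
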